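/- Let d ≥ 1, γ ≥ 0, let T > 0 and I = [0,T], and let (p,q) be an admissible pair with q < ∞. Then there exists C > 0, depending on d, γ, p, q and T, such that for every Schwartz function u₀ on ℝ^d and every Schwartz function F on ℝ^{1+d}, the function u(t,x) := (e^{itΔ²}u₀)(x) + ∫₀ᵗ (e^{i(t-s)Δ²}F(s,·))(x) ds satisfies ( ∫_I ‖u(t,·)‖_{H^{γ-γ_{p,q}}_q}^p dt )^{1/p} ≤ C ( ‖u₀‖_{H^γ} + ∫_I ‖F(t,·)‖_{H^γ} dt ), with the essential-supremum modification when p = ∞. -/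

import Mathlib

open MeasureTheory Real Complex
open scoped FourierTransform ENNReal SchwartzMap RealInnerProductSpace

/-- A pair `(p,q)` is admissible if `p,q ∈ [2,∞]`, `(p,q,d) ≠ (2,∞,2)` and
`2/p + d/q ≤ d/2` (with `1/∞ = 0`). -/
def Admissible (d : ℕ) (p q : ℝ≥0∞) : Prop :=
  2 ≤ p ∧ 2 ≤ q ∧ ¬(p = 2 ∧ q = ∞ ∧ d = 2) ∧
    2 / p + (d : ℝ≥0∞) / q ≤ (d : ℝ≥0∞) / 2

/-- The exponent `γ_{p,q} = d/2 - d/q - 4/p` (with `1/∞ = 0`). -/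
noncomputable def gammaExp (d : ℕ) (p q : ℝ≥0∞) : ℝ :=
  (d : ℝ) / 2 - (d : ℝ) / q.toReal - 4 / p.toReal

/-- `L^p`-in-time norm on a set `I` of an `ℝ≥0∞`-valued function, with the usual
essential supremum convention when `p = ∞`. -/
noncomputable def timeLp (p : ℝ≥0∞) (I : Set ℝ) (g : ℝ → ℝ≥0∞) : ℝ≥0∞ :=
  if p = ∞ then essSup g (MeasureTheory.volume.restrict I)
  else (∫⁻ t in I, g t ^ p.toReal) ^ (1 / p.toReal)

/-- The mixed norm `‖u‖_{L^p(I, L^q)}`. -/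
noncomputable def mixedLp {d : ℕ} (p q : ℝ≥0∞) (I : Set ℝ)
    (u : ℝ → EuclideanSpace ℝ (Fin d) → ℂ) : ℝ≥0∞ :=
  timeLp p I fun t => eLpNorm (u t) q MeasureTheory.volume

/-- The fourth-order Schrödinger propagator
`(e^{itΔ²}u₀)(x) = ∫ e^{2πi x·ξ} e^{it(2π|ξ|)⁴} û₀(ξ) dξ`. -/
noncomputable def prop4 {d : ℕ} (t : ℝ) (u₀ : EuclideanSpace ℝ (Fin d) → ℂ)
    (x : EuclideanSpace ℝ (Fin d)) : ℂ :=
  ∫ ξ : EuclideanSpace ℝ (Fin d),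
    Complex.exp (2 * Real.pi * Complex.I * ((⟪x, ξ⟫ : ℝ) : ℂ)) *
      Complex.exp (Complex.I * (t : ℂ) * ((2 * Real.pi * ‖ξ‖ : ℝ) : ℂ) ^ 4) * 𝓕 u₀ ξ


/-- The Bessel potential `⟨Λ⟩^s f`, i.e. the function with Fourier transform
`(1+|ξ|²)^{s/2} f̂(ξ)`. -/
noncomputable def besselPot {d : ℕ} (s : ℝ) (f : EuclideanSpace ℝ (Fin d) → ℂ)
    (x : EuclideanSpace ℝ (Fin d)) : ℂ :=
  ∫ ξ : EuclideanSpace ℝ (Fin d),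
    Complex.exp (2 * Real.pi * Complex.I * ((⟪x, ξ⟫ : ℝ) : ℂ)) *
      (((1 + ‖ξ‖ ^ 2) ^ (s / 2) : ℝ) : ℂ) * 𝓕 f ξ

/-- The generalized Sobolev norm `‖f‖_{H^s_q} = ‖⟨Λ⟩^s f‖_{L^q}`. -/
noncomputable def sobNormQ {d : ℕ} (s : ℝ) (q : ℝ≥0∞)
    (f : EuclideanSpace ℝ (Fin d) → ℂ) : ℝ≥0∞ :=
  eLpNorm (besselPot s f) q MeasureTheory.volume

/-- The Sobolev norm `‖f‖_{H^γ} = (∫ (1+|ξ|²)^γ |f̂(ξ)|² dξ)^{1/2}`. -/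
noncomputable def sobNorm {d : ℕ} (γ : ℝ) (f : EuclideanSpace ℝ (Fin d) → ℂ) : ℝ≥0∞ :=
  (∫⁻ ξ : EuclideanSpace ℝ (Fin d),
      ENNReal.ofReal ((1 + ‖ξ‖ ^ 2) ^ γ) * (‖𝓕 f ξ‖₊ : ℝ≥0∞) ^ (2 : ℝ)) ^ ((1 : ℝ) / 2)

set_option linter.unusedVariables false

namespace Strich

lemma summable_geom_int (r : ℝ) (h0 : 0 ≤ r) (h1 : r < 1) :
    Summable (fun n : ℤ => r ^ n.natAbs) := by
  apply Summable.of_nat_of_neg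
  · simpa using summable_geometric_of_lt_one h0 h1
  · simpa using summable_geometric_of_lt_one h0 h1

/-- Uniform bound for sums of a two-sided geometric bump. -/
lemma sum_bump (ε α : ℝ) (hε : 0 < ε) (hα : 0 < α) :
    ∃ C : ℝ, 0 < C ∧ ∀ (β : ℝ) (s : Finset ℤ),
      ∑ n ∈ s, (2 : ℝ) ^ (-(ε * |α * n - β|)) ≤ C := by
  set r : ℝ := (2 : ℝ) ^ (-(ε * α)) with hr
  have hr0 : 0 < r := by positivity
  have hr1 : r < 1 := by
    rw [hr]; apply Real.rpow_lt_one_of_one_lt_of_neg (by norm_num)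
    have := mul_pos hε hα; linarith
  have hs := summable_geom_int r hr0.le hr1
  refine ⟨(2 : ℝ) ^ (ε * α) * (∑' n : ℤ, r ^ n.natAbs) + 1, ?_, ?_⟩
  · have : 0 ≤ ∑' n : ℤ, r ^ n.natAbs := tsum_nonneg (fun n => by positivity)
    positivity
  intro β s
  set n0 : ℤ := ⌊β / α⌋ with hn0
  have key : ∀ n : ℤ, (2 : ℝ) ^ (-(ε * |α * n - β|)) ≤ (2 : ℝ) ^ (ε * α) * r ^ (n - n0).natAbs := by
    intro n
    have h1 : (n0 : ℝ) ≤ β / α := Int.floor_le _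
    have h2 : β / α < n0 + 1 := Int.lt_floor_add_one _
    rw [le_div_iff₀ hα] at h1
    rw [div_lt_iff₀ hα] at h2
    have h3 : α * |(n : ℝ) - n0| ≤ |α * n - β| + α := by
      have e : α * |(n : ℝ) - n0| = |α * (n - n0)| := by rw [abs_mul, abs_of_pos hα]
      rw [e]
      have : α * ((n : ℝ) - n0) = (α * n - β) + (β - α * n0) := by ring
      rw [this]
      refine (abs_add_le _ _).trans ?_
      have : |β - α * n0| ≤ α := by rw [abs_le]; constructor <;> linarith
      linarith
    have h4 : r ^ (n - n0).natAbs = (2 : ℝ) ^ (-(ε * α) * |(n : ℝ) - n0|) := by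
      rw [hr, ← Real.rpow_natCast, ← Real.rpow_mul (by norm_num)]
      congr 2
      rw [Nat.cast_natAbs]; push_cast; rfl
    rw [h4, ← Real.rpow_add (by norm_num)]
    apply Real.rpow_le_rpow_of_exponent_le (by norm_num)
    nlinarith
  calc ∑ n ∈ s, (2 : ℝ) ^ (-(ε * |α * n - β|)) ≤ ∑ n ∈ s, (2 : ℝ) ^ (ε * α) * r ^ (n - n0).natAbs :=
        Finset.sum_le_sum (fun n _ => key n)
    _ = (2 : ℝ) ^ (ε * α) * ∑ n ∈ s, r ^ (n - n0).natAbs := by rw [Finset.mul_sum]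
    _ ≤ (2 : ℝ) ^ (ε * α) * (∑' n : ℤ, r ^ n.natAbs) := by
        apply mul_le_mul_of_nonneg_left _ (by positivity)
        have hs' : Summable (fun n : ℤ => r ^ (n - n0).natAbs) :=
          hs.comp_injective (Equiv.subRight n0).injective
        have := hs'.sum_le_tsum s (fun n _ => by positivity)
        refine this.trans (le_of_eq ?_)
        exact (Equiv.subRight n0).tsum_eq (fun n : ℤ => r ^ n.natAbs)
    _ ≤ _ := by linarith

/-- Two-parameter bound at a fixed pair of times. -/
lemma min_le_bump (a b x x0 τ : ℝ) (ha : 0 < a) (hb : 0 < b) :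
    min ((2:ℝ) ^ (τ + a * (x - x0))) ((2:ℝ) ^ (τ - b * (x - x0)))
      ≤ (2:ℝ) ^ τ * (2:ℝ) ^ (-(min a b * |1 * x - x0|)) := by
  rw [← Real.rpow_add (by norm_num)]
  rcases le_total x x0 with h | h
  · apply (min_le_left _ _).trans
    apply Real.rpow_le_rpow_of_exponent_le (by norm_num)
    rw [one_mul, abs_of_nonpos (by linarith)]
    nlinarith [min_le_left a b]
  · apply (min_le_right _ _).trans
    apply Real.rpow_le_rpow_of_exponent_le (by norm_num)
    rw [one_mul, abs_of_nonneg (by linarith)]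
    nlinarith [min_le_right a b]

/-- KT three-way minimum. -/
lemma min3_le_bump (a A B x : ℝ) (ha : 0 < a) (h1 : x ≤ (2:ℝ) ^ (a * (A + B)))
    (h2 : x ≤ (2:ℝ) ^ (-A)) (h3 : x ≤ (2:ℝ) ^ (-B)) :
    x ≤ (2:ℝ) ^ (-(a / (2 * (1 + a)) * |A|)) * (2:ℝ) ^ (-(a / (2 * (1 + a)) * |B|)) := by
  rw [← Real.rpow_add (by norm_num)]
  rcases le_or_gt x 0 with hx | hx
  · exact hx.trans (by positivity)
  set e := Real.logb 2 x with he
  have hxe : x = (2:ℝ) ^ e := by rw [he, Real.rpow_logb (by norm_num) (by norm_num) hx]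
  rw [hxe] at h1 h2 h3 ⊢
  rw [Real.rpow_le_rpow_left_iff (by norm_num)] at h1 h2 h3 ⊢
  set θ := 1 / (2 * (1 + a)) with hθ
  have hθ0 : 0 < θ := by positivity
  have hθ1 : θ * (1 + a) = 1 / 2 := by rw [hθ]; field_simp
  have hε : a / (2 * (1 + a)) = θ * a := by rw [hθ]; field_simp
  rw [hε]
  rcases le_total 0 A with hA | hA <;> rcases le_total 0 B with hB | hB
  · rw [abs_of_nonneg hA, abs_of_nonneg hB]; nlinarith
  · rw [abs_of_nonneg hA, abs_of_nonpos hB]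
    have : e ≤ (1 - θ) * (-A) + θ * (a * (A + B)) := by
      have : θ ≤ 1 / 2 := by nlinarith
      nlinarith
    nlinarith
  · rw [abs_of_nonpos hA, abs_of_nonneg hB]
    have : e ≤ (1 - θ) * (-B) + θ * (a * (A + B)) := by
      have : θ ≤ 1 / 2 := by nlinarith
      nlinarith
    nlinarith
  · rw [abs_of_nonpos hA, abs_of_nonpos hB]
    have : θ * a ≤ a := by nlinarith
    nlinarith

end Strich

set_option linter.unusedVariables false

namespace Strich

/-- Minkowski's integral inequality. -/
lemma minkowski {A B : Type*} [MeasurableSpace A] [MeasurableSpace B]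
    (μ : Measure A) (ν : Measure B) [SigmaFinite μ] [SFinite ν]
    (f : A → B → ℝ≥0∞) (hf : Measurable (Function.uncurry f)) (q : ℝ) (hq : 1 ≤ q) :
    (∫⁻ a, (∫⁻ b, f a b ∂ν) ^ q ∂μ) ^ (1 / q) ≤ ∫⁻ b, (∫⁻ a, f a b ^ q ∂μ) ^ (1 / q) ∂ν := by
  have hq0 : 0 < q := by linarith
  rcases eq_or_lt_of_le hq with h1 | h1
  · subst h1
    simp only [ENNReal.rpow_one, div_one]
    rw [lintegral_lintegral_swap hf.aemeasurable]
  have hqq : q.HolderConjugate (q / (q - 1)) := Real.HolderConjugate.conjExponent h1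
  set Φ : A → ℝ≥0∞ := fun a => ∫⁻ b, f a b ∂ν with hΦ
  have mΦ : Measurable Φ := hf.lintegral_prod_right'
  set RHS := ∫⁻ b, (∫⁻ a, f a b ^ q ∂μ) ^ (1 / q) ∂ν with hRHS
  set Φn : ℕ → A → ℝ≥0∞ := fun n => (spanningSets μ n).indicator (fun a => min (Φ a) n) with hΦn
  have mΦn : ∀ n, Measurable (Φn n) := fun n =>
    (mΦ.min measurable_const).indicator (measurableSet_spanningSets μ n)
  have hle : ∀ n a, Φn n a ≤ Φ a := by
    intro n a
    simp only [hΦn]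
    exact Set.indicator_apply_le' (fun _ => min_le_left _ _) (fun _ => zero_le)
  have hfin : ∀ n, ∫⁻ a, Φn n a ^ q ∂μ ≠ ∞ := by
    intro n
    have : ∫⁻ a, Φn n a ^ q ∂μ ≤ ∫⁻ a, (spanningSets μ n).indicator (fun _ => (n : ℝ≥0∞) ^ q) a ∂μ := by
      apply lintegral_mono
      intro a
      simp only [hΦn]
      by_cases ha : a ∈ spanningSets μ n
      · simp only [ha, Set.indicator_of_mem]
        exact ENNReal.rpow_le_rpow (min_le_right _ _) hq0.le
      · simp [ha, hq0]
    refine ne_top_of_le_ne_top ?_ this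
    rw [lintegral_indicator_const (measurableSet_spanningSets μ n)]
    exact ENNReal.mul_ne_top (ENNReal.rpow_ne_top_of_nonneg hq0.le (by simp))
      (measure_spanningSets_lt_top μ n).ne
  have main : ∀ n, (∫⁻ a, Φn n a ^ q ∂μ) ^ (1 / q) ≤ RHS := by
    intro n
    set X := ∫⁻ a, Φn n a ^ q ∂μ with hX
    have step : X ≤ RHS * X ^ (1 / (q / (q - 1))) := by
      calc X ≤ ∫⁻ a, Φ a * Φn n a ^ (q - 1) ∂μ := by
            apply lintegral_mono
            intro a
            have e : Φn n a ^ q = Φn n a * Φn n a ^ (q - 1) := by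
              conv_lhs => rw [show q = 1 + (q - 1) by ring]
              rw [ENNReal.rpow_add_of_nonneg _ _ (by norm_num) (by linarith), ENNReal.rpow_one]
            simp only [e]
            gcongr
            exact hle n a
        _ = ∫⁻ a, ∫⁻ b, f a b * Φn n a ^ (q - 1) ∂ν ∂μ := by
            congr 1; ext a
            rw [lintegral_mul_const _ (hf.of_uncurry_left)]
        _ = ∫⁻ b, ∫⁻ a, f a b * Φn n a ^ (q - 1) ∂μ ∂ν := by
            rw [lintegral_lintegral_swap]
            apply Measurable.aemeasurable
            exact hf.mul (((mΦn n).comp measurable_fst).pow_const _)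
        _ ≤ ∫⁻ b, (∫⁻ a, f a b ^ q ∂μ) ^ (1 / q) * X ^ (1 / (q / (q - 1))) ∂ν := by
            apply lintegral_mono
            intro b
            have hm : Measurable (fun a => f a b) := hf.of_uncurry_right
            refine (ENNReal.lintegral_mul_le_Lp_mul_Lq μ hqq hm.aemeasurable
              ((mΦn n).pow_const (q - 1)).aemeasurable).trans (le_of_eq ?_)
            congr 2
            rw [hX]
            congr 1; ext a
            rw [← ENNReal.rpow_mul]
            congr 1
            field_simp [show q - 1 ≠ 0 by linarith]
        _ = RHS * X ^ (1 / (q / (q - 1))) := by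
            rw [lintegral_mul_const]
            exact ((hf.pow_const q).lintegral_prod_left').pow_const _
    rcases eq_or_ne X 0 with h0 | h0
    · rw [h0, ENNReal.zero_rpow_of_pos (by positivity)]; exact zero_le
    have hne : X ^ (1 / (q / (q - 1))) ≠ 0 := by
      exact (ENNReal.rpow_pos (pos_iff_ne_zero.2 h0) (hfin n)).ne'
    have hnt : X ^ (1 / (q / (q - 1))) ≠ ∞ :=
      ENNReal.rpow_ne_top_of_nonneg (by have : 0 < q - 1 := by linarith
                                        positivity) (hfin n)
    rw [← ENNReal.mul_le_mul_iff_left hne hnt, ← ENNReal.rpow_add _ _ h0 (hfin n)]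
    rw [show 1 / q + 1 / (q / (q - 1)) = 1 by
      have : q - 1 ≠ 0 := by linarith
      field_simp; ring, ENNReal.rpow_one]
    exact step
  have lim : ∫⁻ a, Φ a ^ q ∂μ ≤ RHS ^ q := by
    have mono : Monotone Φn := by
      intro n m hnm a
      simp only [hΦn]
      apply Set.indicator_le_indicator_of_subset (monotone_spanningSets μ hnm) (fun _ => zero_le) a |>.trans
      apply Set.indicator_le_indicator
      exact min_le_min le_rfl (by exact_mod_cast hnm)
    have e : ∀ a, ⨆ n, Φn n a = Φ a := by
      intro a
      apply le_antisymm (iSup_le (fun n => hle n a))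
      apply le_of_forall_lt
      intro c hc
      have hct : c < ∞ := lt_of_lt_of_le hc le_top
      obtain ⟨n1, hn1⟩ := ENNReal.exists_nat_gt hct.ne
      have : a ∈ ⋃ n, spanningSets μ n := by rw [iUnion_spanningSets]; trivial
      obtain ⟨n2, hn2⟩ := Set.mem_iUnion.1 this
      refine lt_of_lt_of_le ?_ (le_iSup (fun n => Φn n a) (max n1 n2))
      simp only [hΦn]
      rw [Set.indicator_of_mem (monotone_spanningSets μ (le_max_right n1 n2) hn2)]
      refine lt_min hc (hn1.trans_le ?_)
      exact_mod_cast le_max_left n1 n2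
    have e2 : ∀ a, Φ a ^ q = ⨆ n, Φn n a ^ q := by
      intro a
      rw [← e a]
      exact (ENNReal.orderIsoRpow q hq0).map_iSup _
    calc ∫⁻ a, Φ a ^ q ∂μ = ∫⁻ a, ⨆ n, Φn n a ^ q ∂μ := by simp only [e2]
      _ = ⨆ n, ∫⁻ a, Φn n a ^ q ∂μ := lintegral_iSup (fun n => (mΦn n).pow_const q)
          (fun n m hnm a => ENNReal.rpow_le_rpow (mono hnm a) hq0.le)
      _ ≤ RHS ^ q := by
          apply iSup_le
          intro n
          have := ENNReal.rpow_le_rpow (main n) hq0.le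
          rwa [← ENNReal.rpow_mul, one_div_mul_cancel hq0.ne', ENNReal.rpow_one] at this
  have := ENNReal.rpow_le_rpow lim (show 0 ≤ 1 / q by positivity)
  rwa [← ENNReal.rpow_mul, mul_one_div_cancel hq0.ne', ENNReal.rpow_one] at this

end Strich

set_option linter.unusedVariables false

namespace Strich

/-- Formal polynomial expressions in three quantities `R, Q, S`. -/
inductive Ex where
  | c : ℝ → Ex
  | R : Ex
  | Q : Ex
  | S : Ex
  | add : Ex → Ex → Ex
  | mul : Ex → Ex → Ex

namespace Ex
noncomputable def ev (r q s : ℝ) : Ex → ℝ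
  | c a => a
  | R => r
  | Q => q
  | S => s
  | add e f => ev r q s e + ev r q s f
  | mul e f => ev r q s e * ev r q s f

noncomputable def D : Ex → Ex
  | c _ => c 0
  | R => mul (c 2) Q
  | Q => S
  | S => c 0
  | add e f => add (D e) (D f)
  | mul e f => add (mul (D e) f) (mul e (D f))
end Ex

open Ex in
inductive W : ℕ → ℕ → Ex → Prop
  | zero (a b) : W a b (c 0)
  | const (r) : W 0 0 (c r)
  | R : W 0 2 R
  | Q : W 1 2 Q
  | S : W 2 2 S
  | add {a b e f} : W a b e → W a b f → W a b (Ex.add e f)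
  | mul {a b a' b' e f} : W a b e → W a' b' f → W (a + a') (b + b') (Ex.mul e f)
  | weak {a b a' b' e} : W a b e → a' ≤ a → b' ≤ b → W a' b' e

lemma W.D {a b e} (h : W a b e) : W (a + 1) b e.D := by
  induction h with
  | zero a b => exact W.zero _ _
  | const r => exact W.zero _ _
  | R => exact W.weak (W.mul (W.const 2) W.Q) (by norm_num) (by norm_num)
  | Q => exact W.S
  | S => exact W.zero _ _
  | add h1 h2 i1 i2 => exact W.add i1 i2
  | mul h1 h2 i1 i2 =>
    refine W.add (W.weak (W.mul i1 h2) (by omega) le_rfl) (W.weak (W.mul h1 i2) (by omega) le_rfl)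
  | weak h1 h2 h3 i1 => exact W.weak i1 (by omega) h3

lemma W.bound {a b e} (h : W a b e) : ∃ C : ℝ, 0 ≤ C ∧ ∃ L : ℕ, ∀ r q H ρ : ℝ, 0 ≤ r → 0 < H → 0 < ρ →
    H ^ 2 + r = ρ ^ 2 → q ^ 2 ≤ r * H ^ 2 →
    |e.ev r q (H ^ 2)| * ρ ^ a ≤ C * H ^ a * ρ ^ b * (1 + ρ) ^ L := by
  induction h with
  | zero a b => exact ⟨0, le_rfl, 0, by intros; simp [Ex.ev]⟩
  | const r => exact ⟨|r|, abs_nonneg _, 0, by intros; simp [Ex.ev]⟩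
  | R =>
    refine ⟨1, zero_le_one, 0, ?_⟩
    intro r q H ρ hr hH hρ h1 h2
    simp only [Ex.ev, abs_of_nonneg hr]
    nlinarith
  | Q =>
    refine ⟨1, zero_le_one, 0, ?_⟩
    intro r q H ρ hr hH hρ h1 h2
    simp only [Ex.ev]
    have : |q| ≤ ρ * H := by
      apply abs_le_of_sq_le_sq _ (by positivity)
      nlinarith [sq_nonneg H]
    simp only [pow_one, one_mul, pow_zero, mul_one]
    nlinarith
  | S =>
    refine ⟨1, zero_le_one, 0, ?_⟩
    intro r q H ρ hr hH hρ h1 h2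
    simp only [Ex.ev, abs_of_nonneg (sq_nonneg H)]
    simp
  | @add a b e f h1 h2 i1 i2 =>
    obtain ⟨C1, hC1, L1, i1⟩ := i1
    obtain ⟨C2, hC2, L2, i2⟩ := i2
    refine ⟨C1 + C2, by positivity, L1 + L2, ?_⟩
    intro r q H ρ hr hH hρ e1 e2
    have a1 := i1 r q H ρ hr hH hρ e1 e2
    have a2 := i2 r q H ρ hr hH hρ e1 e2
    have b1 : (1 + ρ) ^ L1 ≤ (1 + ρ) ^ (L1 + L2) := pow_le_pow_right₀ (by linarith) (by omega)
    have b2 : (1 + ρ) ^ L2 ≤ (1 + ρ) ^ (L1 + L2) := pow_le_pow_right₀ (by linarith) (by omega)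
    have c1 : C1 * H ^ a * ρ ^ b * (1 + ρ) ^ L1 ≤ C1 * H ^ a * ρ ^ b * (1 + ρ) ^ (L1 + L2) := by gcongr
    have c2 : C2 * H ^ a * ρ ^ b * (1 + ρ) ^ L2 ≤ C2 * H ^ a * ρ ^ b * (1 + ρ) ^ (L1 + L2) := by gcongr
    have d1 : |(Ex.add e f).ev r q (H^2)| * ρ ^ a ≤ |e.ev r q (H^2)| * ρ ^ a + |f.ev r q (H^2)| * ρ ^ a := by
      rw [← add_mul]
      exact mul_le_mul_of_nonneg_right (abs_add_le _ _) (by positivity)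
    linarith
  | @mul a b a' b' e f h1 h2 i1 i2 =>
    obtain ⟨C1, hC1, L1, i1⟩ := i1
    obtain ⟨C2, hC2, L2, i2⟩ := i2
    refine ⟨C1 * C2, by positivity, L1 + L2, ?_⟩
    intro r q H ρ hr hH hρ e1 e2
    have a1 := i1 r q H ρ hr hH hρ e1 e2
    have a2 := i2 r q H ρ hr hH hρ e1 e2
    have := mul_le_mul a1 a2 (by positivity) (by positivity)
    calc |(Ex.mul e f).ev r q (H^2)| * ρ ^ (a + a') 
        = |e.ev r q (H ^ 2)| * ρ ^ a * (|f.ev r q (H ^ 2)| * ρ ^ a') := by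
          simp only [Ex.ev, abs_mul, pow_add]; ring
      _ ≤ _ := this
      _ = _ := by simp only [pow_add]; ring
  | @weak a b a' b' e h1 h2 h3 i1 =>
    obtain ⟨C1, hC1, L1, i1⟩ := i1
    refine ⟨C1, hC1, L1 + (b - b'), ?_⟩
    intro r q H ρ hr hH hρ e1 e2
    have a1 := i1 r q H ρ hr hH hρ e1 e2
    obtain ⟨n, rfl⟩ := Nat.exists_eq_add_of_le h2
    obtain ⟨m, rfl⟩ := Nat.exists_eq_add_of_le h3
    have hHρ : H ≤ ρ := by nlinarith
    have x1 : H ^ n ≤ ρ ^ n := by gcongr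
    have x2 : ρ ^ m ≤ (1 + ρ) ^ m := by gcongr; linarith
    rw [← mul_le_mul_iff_left₀ (show 0 < ρ ^ n by positivity)]
    calc _ = |e.ev r q (H ^ 2)| * ρ ^ (a' + n) := by rw [pow_add]; ring
      _ ≤ _ := a1
      _ = C1 * H ^ a' * ρ ^ b' * (1 + ρ) ^ L1 * (H ^ n * ρ ^ m) := by simp only [pow_add]; ring
      _ ≤ C1 * H ^ a' * ρ ^ b' * (1 + ρ) ^ L1 * (ρ ^ n * (1 + ρ) ^ m) := by gcongr
      _ = _ := by
        rw [show b' + m - b' = m by omega]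
        simp only [pow_add]; ring

/-- `q = 4 R S + S² + 8 Q²`. -/
noncomputable def qEx : Ex :=
  Ex.add (Ex.add (Ex.mul (Ex.c 4) (Ex.mul Ex.R Ex.S)) (Ex.mul Ex.S Ex.S)) (Ex.mul (Ex.c 8) (Ex.mul Ex.Q Ex.Q))

lemma W_q : W 2 4 qEx := by
  unfold qEx
  refine W.add (W.add ?_ ?_) ?_
  · exact W.weak (W.mul (W.const 4) (W.mul W.R W.S)) (by norm_num) (by norm_num)
  · exact W.weak (W.mul W.S W.S) (by norm_num) (by norm_num)
  · exact W.weak (W.mul (W.const 8) (W.mul W.Q W.Q)) (by norm_num) (by norm_num)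

noncomputable def stepEx (k : ℕ) (N : Ex) : Ex :=
  Ex.add (Ex.mul (Ex.add N.D (Ex.mul (Ex.c (-8)) (Ex.mul Ex.Q N))) qEx)
    (Ex.mul (Ex.c (-((k:ℝ) + 1) * 24)) (Ex.mul N (Ex.mul Ex.Q Ex.S)))

lemma W_step {a b N} (k : ℕ) (h : W a b N) : W (a + 3) (b + 4) (stepEx k N) := by
  unfold stepEx
  refine W.add (W.weak (W.mul (W.add h.D (W.weak (W.mul (W.const _) (W.mul W.Q h)) (by omega) (by omega)))
    W_q) (by omega) (by omega)) (W.weak (W.mul (W.const _) (W.mul h (W.mul W.Q W.S))) (by omega) (by omega))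

noncomputable def pEx : Ex :=
  Ex.add (Ex.mul (Ex.add Ex.R (Ex.mul (Ex.c (1/4)) Ex.S)) (Ex.add Ex.R (Ex.mul (Ex.c (1/4)) Ex.S)))
    (Ex.mul (Ex.c (-1)) (Ex.mul Ex.Q Ex.Q))

lemma W_p : W 0 4 pEx := by
  have h : W 0 2 (Ex.add Ex.R (Ex.mul (Ex.c (1/4)) Ex.S)) :=
    W.add W.R (W.weak (W.mul (W.const _) W.S) (by norm_num) (by norm_num))
  exact W.add (W.mul h h) (W.weak (W.mul (W.const _) (W.mul W.Q W.Q)) (by norm_num) (by norm_num))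

noncomputable def powEx (e : Ex) : ℕ → Ex
  | 0 => Ex.c 1
  | n + 1 => Ex.mul (powEx e n) e

lemma W_pow {a b e} (h : W a b e) (n : ℕ) : W (n * a) (n * b) (powEx e n) := by
  induction n with
  | zero => simpa [powEx] using W.const 1
  | succ n ih => simpa [powEx, add_mul] using W.mul ih h

lemma ev_pow (r q s : ℝ) (e : Ex) (n : ℕ) : (powEx e n).ev r q s = (e.ev r q s) ^ n := by
  induction n with
  | zero => simp [powEx, Ex.ev]
  | succ n ih => simp [powEx, Ex.ev, ih, pow_succ]

noncomputable def iterEx (N0 : Ex) : ℕ → Ex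
  | 0 => N0
  | n + 1 => stepEx (2 * n) (iterEx N0 n)

lemma W_iter {b N0} (h : W 0 b N0) (n : ℕ) : W (3 * n) (b + 4 * n) (iterEx N0 n) := by
  induction n with
  | zero => simpa [iterEx] using h
  | succ n ih => exact W_step _ ih

end Strich

set_option linter.unusedVariables false

namespace Strich

lemma one_add_pow_le (L : ℕ) : ∃ C : ℝ, 0 < C ∧ ∀ x : ℝ, 0 ≤ x → (1 + x) ^ L ≤ C * Real.exp (x ^ 2 / 2) := by
  refine ⟨L.factorial * Real.exp (3 / 2), by positivity, fun x hx => ?_⟩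
  have h1 := Real.pow_div_factorial_le_exp (1 + x) (by linarith) L
  rw [div_le_iff₀ (by positivity)] at h1
  have h2 : Real.exp (1 + x) ≤ Real.exp (3 / 2) * Real.exp (x ^ 2 / 2) := by
    rw [← Real.exp_add]; apply Real.exp_le_exp.2; nlinarith [sq_nonneg (x - 1)]
  calc (1 + x) ^ L ≤ Real.exp (1 + x) * L.factorial := h1
    _ ≤ (Real.exp (3 / 2) * Real.exp (x ^ 2 / 2)) * L.factorial := by gcongr
    _ = _ := by ring

variable {d : ℕ}

noncomputable def evE (e : Ex) (h μ : EuclideanSpace ℝ (Fin d)) : ℝ := e.ev (‖μ‖ ^ 2) ⟪μ, h⟫ (‖h‖ ^ 2)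

lemma evE_cont (e : Ex) (h : EuclideanSpace ℝ (Fin d)) : Continuous (evE e h) := by
  unfold evE
  induction e with
  | c a => simp only [Ex.ev]; fun_prop
  | R => simp only [Ex.ev]; fun_prop
  | Q => simp only [Ex.ev]; fun_prop
  | S => simp only [Ex.ev]; fun_prop
  | add e f h1 h2 => simp only [Ex.ev]; exact h1.add h2
  | mul e f h1 h2 => simp only [Ex.ev]; exact h1.mul h2

lemma deriv_R (h μ : EuclideanSpace ℝ (Fin d)) :
    HasDerivAt (fun s : ℝ => ‖μ + s • h‖ ^ 2) (2 * ⟪μ, h⟫) 0 := by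
  have e : (fun s : ℝ => ‖μ + s • h‖ ^ 2) = fun s : ℝ => ‖μ‖ ^ 2 + 2 * (s * ⟪μ, h⟫) + s ^ 2 * ‖h‖ ^ 2 := by
    ext s
    rw [norm_add_sq_real, inner_smul_right, norm_smul, mul_pow, Real.norm_eq_abs, sq_abs]
  rw [e]
  have h1 : HasDerivAt (fun s : ℝ => ‖μ‖ ^ 2 + 2 * (s * ⟪μ, h⟫) + s ^ 2 * ‖h‖ ^ 2)
    (0 + 2 * (1 * ⟪μ, h⟫) + (2 * (0:ℝ) ^ (2 - 1) * 1) * ‖h‖ ^ 2) 0 := by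
    refine ((hasDerivAt_const _ _).add (((hasDerivAt_id _).mul_const _).const_mul _)).add ?_
    exact ((hasDerivAt_id (0:ℝ)).pow 2).mul_const _
  simpa using h1

lemma deriv_Q (h μ : EuclideanSpace ℝ (Fin d)) :
    HasDerivAt (fun s : ℝ => ⟪μ + s • h, h⟫) (‖h‖ ^ 2) 0 := by
  have e : (fun s : ℝ => ⟪μ + s • h, h⟫) = fun s : ℝ => ⟪μ, h⟫ + s * ‖h‖ ^ 2 := by
    ext s
    rw [inner_add_left, inner_smul_left, real_inner_self_eq_norm_sq]; rfl
  rw [e]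
  simpa using ((hasDerivAt_id (0:ℝ)).mul_const (‖h‖ ^ 2)).const_add (⟪μ, h⟫)

lemma evE_deriv (e : Ex) (h μ : EuclideanSpace ℝ (Fin d)) :
    HasDerivAt (fun s : ℝ => evE e h (μ + s • h)) (evE e.D h μ) 0 := by
  unfold evE
  induction e with
  | c a => simp only [Ex.ev, Ex.D]; exact hasDerivAt_const _ _
  | R => simpa only [Ex.ev, Ex.D] using deriv_R h μ
  | Q => simpa only [Ex.ev, Ex.D] using deriv_Q h μ
  | S => simp only [Ex.ev, Ex.D]; exact hasDerivAt_const _ _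
  | add e f h1 h2 => simp only [Ex.ev, Ex.D]; exact h1.add h2
  | mul e f h1 h2 =>
    simp only [Ex.ev, Ex.D]
    have := h1.fun_mul h2
    simpa using this

lemma evE_bound {a b e} (hW : W a b e) : ∃ C : ℝ, 0 < C ∧ ∀ h μ : EuclideanSpace ℝ (Fin d), h ≠ 0 →
    |evE e h μ| ≤ C * Real.exp ((‖μ‖ ^ 2 + ‖h‖ ^ 2) / 2) := by
  have h0 : W 0 0 e := W.weak hW (by omega) (by omega)
  obtain ⟨C, hC, L, hb⟩ := h0.bound
  obtain ⟨C', hC', hb'⟩ := one_add_pow_le L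
  refine ⟨C * C' + 1, by positivity, fun h μ hh => ?_⟩
  have hH : 0 < ‖h‖ := norm_pos_iff.2 hh
  have hp : 0 < ‖h‖ ^ 2 + ‖μ‖ ^ 2 := by positivity
  set ρ := Real.sqrt (‖h‖ ^ 2 + ‖μ‖ ^ 2) with hρ
  have hρ2 : ρ ^ 2 = ‖h‖ ^ 2 + ‖μ‖ ^ 2 := Real.sq_sqrt hp.le
  have hρ0 : 0 < ρ := Real.sqrt_pos.2 hp
  have := hb (‖μ‖ ^ 2) ⟪μ, h⟫ ‖h‖ ρ (by positivity) hH hρ0 hρ2.symm (by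
    have := abs_real_inner_le_norm μ h
    rw [← mul_pow, sq_le_sq, abs_of_nonneg (by positivity : 0 ≤ ‖μ‖ * ‖h‖)]; exact this)
  simp only [pow_zero, mul_one] at this
  unfold evE
  refine this.trans ?_
  have h3 := hb' ρ hρ0.le
  rw [hρ2, add_comm (‖h‖ ^ 2)] at h3
  have : 0 < Real.exp ((‖μ‖ ^ 2 + ‖h‖ ^ 2) / 2) := Real.exp_pos _
  nlinarith

lemma q_lower (h μ : EuclideanSpace ℝ (Fin d)) : ‖h‖ ^ 2 * (4 * ‖μ‖ ^ 2 + ‖h‖ ^ 2) ≤ evE qEx h μ := by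
  simp only [evE, qEx, Ex.ev]
  nlinarith [sq_nonneg (⟪μ, h⟫)]

lemma q_pos (h μ : EuclideanSpace ℝ (Fin d)) (hh : h ≠ 0) : 0 < evE qEx h μ := by
  have hH : 0 < ‖h‖ := norm_pos_iff.2 hh
  exact lt_of_lt_of_le (by positivity) (q_lower h μ)

lemma integrable_gauss (b : ℝ) (hb : 0 < b) :
    Integrable (fun μ : EuclideanSpace ℝ (Fin d) => Real.exp (-(b * ‖μ‖ ^ 2))) := by
  have := (GaussianFourier.integrable_cexp_neg_mul_sq_norm_add (V := EuclideanSpace ℝ (Fin d))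
    (b := (b : ℂ)) (by simpa using hb) 0 0).norm
  refine this.congr (Filter.Eventually.of_forall fun μ => ?_)
  simp only [Complex.norm_exp]
  congr 1
  simp [← Complex.ofReal_pow, ← Complex.ofReal_mul, ← Complex.ofReal_neg]

noncomputable def phE (h μ : EuclideanSpace ℝ (Fin d)) : ℝ := ⟪μ, h⟫ * (4 * ‖μ‖ ^ 2 + ‖h‖ ^ 2)

noncomputable def ampE (N : Ex) (k : ℕ) (h μ : EuclideanSpace ℝ (Fin d)) : ℝ :=
  evE N h μ * Real.exp (-(4 * ‖μ‖ ^ 2)) / (evE qEx h μ) ^ k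

noncomputable def termE (τ : ℝ) (N : Ex) (k : ℕ) (h μ : EuclideanSpace ℝ (Fin d)) : ℂ :=
  Complex.exp (Complex.I * ((τ * phE h μ : ℝ) : ℂ)) * ((ampE N k h μ : ℝ) : ℂ)

lemma norm_termE (τ : ℝ) (N : Ex) (k : ℕ) (h μ : EuclideanSpace ℝ (Fin d)) :
    ‖termE τ N k h μ‖ = |ampE N k h μ| := by
  unfold termE
  rw [norm_mul, mul_comm Complex.I, Complex.norm_exp_ofReal_mul_I, one_mul, Complex.norm_real, Real.norm_eq_abs]

lemma termE_cont (τ : ℝ) (N : Ex) (k : ℕ) (h : EuclideanSpace ℝ (Fin d)) (hh : h ≠ 0) :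
    Continuous (termE τ N k h) := by
  have h1 : Continuous (ampE N k h) := by
    unfold ampE
    refine Continuous.div ((evE_cont N h).mul (by fun_prop)) ((evE_cont qEx h).pow k) ?_
    intro μ; exact pow_ne_zero _ (q_pos h μ hh).ne'
  unfold termE phE
  fun_prop

lemma ampE_bound {a b N} (hW : W a b N) (k : ℕ) (h : EuclideanSpace ℝ (Fin d)) (hh : h ≠ 0) :
    ∃ C : ℝ, ∀ μ, |ampE N k h μ| ≤ C * Real.exp (-(3 * ‖μ‖ ^ 2)) := by
  obtain ⟨C, hC, hb⟩ := evE_bound (d := d) hW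
  have hH : 0 < ‖h‖ := norm_pos_iff.2 hh
  refine ⟨C * Real.exp (‖h‖ ^ 2 / 2) / (‖h‖ ^ 4) ^ k, fun μ => ?_⟩
  have h1 := hb h μ hh
  have hq : ‖h‖ ^ 4 ≤ evE qEx h μ := by
    refine le_trans ?_ (q_lower h μ)
    nlinarith [mul_nonneg (sq_nonneg ‖h‖) (sq_nonneg ‖μ‖)]
  unfold ampE
  rw [abs_div, abs_mul, abs_of_pos (Real.exp_pos _), abs_of_pos (pow_pos (q_pos h μ hh) k)]
  have h4 : (‖h‖ ^ 4) ^ k ≤ evE qEx h μ ^ k := by gcongr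
  calc |evE N h μ| * Real.exp (-(4 * ‖μ‖ ^ 2)) / evE qEx h μ ^ k
      ≤ (C * Real.exp ((‖μ‖ ^ 2 + ‖h‖ ^ 2) / 2)) * Real.exp (-(4 * ‖μ‖ ^ 2)) / (‖h‖ ^ 4) ^ k := by gcongr
    _ ≤ (C * Real.exp (‖h‖ ^ 2 / 2) * Real.exp (-(3 * ‖μ‖ ^ 2))) / (‖h‖ ^ 4) ^ k := by
        refine div_le_div_of_nonneg_right ?_ (by positivity)
        rw [mul_assoc, mul_assoc, ← Real.exp_add, ← Real.exp_add]
        refine mul_le_mul_of_nonneg_left (Real.exp_le_exp.2 ?_) hC.le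
        nlinarith [sq_nonneg ‖μ‖]
    _ = _ := by ring

lemma termE_int {a b N} (hW : W a b N) (τ : ℝ) (k : ℕ) (h : EuclideanSpace ℝ (Fin d)) (hh : h ≠ 0) :
    Integrable (termE τ N k h) := by
  obtain ⟨C, hC⟩ := ampE_bound hW k h hh
  refine ((integrable_gauss (d := d) 3 (by norm_num)).const_mul C).mono'
    (termE_cont τ N k h hh).aestronglyMeasurable (Filter.Eventually.of_forall fun μ => ?_)
  rw [norm_termE]; exact hC μ

lemma phE_deriv (h μ : EuclideanSpace ℝ (Fin d)) :
    HasDerivAt (fun s : ℝ => phE h (μ + s • h)) (evE qEx h μ) 0 := by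
  unfold phE
  have := (deriv_Q h μ).fun_mul (((deriv_R h μ).const_mul 4).add_const (‖h‖ ^ 2))
  refine this.congr_deriv ?_
  simp [evE, qEx, Ex.ev]
  ring

lemma termE_deriv (τ : ℝ) (N : Ex) (k : ℕ) (h μ : EuclideanSpace ℝ (Fin d)) (hh : h ≠ 0) :
    HasDerivAt (fun s : ℝ => termE τ N (k + 1) h (μ + s • h))
      (Complex.I * τ * termE τ N k h μ + termE τ (stepEx k N) (k + 2) h μ) 0 := by
  have hq := q_pos h μ hh
  have h1 : HasDerivAt (fun s : ℝ => Complex.exp (Complex.I * ((τ * phE h (μ + s • h) : ℝ) : ℂ)))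
      (Complex.exp (Complex.I * ((τ * phE h μ : ℝ) : ℂ)) * (Complex.I * ((τ * evE qEx h μ : ℝ) : ℂ))) 0 := by
    have := (((phE_deriv h μ).const_mul τ).ofReal_comp.const_mul Complex.I).cexp
    simpa using this
  have hexp : HasDerivAt (fun s : ℝ => Real.exp (-(4 * ‖μ + s • h‖ ^ 2)))
      (Real.exp (-(4 * ‖μ‖ ^ 2)) * (-(4 * (2 * ⟪μ, h⟫)))) 0 := by
    have := ((deriv_R h μ).const_mul 4).neg.exp
    simpa using this
  have h2 : HasDerivAt (fun s : ℝ => ampE N (k + 1) h (μ + s • h))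
      (((evE N.D h μ * Real.exp (-(4 * ‖μ‖ ^ 2)) + evE N h μ * (Real.exp (-(4 * ‖μ‖ ^ 2)) * (-(4 * (2 * ⟪μ, h⟫)))))
        * evE qEx h μ ^ (k + 1) - evE N h μ * Real.exp (-(4 * ‖μ‖ ^ 2)) *
          ((k + 1 : ℕ) * evE qEx h μ ^ (k + 1 - 1) * evE qEx.D h μ)) / (evE qEx h μ ^ (k + 1)) ^ 2) 0 := by
    unfold ampE
    have := ((evE_deriv N h μ).fun_mul hexp).fun_div ((evE_deriv qEx h μ).fun_pow (k + 1))
      (by simpa using hq.ne')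
    simpa using this
  have h3 := h1.fun_mul h2.ofReal_comp
  unfold termE
  refine h3.congr_deriv ?_
  simp only [zero_smul, add_zero]
  have e1 : evE qEx.D h μ = 24 * ⟪μ, h⟫ * ‖h‖ ^ 2 := by
    simp only [evE, qEx, Ex.ev, Ex.D]; ring
  have e2 : evE (stepEx k N) h μ = (evE N.D h μ - 8 * ⟪μ, h⟫ * evE N h μ) * evE qEx h μ
      - (k + 1) * evE N h μ * (24 * ⟪μ, h⟫ * ‖h‖ ^ 2) := by
    simp only [evE, stepEx, Ex.ev]; ring
  have e3 : ampE N (k + 1) h μ * evE qEx h μ = ampE N k h μ := by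
    unfold ampE; field_simp; ring
  have e4 : ((evE N.D h μ * Real.exp (-(4 * ‖μ‖ ^ 2)) + evE N h μ * (Real.exp (-(4 * ‖μ‖ ^ 2)) * (-(4 * (2 * ⟪μ, h⟫)))))
        * evE qEx h μ ^ (k + 1) - evE N h μ * Real.exp (-(4 * ‖μ‖ ^ 2)) *
          ((k + 1 : ℕ) * evE qEx h μ ^ (k + 1 - 1) * evE qEx.D h μ)) / (evE qEx h μ ^ (k + 1)) ^ 2
      = ampE (stepEx k N) (k + 2) h μ := by
    unfold ampE
    rw [e1, e2]
    simp only [Nat.add_sub_cancel]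
    push_cast
    field_simp
    ring
  rw [e4, ← e3]
  push_cast
  ring

lemma ibp {a b N} (hW : W a b N) (τ : ℝ) (hτ : τ ≠ 0) (k : ℕ) (h : EuclideanSpace ℝ (Fin d)) (hh : h ≠ 0) :
    ‖∫ μ, termE τ N k h μ‖ = |τ|⁻¹ * ‖∫ μ, termE τ (stepEx k N) (k + 2) h μ‖ := by
  have i1 := termE_int hW τ k h hh
  have i2 := termE_int (W_step k hW) τ (k + 2) h hh
  have i3 := termE_int hW τ (k + 1) h hh
  have key := integral_bilinear_hasLineDerivAt_right_eq_neg_left_of_integrable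
    (μ := (volume : Measure (EuclideanSpace ℝ (Fin d))))
    (f := fun _ : EuclideanSpace ℝ (Fin d) => (1 : ℂ)) (f' := fun _ => 0)
    (g := termE τ N (k + 1) h)
    (g' := fun μ => Complex.I * τ * termE τ N k h μ + termE τ (stepEx k N) (k + 2) h μ) (v := h)
    (B := ContinuousLinearMap.mul ℝ ℂ) (by simp)
    (by simpa using (i1.const_mul (Complex.I * τ)).fun_add i2) (by simpa using i3)
    (fun x _ => by simpa [HasLineDerivAt] using hasDerivAt_const (0:ℝ) (1:ℂ))
    (fun x _ => termE_deriv τ N k h x hh)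
  simp only [ContinuousLinearMap.mul_apply', one_mul, zero_mul, integral_zero, neg_zero] at key
  rw [integral_add (i1.const_mul _) i2, integral_const_mul] at key
  have e : ‖Complex.I * τ * ∫ μ, termE τ N k h μ‖ = ‖∫ μ, termE τ (stepEx k N) (k + 2) h μ‖ := by
    rw [eq_neg_of_add_eq_zero_left key, norm_neg]
  rw [norm_mul, norm_mul, Complex.norm_I, one_mul, Complex.norm_real, Real.norm_eq_abs] at e
  rw [← e]
  field_simp [abs_ne_zero.2 hτ]

lemma ibp_iter {b N0} (hW : W 0 b N0) (τ : ℝ) (hτ : τ ≠ 0) (n : ℕ) (h : EuclideanSpace ℝ (Fin d)) (hh : h ≠ 0) :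
    ‖∫ μ, termE τ N0 0 h μ‖ = (|τ|⁻¹) ^ n * ‖∫ μ, termE τ (iterEx N0 n) (2 * n) h μ‖ := by
  induction n with
  | zero => simp [iterEx]
  | succ n ih => rw [ih, ibp (W_iter hW n) τ hτ (2 * n) h hh, iterEx, pow_succ]; ring_nf

/-- Bound for the inner integral. -/
lemma inner_bound (K n : ℕ) (hK : 3 * n ≤ 8 * K) : ∃ C : ℝ, 0 < C ∧
    ∀ (τ : ℝ) (h : EuclideanSpace ℝ (Fin d)), τ ≠ 0 → h ≠ 0 →
    ‖∫ μ, termE τ (powEx pEx (2 * K)) 0 h μ‖ * Real.exp (-‖h‖ ^ 2) ≤ C * ((|τ| * ‖h‖)⁻¹) ^ n := by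
  have hW0 : W 0 (8 * K) (powEx pEx (2 * K)) := W.weak (W_pow W_p (2 * K)) (by omega) (by omega)
  have hW := W_iter hW0 n
  obtain ⟨C, hC, L, hb⟩ := hW.bound
  obtain ⟨C', hC', hb'⟩ := one_add_pow_le (8 * K - 3 * n + L)
  set G := ∫ μ : EuclideanSpace ℝ (Fin d), Real.exp (-(3 * ‖μ‖ ^ 2)) with hG
  have hG0 : 0 ≤ G := integral_nonneg (fun _ => (Real.exp_pos _).le)
  refine ⟨C * C' * G + 1, by positivity, fun τ h hτ hh => ?_⟩
  have hH : 0 < ‖h‖ := norm_pos_iff.2 hh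
  rw [ibp_iter hW0 τ hτ n h hh]
  have pt : ∀ μ, |ampE (iterEx (powEx pEx (2 * K)) n) (2 * n) h μ| * Real.exp (-‖h‖ ^ 2) ≤
      C * C' * (‖h‖⁻¹) ^ n * Real.exp (-(3 * ‖μ‖ ^ 2)) := by
    intro μ
    have hp : 0 < ‖h‖ ^ 2 + ‖μ‖ ^ 2 := by positivity
    set ρ := Real.sqrt (‖h‖ ^ 2 + ‖μ‖ ^ 2) with hρ
    have hρ2 : ρ ^ 2 = ‖h‖ ^ 2 + ‖μ‖ ^ 2 := Real.sq_sqrt hp.le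
    have hρ0 : 0 < ρ := Real.sqrt_pos.2 hp
    have h1 := hb (‖μ‖ ^ 2) ⟪μ, h⟫ ‖h‖ ρ (by positivity) hH hρ0 hρ2.symm (by
      have := abs_real_inner_le_norm μ h
      rw [← mul_pow, sq_le_sq, abs_of_nonneg (by positivity : 0 ≤ ‖μ‖ * ‖h‖)]; exact this)
    change |evE _ h μ| * _ ≤ _ at h1
    set N := evE (iterEx (powEx pEx (2 * K)) n) h μ with hN
    have hq : ‖h‖ ^ 2 * ρ ^ 2 ≤ evE qEx h μ := by
      refine le_trans ?_ (q_lower h μ)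
      rw [hρ2]
      refine mul_le_mul_of_nonneg_left ?_ (sq_nonneg _)
      nlinarith [sq_nonneg ‖μ‖]
    have hqp := q_pos h μ hh
    have h3 := hb' ρ hρ0.le
    have hN1 : |N| ≤ C * ‖h‖ ^ (3 * n) * ρ ^ (8 * K - 3 * n + 4 * n) * (1 + ρ) ^ L := by
      rw [← mul_le_mul_iff_left₀ (show 0 < ρ ^ (3 * n) by positivity)]
      refine h1.trans (le_of_eq ?_)
      rw [show 8 * K + 4 * n = (8 * K - 3 * n + 4 * n) + 3 * n by omega, pow_add ρ _ (3 * n)]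
      ring
    have hN2 : |N| / evE qEx h μ ^ (2 * n) ≤ C * C' * (‖h‖⁻¹) ^ n * Real.exp (ρ ^ 2 / 2) := by
      calc |N| / evE qEx h μ ^ (2 * n) ≤ (C * ‖h‖ ^ (3 * n) * ρ ^ (8 * K - 3 * n + 4 * n) * (1 + ρ) ^ L) /
            (‖h‖ ^ 2 * ρ ^ 2) ^ (2 * n) := by gcongr
        _ = C * (‖h‖⁻¹) ^ n * (ρ ^ (8 * K - 3 * n) * (1 + ρ) ^ L) := by
            rw [inv_pow, mul_pow, ← pow_mul, ← pow_mul, pow_add,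
              show 2 * (2 * n) = 4 * n by ring, show ‖h‖ ^ (4 * n) = ‖h‖ ^ (3 * n) * ‖h‖ ^ n by
                rw [← pow_add]; congr 1; ring]
            field_simp
        _ ≤ C * (‖h‖⁻¹) ^ n * ((1 + ρ) ^ (8 * K - 3 * n) * (1 + ρ) ^ L) := by
            gcongr; linarith
        _ ≤ C * (‖h‖⁻¹) ^ n * (C' * Real.exp (ρ ^ 2 / 2)) := by rw [← pow_add]; gcongr
        _ = _ := by ring
    unfold ampE
    rw [abs_div, abs_mul, abs_of_pos (Real.exp_pos _), abs_of_pos (pow_pos hqp _)]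
    calc _ = |N| / evE qEx h μ ^ (2 * n) * (Real.exp (-(4 * ‖μ‖ ^ 2)) * Real.exp (-‖h‖ ^ 2)) := by ring
      _ ≤ (C * C' * (‖h‖⁻¹) ^ n * Real.exp (ρ ^ 2 / 2)) * (Real.exp (-(4 * ‖μ‖ ^ 2)) * Real.exp (-‖h‖ ^ 2)) := by
          gcongr
      _ = (C * C' * (‖h‖⁻¹) ^ n) * Real.exp (ρ ^ 2 / 2 + (-(4 * ‖μ‖ ^ 2) + -‖h‖ ^ 2)) := by
          rw [Real.exp_add, Real.exp_add]; ring
      _ ≤ _ := by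
          gcongr
          rw [hρ2]; nlinarith [sq_nonneg ‖μ‖, sq_nonneg ‖h‖]
  have h5 : ‖∫ μ, termE τ (iterEx (powEx pEx (2 * K)) n) (2 * n) h μ‖ * Real.exp (-‖h‖ ^ 2)
      ≤ C * C' * (‖h‖⁻¹) ^ n * G := by
    calc _ ≤ (∫ μ, ‖termE τ (iterEx (powEx pEx (2 * K)) n) (2 * n) h μ‖) * Real.exp (-‖h‖ ^ 2) := by
          gcongr; exact norm_integral_le_integral_norm _
      _ = ∫ μ, |ampE (iterEx (powEx pEx (2 * K)) n) (2 * n) h μ| * Real.exp (-‖h‖ ^ 2) := by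
          rw [← integral_mul_const]; simp only [norm_termE]
      _ ≤ ∫ μ, C * C' * (‖h‖⁻¹) ^ n * Real.exp (-(3 * ‖μ‖ ^ 2)) := by
          apply integral_mono_of_nonneg (Filter.Eventually.of_forall fun μ => by positivity)
          · exact (integrable_gauss 3 (by norm_num)).const_mul _
          · exact Filter.Eventually.of_forall pt
      _ = _ := by rw [integral_const_mul]
  have h6 : 0 ≤ (‖h‖⁻¹) ^ n * |τ|⁻¹ ^ n := by positivity
  calc _ = |τ|⁻¹ ^ n * (‖∫ μ, termE τ (iterEx (powEx pEx (2 * K)) n) (2 * n) h μ‖ * Real.exp (-‖h‖ ^ 2)) := by ring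
    _ ≤ |τ|⁻¹ ^ n * (C * C' * (‖h‖⁻¹) ^ n * G) := by gcongr
    _ = C * C' * G * ((‖h‖⁻¹) ^ n * |τ|⁻¹ ^ n) := by ring
    _ ≤ (C * C' * G + 1) * ((‖h‖⁻¹) ^ n * |τ|⁻¹ ^ n) := by nlinarith
    _ = _ := by rw [mul_inv, mul_pow]; ring

end Strich

set_option linter.unusedVariables false

namespace Strich
variable {d : ℕ}

/-- The smooth cutoff symbol. -/
noncomputable def mK (d : ℕ) (ξ : EuclideanSpace ℝ (Fin d)) : ℝ :=
  ‖ξ‖ ^ (2 * (d + 1)) * Real.exp (-‖ξ‖ ^ 2)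

lemma mK_cont : Continuous (mK d) := by unfold mK; fun_prop

lemma mK_nonneg (ξ : EuclideanSpace ℝ (Fin d)) : 0 ≤ mK d ξ := by unfold mK; positivity

lemma mK_bound (d : ℕ) : ∃ C : ℝ, 0 < C ∧ ∀ ξ : EuclideanSpace ℝ (Fin d), mK d ξ ≤ C * Real.exp (-(‖ξ‖ ^ 2 / 2)) := by
  obtain ⟨C, hC, hb⟩ := one_add_pow_le (2 * (d + 1))
  refine ⟨C, hC, fun ξ => ?_⟩
  unfold mK
  calc ‖ξ‖ ^ (2 * (d + 1)) * Real.exp (-‖ξ‖ ^ 2) ≤ (1 + ‖ξ‖) ^ (2 * (d + 1)) * Real.exp (-‖ξ‖ ^ 2) := by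
        gcongr; linarith
    _ ≤ (C * Real.exp (‖ξ‖ ^ 2 / 2)) * Real.exp (-‖ξ‖ ^ 2) := by gcongr; exact hb _ (norm_nonneg _)
    _ = _ := by rw [mul_assoc, ← Real.exp_add]; congr 2; ring

noncomputable def theta (t : ℝ) (x ξ : EuclideanSpace ℝ (Fin d)) : ℝ :=
  2 * Real.pi * ⟪x, ξ⟫ + t * (2 * Real.pi * ‖ξ‖) ^ 4

noncomputable def gK (t : ℝ) (x ξ : EuclideanSpace ℝ (Fin d)) : ℂ :=
  Complex.exp (Complex.I * (theta t x ξ : ℝ)) * ((mK d ξ ^ 2 : ℝ) : ℂ)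

lemma norm_expI (r : ℝ) : ‖Complex.exp (Complex.I * (r : ℂ))‖ = 1 := by
  rw [mul_comm, Complex.norm_exp_ofReal_mul_I]

lemma norm_gK (t : ℝ) (x ξ : EuclideanSpace ℝ (Fin d)) : ‖gK t x ξ‖ = mK d ξ ^ 2 := by
  unfold gK
  rw [norm_mul, norm_expI, one_mul, Complex.norm_real, Real.norm_eq_abs, abs_of_nonneg (sq_nonneg _)]

lemma gK_cont (t : ℝ) (x : EuclideanSpace ℝ (Fin d)) : Continuous (gK t x) := by
  unfold gK theta
  have := mK_cont (d := d)
  fun_prop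

lemma gK_pair (t : ℝ) (x h μ : EuclideanSpace ℝ (Fin d)) :
    gK t x (μ + (1/2 : ℝ) • h) * (starRingEnd ℂ) (gK t x (μ - (1/2 : ℝ) • h)) =
      Complex.exp (Complex.I * ((2 * Real.pi * ⟪x, h⟫ : ℝ) : ℂ)) * ((Real.exp (-‖h‖ ^ 2) : ℝ) : ℂ) *
        termE (t * (2 * Real.pi) ^ 4) (powEx pEx (2 * (d + 1))) 0 h μ := by
  have n1 : ‖μ + (1/2 : ℝ) • h‖ ^ 2 = ‖μ‖ ^ 2 + ‖h‖ ^ 2 / 4 + ⟪μ, h⟫ := by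
    rw [norm_add_sq_real, inner_smul_right, norm_smul, mul_pow, Real.norm_eq_abs, sq_abs]; ring
  have n2 : ‖μ - (1/2 : ℝ) • h‖ ^ 2 = ‖μ‖ ^ 2 + ‖h‖ ^ 2 / 4 - ⟪μ, h⟫ := by
    rw [norm_sub_sq_real, inner_smul_right, norm_smul, mul_pow, Real.norm_eq_abs, sq_abs]; ring
  have hth : theta t x (μ + (1/2 : ℝ) • h) - theta t x (μ - (1/2 : ℝ) • h)
      = 2 * Real.pi * ⟪x, h⟫ + t * (2 * Real.pi) ^ 4 * phE h μ := by
    unfold theta phE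
    have e1 : ∀ v : EuclideanSpace ℝ (Fin d), (2 * Real.pi * ‖v‖) ^ 4 = (2 * Real.pi) ^ 4 * (‖v‖ ^ 2) ^ 2 := by
      intro v; ring
    rw [e1, e1, n1, n2, inner_add_right, inner_sub_right, inner_smul_right]
    ring
  have hamp : mK d (μ + (1/2 : ℝ) • h) ^ 2 * mK d (μ - (1/2 : ℝ) • h) ^ 2
      = Real.exp (-‖h‖ ^ 2) * ampE (powEx pEx (2 * (d + 1))) 0 h μ := by
    unfold mK ampE
    simp only [evE, ev_pow, pow_zero, div_one]
    have e2 : Ex.ev (‖μ‖ ^ 2) ⟪μ, h⟫ (‖h‖ ^ 2) pEx = (‖μ + (1/2 : ℝ) • h‖ ^ 2) * (‖μ - (1/2 : ℝ) • h‖ ^ 2) := by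
      rw [n1, n2]; simp only [pEx, Ex.ev]; ring
    rw [e2]
    have e3 : Real.exp (-‖h‖ ^ 2) * Real.exp (-(4 * ‖μ‖ ^ 2)) =
        (Real.exp (-‖μ + (1/2 : ℝ) • h‖ ^ 2)) ^ 2 * (Real.exp (-‖μ - (1/2 : ℝ) • h‖ ^ 2)) ^ 2 := by
      rw [← Real.exp_nat_mul, ← Real.exp_nat_mul, ← Real.exp_add, ← Real.exp_add, n1, n2]
      congr 1; push_cast; ring
    calc _ = ((‖μ + (1/2 : ℝ) • h‖ ^ 2) * (‖μ - (1/2 : ℝ) • h‖ ^ 2)) ^ (2 * (d + 1)) *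
          ((Real.exp (-‖μ + (1/2 : ℝ) • h‖ ^ 2)) ^ 2 * (Real.exp (-‖μ - (1/2 : ℝ) • h‖ ^ 2)) ^ 2) := by
            rw [mul_pow, mul_pow, mul_pow, ← pow_mul, ← pow_mul, ← pow_mul, ← pow_mul,
              show 2 * (d + 1) * 2 = 2 * (2 * (d + 1)) by ring]
            ring
      _ = _ := by rw [← e3]; ring
  unfold gK termE
  rw [map_mul, ← Complex.exp_conj, map_mul, Complex.conj_I, Complex.conj_ofReal, Complex.conj_ofReal]
  calc _ = (Complex.exp (Complex.I * ((theta t x (μ + (1/2 : ℝ) • h)) : ℝ)) *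
        Complex.exp (-Complex.I * (theta t x (μ - (1/2 : ℝ) • h) : ℝ))) *
        ((mK d (μ + (1/2 : ℝ) • h) ^ 2 * mK d (μ - (1/2 : ℝ) • h) ^ 2 : ℝ) : ℂ) := by push_cast; ring
    _ = Complex.exp (Complex.I * ((theta t x (μ + (1/2 : ℝ) • h) - theta t x (μ - (1/2 : ℝ) • h) : ℝ) : ℂ)) *
        ((mK d (μ + (1/2 : ℝ) • h) ^ 2 * mK d (μ - (1/2 : ℝ) • h) ^ 2 : ℝ) : ℂ) := by
          rw [← Complex.exp_add]; congr 2; push_cast; ring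
    _ = _ := by
          rw [hth, hamp]
          push_cast
          rw [mul_add, Complex.exp_add]
          ring

lemma mK2_bound (d : ℕ) : ∃ C : ℝ, 0 < C ∧ ∀ ξ : EuclideanSpace ℝ (Fin d), mK d ξ ^ 2 ≤ C * Real.exp (-(‖ξ‖ ^ 2)) := by
  obtain ⟨C, hC, hb⟩ := mK_bound d
  refine ⟨C ^ 2, by positivity, fun ξ => ?_⟩
  calc mK d ξ ^ 2 ≤ (C * Real.exp (-(‖ξ‖ ^ 2 / 2))) ^ 2 := by
        have := mK_nonneg ξ; gcongr; exact hb ξ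
    _ = _ := by rw [mul_pow, ← Real.exp_nat_mul]; congr 2; push_cast; ring

lemma mK2_int : Integrable (fun ξ : EuclideanSpace ℝ (Fin d) => mK d ξ ^ 2) := by
  obtain ⟨C, hC, hb⟩ := mK2_bound d
  refine ((integrable_gauss 1 one_pos).const_mul C).mono' ((mK_cont.pow 2).aestronglyMeasurable)
    (Filter.Eventually.of_forall fun ξ => ?_)
  rw [Real.norm_eq_abs, abs_of_nonneg (sq_nonneg _), one_mul]; exact hb ξ

lemma gK_int (t : ℝ) (x : EuclideanSpace ℝ (Fin d)) : Integrable (gK t x) := by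
  refine mK2_int.mono' (gK_cont t x).aestronglyMeasurable (Filter.Eventually.of_forall fun ξ => ?_)
  rw [norm_gK]

lemma pair_int (t : ℝ) (x : EuclideanSpace ℝ (Fin d)) :
    Integrable (Function.uncurry fun η h : EuclideanSpace ℝ (Fin d) =>
      gK t x (η + h) * (starRingEnd ℂ) (gK t x η)) (volume.prod volume) := by
  obtain ⟨C, hC, hb⟩ := mK2_bound d
  have hi : Integrable (fun z : EuclideanSpace ℝ (Fin d) × EuclideanSpace ℝ (Fin d) =>
      (C ^ 2 * Real.exp (-((1/2) * ‖z.1‖ ^ 2))) * Real.exp (-((1/4) * ‖z.2‖ ^ 2))) (volume.prod volume) :=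
    ((integrable_gauss (d := d) (1/2) (by norm_num)).const_mul (C^2)).mul_prod
      (integrable_gauss (d := d) (1/4) (by norm_num))
  refine hi.mono' ?_ (Filter.Eventually.of_forall fun z => ?_)
  · apply Continuous.aestronglyMeasurable
    have := gK_cont t x
    unfold Function.uncurry
    fun_prop
  · obtain ⟨η, h⟩ := z
    simp only [Function.uncurry]
    rw [norm_mul, RCLike.norm_conj, norm_gK, norm_gK]
    have : ‖h‖ ^ 2 ≤ 2 * ‖η + h‖ ^ 2 + 2 * ‖η‖ ^ 2 := by
      have : ‖h‖ ≤ ‖η + h‖ + ‖η‖ := by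
        calc ‖h‖ = ‖(η + h) - η‖ := by simp
          _ ≤ _ := norm_sub_le _ _
      nlinarith [sq_nonneg (‖η + h‖ - ‖η‖), norm_nonneg h]
    calc _ ≤ (C * Real.exp (-(‖η + h‖ ^ 2))) * (C * Real.exp (-(‖η‖ ^ 2))) := by
          gcongr; exact hb _; exact hb _
      _ = C ^ 2 * Real.exp (-(‖η + h‖ ^ 2) + -(‖η‖ ^ 2)) := by rw [Real.exp_add]; ring
      _ ≤ C ^ 2 * Real.exp (-((1/2) * ‖η‖ ^ 2) + -((1/4) * ‖h‖ ^ 2)) := by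
          refine mul_le_mul_of_nonneg_left (Real.exp_le_exp.2 ?_) (by positivity)
          linarith [sq_nonneg ‖η + h‖]
      _ = _ := by rw [Real.exp_add]; ring

lemma sq_bound (t : ℝ) (x : EuclideanSpace ℝ (Fin d)) :
    ‖∫ ξ, gK t x ξ‖ ^ 2 = ‖∫ h : EuclideanSpace ℝ (Fin d),
      Complex.exp (Complex.I * ((2 * Real.pi * ⟪x, h⟫ : ℝ) : ℂ)) * ((Real.exp (-‖h‖ ^ 2) : ℝ) : ℂ) *
        ∫ μ, termE (t * (2 * Real.pi) ^ 4) (powEx pEx (2 * (d + 1))) 0 h μ‖ := by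
  have e : (∫ ξ, gK t x ξ) * (starRingEnd ℂ) (∫ ξ, gK t x ξ) = ∫ h : EuclideanSpace ℝ (Fin d),
      Complex.exp (Complex.I * ((2 * Real.pi * ⟪x, h⟫ : ℝ) : ℂ)) * ((Real.exp (-‖h‖ ^ 2) : ℝ) : ℂ) *
        ∫ μ, termE (t * (2 * Real.pi) ^ 4) (powEx pEx (2 * (d + 1))) 0 h μ := by
    calc _ = ∫ η, (∫ ξ, gK t x ξ) * (starRingEnd ℂ) (gK t x η) := by
            rw [integral_const_mul, integral_conj]
      _ = ∫ η, ∫ h, gK t x (η + h) * (starRingEnd ℂ) (gK t x η) := by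
            congr 1; ext η
            rw [integral_mul_const, integral_add_left_eq_self (fun ξ => gK t x ξ)]
      _ = ∫ h, ∫ η, gK t x (η + h) * (starRingEnd ℂ) (gK t x η) := integral_integral_swap (pair_int t x)
      _ = ∫ h, ∫ μ, gK t x (μ + (1/2 : ℝ) • h) * (starRingEnd ℂ) (gK t x (μ - (1/2 : ℝ) • h)) := by
            congr 1; ext h
            rw [← integral_sub_right_eq_self _ ((1/2 : ℝ) • h)]
            congr 1; ext μ
            congr 2
            rw [show μ - (1/2 : ℝ) • h + h = μ + (1/2 : ℝ) • h by
              rw [sub_add_eq_add_sub, add_sub_assoc]; congr 1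
              rw [sub_eq_iff_eq_add, ← add_smul]; norm_num]
      _ = _ := by
            congr 1; ext h
            simp only [gK_pair]
            rw [integral_const_mul]
  rw [← e, norm_mul, RCLike.norm_conj, sq]

theorem disp (hd : 1 ≤ d) : ∃ C : ℝ, 0 < C ∧ ∀ (t : ℝ) (x : EuclideanSpace ℝ (Fin d)),
    ‖∫ ξ, gK t x ξ‖ ≤ C ∧ (t ≠ 0 → ‖∫ ξ, gK t x ξ‖ ≤ C * |t| ^ (-(d : ℝ) / 2)) := by
  obtain ⟨C1, hC1, hb1⟩ := inner_bound (d := d) (d + 1) 0 (by omega)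
  obtain ⟨C2, hC2, hb2⟩ := inner_bound (d := d) (d + 1) (d + 1) (by omega)
  set C3 := 2 ^ (d + 1) * (C1 + C2) with hC3
  set J := ∫ h : EuclideanSpace ℝ (Fin d), (1 + ‖h‖) ^ (-((d : ℝ) + 1)) with hJ
  have hJ0 : 0 ≤ J := integral_nonneg (fun h => by positivity)
  have hJi : Integrable (fun h : EuclideanSpace ℝ (Fin d) => (1 + ‖h‖) ^ (-((d : ℝ) + 1))) :=
    integrable_one_add_norm (by simp)
  have triv : ∀ (t : ℝ) (x : EuclideanSpace ℝ (Fin d)), ‖∫ ξ, gK t x ξ‖ ≤ ∫ ξ : EuclideanSpace ℝ (Fin d), mK d ξ ^ 2 := by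
    intro t x
    refine (norm_integral_le_integral_norm _).trans (le_of_eq ?_)
    simp only [norm_gK]
  set M := ∫ ξ : EuclideanSpace ℝ (Fin d), mK d ξ ^ 2 with hM
  have hM0 : 0 ≤ M := integral_nonneg (fun h => sq_nonneg _)
  have key : ∀ (t : ℝ) (x : EuclideanSpace ℝ (Fin d)), t ≠ 0 →
      ‖∫ ξ, gK t x ξ‖ ^ 2 ≤ C3 * J * |t| ^ (-(d : ℝ)) := by
    intro t x ht
    set τ := t * (2 * Real.pi) ^ 4 with hτ
    have hpi : 1 ≤ 2 * Real.pi := by linarith [Real.pi_gt_three]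
    have hτ0 : τ ≠ 0 := by positivity
    have hτt : |t| ≤ |τ| := by
      rw [hτ, abs_mul, abs_of_pos (by positivity : 0 < (2 * Real.pi) ^ 4)]
      exact le_mul_of_one_le_right (abs_nonneg _) (one_le_pow₀ hpi)
    have hτp : 0 < |τ| := abs_pos.2 hτ0
    rw [sq_bound]
    have pt : ∀ h : EuclideanSpace ℝ (Fin d), h ≠ 0 →
        ‖Complex.exp (Complex.I * ((2 * Real.pi * ⟪x, h⟫ : ℝ) : ℂ)) * ((Real.exp (-‖h‖ ^ 2) : ℝ) : ℂ) *
        ∫ μ, termE (t * (2 * Real.pi) ^ 4) (powEx pEx (2 * (d + 1))) 0 h μ‖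
        ≤ C3 * (1 + ‖|τ| • h‖) ^ (-((d : ℝ) + 1)) := by
      intro h hh
      rw [norm_mul, norm_mul, norm_expI, one_mul, Complex.norm_real, Real.norm_eq_abs, abs_of_pos (Real.exp_pos _),
        mul_comm]
      have a1 := hb1 τ h hτ0 hh
      have a2 := hb2 τ h hτ0 hh
      set X := ‖∫ μ, termE τ (powEx pEx (2 * (d + 1))) 0 h μ‖ * Real.exp (-‖h‖ ^ 2) with hX
      rw [norm_smul, Real.norm_eq_abs, abs_abs]
      set y := |τ| * ‖h‖ with hy
      have hy0 : 0 < y := mul_pos hτp (norm_pos_iff.2 hh)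
      rw [pow_zero, mul_one] at a1
      rw [show -((d : ℝ) + 1) = -((d + 1 : ℕ) : ℝ) by push_cast; ring, Real.rpow_neg (by positivity), Real.rpow_natCast,
        ← div_eq_mul_inv, le_div_iff₀ (by positivity)]
      rw [inv_pow, ← div_eq_mul_inv, le_div_iff₀ (by positivity)] at a2
      have hX0 : 0 ≤ X := by positivity
      rcases le_total y 1 with h1 | h1
      · calc X * (1 + y) ^ (d + 1) ≤ X * 2 ^ (d + 1) := by gcongr; linarith
          _ ≤ C1 * 2 ^ (d + 1) := by gcongr
          _ ≤ C3 := by rw [hC3]; have : (0:ℝ) < 2 ^ (d + 1) := by positivity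
                       nlinarith
      · calc X * (1 + y) ^ (d + 1) ≤ X * (2 * y) ^ (d + 1) := by gcongr; linarith
          _ = 2 ^ (d + 1) * (X * y ^ (d + 1)) := by rw [mul_pow]; ring
          _ ≤ 2 ^ (d + 1) * C2 := by gcongr
          _ ≤ C3 := by rw [hC3]; have : (0:ℝ) < 2 ^ (d + 1) := by positivity
                       nlinarith
    have : Nonempty (Fin d) := ⟨⟨0, hd⟩⟩
    have hne : ∀ᵐ h : EuclideanSpace ℝ (Fin d), h ≠ 0 := by
      rw [ae_iff]; simp
    calc _ ≤ ∫ h : EuclideanSpace ℝ (Fin d), ‖Complex.exp (Complex.I * ((2 * Real.pi * ⟪x, h⟫ : ℝ) : ℂ)) * ((Real.exp (-‖h‖ ^ 2) : ℝ) : ℂ) *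
        ∫ μ, termE (t * (2 * Real.pi) ^ 4) (powEx pEx (2 * (d + 1))) 0 h μ‖ := norm_integral_le_integral_norm _
      _ ≤ ∫ h : EuclideanSpace ℝ (Fin d), C3 * (1 + ‖|τ| • h‖) ^ (-((d : ℝ) + 1)) := by
          apply integral_mono_of_nonneg (Filter.Eventually.of_forall fun μ => by positivity)
          · exact ((integrable_comp_smul_iff volume (fun h : EuclideanSpace ℝ (Fin d) => (1 + ‖h‖) ^ (-((d : ℝ) + 1)))
              hτp.ne').2 hJi).const_mul _
          · filter_upwards [hne] with h hh using pt h hh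
      _ = C3 * ((|τ| ^ d)⁻¹ * J) := by
          rw [integral_const_mul, Measure.integral_comp_smul volume
            (fun h : EuclideanSpace ℝ (Fin d) => (1 + ‖h‖) ^ (-((d : ℝ) + 1)))]
          simp [hJ]
      _ ≤ C3 * ((|t| ^ d)⁻¹ * J) := by
          have : 0 < |t| := abs_pos.2 ht
          gcongr
      _ = _ := by rw [Real.rpow_neg (abs_nonneg _), Real.rpow_natCast]; ring
  refine ⟨M + Real.sqrt (C3 * J) + 1, by positivity, fun t x => ⟨?_, fun ht => ?_⟩⟩
  · have := triv t x
    have := Real.sqrt_nonneg (C3 * J)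
    linarith
  · have ht' : 0 < |t| := abs_pos.2 ht
    have h1 : ‖∫ ξ, gK t x ξ‖ ≤ Real.sqrt (C3 * J) * |t| ^ (-(d : ℝ) / 2) := by
      apply le_of_sq_le_sq _ (by positivity)
      refine (key t x ht).trans (le_of_eq ?_)
      rw [mul_pow, Real.sq_sqrt (by positivity), ← Real.rpow_natCast (|t| ^ _), ← Real.rpow_mul (abs_nonneg _)]
      congr 2; push_cast; ring
    refine h1.trans ?_
    gcongr
    linarith

end Strich

set_option linter.unusedVariables false

namespace Strich

section Abstract
variable {X : Type*} [MeasurableSpace X] {μ : Measure X} [SigmaFinite μ]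

/-- Domination of a time dependent family. -/
structure Dom (R : ℝ) (M : X → ℝ) (β : ℝ → X → ℂ) : Prop where
  meas : Measurable (Function.uncurry β)
  le : ∀ s ξ, ‖β s ξ‖ ≤ (Set.Icc (-R) R).indicator (fun _ => M ξ) s

/-- The `L²` pairing of two slices. -/
noncomputable def ip (μ : Measure X) (f g : X → ℂ) : ℂ := ∫ ξ, f ξ * (starRingEnd ℂ) (g ξ) ∂μ

variable {R : ℝ} {M : X → ℝ} {β γ : ℝ → X → ℂ}

lemma Dom.slice (h : Dom R M β) (s : ℝ) : Measurable (β s) := h.meas.of_uncurry_left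

lemma Dom.le' (h : Dom R M β) (s : ℝ) (ξ : X) : ‖β s ξ‖ ≤ |M ξ| := by
  refine (h.le s ξ).trans ?_
  by_cases hs : s ∈ Set.Icc (-R) R
  · simp only [hs, Set.indicator_of_mem]; exact le_abs_self _
  · simp only [hs, not_false_eq_true, Set.indicator_of_notMem]; exact abs_nonneg _

lemma Dom.indicator (h : Dom R M β) {S : Set ℝ} (hS : MeasurableSet S) :
    Dom R M (fun s ξ => S.indicator (fun s => β s ξ) s) := by
  constructor
  · have : (Function.uncurry fun s ξ => S.indicator (fun s => β s ξ) s) =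
        (Prod.fst ⁻¹' S : Set (ℝ × X)).indicator (Function.uncurry β) := by
      ext ⟨s, ξ⟩
      by_cases hs : s ∈ S
      · simp [Function.uncurry, hs]
      · simp [Function.uncurry, hs]
    rw [this]
    exact h.meas.indicator (measurable_fst hS)
  · intro s ξ
    refine le_trans ?_ (h.le s ξ)
    exact norm_indicator_le_norm_self _ _

lemma Dom.sum {K : Finset ℤ} {α : ℤ → ℝ → X → ℂ} (h : ∀ k, Dom R M (α k)) :
    Dom R (fun ξ => K.card * M ξ) (fun s ξ => ∑ k ∈ K, α k s ξ) := by
  constructor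
  · have : (Function.uncurry fun s ξ => ∑ k ∈ K, α k s ξ) = fun z => ∑ k ∈ K, Function.uncurry (α k) z := by
      ext ⟨s, ξ⟩; rfl
    rw [this]
    exact Finset.measurable_sum _ (fun k _ => (h k).meas)
  · intro s ξ
    refine (norm_sum_le _ _).trans ?_
    refine (Finset.sum_le_sum (fun k _ => (h k).le s ξ)).trans ?_
    rw [Finset.sum_const, nsmul_eq_mul]
    by_cases hs : s ∈ Set.Icc (-R) R
    · simp [hs]
    · simp [hs]

lemma Dom.int3 (hM : Measurable M) (hM2 : Integrable (fun ξ => M ξ ^ 2) μ) (hβ : Dom R M β) (hγ : Dom R M γ) :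
    Integrable (fun z : (ℝ × ℝ) × X => β z.1.1 z.2 * (starRingEnd ℂ) (γ z.1.2 z.2)) ((volume.prod volume).prod μ) := by
  have i1 : Integrable (fun z : ℝ × ℝ => (Set.Icc (-R) R).indicator (fun _ => (1:ℝ)) z.1 *
      (Set.Icc (-R) R).indicator (fun _ => (1:ℝ)) z.2) (volume.prod volume) := by
    apply Integrable.mul_prod <;>
    · rw [integrable_indicator_iff measurableSet_Icc]
      exact integrableOn_const (by simp)
  refine (i1.mul_prod hM2).mono' ?_ (Filter.Eventually.of_forall fun z => ?_)
  · apply Measurable.aestronglyMeasurable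
    apply Measurable.mul
    · exact hβ.meas.comp ((measurable_fst.comp measurable_fst).prodMk measurable_snd)
    · exact Complex.continuous_conj.measurable.comp
        (hγ.meas.comp ((measurable_snd.comp measurable_fst).prodMk measurable_snd))
  · obtain ⟨⟨s, t⟩, ξ⟩ := z
    rw [norm_mul, RCLike.norm_conj]
    refine (mul_le_mul (hβ.le s ξ) (hγ.le t ξ) (norm_nonneg _) ((norm_nonneg _).trans (hβ.le s ξ))).trans (le_of_eq ?_)
    by_cases hs : s ∈ Set.Icc (-R) R <;> by_cases ht : t ∈ Set.Icc (-R) R <;> simp [hs, ht, sq]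

lemma Dom.int_ip (hM : Measurable M) (hM2 : Integrable (fun ξ => M ξ ^ 2) μ) (hβ : Dom R M β) (hγ : Dom R M γ) :
    Integrable (fun z : ℝ × ℝ => ip μ (β z.1) (γ z.2)) (volume.prod volume) :=
  (Dom.int3 hM hM2 hβ hγ).integral_prod_left

lemma Dom.fubini (hM : Measurable M) (hM2 : Integrable (fun ξ => M ξ ^ 2) μ) (hβ : Dom R M β) (hγ : Dom R M γ) :
    ip μ (fun ξ => ∫ s, β s ξ) (fun ξ => ∫ t, γ t ξ) =
      ∫ z : ℝ × ℝ, ip μ (β z.1) (γ z.2) ∂(volume.prod volume) := by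
  have h := integral_integral_swap (f := fun (z : ℝ × ℝ) ξ => β z.1 ξ * (starRingEnd ℂ) (γ z.2 ξ))
    (Dom.int3 hM hM2 hβ hγ)
  unfold ip
  rw [h]
  congr 1; ext ξ
  rw [← integral_conj]
  exact (integral_prod_mul (fun s => β s ξ) (fun t => (starRingEnd ℂ) (γ t ξ))).symm

/-- Mixed version: integrate only in the first variable. -/
lemma Dom.fubini1 (hM : Measurable M) (hM2 : Integrable (fun ξ => M ξ ^ 2) μ) (hβ : Dom R M β) (hγ : Dom R M γ)
    (t : ℝ) : ip μ (fun ξ => ∫ s, β s ξ) (γ t) = ∫ s, ip μ (β s) (γ t) := by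
  have i1 : Integrable (fun z : ℝ × X => β z.1 z.2 * (starRingEnd ℂ) (γ t z.2)) (volume.prod μ) := by
    have i0 : Integrable (fun s : ℝ => (Set.Icc (-R) R).indicator (fun _ => (1:ℝ)) s) := by
      rw [integrable_indicator_iff measurableSet_Icc]
      exact integrableOn_const (by simp)
    refine (i0.mul_prod hM2).mono' ?_ (Filter.Eventually.of_forall fun z => ?_)
    · apply Measurable.aestronglyMeasurable
      apply Measurable.mul
      · exact hβ.meas
      · exact Complex.continuous_conj.measurable.comp ((hγ.slice t).comp measurable_snd)
    · obtain ⟨s, ξ⟩ := z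
      rw [norm_mul, RCLike.norm_conj]
      refine (mul_le_mul (hβ.le s ξ) (hγ.le' t ξ) (norm_nonneg _) ((norm_nonneg _).trans (hβ.le s ξ))).trans ?_
      by_cases hs : s ∈ Set.Icc (-R) R
      · simp only [hs, Set.indicator_of_mem, one_mul]
        nlinarith [le_abs_self (M ξ), abs_nonneg (M ξ), sq_abs (M ξ)]
      · simp [hs]
  have h := integral_integral_swap (f := fun (s : ℝ) ξ => β s ξ * (starRingEnd ℂ) (γ t ξ)) i1
  unfold ip
  rw [h]
  congr 1; ext ξ
  rw [integral_mul_const]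

lemma Dom.meas_int (hβ : Dom R M β) : Measurable (fun ξ => ∫ s, β s ξ) := by
  have : StronglyMeasurable (fun ξ => ∫ s, β s ξ) :=
    StronglyMeasurable.integral_prod_left' (f := Function.uncurry β) hβ.meas.stronglyMeasurable
  exact this.measurable

lemma enorm_ip_self {f : X → ℂ} (hf : Measurable f) (hi : Integrable (fun ξ => ‖f ξ‖ ^ 2) μ) :
    ‖ip μ f f‖ₑ = ∫⁻ ξ, ‖f ξ‖ₑ ^ 2 ∂μ := by
  unfold ip
  have e : ∀ ξ, f ξ * (starRingEnd ℂ) (f ξ) = ((‖f ξ‖ ^ 2 : ℝ) : ℂ) := by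
    intro ξ; rw [Complex.mul_conj, Complex.normSq_eq_norm_sq]
  simp only [e]
  rw [integral_complex_ofReal, ← ofReal_norm_eq_enorm, Complex.norm_real, Real.norm_eq_abs,
    abs_of_nonneg (integral_nonneg fun _ => sq_nonneg _),
    ofReal_integral_eq_lintegral_ofReal hi (Filter.Eventually.of_forall fun _ => sq_nonneg _)]
  congr 1; ext ξ
  rw [ENNReal.ofReal_pow (norm_nonneg _), ofReal_norm_eq_enorm]

lemma Dom.int_sq (hM : Measurable M) (hM2 : Integrable (fun ξ => M ξ ^ 2) μ) (hβ : Dom R M β) :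
    Integrable (fun ξ => ‖∫ s, β s ξ‖ ^ 2) μ := by
  refine (hM2.const_mul ((2 * |R|) ^ 2)).mono' (hβ.meas_int.norm.pow_const 2).aestronglyMeasurable
    (Filter.Eventually.of_forall fun ξ => ?_)
  have h1 : ‖∫ s, β s ξ‖ ≤ 2 * |R| * |M ξ| := by
    calc ‖∫ s, β s ξ‖ ≤ ∫ s, (Set.Icc (-R) R).indicator (fun _ => |M ξ|) s := by
          apply norm_integral_le_of_norm_le
          · rw [integrable_indicator_iff measurableSet_Icc]; exact integrableOn_const (by simp)
          · refine Filter.Eventually.of_forall fun s => (hβ.le s ξ).trans ?_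
            apply Set.indicator_le_indicator; exact le_abs_self _
      _ ≤ _ := by
          rw [integral_indicator measurableSet_Icc, setIntegral_const, smul_eq_mul, Measure.real, Real.volume_Icc]
          gcongr
          apply ENNReal.toReal_le_of_le_ofReal (by positivity)
          apply ENNReal.ofReal_le_ofReal
          linarith [le_abs_self R]
  rw [Real.norm_eq_abs, abs_of_nonneg (sq_nonneg _)]
  calc ‖∫ s, β s ξ‖ ^ 2 ≤ (2 * |R| * |M ξ|) ^ 2 := by gcongr
    _ = _ := by rw [mul_pow, sq_abs]

/-- TT*: the basic inequality. -/
lemma Dom.ttstar (hM : Measurable M) (hM2 : Integrable (fun ξ => M ξ ^ 2) μ) (hβ : Dom R M β) :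
    ∫⁻ ξ, ‖∫ s, β s ξ‖ₑ ^ 2 ∂μ = ‖∫ z : ℝ × ℝ, ip μ (β z.1) (β z.2) ∂(volume.prod volume)‖ₑ := by
  rw [← Dom.fubini hM hM2 hβ hβ, enorm_ip_self hβ.meas_int (hβ.int_sq hM hM2)]

lemma ip_cs {f g : X → ℂ} (hf : Measurable f) (hg : Measurable g) :
    ‖ip μ f g‖ₑ ≤ (∫⁻ ξ, ‖f ξ‖ₑ ^ 2 ∂μ) ^ (1/2 : ℝ) * (∫⁻ ξ, ‖g ξ‖ₑ ^ 2 ∂μ) ^ (1/2 : ℝ) := by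
  unfold ip
  refine (enorm_integral_le_lintegral_enorm _).trans ?_
  have h := ENNReal.lintegral_mul_le_Lp_mul_Lq μ (p := 2) (q := 2) Real.HolderConjugate.two_two
    hf.enorm.aemeasurable hg.enorm.aemeasurable
  simp only [ENNReal.rpow_two] at h
  refine le_trans (le_of_eq ?_) h
  congr 1; ext ξ
  simp only [Pi.mul_apply, enorm_mul]
  congr 1
  rw [← ofReal_norm_eq_enorm, RCLike.norm_conj, ofReal_norm_eq_enorm]

end Abstract
end Strich

set_option linter.unusedVariables false
namespace Strich

/-- powers of two as extended nonnegative reals -/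
noncomputable def tw (x : ℝ) : ℝ≥0∞ := ENNReal.ofReal ((2:ℝ) ^ x)

lemma tw_add (x y : ℝ) : tw (x + y) = tw x * tw y := by
  unfold tw; rw [Real.rpow_add two_pos, ENNReal.ofReal_mul (by positivity)]
lemma tw_ne_top (x : ℝ) : tw x ≠ ∞ := ENNReal.ofReal_ne_top
lemma tw_ne_zero (x : ℝ) : tw x ≠ 0 := by
  unfold tw; rw [Ne, ENNReal.ofReal_eq_zero, not_le]; positivity
lemma tw_mono {x y : ℝ} (h : x ≤ y) : tw x ≤ tw y :=
  ENNReal.ofReal_le_ofReal (Real.rpow_le_rpow_of_exponent_le one_le_two h)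
lemma tw_zero : tw 0 = 1 := by simp [tw]
lemma tw_one : tw 1 = 2 := by simp [tw]
lemma tw_rpow (x y : ℝ) : tw x ^ y = tw (x * y) := by
  unfold tw; rw [ENNReal.ofReal_rpow_of_pos (by positivity), ← Real.rpow_mul two_pos.le]

lemma tsum_bump (ε : ℝ) (hε : 0 < ε) (α : ℝ) (hα : 0 < α) : ∃ C : ℝ≥0∞, C ≠ ∞ ∧
    ∀ β : ℝ, ∑' n : ℤ, tw (-(ε * |α * n - β|)) ≤ C := by
  obtain ⟨C, hC, h⟩ := sum_bump ε α hε hα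
  refine ⟨ENNReal.ofReal C, ENNReal.ofReal_ne_top, fun β => ?_⟩
  rw [ENNReal.tsum_eq_iSup_sum]
  refine iSup_le fun s => ?_
  unfold tw
  rw [← ENNReal.ofReal_sum_of_nonneg (fun _ _ => by positivity)]
  exact ENNReal.ofReal_le_ofReal (h β s)

lemma le3_bump (a A B : ℝ) (x y : ℝ≥0∞) (ha : 0 < a) (h1 : x ≤ tw (a * (A + B)) * y)
    (h2 : x ≤ tw (-A) * y) (h3 : x ≤ tw (-B) * y) :
    x ≤ tw (-(a/(2*(1+a)) * |A|)) * tw (-(a/(2*(1+a)) * |B|)) * y := by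
  have h := min3_le_bump a A B (min ((2:ℝ)^(a*(A+B))) (min ((2:ℝ)^(-A)) ((2:ℝ)^(-B)))) ha
    (min_le_left _ _) ((min_le_right _ _).trans (min_le_left _ _)) ((min_le_right _ _).trans (min_le_right _ _))
  have h' := ENNReal.ofReal_le_ofReal h
  rw [ENNReal.ofReal_mul (by positivity)] at h'
  refine le_trans ?_ (mul_le_mul_left h' y)
  rcases min_choice ((2:ℝ)^(a*(A+B))) (min ((2:ℝ)^(-A)) ((2:ℝ)^(-B))) with e | e
  · rw [e]; exact h1
  · rw [e]
    rcases min_choice ((2:ℝ)^(-A)) ((2:ℝ)^(-B)) with e | e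
    · rw [e]; exact h2
    · rw [e]; exact h3

lemma le2_bump (a b x x0 τ : ℝ) (y z : ℝ≥0∞) (ha : 0 < a) (hb : 0 < b) (h1 : y ≤ tw (τ + a * (x - x0)) * z)
    (h2 : y ≤ tw (τ - b * (x - x0)) * z) :
    y ≤ tw τ * tw (-(min a b * |1 * x - x0|)) * z := by
  have h' := ENNReal.ofReal_le_ofReal (min_le_bump a b x x0 τ ha hb)
  rw [ENNReal.ofReal_mul (by positivity)] at h'
  refine le_trans ?_ (mul_le_mul_left h' z)
  rcases min_choice ((2:ℝ) ^ (τ + a * (x - x0))) ((2:ℝ) ^ (τ - b * (x - x0))) with e | e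
  · rw [e]; exact h1
  · rw [e]; exact h2

lemma mul_le_sq_add_sq (x y : ℝ≥0∞) : x * y ≤ x ^ 2 + y ^ 2 := by
  rcases le_total x y with h | h
  · calc x * y ≤ y * y := by gcongr
      _ = y ^ 2 := by ring
      _ ≤ _ := le_add_self
  · calc x * y ≤ x * x := by gcongr
      _ = x ^ 2 := by ring
      _ ≤ _ := le_self_add

/-- dyadic shells -/
def Sh (j : ℤ) : Set ℝ := {τ | (2:ℝ) ^ (j:ℝ) ≤ |τ| ∧ |τ| < (2:ℝ) ^ ((j:ℝ) + 1)}

lemma Sh_meas (j : ℤ) : MeasurableSet (Sh j) :=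
  (measurableSet_le measurable_const measurable_id.abs).inter (measurableSet_lt measurable_id.abs measurable_const)

lemma Sh_vol (j : ℤ) : volume (Sh j) ≤ 4 * tw j := by
  have : Sh j ⊆ Set.Ioo (-(2:ℝ) ^ ((j:ℝ) + 1)) ((2:ℝ) ^ ((j:ℝ) + 1)) := fun τ h => abs_lt.1 h.2
  refine (measure_mono this).trans ?_
  rw [Real.volume_Ioo]
  unfold tw
  rw [show (4:ℝ≥0∞) = ENNReal.ofReal 4 by simp, ← ENNReal.ofReal_mul (by norm_num), Real.rpow_add two_pos]
  apply ENNReal.ofReal_le_ofReal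
  simp; linarith

lemma Sh_cover (τ : ℝ) (h : τ ≠ 0) : ∃ j : ℤ, τ ∈ Sh j := by
  obtain ⟨n, hn⟩ := exists_mem_Ico_zpow (abs_pos.2 h) (one_lt_two : (1:ℝ) < 2)
  refine ⟨n, ?_, ?_⟩
  · rw [Real.rpow_intCast]; exact hn.1
  · have := hn.2
    rw [← Real.rpow_intCast] at this; push_cast at this; exact this

lemma Sh_disj : Pairwise (fun i j : ℤ => Disjoint (Sh i) (Sh j)) := by
  have key : ∀ i j : ℤ, i < j → ∀ τ, τ ∈ Sh i → τ ∈ Sh j → False := by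
    intro i j hij τ h1 h2
    have : (2:ℝ) ^ ((i:ℝ)+1) ≤ 2 ^ (j:ℝ) := by
      apply Real.rpow_le_rpow_of_exponent_le one_le_two
      exact_mod_cast hij
    have := h1.2; have := h2.1; linarith
  intro i j hij
  rw [Set.disjoint_left]
  intro τ h1 h2
  rcases lt_or_gt_of_ne hij with h | h
  · exact key _ _ h _ h1 h2
  · exact key _ _ h _ h2 h1

lemma Sh_neg (j : ℤ) (s t : ℝ) : (t - s ∈ Sh j) ↔ (s - t ∈ Sh j) := by
  unfold Sh; simp only [Set.mem_ofPred_eq, abs_sub_comm]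

lemma Sh_rpow {j : ℤ} {τ : ℝ} (h : τ ∈ Sh j) (σ : ℝ) (hσ : 0 ≤ σ) :
    (ENNReal.ofReal |τ|) ^ (-σ) ≤ tw (-(j * σ)) := by
  have h0 : 0 < (2:ℝ) ^ (j:ℝ) := by positivity
  rw [ENNReal.ofReal_rpow_of_pos (h0.trans_le h.1)]
  unfold tw
  apply ENNReal.ofReal_le_ofReal
  calc |τ| ^ (-σ) ≤ ((2:ℝ) ^ (j:ℝ)) ^ (-σ) := Real.rpow_le_rpow_of_nonpos h0 h.1 (by linarith)
    _ = _ := by rw [← Real.rpow_mul two_pos.le]; congr 1; ring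

lemma Sh_shift_meas (j : ℤ) (t : ℝ) : MeasurableSet {s | t - s ∈ Sh j} :=
  (measurable_const.sub measurable_id) (Sh_meas j)

lemma Sh_shift_vol (j : ℤ) (t : ℝ) : volume {s | t - s ∈ Sh j} ≤ 4 * tw j := by
  have : volume {s | t - s ∈ Sh j} = volume (Sh j) :=
    (Measure.measurePreserving_sub_left volume t).measure_preimage (Sh_meas j).nullMeasurableSet
  rw [this]; exact Sh_vol j

lemma Sh_prod_meas (j : ℤ) : MeasurableSet {z : ℝ × ℝ | z.2 - z.1 ∈ Sh j} :=
  (measurable_snd.sub measurable_fst) (Sh_meas j)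

lemma Sh_union : ∀ᵐ z : ℝ × ℝ ∂(volume.prod volume), z ∈ ⋃ j : ℤ, {z : ℝ × ℝ | z.2 - z.1 ∈ Sh j} := by
  refine (Measure.ae_prod_iff_ae_ae ?_).2 ?_
  · exact MeasurableSet.iUnion Sh_prod_meas
  · refine Filter.Eventually.of_forall fun s => ?_
    filter_upwards [compl_mem_ae_iff.2 (measure_singleton (μ := (volume : Measure ℝ)) s)] with t ht
    obtain ⟨j, hj⟩ := Sh_cover (t - s) (sub_ne_zero.2 ht)
    exact Set.mem_iUnion.2 ⟨j, hj⟩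

lemma Sh_restrict : (volume.prod volume : Measure (ℝ × ℝ)).restrict (⋃ j : ℤ, {z : ℝ × ℝ | z.2 - z.1 ∈ Sh j}) =
    volume.prod volume := Measure.restrict_eq_self_of_ae_mem Sh_union

lemma Sh_prod_disj : Pairwise (fun i j : ℤ => Disjoint {z : ℝ × ℝ | z.2 - z.1 ∈ Sh i} {z : ℝ × ℝ | z.2 - z.1 ∈ Sh j}) := by
  intro i j hij
  rw [Set.disjoint_left]
  intro z h1 h2
  exact Set.disjoint_left.1 (Sh_disj hij) h1 h2

/-- lower integral over the plane split along shells -/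
lemma lint_shell (f : ℝ × ℝ → ℝ≥0∞) : ∫⁻ z, f z ∂(volume.prod volume) =
    ∑' j : ℤ, ∫⁻ z in {z : ℝ × ℝ | z.2 - z.1 ∈ Sh j}, f z ∂(volume.prod volume) := by
  rw [← lintegral_iUnion Sh_prod_meas Sh_prod_disj, Sh_restrict]

/-- One shell, function of the first or second variable only. -/
lemma lint_shell1 (j : ℤ) (f : ℝ → ℝ≥0∞) (hf : Measurable f) :
    ∫⁻ z in {z : ℝ × ℝ | z.2 - z.1 ∈ Sh j}, f z.1 ∂(volume.prod volume) ≤ 4 * tw j * ∫⁻ s, f s := by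
  rw [← lintegral_indicator (Sh_prod_meas j), lintegral_prod _ (Measurable.indicator (f := fun z : ℝ × ℝ => f z.1) (hf.comp measurable_fst) (Sh_prod_meas j)).aemeasurable,
    ← lintegral_const_mul _ hf]
  refine lintegral_mono fun s => ?_
  have e : ∀ t, ({z : ℝ × ℝ | z.2 - z.1 ∈ Sh j}.indicator (fun z => f z.1) (s, t)) =
      ({t | s - t ∈ Sh j}.indicator (fun _ => f s) t) := by
    intro t
    by_cases h : t - s ∈ Sh j
    · rw [Set.indicator_of_mem (by exact h), Set.indicator_of_mem (by exact (Sh_neg j s t).1 h)]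
    · rw [Set.indicator_of_notMem (by exact h), Set.indicator_of_notMem (by exact fun h' => h ((Sh_neg j s t).2 h'))]
  simp only [e]
  rw [lintegral_indicator (Sh_shift_meas j s), setLIntegral_const, mul_comm]
  gcongr
  exact Sh_shift_vol j s

lemma lint_shell2 (j : ℤ) (f : ℝ → ℝ≥0∞) (hf : Measurable f) :
    ∫⁻ z in {z : ℝ × ℝ | z.2 - z.1 ∈ Sh j}, f z.2 ∂(volume.prod volume) ≤ 4 * tw j * ∫⁻ s, f s := by
  rw [← lintegral_indicator (Sh_prod_meas j), lintegral_prod_symm _ (Measurable.indicator (f := fun z : ℝ × ℝ => f z.2) (hf.comp measurable_snd) (Sh_prod_meas j)).aemeasurable,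
    ← lintegral_const_mul _ hf]
  refine lintegral_mono fun t => ?_
  have e : ∀ s, ({z : ℝ × ℝ | z.2 - z.1 ∈ Sh j}.indicator (fun z => f z.2) (s, t)) =
      ({s | t - s ∈ Sh j}.indicator (fun _ => f t) s) := by
    intro s; rfl
  simp only [e]
  rw [lintegral_indicator (Sh_shift_meas j t), setLIntegral_const, mul_comm]
  gcongr
  exact Sh_shift_vol j t

end Strich

set_option linter.unusedVariables false
namespace Strich

lemma atom_exists (r c : ℝ) (hr : 0 < r) (hc : 0 < c) :
    ∃ a : ℤ, (2:ℝ) ^ (-(a * c)) ≤ r ∧ r < (2:ℝ) ^ (-((a - 1) * c)) := by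
  have h1 : (1:ℝ) < 2 ^ c := Real.one_lt_rpow one_lt_two hc
  obtain ⟨n, hn⟩ := exists_mem_Ico_zpow hr h1
  refine ⟨-n, ?_, ?_⟩
  · have := hn.1
    rw [← Real.rpow_intCast, ← Real.rpow_mul two_pos.le] at this
    rw [show -(((-n : ℤ) : ℝ) * c) = c * n by push_cast; ring]; exact this
  · have := hn.2
    rw [← Real.rpow_intCast, ← Real.rpow_mul two_pos.le] at this
    rw [show -((((-n : ℤ) : ℝ) - 1) * c) = c * ((n + 1 : ℤ) : ℝ) by push_cast; ring]; exact this

lemma atom_exists' (r : ℝ≥0∞) (c : ℝ) (hr : r ≠ 0) (hr' : r ≠ ∞) (hc : 0 < c) :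
    ∃ a : ℤ, tw (-(a * c)) ≤ r ∧ r < tw (-((a - 1) * c)) := by
  have h0 : 0 < r.toReal := ENNReal.toReal_pos hr hr'
  obtain ⟨a, h1, h2⟩ := atom_exists r.toReal c h0 hc
  refine ⟨a, ?_, ?_⟩
  · rw [← ENNReal.ofReal_toReal hr']; exact ENNReal.ofReal_le_ofReal h1
  · rw [← ENNReal.ofReal_toReal hr']; exact (ENNReal.ofReal_lt_ofReal_iff (by positivity)).2 h2

lemma le3_bump' (θ A B : ℝ) (x y : ℝ≥0∞) (h0 : 0 < θ) (h12 : θ < 1/2) (h1 : x ≤ tw (θ * (A + B)) * y)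
    (h2 : x ≤ tw (θ * (A + B) - A) * y) (h3 : x ≤ tw (θ * (A + B) - B) * y) :
    x ≤ tw (-(min θ ((1 - 2 * θ)/2) * |A|)) * tw (-(min θ ((1 - 2 * θ)/2) * |B|)) * y := by
  set ε := min θ ((1 - 2 * θ)/2) with hε
  have e1 : ε ≤ θ := min_le_left _ _
  have e2 : ε ≤ (1 - 2 * θ)/2 := min_le_right _ _
  have e0 : 0 < ε := lt_min h0 (by linarith)
  rw [← tw_add]
  rcases le_total A 0 with hA | hA <;> rcases le_total B 0 with hB | hB
  · refine h1.trans (mul_le_mul_left (tw_mono ?_) _)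
    rw [abs_of_nonpos hA, abs_of_nonpos hB]; nlinarith
  · refine h3.trans (mul_le_mul_left (tw_mono ?_) _)
    rw [abs_of_nonpos hA, abs_of_nonneg hB]; nlinarith
  · refine h2.trans (mul_le_mul_left (tw_mono ?_) _)
    rw [abs_of_nonneg hA, abs_of_nonpos hB]; nlinarith
  · rw [abs_of_nonneg hA, abs_of_nonneg hB]
    rcases le_total A B with h | h
    · refine h3.trans (mul_le_mul_left (tw_mono ?_) _); nlinarith
    · refine h2.trans (mul_le_mul_left (tw_mono ?_) _); nlinarith

lemma sum_e_bump (ε : ℝ) (hε : 0 < ε) : ∃ C : ℝ≥0∞, C ≠ ∞ ∧ ∀ e : ℤ → ℝ≥0∞, ∑' a, e a ≤ 1 →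
    ∑' j : ℤ, ∑' a : ℤ, ∑' b : ℤ, tw (-(ε * |(a:ℝ) - j|)) * tw (-(ε * |(b:ℝ) - j|)) * (e a + e b) ≤ C := by
  obtain ⟨C, hC, h⟩ := tsum_bump ε hε 1 one_pos
  have h1 : ∀ j : ℤ, ∑' b : ℤ, tw (-(ε * |(b:ℝ) - j|)) ≤ C := by
    intro j; simpa using h j
  have h2 : ∀ b : ℤ, ∑' j : ℤ, tw (-(ε * |(b:ℝ) - j|)) ≤ C := by
    intro b; simpa [abs_sub_comm] using h b
  refine ⟨C * C + C * C, by finiteness, fun e he => ?_⟩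
  have key : ∑' j : ℤ, ∑' a : ℤ, ∑' b : ℤ, tw (-(ε * |(a:ℝ) - j|)) * tw (-(ε * |(b:ℝ) - j|)) * e a ≤ C * C := by
    calc _ = ∑' j : ℤ, ∑' a : ℤ, tw (-(ε * |(a:ℝ) - j|)) * e a * ∑' b : ℤ, tw (-(ε * |(b:ℝ) - j|)) := by
          congr 1; ext j; congr 1; ext a
          rw [← ENNReal.tsum_mul_left]; congr 1; ext b; ring
      _ ≤ ∑' j : ℤ, ∑' a : ℤ, tw (-(ε * |(a:ℝ) - j|)) * e a * C := by
          gcongr with j a; exact h1 j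
      _ = ∑' a : ℤ, (e a * C) * ∑' j : ℤ, tw (-(ε * |(a:ℝ) - j|)) := by
          rw [ENNReal.tsum_comm]; congr 1; ext a
          rw [← ENNReal.tsum_mul_left]; congr 1; ext b; ring
      _ ≤ ∑' a : ℤ, (e a * C) * C := by gcongr with a; exact h2 a
      _ = (∑' a, e a) * (C * C) := by rw [← ENNReal.tsum_mul_right]; congr 1; ext a; ring
      _ ≤ 1 * (C * C) := by gcongr
      _ = C * C := one_mul _
  have key2 : ∑' j : ℤ, ∑' a : ℤ, ∑' b : ℤ, tw (-(ε * |(a:ℝ) - j|)) * tw (-(ε * |(b:ℝ) - j|)) * e b ≤ C * C := by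
    refine le_trans (le_of_eq ?_) key
    congr 1; ext j; rw [ENNReal.tsum_comm]; congr 1; ext a; congr 1; ext b; ring
  calc _ = ∑' j : ℤ, ∑' a : ℤ, ∑' b : ℤ, tw (-(ε * |(a:ℝ) - j|)) * tw (-(ε * |(b:ℝ) - j|)) * e a +
        ∑' j : ℤ, ∑' a : ℤ, ∑' b : ℤ, tw (-(ε * |(a:ℝ) - j|)) * tw (-(ε * |(b:ℝ) - j|)) * e b := by
        simp only [mul_add, ENNReal.tsum_add]
    _ ≤ _ := add_le_add key key2

/-- Diagonal one dimensional Hardy-Littlewood-Sobolev. -/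
lemma hls (θ : ℝ) (h0 : 0 < θ) (h12 : θ < 1/2) : ∃ C : ℝ≥0∞, C ≠ ∞ ∧ ∀ N : ℝ → ℝ≥0∞, Measurable N →
    ∫⁻ s, N s ^ (1/(1-θ)) ≤ 1 →
    ∫⁻ z : ℝ × ℝ, (ENNReal.ofReal |z.2 - z.1|) ^ (-(2*θ)) * (N z.1 * N z.2) ∂(volume.prod volume) ≤ C := by
  set ε := min θ ((1 - 2 * θ)/2) with hε
  have e0 : 0 < ε := lt_min h0 (by linarith)
  have hc : 0 < 1 - θ := by linarith
  obtain ⟨C, hC, hsum⟩ := sum_e_bump ε e0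
  refine ⟨16 * C, by finiteness, fun N hN hN1 => ?_⟩
  let Om : ℤ → Set ℝ := fun a => {s | tw (-(a * (1-θ))) ≤ N s ∧ N s < tw (-((a - 1) * (1-θ)))}
  have Om_meas : ∀ a, MeasurableSet (Om a) := fun a =>
    (measurableSet_le measurable_const hN).inter (measurableSet_lt hN measurable_const)
  have Om_disj : Pairwise (fun a b => Disjoint (Om a) (Om b)) := by
    have key : ∀ i j : ℤ, i < j → ∀ τ, τ ∈ Om i → τ ∈ Om j → False := by
      intro i j hij τ h1 h2
      have : tw (-((j - 1) * (1-θ))) ≤ tw (-(i * (1-θ))) := by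
        apply tw_mono
        have : (i:ℝ) ≤ j - 1 := by
          have : i + 1 ≤ j := hij
          have : (i:ℝ) + 1 ≤ j := by exact_mod_cast this
          linarith
        nlinarith
      exact absurd (h1.1.trans_lt h2.2) (not_lt.2 this)
    intro i j hij
    rw [Set.disjoint_left]
    intro τ h1 h2
    rcases lt_or_gt_of_ne hij with h | h
    · exact key _ _ h _ h1 h2
    · exact key _ _ h _ h2 h1
  let e : ℤ → ℝ≥0∞ := fun a => tw (-a) * volume (Om a)
  have vol_e : ∀ a, volume (Om a) = tw a * e a := by
    intro a; simp only [e]; rw [← mul_assoc, ← tw_add]; simp [tw_zero]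
  have e_sum : ∑' a, e a ≤ 1 := by
    refine le_trans ?_ hN1
    calc ∑' a, e a ≤ ∑' a, ∫⁻ s in Om a, N s ^ (1/(1-θ)) := by
          gcongr with a
          change tw (-a) * volume (Om a) ≤ _
          rw [← setLIntegral_const]
          refine setLIntegral_mono (hN.pow_const _) fun s hs => ?_
          calc tw (-a) = (tw (-(a * (1-θ)))) ^ (1/(1-θ)) := by
                rw [tw_rpow]; congr 1; field_simp
            _ ≤ _ := ENNReal.rpow_le_rpow hs.1 (by positivity)
      _ = ∫⁻ s in ⋃ a, Om a, N s ^ (1/(1-θ)) := (lintegral_iUnion Om_meas Om_disj _).symm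
      _ ≤ _ := setLIntegral_le_lintegral _ _
  have e_le : ∀ a, e a ≤ 1 := fun a => (ENNReal.le_tsum a).trans e_sum
  have Nfin : ∀ᵐ s, N s ≠ ∞ := by
    have := ae_lt_top (hN.pow_const (1/(1-θ))) (hN1.trans_lt ENNReal.one_lt_top).ne
    filter_upwards [this] with s hs h
    rw [h, ENNReal.top_rpow_of_pos (by positivity)] at hs
    exact lt_irrefl _ hs
  have Nle : ∀ᵐ s, N s ≤ ∑' a : ℤ, tw (-((a - 1) * (1-θ))) * (Om a).indicator 1 s := by
    filter_upwards [Nfin] with s hs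
    by_cases hz : N s = 0
    · rw [hz]; exact zero_le
    · obtain ⟨a, ha⟩ := atom_exists' (N s) (1-θ) hz hs hc
      refine le_trans ?_ (ENNReal.le_tsum a)
      rw [Set.indicator_of_mem (show s ∈ Om a from ha)]
      simpa using ha.2.le
  have Nz : ∀ᵐ z : ℝ × ℝ ∂(volume.prod volume), N z.1 * N z.2 ≤
      ∑' a : ℤ, ∑' b : ℤ, tw (-((a - 1) * (1-θ))) * tw (-((b - 1) * (1-θ))) *
        ((Om a).indicator 1 z.1 * (Om b).indicator 1 z.2) := by
    have a1 := (Measure.quasiMeasurePreserving_fst (μ := (volume : Measure ℝ)) (ν := (volume : Measure ℝ))).ae Nle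
    have a2 := (Measure.quasiMeasurePreserving_snd (μ := (volume : Measure ℝ)) (ν := (volume : Measure ℝ))).ae Nle
    filter_upwards [a1, a2] with z h1 h2
    refine (mul_le_mul' h1 h2).trans (le_of_eq ?_)
    rw [← ENNReal.tsum_mul_right]; congr 1; ext a
    rw [← ENNReal.tsum_mul_left]; congr 1; ext b; ring
  rw [lint_shell]
  refine le_trans ?_ (mul_le_mul_right (hsum e e_sum) 16)
  rw [← ENNReal.tsum_mul_left]
  refine ENNReal.tsum_le_tsum fun j => ?_
  set D := {z : ℝ × ℝ | z.2 - z.1 ∈ Sh j} with hD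
  have mi : ∀ a, Measurable ((Om a).indicator (1 : ℝ → ℝ≥0∞)) := fun a => measurable_one.indicator (Om_meas a)
  have mm : ∀ a b, Measurable (fun z : ℝ × ℝ => (Om a).indicator (1 : ℝ → ℝ≥0∞) z.1 * (Om b).indicator (1 : ℝ → ℝ≥0∞) z.2) :=
    fun a b => ((mi a).comp measurable_fst).mul ((mi b).comp measurable_snd)
  calc ∫⁻ z in D, (ENNReal.ofReal |z.2 - z.1|) ^ (-(2*θ)) * (N z.1 * N z.2) ∂(volume.prod volume)
      ≤ ∫⁻ z in D, tw (-(j * (2*θ))) * ∑' a : ℤ, ∑' b : ℤ, tw (-((a - 1) * (1-θ))) * tw (-((b - 1) * (1-θ))) *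
        ((Om a).indicator 1 z.1 * (Om b).indicator 1 z.2) ∂(volume.prod volume) := by
        refine lintegral_mono_ae ?_
        filter_upwards [ae_restrict_of_ae Nz, ae_restrict_mem (Sh_prod_meas j)] with z h1 h2
        exact mul_le_mul' (Sh_rpow h2 _ (by linarith)) h1
    _ = ∑' a : ℤ, ∑' b : ℤ, tw (-(j * (2*θ))) * (tw (-((a - 1) * (1-θ))) * tw (-((b - 1) * (1-θ))) *
        ∫⁻ z in D, ((Om a).indicator 1 z.1 * (Om b).indicator 1 z.2) ∂(volume.prod volume)) := by
        rw [lintegral_const_mul _ (Measurable.tsum fun a => Measurable.tsum fun b => (mm a b).const_mul _),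
          lintegral_tsum (fun a => (Measurable.tsum fun b => (mm a b).const_mul _).aemeasurable),
          ← ENNReal.tsum_mul_left]
        congr 1; ext a
        rw [lintegral_tsum (fun b => ((mm a b).const_mul _).aemeasurable), ← ENNReal.tsum_mul_left]
        congr 1; ext b
        rw [lintegral_const_mul _ (mm a b)]
    _ ≤ _ := by
        rw [← ENNReal.tsum_mul_left]
        refine ENNReal.tsum_le_tsum fun a => ?_
        rw [← ENNReal.tsum_mul_left]
        refine ENNReal.tsum_le_tsum fun b => ?_
        set m := ∫⁻ z in D, ((Om a).indicator (1 : ℝ → ℝ≥0∞) z.1 * (Om b).indicator (1 : ℝ → ℝ≥0∞) z.2) ∂(volume.prod volume)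
        have lei : ∀ (a : ℤ) (s : ℝ), (Om a).indicator (1 : ℝ → ℝ≥0∞) s ≤ 1 := fun a s => Set.indicator_le_self' (fun _ _ => zero_le) s
        have m1 : m ≤ volume (Om a) * volume (Om b) := by
          refine (setLIntegral_le_lintegral _ _).trans (le_of_eq ?_)
          rw [lintegral_prod_mul (mi a).aemeasurable (mi b).aemeasurable, lintegral_indicator_one (Om_meas a),
            lintegral_indicator_one (Om_meas b)]
        have m2 : m ≤ 4 * tw j * volume (Om a) := by
          rw [← lintegral_indicator_one (Om_meas a)]
          refine le_trans ?_ (lint_shell1 j _ (mi a))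
          refine lintegral_mono fun z => ?_
          exact (mul_le_mul_right (lei b z.2) _).trans (le_of_eq (mul_one _))
        have m3 : m ≤ 4 * tw j * volume (Om b) := by
          rw [← lintegral_indicator_one (Om_meas b)]
          refine le_trans ?_ (lint_shell2 j _ (mi b))
          refine lintegral_mono fun z => ?_
          exact (mul_le_mul_left (lei a z.1) _).trans (le_of_eq (one_mul _))
        rw [vol_e, vol_e] at m1
        rw [vol_e] at m2 m3
        have c4 : tw (2 * (1 - θ)) ≤ 4 := by
          refine (tw_mono (show 2 * (1-θ) ≤ 1 + 1 by linarith)).trans (le_of_eq ?_)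
          rw [tw_add, tw_one]; norm_num
        have s1 : tw (-(j * (2*θ))) * (tw (-((a - 1) * (1-θ))) * tw (-((b - 1) * (1-θ))) * m) ≤
            4 * (tw (-(j * (2*θ)) - a * (1-θ) - b * (1-θ)) * m) := by
          rw [← mul_assoc, ← mul_assoc (tw _) (tw _) (tw _), ← tw_add, ← tw_add, ← mul_assoc 4]
          refine mul_le_mul_left (le_trans (le_of_eq ?_) (mul_le_mul_left c4 _)) m
          rw [← tw_add]; congr 1; ring
        refine s1.trans ?_
        have c16 : (16:ℝ≥0∞) = 4 * 4 := by norm_num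
        rw [c16, mul_assoc 4 4]
        refine mul_le_mul_right ?_ 4
        have hf := le3_bump' θ (a - j) (b - j) (tw (-(j * (2*θ)) - a * (1-θ) - b * (1-θ)) * m) (4 * (e a + e b)) h0 h12 ?_ ?_ ?_
        · refine hf.trans (le_of_eq ?_); ring
        · calc _ ≤ tw (-(j * (2*θ)) - a * (1-θ) - b * (1-θ)) * (tw a * e a * (tw b * e b)) := by gcongr
            _ = tw (-(j * (2*θ)) - a * (1-θ) - b * (1-θ)) * tw a * tw b * (e a * e b) := by ring
            _ = tw (θ * (a - j + (b - j))) * (e a * e b) := by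
                rw [← tw_add, ← tw_add]; congr 2; ring
            _ ≤ _ := by
                refine mul_le_mul_right ?_ _
                calc e a * e b ≤ e a * 1 := by gcongr; exact e_le b
                  _ = 1 * e a := by rw [mul_comm]
                  _ ≤ 4 * (e a + e b) := mul_le_mul' (by norm_num) le_self_add
        · calc _ ≤ tw (-(j * (2*θ)) - a * (1-θ) - b * (1-θ)) * (4 * tw j * (tw b * e b)) := by gcongr
            _ = tw (-(j * (2*θ)) - a * (1-θ) - b * (1-θ)) * tw j * tw b * (4 * e b) := by ring
            _ = tw (θ * (a - j + (b - j)) - (a - j)) * (4 * e b) := by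
                rw [← tw_add, ← tw_add]; congr 2; ring
            _ ≤ _ := by gcongr; exact le_add_self
        · calc _ ≤ tw (-(j * (2*θ)) - a * (1-θ) - b * (1-θ)) * (4 * tw j * (tw a * e a)) := by gcongr
            _ = tw (-(j * (2*θ)) - a * (1-θ) - b * (1-θ)) * tw j * tw a * (4 * e a) := by ring
            _ = tw (θ * (a - j + (b - j)) - (b - j)) * (4 * e a) := by
                rw [← tw_add, ← tw_add]; congr 2; ring
            _ ≤ _ := by gcongr; exact le_self_add

end Strich

set_option linter.unusedVariables false
set_option linter.unusedSectionVars false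
namespace Strich

lemma tw_log (τ σ : ℝ) (h : τ ≠ 0) : (ENNReal.ofReal |τ|) ^ (-σ) = tw (-σ * Real.logb 2 |τ|) := by
  have h0 : 0 < |τ| := abs_pos.2 h
  rw [ENNReal.ofReal_rpow_of_pos h0]
  unfold tw
  rw [mul_comm, Real.rpow_mul two_pos.le, Real.rpow_logb two_pos (by norm_num) h0]

lemma mstep (ρ q : ℝ) (hρ : 0 < ρ) (hq : 0 < q) (hρq : ρ + 1/q = 1/2) : ∃ C : ℝ≥0∞, C ≠ ∞ ∧
    ∀ (K : Finset ℤ) (σ L : ℝ) (x : ℤ → ℤ → ℝ≥0∞) (u : ℝ≥0∞) (e f : ℤ → ℝ≥0∞),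
      ∑ k ∈ K, e k ≤ 1 → ∑ k ∈ K, f k ≤ 1 →
      (∀ k ∈ K, ∀ l ∈ K, x k l ≤ tw (-σ * L) * tw ((k + l)/q) * (u * (e k + f l))) →
      (∀ k ∈ K, ∀ l ∈ K, x k l ≤ tw (-((k + l) * ρ)) * (u * (e k + f l))) →
      ∑ k ∈ K, ∑ l ∈ K, x k l ≤ C * (tw (-(2 * σ * ρ) * L) * u) := by
  have hm : 0 < min (1/q) ρ := lt_min (by positivity) hρ
  obtain ⟨C, hC, hb⟩ := tsum_bump (min (1/q) ρ) hm 1 one_pos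
  refine ⟨C + C, by finiteness, fun K σ L x u e f he hf h1 h2 => ?_⟩
  set T := tw (-(2 * σ * ρ) * L)
  have key : ∀ k ∈ K, ∀ l ∈ K, x k l ≤ T * tw (-(min (1/q) ρ * |1 * ((k:ℝ) + l) - 2 * σ * L|)) * (u * (e k + f l)) := by
    intro k hk l hl
    apply le2_bump (1/q) ρ ((k:ℝ) + l) (2 * σ * L) (-(2 * σ * ρ) * L) _ _ (by positivity) hρ
    · refine (h1 k hk l hl).trans (mul_le_mul_left (le_of_eq ?_) _)
      rw [← tw_add]; congr 1
      have : 1/q = 1/2 - ρ := by linarith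
      rw [this, div_eq_mul_one_div _ q, this]; ring
    · refine (h2 k hk l hl).trans (mul_le_mul_left (le_of_eq ?_) _)
      congr 1; ring
  have b1 : ∀ k : ℤ, ∑ l ∈ K, tw (-(min (1/q) ρ * |1 * ((k:ℝ) + l) - 2 * σ * L|)) ≤ C := by
    intro k
    refine (ENNReal.sum_le_tsum K).trans (le_trans (le_of_eq ?_) (hb (2 * σ * L - k)))
    congr 1; ext l; rw [show 1 * ((k:ℝ) + l) - 2*σ*L = 1*(l:ℝ) - (2*σ*L-k) by ring]
  have b2 : ∀ l : ℤ, ∑ k ∈ K, tw (-(min (1/q) ρ * |1 * ((k:ℝ) + l) - 2 * σ * L|)) ≤ C := by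
    intro l
    refine (ENNReal.sum_le_tsum K).trans (le_trans (le_of_eq ?_) (hb (2 * σ * L - l)))
    congr 1; ext k; rw [show 1 * ((k:ℝ) + l) - 2*σ*L = 1*(k:ℝ) - (2*σ*L-l) by ring]
  calc ∑ k ∈ K, ∑ l ∈ K, x k l
      ≤ ∑ k ∈ K, ∑ l ∈ K, T * tw (-(min (1/q) ρ * |1 * ((k:ℝ) + l) - 2 * σ * L|)) * (u * (e k + f l)) :=
        Finset.sum_le_sum fun k hk => Finset.sum_le_sum fun l hl => key k hk l hl
    _ = ∑ k ∈ K, (T * u * e k) * ∑ l ∈ K, tw (-(min (1/q) ρ * |1 * ((k:ℝ) + l) - 2 * σ * L|)) +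
        ∑ l ∈ K, (T * u * f l) * ∑ k ∈ K, tw (-(min (1/q) ρ * |1 * ((k:ℝ) + l) - 2 * σ * L|)) := by
        simp only [Finset.mul_sum]
        rw [Finset.sum_comm (s := K) (t := K) (f := fun l k => T * u * f l * tw (-(min (1/q) ρ * |1 * ((k:ℝ) + l) - 2 * σ * L|))),
          ← Finset.sum_add_distrib]
        refine Finset.sum_congr rfl fun k _ => ?_
        rw [← Finset.sum_add_distrib]
        refine Finset.sum_congr rfl fun l _ => ?_
        ring
    _ ≤ ∑ k ∈ K, (T * u * e k) * C + ∑ l ∈ K, (T * u * f l) * C := by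
        refine add_le_add (Finset.sum_le_sum fun k _ => mul_le_mul_right (b1 k) _)
          (Finset.sum_le_sum fun k _ => mul_le_mul_right (b2 k) _)
    _ = T * u * C * (∑ k ∈ K, e k) + T * u * C * (∑ k ∈ K, f k) := by
        simp only [Finset.mul_sum]
        congr 1 <;> refine Finset.sum_congr rfl fun k _ => by ring
    _ ≤ T * u * C * 1 + T * u * C * 1 := by gcongr
    _ = _ := by ring

lemma sqrt_mul_le (x y : ℝ≥0∞) : x ^ (1/2:ℝ) * y ^ (1/2:ℝ) ≤ x + y := by
  refine (mul_le_sq_add_sq _ _).trans (le_of_eq ?_)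
  rw [← ENNReal.rpow_two, ← ENNReal.rpow_two, ← ENNReal.rpow_mul, ← ENNReal.rpow_mul]; norm_num

section Abs
variable {X : Type*} [MeasurableSpace X] {μ : Measure X} [SigmaFinite μ]

lemma ip_bound {ρ : ℝ} {k l : ℤ} {f g : X → ℂ} {c c' : ℝ≥0∞} (hf : Measurable f) (hg : Measurable g)
    (h1 : ∫⁻ ξ, ‖f ξ‖ₑ ^ 2 ∂μ ≤ tw (-(2 * k * ρ)) * c ^ 2)
    (h2 : ∫⁻ ξ, ‖g ξ‖ₑ ^ 2 ∂μ ≤ tw (-(2 * l * ρ)) * c' ^ 2) :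
    ‖ip μ f g‖ₑ ≤ tw (-((k + l) * ρ)) * (c * c') := by
  have key : ∀ (k : ℤ) (c : ℝ≥0∞), (tw (-(2 * k * ρ)) * c ^ 2) ^ (1/2:ℝ) = tw (-(k * ρ)) * c := by
    intro k c
    rw [ENNReal.mul_rpow_of_nonneg _ _ (by norm_num), tw_rpow, ← ENNReal.rpow_two, ← ENNReal.rpow_mul]
    norm_num; congr 2; ring
  refine (ip_cs hf hg).trans ?_
  refine (mul_le_mul' (ENNReal.rpow_le_rpow h1 (by norm_num)) (ENNReal.rpow_le_rpow h2 (by norm_num))).trans (le_of_eq ?_)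
  rw [key, key, mul_mul_mul_comm, ← tw_add]; congr 2; ring

lemma ip_sum {K : Finset ℤ} {f g : ℤ → X → ℂ}
    (hi : ∀ k l, Integrable (fun ξ => f k ξ * (starRingEnd ℂ) (g l ξ)) μ) :
    ip μ (fun ξ => ∑ k ∈ K, f k ξ) (fun ξ => ∑ k ∈ K, g k ξ) = ∑ k ∈ K, ∑ l ∈ K, ip μ (f k) (g l) := by
  unfold ip
  have : ∀ ξ, (∑ k ∈ K, f k ξ) * (starRingEnd ℂ) (∑ k ∈ K, g k ξ) = ∑ k ∈ K, ∑ l ∈ K, f k ξ * (starRingEnd ℂ) (g l ξ) := by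
    intro ξ; rw [map_sum, Finset.sum_mul_sum]
  simp only [this]
  rw [integral_finsetSum _ (fun k _ => integrable_finsetSum _ fun l _ => hi k l)]
  refine Finset.sum_congr rfl fun k _ => ?_
  rw [integral_finsetSum _ (fun l _ => hi k l)]

lemma Dom.int_slice {R : ℝ} {M : X → ℝ} {β γ : ℝ → X → ℂ} (hM : Measurable M) (hM2 : Integrable (fun ξ => M ξ ^ 2) μ)
    (hβ : Dom R M β) (hγ : Dom R M γ) (s t : ℝ) :
    Integrable (fun ξ => β s ξ * (starRingEnd ℂ) (γ t ξ)) μ := by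
  refine hM2.mono' ((hβ.slice s).mul (Complex.continuous_conj.measurable.comp (hγ.slice t))).aestronglyMeasurable
    (Filter.Eventually.of_forall fun ξ => ?_)
  rw [norm_mul, RCLike.norm_conj, ← sq_abs, sq]
  exact mul_le_mul (hβ.le' s ξ) (hγ.le' t ξ) (norm_nonneg _) (abs_nonneg _)

/-- Non-endpoint abstract Strichartz. -/
lemma strich_hls (p q : ℝ) (hp : 2 < p) (hq : 2 < q) : ∃ C : ℝ≥0∞, C ≠ ∞ ∧
    ∀ (R : ℝ) (M : X → ℝ) (hM : Measurable M) (hM2 : Integrable (fun ξ => M ξ ^ 2) μ)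
      (K : Finset ℤ) (α : ℤ → ℝ → X → ℂ) (hα : ∀ k, Dom R M (α k)) (N : ℝ → ℝ≥0∞) (hN : Measurable N)
      (e : ℤ → ℝ → ℝ≥0∞) (he : ∀ s, ∑ k ∈ K, e k s ≤ 1) (hN1 : ∫⁻ s, N s ^ (1/(1-1/p)) ≤ 1)
      (h1 : ∀ k ∈ K, ∀ l ∈ K, ∀ s t, s ≠ t → ‖ip μ (α k s) (α l t)‖ₑ ≤
        (ENNReal.ofReal |t - s|) ^ (-((2/p)/(1-2/q))) * tw ((k+l)/q) * (N s * N t * (e k s ^ (1/2:ℝ) * e l t ^ (1/2:ℝ))))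
      (h2 : ∀ k ∈ K, ∀ s, ∫⁻ ξ, ‖α k s ξ‖ₑ ^ 2 ∂μ ≤ tw (-(2 * k * (1/2 - 1/q))) * (N s * e k s ^ (1/2:ℝ)) ^ 2),
      ∫⁻ ξ, ‖∫ s, ∑ k ∈ K, α k s ξ‖ₑ ^ 2 ∂μ ≤ C := by
  have hq0 : 1/q < 1/2 := by rw [div_lt_div_iff₀ (by linarith) (by norm_num)]; linarith
  have hp0 : 1/p < 1/2 := by rw [div_lt_div_iff₀ (by linarith) (by norm_num)]; linarith
  obtain ⟨C, hC, hm⟩ := mstep (1/2 - 1/q) q (by linarith) (by linarith) (by ring)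
  obtain ⟨C', hC', hh⟩ := hls (1/p) (by positivity) hp0
  refine ⟨C * C', by finiteness, ?_⟩
  intro R M hM hM2 K α hα N hN e he hN1 h1 h2
  have hD := Dom.sum (K := K) hα
  have hM' : Integrable (fun ξ => ((K.card:ℝ) * M ξ) ^ 2) μ := by
    simp only [mul_pow]; exact hM2.const_mul _
  rw [Dom.ttstar (hM.const_mul _) hM' hD]
  refine (enorm_integral_le_lintegral_enorm _).trans ?_
  refine le_trans ?_ (mul_le_mul_right (hh N hN hN1) C)
  rw [← lintegral_const_mul']
  swap; · exact hC
  refine lintegral_mono_ae ?_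
  filter_upwards [Sh_union] with z hz
  have hne : z.2 - z.1 ≠ 0 := by
    obtain ⟨j, hj⟩ := Set.mem_iUnion.1 hz
    intro h0
    have := hj.1
    rw [h0, abs_zero] at this
    exact absurd this (not_le.2 (by positivity))
  have hne' : z.1 ≠ z.2 := fun h => hne (by rw [h, sub_self])
  rw [ip_sum (fun k l => Dom.int_slice hM hM2 (hα k) (hα l) z.1 z.2)]
  refine (enorm_sum_le _ _).trans ?_
  refine (Finset.sum_le_sum fun k _ => enorm_sum_le _ _).trans ?_
  rw [tw_log _ _ hne]
  have := hm K ((2/p)/(1-2/q)) (Real.logb 2 |z.2 - z.1|) (fun k l => ‖ip μ (α k z.1) (α l z.2)‖ₑ) (N z.1 * N z.2)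
    (fun k => e k z.1) (fun k => e k z.2) (he _) (he _) ?_ ?_
  · refine this.trans (le_of_eq ?_)
    congr 4
    have : 1 - 2/q ≠ 0 := by
      have : 2/q = 2 * (1/q) := by ring
      rw [this]; intro h; linarith
    have e1 : 1/2 - 1/q = (1 - 2/q)/2 := by ring
    rw [e1]
    generalize 1 - 2/q = w at this
    field_simp
  · intro k hk l hl
    refine (h1 k hk l hl _ _ hne').trans ?_
    rw [tw_log _ _ hne]
    gcongr
    exact sqrt_mul_le _ _
  · intro k hk l hl
    refine (ip_bound ((hα k).slice _) ((hα l).slice _) (h2 k hk z.1) (h2 l hl z.2)).trans ?_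
    rw [mul_mul_mul_comm]
    gcongr
    exact sqrt_mul_le _ _

end Abs
end Strich

set_option linter.unusedVariables false
set_option linter.unusedSectionVars false
namespace Strich
section Abs
variable {X : Type*} [MeasurableSpace X] {μ : Measure X} [SigmaFinite μ]

lemma ip_zero_left (g : X → ℂ) : ip μ (fun _ => 0) g = 0 := by simp [ip]
lemma ip_zero_right (g : X → ℂ) : ip μ g (fun _ => 0) = 0 := by simp [ip]

lemma kt_diag (q : ℝ) (hq : 2 < q) : ∃ C : ℝ≥0∞, C ≠ ∞ ∧
    ∀ (R : ℝ) (M : X → ℝ) (hM : Measurable M) (hM2 : Integrable (fun ξ => M ξ ^ 2) μ)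
      (k : ℤ) (α : ℝ → X → ℂ) (hα : Dom R M α) (c : ℝ → ℝ≥0∞) (hc : Measurable c)
      (h1 : ∀ s t, s ≠ t → ‖ip μ (α s) (α t)‖ₑ ≤
        (ENNReal.ofReal |t - s|) ^ (-(q/(q-2))) * tw ((k+k)/q) * (c s * c t))
      (h3 : ∀ s t, ‖ip μ (α s) (α t)‖ₑ ≤ tw (-((k+k) * (1/2 - 1/q))) * (c s * c t))
      (W : Set ℝ) (hW : MeasurableSet W),
      ∫⁻ ξ, ‖∫ s, W.indicator (fun s => α s ξ) s‖ₑ ^ 2 ∂μ ≤ C * ∫⁻ s, W.indicator (fun s => c s ^ 2) s := by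
  have hq2 : 0 < q - 2 := by linarith
  have hm : 0 < min 1 (2/(q-2)) := lt_min one_pos (by positivity)
  obtain ⟨C, hC, hb⟩ := tsum_bump (min 1 (2/(q-2))) hm 1 one_pos
  refine ⟨C * 8, by finiteness, ?_⟩
  intro R M hM hM2 k α hα c hc h1 h3 W hW
  set g : ℝ → ℝ≥0∞ := W.indicator (fun s => c s ^ 2) with hg
  have gm : Measurable g := (hc.pow_const 2).indicator hW
  set I := ∫⁻ s, g s
  rw [Dom.ttstar hM hM2 (hα.indicator hW)]
  refine (enorm_integral_le_lintegral_enorm _).trans ?_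
  rw [lint_shell]
  have pt : ∀ (a : ℝ≥0∞) (s t : ℝ), (‖ip μ (α s) (α t)‖ₑ ≤ a * (c s * c t)) →
      ‖ip μ (fun ξ => W.indicator (fun s => α s ξ) s) (fun ξ => W.indicator (fun s => α s ξ) t)‖ₑ ≤ a * (g s + g t) := by
    intro a s t h
    by_cases hs : s ∈ W
    · by_cases ht : t ∈ W
      · simp only [hg, hs, ht, Set.indicator_of_mem]
        exact h.trans (mul_le_mul_right (mul_le_sq_add_sq _ _) _)
      · simp only [ht, not_false_eq_true, Set.indicator_of_notMem, ip_zero_right]; simp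
    · simp only [hs, not_false_eq_true, Set.indicator_of_notMem, ip_zero_left]; simp
  have sh : ∀ j : ℤ, ∫⁻ z in {z : ℝ × ℝ | z.2 - z.1 ∈ Sh j}, (g z.1 + g z.2) ∂(volume.prod volume) ≤ tw j * (8 * I) := by
    intro j
    rw [lintegral_add_left (f := fun z : ℝ × ℝ => g z.1) (gm.comp measurable_fst)]
    refine (add_le_add (lint_shell1 j g gm) (lint_shell2 j g gm)).trans (le_of_eq ?_)
    ring
  have key : ∀ j : ℤ, ∫⁻ z in {z : ℝ × ℝ | z.2 - z.1 ∈ Sh j}, ‖ip μ (fun ξ => W.indicator (fun s => α s ξ) z.1)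
      (fun ξ => W.indicator (fun s => α s ξ) z.2)‖ₑ ∂(volume.prod volume) ≤
      tw 0 * tw (-(min 1 (2/(q-2)) * |1 * (j:ℝ) - (k+k)*(1/2-1/q)|)) * (8 * I) := by
    intro j
    apply le2_bump 1 (2/(q-2)) j ((k+k)*(1/2-1/q)) 0 _ _ one_pos (by positivity)
    · calc _ ≤ ∫⁻ z in {z : ℝ × ℝ | z.2 - z.1 ∈ Sh j}, tw (-((k+k) * (1/2 - 1/q))) * (g z.1 + g z.2) ∂(volume.prod volume) :=
            lintegral_mono fun z => pt _ _ _ (h3 _ _)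
        _ ≤ tw (-((k+k) * (1/2 - 1/q))) * (tw j * (8 * I)) := by
            rw [lintegral_const_mul' _ _ (tw_ne_top _)]; gcongr; exact sh j
        _ = _ := by rw [← mul_assoc, ← tw_add]; congr 2; ring
    · calc _ ≤ ∫⁻ z in {z : ℝ × ℝ | z.2 - z.1 ∈ Sh j}, (tw (-(j * (q/(q-2)))) * tw ((k+k)/q)) * (g z.1 + g z.2) ∂(volume.prod volume) := by
            refine lintegral_mono_ae ?_
            filter_upwards [ae_restrict_mem (Sh_prod_meas j)] with z hz
            apply pt
            have hne : z.1 ≠ z.2 := by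
              intro h0
              have := hz.1
              rw [h0, sub_self, abs_zero] at this
              exact absurd this (not_le.2 (by positivity))
            refine (h1 _ _ hne).trans ?_
            gcongr
            exact Sh_rpow hz _ (by positivity)
        _ ≤ (tw (-(j * (q/(q-2)))) * tw ((k+k)/q)) * (tw j * (8 * I)) := by
            rw [lintegral_const_mul' _ _ (ENNReal.mul_ne_top (tw_ne_top _) (tw_ne_top _))]; gcongr; exact sh j
        _ = _ := by
            rw [← mul_assoc, ← tw_add, ← tw_add]; congr 2
            field_simp; ring
  calc _ ≤ ∑' j : ℤ, tw 0 * tw (-(min 1 (2/(q-2)) * |1 * (j:ℝ) - (k+k)*(1/2-1/q)|)) * (8 * I) := ENNReal.tsum_le_tsum key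
    _ = (∑' j : ℤ, tw (-(min 1 (2/(q-2)) * |1 * (j:ℝ) - (k+k)*(1/2-1/q)|))) * (8 * I) := by
        rw [← ENNReal.tsum_mul_right]; simp only [tw_zero, one_mul]
    _ ≤ C * (8 * I) := by gcongr; exact hb _
    _ = _ := by ring

lemma kt_shell1 {β γ : ℝ → X → ℂ} {b c : ℝ → ℝ≥0∞} (hb : Measurable b) (hc : Measurable c) (k l j : ℤ)
    (q : ℝ) (hq : 2 < q)
    (h1 : ∀ s t, s ≠ t → ‖ip μ (β s) (γ t)‖ₑ ≤
        (ENNReal.ofReal |t - s|) ^ (-(q/(q-2))) * tw ((k+l)/q) * (b s * c t)) :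
    ‖∫ z in {z : ℝ × ℝ | z.2 - z.1 ∈ Sh j}, ip μ (β z.1) (γ z.2) ∂(volume.prod volume)‖ₑ ≤
      tw (2/(q-2) * ((k * (1/2-1/q) - j/2) + (l * (1/2-1/q) - j/2))) * (4 * ((∫⁻ s, b s ^ 2) + ∫⁻ s, c s ^ 2)) := by
  have hq2 : 0 < q - 2 := by linarith
  refine (enorm_integral_le_lintegral_enorm _).trans ?_
  calc _ ≤ ∫⁻ z in {z : ℝ × ℝ | z.2 - z.1 ∈ Sh j}, (tw (-(j * (q/(q-2)))) * tw ((k+l)/q)) * (b z.1 ^ 2 + c z.2 ^ 2) ∂(volume.prod volume) := by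
            refine lintegral_mono_ae ?_
            filter_upwards [ae_restrict_mem (Sh_prod_meas j)] with z hz
            have hne : z.1 ≠ z.2 := by
              intro h0
              have := hz.1
              rw [h0, sub_self, abs_zero] at this
              exact absurd this (not_le.2 (by positivity))
            refine (h1 _ _ hne).trans ?_
            exact mul_le_mul' (mul_le_mul_left (Sh_rpow hz _ (by positivity)) _) (mul_le_sq_add_sq _ _)
    _ ≤ (tw (-(j * (q/(q-2)))) * tw ((k+l)/q)) * (tw j * (4 * ((∫⁻ s, b s ^ 2) + ∫⁻ s, c s ^ 2))) := by
        rw [lintegral_const_mul' _ _ (ENNReal.mul_ne_top (tw_ne_top _) (tw_ne_top _)), lintegral_add_left (f := fun z : ℝ × ℝ => b z.1 ^ 2) ((hb.pow_const 2).comp measurable_fst)]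
        refine mul_le_mul_right ?_ _
        refine (add_le_add (lint_shell1 j _ (hb.pow_const 2)) (lint_shell2 j _ (hc.pow_const 2))).trans (le_of_eq ?_)
        ring
    _ = _ := by
        rw [← mul_assoc, ← tw_add, ← tw_add]; congr 2
        field_simp; ring

lemma kt_shell3 {R : ℝ} {M : X → ℝ} (hM : Measurable M) (hM2 : Integrable (fun ξ => M ξ ^ 2) μ)
    {β γ : ℝ → X → ℂ} (hβ : Dom R M β) (hγ : Dom R M γ)
    {b c : ℝ → ℝ≥0∞} (hb : Measurable b) (hc : Measurable c) (l j : ℤ) (ρ : ℝ) (C0 : ℝ≥0∞)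
    (h1 : ∀ W : Set ℝ, MeasurableSet W → ∫⁻ ξ, ‖∫ s, W.indicator (fun s => β s ξ) s‖ₑ ^ 2 ∂μ ≤
      C0 * ∫⁻ s, W.indicator (fun s => b s ^ 2) s)
    (h2 : ∀ t, ∫⁻ ξ, ‖γ t ξ‖ₑ ^ 2 ∂μ ≤ tw (-(2 * l * ρ)) * c t ^ 2) :
    ‖∫ z in {z : ℝ × ℝ | z.2 - z.1 ∈ Sh j}, ip μ (β z.1) (γ z.2) ∂(volume.prod volume)‖ₑ ≤
      tw (-(l * ρ - j/2)) * (4 * C0 * (∫⁻ s, b s ^ 2) + ∫⁻ s, c s ^ 2) := by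
  set D := {z : ℝ × ℝ | z.2 - z.1 ∈ Sh j} with hD
  have hDm : MeasurableSet D := Sh_prod_meas j
  have e1 : ∫ z in D, ip μ (β z.1) (γ z.2) ∂(volume.prod volume) =
      ∫ t, ip μ (fun ξ => ∫ s, {s | t - s ∈ Sh j}.indicator (fun s => β s ξ) s) (γ t) := by
    rw [← integral_indicator hDm, integral_prod_symm _ ((Dom.int_ip hM hM2 hβ hγ).indicator hDm)]
    congr 1; ext t
    rw [Dom.fubini1 hM hM2 (hβ.indicator (Sh_shift_meas j t)) hγ t]
    congr 1; ext s
    by_cases h : t - s ∈ Sh j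
    · have hD1 : s ∈ {s | t - s ∈ Sh j} := h
      have hD2 : (s, t) ∈ D := h
      simp only [hD1, hD2, Set.indicator_of_mem]
    · have hD1 : s ∉ {s | t - s ∈ Sh j} := h
      have hD2 : (s, t) ∉ D := h
      simp only [hD1, hD2, Set.indicator_of_notMem, not_false_eq_true, ip_zero_left]
  rw [e1]
  refine (enorm_integral_le_lintegral_enorm _).trans ?_
  have hb2 : Measurable fun s => b s ^ 2 := hb.pow_const 2
  have pt : ∀ t, ‖ip μ (fun ξ => ∫ s, {s | t - s ∈ Sh j}.indicator (fun s => β s ξ) s) (γ t)‖ₑ ≤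
      tw (-(l * ρ - j/2)) * (C0 * tw (-j) * (∫⁻ s, {s | t - s ∈ Sh j}.indicator (fun s => b s ^ 2) s) + c t ^ 2) := by
    intro t
    refine (ip_cs (hβ.indicator (Sh_shift_meas j t)).meas_int (hγ.slice t)).trans ?_
    set u := ∫⁻ s, {s | t - s ∈ Sh j}.indicator (fun s => b s ^ 2) s
    have hw := h1 _ (Sh_shift_meas j t)
    calc _ ≤ (C0 * u) ^ (1/2:ℝ) * (tw (-(2 * l * ρ)) * c t ^ 2) ^ (1/2:ℝ) :=
          mul_le_mul' (ENNReal.rpow_le_rpow hw (by norm_num)) (ENNReal.rpow_le_rpow (h2 t) (by norm_num))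
      _ = tw (-(l * ρ - j/2)) * ((C0 * tw (-j) * u) ^ (1/2:ℝ) * (c t ^ 2) ^ (1/2:ℝ)) := by
          rw [ENNReal.mul_rpow_of_nonneg _ (c t ^ 2) (by norm_num), tw_rpow,
            show C0 * tw (-j) * u = tw (-j) * (C0 * u) by ring, ENNReal.mul_rpow_of_nonneg (tw (-j)) _ (by norm_num), tw_rpow,
            show -(l * ρ - (j:ℝ)/2) = -(2 * l * ρ) * (1/2) + (j:ℝ)/2 by ring, tw_add]
          have : tw ((j:ℝ)/2) * tw (-(j:ℝ) * (1/2)) = 1 := by rw [← tw_add, ← tw_zero]; congr 1; ring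
          calc _ = tw (-(2 * l * ρ) * (1/2)) * ((C0 * u) ^ (1/2:ℝ) * (c t ^ 2) ^ (1/2:ℝ)) * 1 := by ring
            _ = _ := by rw [← this]; ring
      _ ≤ _ := mul_le_mul_right (sqrt_mul_le _ _) _
  have e2 : ∫⁻ t, ∫⁻ s, {s | t - s ∈ Sh j}.indicator (fun s => b s ^ 2) s ≤ 4 * tw j * ∫⁻ s, b s ^ 2 := by
    have := lint_shell1 j _ hb2
    rw [← lintegral_indicator hDm, lintegral_prod_symm _ (Measurable.indicator (f := fun z : ℝ × ℝ => b z.1 ^ 2) (hb2.comp measurable_fst) hDm).aemeasurable] at this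
    exact this
  have mu : Measurable fun t => ∫⁻ s, {s | t - s ∈ Sh j}.indicator (fun s => b s ^ 2) s :=
    Measurable.lintegral_prod_left' (f := D.indicator fun z : ℝ × ℝ => b z.1 ^ 2) ((hb2.comp measurable_fst).indicator hDm)
  calc _ ≤ ∫⁻ t, tw (-(l * ρ - j/2)) * (C0 * tw (-j) * (∫⁻ s, {s | t - s ∈ Sh j}.indicator (fun s => b s ^ 2) s) + c t ^ 2) :=
        lintegral_mono pt
    _ = tw (-(l * ρ - j/2)) * (C0 * tw (-j) * (∫⁻ t, ∫⁻ s, {s | t - s ∈ Sh j}.indicator (fun s => b s ^ 2) s) + ∫⁻ t, c t ^ 2) := by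
        rw [lintegral_const_mul' _ _ (tw_ne_top _), lintegral_add_left (mu.const_mul _), lintegral_const_mul _ mu]
    _ ≤ tw (-(l * ρ - j/2)) * (C0 * tw (-j) * (4 * tw j * ∫⁻ s, b s ^ 2) + ∫⁻ t, c t ^ 2) := by gcongr
    _ = _ := by
        have : tw (-(j:ℝ)) * tw j = 1 := by rw [← tw_add, ← tw_zero]; congr 1; ring
        congr 2
        calc _ = C0 * 4 * (tw (-(j:ℝ)) * tw j) * ∫⁻ s, b s ^ 2 := by ring
          _ = _ := by rw [this]; ring

lemma kt_swap (β γ : ℝ → X → ℂ) (j : ℤ) :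
    ‖∫ z in {z : ℝ × ℝ | z.2 - z.1 ∈ Sh j}, ip μ (β z.1) (γ z.2) ∂(volume.prod volume)‖ₑ =
    ‖∫ z in {z : ℝ × ℝ | z.2 - z.1 ∈ Sh j}, ip μ (γ z.1) (β z.2) ∂(volume.prod volume)‖ₑ := by
  have hc : ∀ f g : X → ℂ, ip μ f g = (starRingEnd ℂ) (ip μ g f) := by
    intro f g; unfold ip; rw [← integral_conj]; congr 1; ext ξ; simp [mul_comm]
  rw [← integral_indicator (Sh_prod_meas j), ← integral_indicator (Sh_prod_meas j), ← integral_prod_swap]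
  have : ∀ z : ℝ × ℝ, ({z : ℝ × ℝ | z.2 - z.1 ∈ Sh j}.indicator (fun z => ip μ (β z.1) (γ z.2)) z.swap) =
      (starRingEnd ℂ) ({z : ℝ × ℝ | z.2 - z.1 ∈ Sh j}.indicator (fun z => ip μ (γ z.1) (β z.2)) z) := by
    rintro ⟨s, t⟩
    by_cases h : t - s ∈ Sh j
    · rw [Set.indicator_of_mem (show (s,t).swap ∈ {z : ℝ × ℝ | z.2 - z.1 ∈ Sh j} from (Sh_neg j s t).1 h),
        Set.indicator_of_mem (show (s,t) ∈ {z : ℝ × ℝ | z.2 - z.1 ∈ Sh j} from h)]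
      exact hc _ _
    · rw [Set.indicator_of_notMem (show (s,t).swap ∉ {z : ℝ × ℝ | z.2 - z.1 ∈ Sh j} from fun h' => h ((Sh_neg j s t).2 h')),
        Set.indicator_of_notMem (show (s,t) ∉ {z : ℝ × ℝ | z.2 - z.1 ∈ Sh j} from h), map_zero]
  simp only [this]
  rw [integral_conj]
  simp only [← ofReal_norm]
  rw [RCLike.norm_conj]

end Abs
end Strich

set_option linter.unusedVariables false
set_option linter.unusedSectionVars false
namespace Strich

lemma sum_kt_bump (ε ρ : ℝ) (hε : 0 < ε) (hρ : 0 < ρ) : ∃ C : ℝ≥0∞, C ≠ ∞ ∧ ∀ (K : Finset ℤ) (e : ℤ → ℝ≥0∞),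
    ∑ k ∈ K, ∑ l ∈ K, ∑' j : ℤ, tw (-(ε * |(k:ℝ) * ρ - j/2|)) * tw (-(ε * |(l:ℝ) * ρ - j/2|)) * (e k + e l) ≤
      C * ∑ k ∈ K, e k := by
  obtain ⟨C, hC, h⟩ := tsum_bump ε hε ρ hρ
  obtain ⟨C', hC', h'⟩ := tsum_bump ε hε (1/2) (by norm_num)
  have h1 : ∀ (K : Finset ℤ) (j : ℤ), ∑ l ∈ K, tw (-(ε * |(l:ℝ) * ρ - j/2|)) ≤ C := by
    intro K j
    refine (ENNReal.sum_le_tsum K).trans (le_trans (le_of_eq ?_) (h (j/2)))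
    congr 1; ext l; rw [mul_comm ρ]
  have h2 : ∀ k : ℤ, ∑' j : ℤ, tw (-(ε * |(k:ℝ) * ρ - j/2|)) ≤ C' := by
    intro k
    refine le_trans (le_of_eq ?_) (h' (k * ρ))
    congr 1; ext j; rw [abs_sub_comm, show (1/2 * (j:ℝ)) = j/2 by ring]
  refine ⟨C' * C + C' * C, by finiteness, fun K e => ?_⟩
  have key : ∑ k ∈ K, ∑ l ∈ K, ∑' j : ℤ, tw (-(ε * |(k:ℝ) * ρ - j/2|)) * tw (-(ε * |(l:ℝ) * ρ - j/2|)) * e k ≤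
      C' * C * ∑ k ∈ K, e k := by
    rw [Finset.mul_sum]
    refine Finset.sum_le_sum fun k _ => ?_
    rw [← Summable.tsum_finsetSum (fun _ _ => ENNReal.summable)]
    calc _ = ∑' j : ℤ, tw (-(ε * |(k:ℝ) * ρ - j/2|)) * e k * ∑ l ∈ K, tw (-(ε * |(l:ℝ) * ρ - j/2|)) := by
          congr 1; ext j; rw [Finset.mul_sum]; refine Finset.sum_congr rfl fun l _ => by ring
      _ ≤ ∑' j : ℤ, tw (-(ε * |(k:ℝ) * ρ - j/2|)) * e k * C := by gcongr with j; exact h1 K j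
      _ = (∑' j : ℤ, tw (-(ε * |(k:ℝ) * ρ - j/2|))) * (C * e k) := by
          rw [← ENNReal.tsum_mul_right]; congr 1; ext j; ring
      _ ≤ C' * (C * e k) := by gcongr; exact h2 k
      _ = _ := by ring
  have key2 : ∑ k ∈ K, ∑ l ∈ K, ∑' j : ℤ, tw (-(ε * |(k:ℝ) * ρ - j/2|)) * tw (-(ε * |(l:ℝ) * ρ - j/2|)) * e l ≤
      C' * C * ∑ k ∈ K, e k := by
    refine le_trans (le_of_eq ?_) key
    rw [Finset.sum_comm]
    refine Finset.sum_congr rfl fun k _ => Finset.sum_congr rfl fun l _ => ?_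
    congr 1; ext j; ring
  calc _ = _ := by
        simp only [mul_add, ENNReal.tsum_add, Finset.sum_add_distrib]
    _ ≤ _ := add_le_add key key2
    _ = _ := by ring

section Abs
variable {X : Type*} [MeasurableSpace X] {μ : Measure X} [SigmaFinite μ]

/-- Endpoint (Keel-Tao) abstract Strichartz. -/
lemma strich_kt (q : ℝ) (hq : 2 < q) : ∃ C : ℝ≥0∞, C ≠ ∞ ∧
    ∀ (R : ℝ) (M : X → ℝ) (hM : Measurable M) (hM2 : Integrable (fun ξ => M ξ ^ 2) μ)
      (K : Finset ℤ) (α : ℤ → ℝ → X → ℂ) (hα : ∀ k, Dom R M (α k)) (c : ℤ → ℝ → ℝ≥0∞) (hc : ∀ k, Measurable (c k))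
      (h1 : ∀ k ∈ K, ∀ l ∈ K, ∀ s t, s ≠ t → ‖ip μ (α k s) (α l t)‖ₑ ≤
        (ENNReal.ofReal |t - s|) ^ (-(q/(q-2))) * tw ((k+l)/q) * (c k s * c l t))
      (h2 : ∀ k ∈ K, ∀ s, ∫⁻ ξ, ‖α k s ξ‖ₑ ^ 2 ∂μ ≤ tw (-(2 * k * (1/2 - 1/q))) * (c k s) ^ 2),
      ∫⁻ ξ, ‖∫ s, ∑ k ∈ K, α k s ξ‖ₑ ^ 2 ∂μ ≤ C * ∑ k ∈ K, ∫⁻ s, c k s ^ 2 := by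
  have hq0 : 1/q < 1/2 := by rw [div_lt_div_iff₀ (by linarith) (by norm_num)]; linarith
  have ha : 0 < 2/(q-2) := div_pos two_pos (by linarith)
  set a := 2/(q-2) with ha'
  set ρ := 1/2 - 1/q with hρ'
  have hρ : 0 < ρ := by linarith
  have hε : 0 < a/(2*(1+a)) := by positivity
  obtain ⟨C0, hC0, hdiag⟩ := kt_diag (X := X) (μ := μ) q hq
  obtain ⟨C1, hC1, hsum⟩ := sum_kt_bump (a/(2*(1+a))) ρ hε hρ
  refine ⟨(4 + 4 * C0) * C1, by finiteness, ?_⟩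
  intro R M hM hM2 K α hα c hc h1 h2
  have hD := Dom.sum (K := K) hα
  have hM' : Integrable (fun ξ => ((K.card:ℝ) * M ξ) ^ 2) μ := by
    simp only [mul_pow]; exact hM2.const_mul _
  have hip : ∀ k l, Integrable (fun z : ℝ × ℝ => ip μ (α k z.1) (α l z.2)) (volume.prod volume) :=
    fun k l => Dom.int_ip hM hM2 (hα k) (hα l)
  rw [Dom.ttstar (hM.const_mul _) hM' hD]
  have e1 : ∀ z : ℝ × ℝ, ip μ (fun ξ => ∑ k ∈ K, α k z.1 ξ) (fun ξ => ∑ k ∈ K, α k z.2 ξ) =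
      ∑ k ∈ K, ∑ l ∈ K, ip μ (α k z.1) (α l z.2) := fun z =>
    ip_sum (fun k l => Dom.int_slice hM hM2 (hα k) (hα l) z.1 z.2)
  simp only [e1]
  rw [integral_finsetSum _ (fun k _ => integrable_finsetSum _ fun l _ => hip k l)]
  simp_rw [integral_finsetSum _ (fun l _ => hip _ l)]
  refine (enorm_sum_le _ _).trans ((Finset.sum_le_sum fun k _ => enorm_sum_le _ _).trans ?_)
  rw [mul_assoc]
  refine le_trans ?_ (mul_le_mul_right (hsum K (fun k => ∫⁻ s, c k s ^ 2)) _)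
  rw [Finset.mul_sum]
  refine Finset.sum_le_sum fun k hk => ?_
  rw [Finset.mul_sum]
  refine Finset.sum_le_sum fun l hl => ?_
  rw [← ENNReal.tsum_mul_left]
  have hs : HasSum (fun j : ℤ => ∫ z in {z : ℝ × ℝ | z.2 - z.1 ∈ Sh j}, ip μ (α k z.1) (α l z.2) ∂(volume.prod volume))
      (∫ z : ℝ × ℝ, ip μ (α k z.1) (α l z.2) ∂(volume.prod volume)) := by
    have := hasSum_integral_iUnion (μ := (volume.prod volume : Measure (ℝ × ℝ))) Sh_prod_meas Sh_prod_disj (hip k l).integrableOn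
    rwa [Sh_restrict] at this
  rw [← hs.tsum_eq]
  refine enorm_tsum_le_tsum_enorm.trans (ENNReal.tsum_le_tsum fun j => ?_)
  have hd : ∀ k ∈ K, ∀ W : Set ℝ, MeasurableSet W → ∫⁻ ξ, ‖∫ s, W.indicator (fun s => α k s ξ) s‖ₑ ^ 2 ∂μ ≤
      C0 * ∫⁻ s, W.indicator (fun s => c k s ^ 2) s := by
    intro k hk W hW
    refine hdiag R M hM hM2 k (α k) (hα k) (c k) (hc k) (h1 k hk k hk) (fun s t => ?_) W hW
    exact ip_bound ((hα k).slice _) ((hα k).slice _) (h2 k hk s) (h2 k hk t)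
  set Ck := ∫⁻ s, c k s ^ 2
  set Cl := ∫⁻ s, c l s ^ 2
  have b := le3_bump a ((k:ℝ) * ρ - j/2) ((l:ℝ) * ρ - j/2)
    ‖∫ z in {z : ℝ × ℝ | z.2 - z.1 ∈ Sh j}, ip μ (α k z.1) (α l z.2) ∂(volume.prod volume)‖ₑ
    ((4 + 4 * C0) * (Ck + Cl)) ha ?_ ?_ ?_
  · refine b.trans (le_of_eq ?_); ring
  · refine (kt_shell1 (hc k) (hc l) k l j q hq (h1 k hk l hl)).trans ?_
    gcongr
    exact le_self_add
  · rw [kt_swap]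
    refine (kt_shell3 hM hM2 (hα l) (hα k) (hc l) (hc k) k j ρ C0 (hd l hl) (h2 k hk)).trans ?_
    refine mul_le_mul_right ?_ _
    calc 4 * C0 * Cl + Ck ≤ 4 * C0 * Cl + Ck + (4 * Cl + 3 * Ck + 4 * C0 * Ck) := le_self_add
      _ = _ := by ring
  · refine (kt_shell3 hM hM2 (hα k) (hα l) (hc k) (hc l) l j ρ C0 (hd k hk) (h2 l hl)).trans ?_
    refine mul_le_mul_right ?_ _
    calc 4 * C0 * Ck + Cl ≤ 4 * C0 * Ck + Cl + (4 * Ck + 3 * Cl + 4 * C0 * Cl) := le_self_add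
      _ = _ := by ring

/-- Abstract Strichartz, all time exponents. -/
lemma strich_abs (p q : ℝ) (hp : 2 ≤ p) (hq : 2 < q) : ∃ C : ℝ≥0∞, C ≠ ∞ ∧
    ∀ (R : ℝ) (M : X → ℝ) (hM : Measurable M) (hM2 : Integrable (fun ξ => M ξ ^ 2) μ)
      (K : Finset ℤ) (α : ℤ → ℝ → X → ℂ) (hα : ∀ k, Dom R M (α k)) (N : ℝ → ℝ≥0∞) (hN : Measurable N)
      (e : ℤ → ℝ → ℝ≥0∞) (hem : ∀ k, Measurable (e k)) (he : ∀ s, ∑ k ∈ K, e k s ≤ 1) (hN1 : ∫⁻ s, N s ^ (1/(1-1/p)) ≤ 1)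
      (h1 : ∀ k ∈ K, ∀ l ∈ K, ∀ s t, s ≠ t → ‖ip μ (α k s) (α l t)‖ₑ ≤
        (ENNReal.ofReal |t - s|) ^ (-((2/p)/(1-2/q))) * tw ((k+l)/q) * (N s * N t * (e k s ^ (1/2:ℝ) * e l t ^ (1/2:ℝ))))
      (h2 : ∀ k ∈ K, ∀ s, ∫⁻ ξ, ‖α k s ξ‖ₑ ^ 2 ∂μ ≤ tw (-(2 * k * (1/2 - 1/q))) * (N s * e k s ^ (1/2:ℝ)) ^ 2),
      ∫⁻ ξ, ‖∫ s, ∑ k ∈ K, α k s ξ‖ₑ ^ 2 ∂μ ≤ C := by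
  rcases eq_or_lt_of_le hp with rfl | hp
  · obtain ⟨C, hC, h⟩ := strich_kt (X := X) (μ := μ) q hq
    refine ⟨C, hC, ?_⟩
    intro R M hM hM2 K α hα N hN e hem he hN1 h1 h2
    refine (h R M hM hM2 K α hα (fun k s => N s * e k s ^ (1/2:ℝ)) (fun k => hN.mul ((hem k).pow_const _)) ?_ h2).trans ?_
    · intro k hk l hl s t hst
      refine (h1 k hk l hl s t hst).trans (le_of_eq ?_)
      rw [mul_mul_mul_comm (N s)]
      congr 3
      have : q - 2 ≠ 0 := by linarith
      field_simp
    · have : ∑ k ∈ K, ∫⁻ s, (N s * e k s ^ (1/2:ℝ)) ^ 2 ≤ 1 := by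
        rw [← lintegral_finsetSum' (f := fun k s => (N s * e k s ^ (1/2:ℝ)) ^ 2) _ (fun k _ => ((hN.mul ((hem k).pow_const _)).pow_const 2).aemeasurable)]
        refine le_trans (lintegral_mono fun s => ?_) hN1
        calc ∑ k ∈ K, (N s * e k s ^ (1/2:ℝ)) ^ 2 = N s ^ 2 * ∑ k ∈ K, e k s := by
              rw [Finset.mul_sum]; refine Finset.sum_congr rfl fun k _ => ?_
              rw [mul_pow, ← ENNReal.rpow_two (e k s ^ (1/2:ℝ)), ← ENNReal.rpow_mul]; norm_num
          _ ≤ N s ^ 2 * 1 := by gcongr; exact he s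
          _ = _ := by rw [mul_one, ← ENNReal.rpow_two]; norm_num
      exact (mul_le_mul_right this C).trans (le_of_eq (mul_one _))
  · obtain ⟨C, hC, h⟩ := strich_hls (X := X) (μ := μ) p q hp hq
    exact ⟨C, hC, fun R M hM hM2 K α hα N hN e hem he hN1 h1 h2 => h R M hM hM2 K α hα N hN e he hN1 h1 h2⟩

end Abs
end Strich

set_option linter.unusedVariables false
set_option linter.unusedSectionVars false
namespace Strich
open scoped ContDiff

theorem fourier_ae {d : ℕ} (g : EuclideanSpace ℝ (Fin d) → ℂ) (hg : Integrable g)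
    (hg2 : MemLp g 2) :
    (𝓕 (hg2.toLp g) : Lp ℂ 2 (volume : Measure (EuclideanSpace ℝ (Fin d)))) =ᵐ[volume] 𝓕 g := by
  have hG := hg2.coeFn_toLp
  set G : Lp (α := EuclideanSpace ℝ (Fin d)) ℂ 2 volume := hg2.toLp g
  have hc : Continuous (𝓕 g) := by
    have := (Real.fourier_eq (E := ℂ) (V := EuclideanSpace ℝ (Fin d)))
    exact VectorFourier.fourierIntegral_continuous Real.continuous_fourierChar
      (by exact continuous_inner) hg
  apply ae_eq_of_integral_contDiff_smul_eq
  · exact (Lp.memLp _).locallyIntegrable (by norm_num)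
  · exact hc.locallyIntegrable
  · intro φ hφ hφc
    have hg₁ : HasCompactSupport (Complex.ofRealCLM ∘ φ) := hφc.comp_left rfl
    have hg₂ : ContDiff ℝ ∞ (Complex.ofRealCLM ∘ φ) := by fun_prop
    set Φ : 𝓢(EuclideanSpace ℝ (Fin d), ℂ) := hg₁.toSchwartzMap hg₂ with hΦ
    have h1 : (𝓕 ((G : Lp ℂ 2 (volume : Measure (EuclideanSpace ℝ (Fin d)))) : 𝓢'(EuclideanSpace ℝ (Fin d), ℂ))) Φ = ((𝓕 G : Lp ℂ 2 (volume : Measure (EuclideanSpace ℝ (Fin d)))) : 𝓢'(EuclideanSpace ℝ (Fin d), ℂ)) Φ := by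
      rw [Lp.fourier_toTemperedDistribution_eq]
    rw [TemperedDistribution.fourier_apply, Lp.toTemperedDistribution_apply,
      Lp.toTemperedDistribution_apply] at h1
    have e1 : ∫ x, φ x • (𝓕 G : Lp ℂ 2 (volume : Measure (EuclideanSpace ℝ (Fin d)))) x
       = ∫ x, Φ x • (𝓕 G : Lp ℂ 2 (volume : Measure (EuclideanSpace ℝ (Fin d)))) x := by
      apply integral_congr_ae; filter_upwards with x; simp [hΦ]
    rw [e1, ← h1]
    have e2 : ∫ x, (𝓕 Φ) x • G x = ∫ x, 𝓕 (⇑Φ) x • g x := by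
      apply integral_congr_ae
      filter_upwards [hG] with x hx
      rw [hx, SchwartzMap.fourier_coe]
    rw [e2]
    have h3 := VectorFourier.integral_fourierIntegral_smul_eq_flip (L := innerₗ (EuclideanSpace ℝ (Fin d))) (μ := volume) (ν := volume) Real.continuous_fourierChar (by exact continuous_inner) Φ.integrable hg
    rw [flip_innerₗ] at h3
    refine Eq.trans h3 ?_
    apply integral_congr_ae; filter_upwards with x
    simp only [hΦ]
    rfl

/-- Plancherel. -/
theorem plancherel {d : ℕ} (g : EuclideanSpace ℝ (Fin d) → ℂ) (hg : Integrable g)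
    (hg2 : MemLp g 2) : ∫⁻ ξ, ‖𝓕 g ξ‖ₑ ^ 2 = ∫⁻ x, ‖g x‖ₑ ^ 2 := by
  have h := Lp.norm_fourier_eq (hg2.toLp g)
  rw [Lp.norm_def, Lp.norm_def] at h
  have h' := (ENNReal.toReal_eq_toReal_iff' (Lp.memLp _).eLpNorm_ne_top (Lp.memLp _).eLpNorm_ne_top).1 h
  rw [eLpNorm_congr_ae (fourier_ae g hg hg2), eLpNorm_congr_ae hg2.coeFn_toLp,
    eLpNorm_eq_lintegral_rpow_enorm_toReal (by norm_num) (by norm_num),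
    eLpNorm_eq_lintegral_rpow_enorm_toReal (by norm_num) (by norm_num)] at h'
  have h2 := congrArg (fun z => z ^ (2:ℝ)) h'
  simp only [← ENNReal.rpow_mul] at h2
  norm_num at h2
  simpa using h2

/-- extension operator -/
noncomputable def Ef {d : ℕ} (φ : EuclideanSpace ℝ (Fin d) → ℂ) (x : EuclideanSpace ℝ (Fin d)) : ℂ :=
  ∫ ξ, cexp (2 * π * I * ((⟪x, ξ⟫ : ℝ) : ℂ)) * φ ξ

theorem Ef_eq_inv {d : ℕ} (φ : EuclideanSpace ℝ (Fin d) → ℂ) (x) : Ef φ x = 𝓕⁻ φ x := by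
  rw [Ef, Real.fourierInv_eq']
  apply integral_congr_ae; filter_upwards with ξ
  rw [real_inner_comm]
  simp only [smul_eq_mul]
  congr 2; push_cast; ring

theorem Ef_eq_neg {d : ℕ} (φ : EuclideanSpace ℝ (Fin d) → ℂ) (x) : Ef φ x = 𝓕 φ (-x) := by
  rw [Ef_eq_inv, Real.fourierInv_eq_fourier_neg]

theorem Ef_plancherel {d : ℕ} (g : EuclideanSpace ℝ (Fin d) → ℂ) (hg : Integrable g)
    (hg2 : MemLp g 2) : ∫⁻ x, ‖Ef g x‖ₑ ^ 2 = ∫⁻ x, ‖g x‖ₑ ^ 2 := by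
  rw [← plancherel g hg hg2, ← lintegral_neg_eq_self (fun x => ‖𝓕 g x‖ₑ^2)]
  simp only [Ef_eq_neg]

theorem Ef_cont {d : ℕ} (g : EuclideanSpace ℝ (Fin d) → ℂ) (hg : Integrable g) : Continuous (Ef g) := by
  have hc : Continuous (𝓕 g) := VectorFourier.fourierIntegral_continuous Real.continuous_fourierChar
      (by exact continuous_inner) hg
  have : Ef g = fun x => 𝓕 g (-x) := by funext x; rw [Ef_eq_neg]
  rw [this]; fun_prop

theorem norm_e2 (r : ℝ) : ‖cexp (2 * π * I * (r:ℂ))‖ = 1 := by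
  rw [show 2 * π * I * (r:ℂ) = ((2 * π * r : ℝ) : ℂ) * I by push_cast; ring]
  exact Complex.norm_exp_ofReal_mul_I _

theorem Ef_le {d : ℕ} (g : EuclideanSpace ℝ (Fin d) → ℂ) (x) : ‖Ef g x‖ₑ ≤ ∫⁻ ξ, ‖g ξ‖ₑ := by
  refine (enorm_integral_le_lintegral_enorm _).trans (lintegral_mono fun ξ => ?_)
  rw [enorm_mul, ← ofReal_norm (cexp _), norm_e2]; simp

end Strich

set_option linter.unusedVariables false
set_option linter.unusedSectionVars false
namespace Strich

variable {d : ℕ}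

noncomputable def phase (t : ℝ) (ξ : EuclideanSpace ℝ (Fin d)) : ℂ :=
  cexp (I * ((t * (2 * π * ‖ξ‖) ^ 4 : ℝ) : ℂ))

lemma norm_phase (t : ℝ) (ξ : EuclideanSpace ℝ (Fin d)) : ‖phase t ξ‖ = 1 := norm_expI _

lemma phase_cont : Continuous (Function.uncurry (phase (d := d))) := by
  unfold phase; unfold Function.uncurry; fun_prop

lemma phase_add (s t : ℝ) (ξ : EuclideanSpace ℝ (Fin d)) : phase (s + t) ξ = phase s ξ * phase t ξ := by
  unfold phase; rw [← Complex.exp_add]; congr 1; push_cast; ring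

lemma phase_conj (t : ℝ) (ξ : EuclideanSpace ℝ (Fin d)) : (starRingEnd ℂ) (phase t ξ) = phase (-t) ξ := by
  unfold phase; rw [← Complex.exp_conj, map_mul, Complex.conj_I, Complex.conj_ofReal]; congr 1; push_cast; ring

noncomputable def al (G : ℝ → EuclideanSpace ℝ (Fin d) → ℂ) (s : ℝ) (ξ : EuclideanSpace ℝ (Fin d)) : ℂ :=
  (mK d ξ : ℂ) * phase (-s) ξ * 𝓕 (G s) ξ

structure Cs (R B : ℝ) (G : ℝ → EuclideanSpace ℝ (Fin d) → ℂ) : Prop where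
  meas : Measurable (Function.uncurry G)
  le : ∀ s x, ‖G s x‖ ≤ B
  supt : ∀ s x, s ∉ Set.Icc (-R) R → G s x = 0
  supx : ∀ s x, x ∉ Metric.closedBall (0 : EuclideanSpace ℝ (Fin d)) R → G s x = 0

variable {R B : ℝ} {G H : ℝ → EuclideanSpace ℝ (Fin d) → ℂ}

lemma Cs.le' (h : Cs R B G) (s x) : ‖G s x‖ ≤ (Metric.closedBall (0 : EuclideanSpace ℝ (Fin d)) R).indicator (fun _ => B) x := by
  by_cases hx : x ∈ Metric.closedBall (0 : EuclideanSpace ℝ (Fin d)) R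
  · rw [Set.indicator_of_mem hx]; exact h.le s x
  · rw [Set.indicator_of_notMem hx, h.supx s x hx, norm_zero]

lemma Cs.slice (h : Cs R B G) (s) : Measurable (G s) := h.meas.comp measurable_prodMk_left

lemma ball_int (R B : ℝ) : Integrable ((Metric.closedBall (0 : EuclideanSpace ℝ (Fin d)) R).indicator (fun _ => B)) :=
  (integrableOn_const (measure_closedBall_lt_top).ne).integrable_indicator
    Metric.isClosed_closedBall.measurableSet

lemma Cs.int (h : Cs R B G) (s) : Integrable (G s) :=
  (ball_int R B).mono' (h.slice s).aestronglyMeasurable (Filter.Eventually.of_forall fun x => h.le' s x)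

lemma Cs.memLp (h : Cs R B G) (s) : MemLp (G s) 2 := by
  refine MemLp.mono (g := (Metric.closedBall (0 : EuclideanSpace ℝ (Fin d)) R).indicator (fun _ => B))
    ?_ (h.slice s).aestronglyMeasurable
    (Filter.Eventually.of_forall fun x => (h.le' s x).trans (le_abs_self _))
  exact memLp_indicator_const 2 Metric.isClosed_closedBall.measurableSet B (Or.inr measure_closedBall_lt_top.ne)

lemma Cs.four_le (h : Cs R B G) (s ξ) : ‖𝓕 (G s) ξ‖ ≤ ∫ x, (Metric.closedBall (0 : EuclideanSpace ℝ (Fin d)) R).indicator (fun _ => B) x := by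
  refine (VectorFourier.norm_fourierIntegral_le_integral_norm _ _ _ _ _).trans ?_
  exact integral_mono (h.int s).norm (ball_int R B) (fun x => h.le' s x)

lemma Cs.four_meas (h : Cs R B G) : Measurable (Function.uncurry fun s => 𝓕 (G s)) := by
  have : (Function.uncurry fun s => 𝓕 (G s)) = fun z : ℝ × EuclideanSpace ℝ (Fin d) =>
      ∫ x, cexp (((-2 * π * ⟪x, z.2⟫ : ℝ) : ℂ) * I) * G z.1 x := by
    funext z
    rw [Function.uncurry, Real.fourier_eq']
    simp only [smul_eq_mul]
  rw [this]
  refine (StronglyMeasurable.integral_prod_right' (f := fun w : (ℝ × EuclideanSpace ℝ (Fin d)) × EuclideanSpace ℝ (Fin d) =>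
    cexp (((-2 * π * ⟪w.2, w.1.2⟫ : ℝ) : ℂ) * I) * G w.1.1 w.2) ?_).measurable
  refine Measurable.stronglyMeasurable (Measurable.mul ?_ ?_)
  · exact Continuous.measurable (by fun_prop)
  · exact h.meas.comp (measurable_fst.fst.prodMk measurable_snd)

lemma Cs.dom (h : Cs R B G) : Dom R (fun ξ => mK d ξ * ∫ x, (Metric.closedBall (0 : EuclideanSpace ℝ (Fin d)) R).indicator (fun _ => B) x) (al G) := by
  constructor
  · unfold al
    refine Measurable.mul (Measurable.mul ?_ ?_) h.four_meas
    · have := mK_cont (d := d)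
      exact Continuous.measurable (by fun_prop)
    · exact (phase_cont.comp (by fun_prop : Continuous fun z : ℝ × EuclideanSpace ℝ (Fin d) => (-z.1, z.2))).measurable
  · intro s ξ
    by_cases hs : s ∈ Set.Icc (-R) R
    · rw [Set.indicator_of_mem hs, al, norm_mul, norm_mul, norm_phase, mul_one, Complex.norm_real,
        Real.norm_of_nonneg (mK_nonneg ξ)]
      exact mul_le_mul_of_nonneg_left (h.four_le s ξ) (mK_nonneg ξ)
    · rw [Set.indicator_of_notMem hs]
      have : G s = 0 := by funext x; exact h.supt s x hs
      rw [al, this, Real.fourier_eq]; simp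

lemma al_L2 (d : ℕ) : ∃ C : ℝ≥0∞, C ≠ ∞ ∧ ∀ (R B : ℝ) (G : ℝ → EuclideanSpace ℝ (Fin d) → ℂ), Cs R B G →
    ∀ s, ∫⁻ ξ, ‖al G s ξ‖ₑ ^ 2 ≤ C * ∫⁻ x, ‖G s x‖ₑ ^ 2 := by
  obtain ⟨C, hC, hb⟩ := mK_bound d
  refine ⟨ENNReal.ofReal C ^ 2, by finiteness, fun R B G h s => ?_⟩
  rw [← plancherel _ (h.int s) (h.memLp s), ← lintegral_const_mul' _ _ (by finiteness)]
  refine lintegral_mono fun ξ => ?_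
  rw [← mul_pow]
  gcongr
  rw [al, enorm_mul, enorm_mul, ← ofReal_norm (phase _ _), norm_phase, ENNReal.ofReal_one, mul_one]
  gcongr
  rw [← ofReal_norm]
  apply ENNReal.ofReal_le_ofReal
  rw [Complex.norm_real, Real.norm_of_nonneg (mK_nonneg ξ)]
  refine (hb ξ).trans (mul_le_of_le_one_right hC.le ?_)
  rw [Real.exp_le_one_iff]; have := sq_nonneg ‖ξ‖; linarith

lemma al_ip (hG : Cs R B G) (hH : Cs R B H) (s t : ℝ) (D : ℝ≥0∞)
    (hD : ∀ x : EuclideanSpace ℝ (Fin d), ‖∫ ξ, gK (t - s) x ξ‖ₑ ≤ D) :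
    ‖ip volume (al G s) (al H t)‖ₑ ≤ D * ((∫⁻ x, ‖G s x‖ₑ) * ∫⁻ x, ‖H t x‖ₑ) := by
  set P : EuclideanSpace ℝ (Fin d) × EuclideanSpace ℝ (Fin d) → ℂ := fun z => G s z.1 * (starRingEnd ℂ) (H t z.2) with hP
  have hPi : Integrable P (volume.prod volume) := by
    have h2 : Integrable (fun y => (starRingEnd ℂ) (H t y)) := by
      have := (LinearIsometryEquiv.integrable_comp_iff Complex.conjLIE (φ := H t)).2 (hH.int t)
      exact this
    exact (hG.int s).mul_prod h2
  have e1 : ∀ ξ, al G s ξ * (starRingEnd ℂ) (al H t ξ) =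
      ∫ z, gK (t - s) (z.2 - z.1) ξ * P z ∂(volume.prod volume) := by
    intro ξ
    have a1 : 𝓕 (G s) ξ * (starRingEnd ℂ) (𝓕 (H t) ξ) =
       ∫ z, (cexp (((-2 * π * ⟪z.1, ξ⟫ : ℝ) : ℂ) * I) * G s z.1) *
          (starRingEnd ℂ) (cexp (((-2 * π * ⟪z.2, ξ⟫ : ℝ) : ℂ) * I) * H t z.2)
          ∂((volume : Measure (EuclideanSpace ℝ (Fin d))).prod volume) := by
      rw [integral_prod_mul (fun x => cexp (((-2 * π * ⟪x, ξ⟫ : ℝ) : ℂ) * I) * G s x)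
        (fun y => (starRingEnd ℂ) (cexp (((-2 * π * ⟪y, ξ⟫ : ℝ) : ℂ) * I) * H t y)), integral_conj,
        Real.fourier_eq', Real.fourier_eq']
      simp only [smul_eq_mul]
    have a2 : al G s ξ * (starRingEnd ℂ) (al H t ξ) = ((mK d ξ ^ 2 : ℝ) : ℂ) * phase (t - s) ξ *
        (𝓕 (G s) ξ * (starRingEnd ℂ) (𝓕 (H t) ξ)) := by
      unfold al
      rw [map_mul, map_mul, phase_conj, Complex.conj_ofReal, neg_neg, show t - s = -s + t by ring, phase_add]
      push_cast; ring
    rw [a2, a1, ← integral_const_mul]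
    apply integral_congr_ae; filter_upwards with z
    rw [hP]; simp only [map_mul]
    unfold gK theta phase
    rw [← Complex.exp_conj, map_mul, Complex.conj_I, Complex.conj_ofReal]
    have : cexp (I * ((2 * π * ⟪z.2 - z.1, ξ⟫ + (t - s) * (2 * π * ‖ξ‖) ^ 4 : ℝ) : ℂ)) =
       cexp (I * (((t - s) * (2 * π * ‖ξ‖) ^ 4 : ℝ) : ℂ)) * cexp (((-2 * π * ⟪z.1, ξ⟫ : ℝ) : ℂ) * I) *
        cexp (((-2 * π * ⟪z.2, ξ⟫ : ℝ) : ℂ) * -I) := by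
      rw [← Complex.exp_add, ← Complex.exp_add, inner_sub_left]; congr 1; push_cast; ring
    rw [this]; ring
  unfold ip
  simp_rw [e1]
  have hInt : Integrable (Function.uncurry fun (ξ : EuclideanSpace ℝ (Fin d)) (z : EuclideanSpace ℝ (Fin d) × EuclideanSpace ℝ (Fin d)) =>
      gK (t - s) (z.2 - z.1) ξ * P z) (volume.prod (volume.prod volume)) := by
    have := (mK2_int (d := d)).mul_prod hPi.norm
    refine this.mono' ?_ (Filter.Eventually.of_forall fun w => ?_)
    · refine Measurable.aestronglyMeasurable (Measurable.mul ?_ ?_)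
      · have := mK_cont (d := d)
        unfold gK theta
        exact Continuous.measurable (by fun_prop)
      · refine Measurable.mul ((hG.slice s).comp (measurable_snd.fst)) ?_
        exact Complex.continuous_conj.measurable.comp ((hH.slice t).comp measurable_snd.snd)
    · simp only [Function.uncurry, norm_mul, norm_gK]; rfl
  rw [integral_integral_swap hInt]
  simp_rw [integral_mul_const]
  refine (enorm_integral_le_lintegral_enorm _).trans ?_
  calc ∫⁻ z, ‖(∫ ξ, gK (t - s) (z.2 - z.1) ξ) * P z‖ₑ ∂(volume.prod volume)
      ≤ ∫⁻ z, D * (‖G s z.1‖ₑ * ‖H t z.2‖ₑ) ∂((volume : Measure (EuclideanSpace ℝ (Fin d))).prod volume) := by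
        refine lintegral_mono fun z => ?_
        rw [enorm_mul]
        refine mul_le_mul' (hD _) ?_
        rw [hP]; simp only [enorm_mul, RCLike.enorm_conj]; rfl
    _ = _ := by
      rw [lintegral_const_mul _ (by
        exact (((hG.slice s).comp measurable_fst).enorm).mul (((hH.slice t).comp measurable_snd).enorm)),
        lintegral_prod_mul (f := fun x => ‖G s x‖ₑ) (g := fun x => ‖H t x‖ₑ) (hG.slice s).enorm.aemeasurable (hH.slice t).enorm.aemeasurable]

end Strich

set_option linter.unusedVariables false
set_option linter.unusedSectionVars false
namespace Strich

variable {d : ℕ}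

lemma Cs.indicator {R B : ℝ} {G : ℝ → EuclideanSpace ℝ (Fin d) → ℂ} (h : Cs R B G)
    (A : Set (ℝ × EuclideanSpace ℝ (Fin d))) (hA : MeasurableSet A) (hB : 0 ≤ B) :
    Cs R B (fun s x => A.indicator (Function.uncurry G) (s, x)) := by
  constructor
  · exact h.meas.indicator hA
  · intro s x
    by_cases hx : (s, x) ∈ A
    · simpa [Set.indicator_of_mem hx, Function.uncurry] using h.le s x
    · simpa [Set.indicator_of_notMem hx] using hB
  · intro s x hs
    by_cases hx : (s, x) ∈ A
    · simpa [Set.indicator_of_mem hx, Function.uncurry] using h.supt s x hs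
    · simp [Set.indicator_of_notMem hx]
  · intro s x hs
    by_cases hx : (s, x) ∈ A
    · simpa [Set.indicator_of_mem hx, Function.uncurry] using h.supx s x hs
    · simp [Set.indicator_of_notMem hx]

lemma Dom.smul {X : Type*} [MeasurableSpace X] {R : ℝ} {M : X → ℝ} {β : ℝ → X → ℂ} (h : Dom R M β) (c : ℝ) (hc : 0 ≤ c) :
    Dom R (fun ξ => c * M ξ) (fun s ξ => (c : ℂ) * β s ξ) := by
  constructor
  · exact h.meas.const_mul _
  · intro s ξ
    have := h.le s ξ
    rw [norm_mul, Complex.norm_real, Real.norm_of_nonneg hc]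
    by_cases hs : s ∈ Set.Icc (-R) R
    · simp only [Set.indicator_of_mem hs] at this ⊢; gcongr
    · simp only [Set.indicator_of_notMem hs] at this ⊢
      have h0 : ‖β s ξ‖ = 0 := le_antisymm this (norm_nonneg _)
      rw [h0]; simp

lemma kernel_le (hd : 1 ≤ d) (σ : ℝ) (hσ0 : 0 ≤ σ) (hσ : σ ≤ (d:ℝ)/2) : ∃ C : ℝ, 0 < C ∧ ∀ s t : ℝ, s ≠ t → ∀ x : EuclideanSpace ℝ (Fin d),
    ‖∫ ξ, gK (t - s) x ξ‖ₑ ≤ ENNReal.ofReal C * (ENNReal.ofReal |t - s|) ^ (-σ) := by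
  obtain ⟨C, hC, h⟩ := disp (d := d) hd
  refine ⟨C, hC, fun s t hst x => ?_⟩
  have h0 : 0 < |t - s| := abs_pos.2 (sub_ne_zero.2 hst.symm)
  rw [ENNReal.ofReal_rpow_of_pos h0, ← ENNReal.ofReal_mul hC.le, ← ofReal_norm]
  apply ENNReal.ofReal_le_ofReal
  obtain ⟨h1, h2⟩ := h (t - s) x
  rcases le_total (|t - s|) 1 with h3 | h3
  · refine h1.trans (le_mul_of_one_le_right hC.le ?_)
    exact Real.one_le_rpow_of_pos_of_le_one_of_nonpos h0 h3 (by linarith)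
  · refine (h2 (sub_ne_zero.2 hst.symm)).trans ?_
    refine mul_le_mul_of_nonneg_left ?_ hC.le
    exact Real.rpow_le_rpow_of_exponent_le h3 (by linarith)

theorem dual_bound (hd : 1 ≤ d) (p q : ℝ) (hp : 2 ≤ p) (hq : 2 < q) (hpq : (2/p)/(1-2/q) ≤ (d:ℝ)/2) :
    ∃ C : ℝ≥0∞, C ≠ ∞ ∧ ∀ (R B a b : ℝ) (hB : 0 ≤ B) (ha : 0 < a) (G : ℝ → EuclideanSpace ℝ (Fin d) → ℂ) (hG : Cs R B G)
      (N : ℝ → ℝ≥0∞) (hN : Measurable N) (hNt : ∀ s, N s ≠ ∞)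
      (hab : ∀ s x, G s x ≠ 0 → N s * ENNReal.ofReal a ≤ ‖G s x‖ₑ ∧ ‖G s x‖ₑ ≤ N s * ENNReal.ofReal b)
      (hN1 : ∫⁻ s, N s ^ (1/(1-1/p)) ≤ 1)
      (hGN : ∀ s, ∫⁻ x, ‖G s x‖ₑ ^ (1/(1-1/q)) ≤ N s ^ (1/(1-1/q))),
      ∫⁻ ξ, ‖∫ s, al G s ξ‖ₑ ^ 2 ≤ C := by
  obtain ⟨C0, hC0, habs⟩ := strich_abs (X := EuclideanSpace ℝ (Fin d)) (μ := volume) p q hp hq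
  obtain ⟨C1, hC1, hL2⟩ := al_L2 d
  have hq0 : 0 < q := by linarith
  have hq1 : 0 < 1 - 2/q := by rw [sub_pos, div_lt_one hq0]; exact hq
  have hq2 : 0 < 1 - 1/q := by have : 2/q = 2 * (1/q) := by ring
                               have : 0 < 1/q := by positivity
                               linarith
  obtain ⟨C2, hC2, hker⟩ := kernel_le hd ((2/p)/(1-2/q)) (by positivity) hpq
  set L : ℝ≥0∞ := tw (2 * (1-1/q)) * (C1 + ENNReal.ofReal C2) with hL
  have hLt : L ≠ ∞ := ENNReal.mul_ne_top (tw_ne_top _) (by finiteness)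
  obtain ⟨c, hc, hcL⟩ : ∃ c : ℝ, 0 < c ∧ ENNReal.ofReal c ^ 2 * L ≤ 1 := by
    refine ⟨(L.toReal + 1)⁻¹, by positivity, ?_⟩
    rw [← ENNReal.ofReal_toReal hLt, ← ENNReal.ofReal_pow (by positivity), ← ENNReal.ofReal_mul (by positivity)]
    rw [ENNReal.ofReal_le_one, ENNReal.toReal_ofReal ENNReal.toReal_nonneg]
    have hx : (0:ℝ) ≤ L.toReal := ENNReal.toReal_nonneg
    rw [inv_pow, inv_mul_le_one₀ (by positivity)]; nlinarith
  refine ⟨(ENNReal.ofReal c ^ 2)⁻¹ * C0, ENNReal.mul_ne_top (ENNReal.inv_ne_top.2 (by simpa using hc)) hC0, ?_⟩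
  intro R B a b hB ha G hG N hN hNt hab hN1 hGN
  set κ : ℤ → ℝ≥0∞ := fun k => tw (-(k * (1-1/q))) with hκ
  set A : ℤ → Set (ℝ × EuclideanSpace ℝ (Fin d)) := fun k =>
    {z | κ k * N z.1 ≤ ‖G z.1 z.2‖ₑ ∧ ‖G z.1 z.2‖ₑ < κ (k-1) * N z.1} with hA
  have hGm : Measurable fun z : ℝ × EuclideanSpace ℝ (Fin d) => ‖G z.1 z.2‖ₑ := hG.meas.enorm
  have hAm : ∀ k, MeasurableSet (A k) := fun k => by
    refine (measurableSet_le ?_ hGm).inter (measurableSet_lt hGm ?_)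
    · exact (hN.comp measurable_fst).const_mul _
    · exact (hN.comp measurable_fst).const_mul _
  have hdisj : ∀ k l z, k < l → z ∈ A k → z ∈ A l → False := by
    intro k l z hkl h1 h2
    have : κ (l-1) ≤ κ k := by
      apply tw_mono
      have : (k:ℝ) ≤ ((l - 1 : ℤ):ℝ) := by exact_mod_cast (by omega)
      nlinarith
    exact absurd (h2.2.trans_le ((mul_le_mul_left this _).trans h1.1)) (lt_irrefl _)
  have hex : ∃ K : Finset ℤ, ∀ s x, G s x ≠ 0 → ∃ k ∈ K, (s, x) ∈ A k := by
    obtain ⟨ka, ha1, ha2⟩ := atom_exists' (ENNReal.ofReal a) (1-1/q) (by simpa using ha) ENNReal.ofReal_ne_top hq2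
    obtain ⟨kb, hb1, hb2⟩ := atom_exists' (ENNReal.ofReal (max a b)) (1-1/q) (by simp [ha]) ENNReal.ofReal_ne_top hq2
    refine ⟨Finset.Icc kb ka, fun s x hx => ?_⟩
    obtain ⟨g1, g2⟩ := hab s x hx
    have hGx : ‖G s x‖ₑ ≠ 0 := by simpa using hx
    have hN0 : N s ≠ 0 := by
      intro h; rw [h, zero_mul] at g2; exact hGx (le_antisymm g2 zero_le)
    obtain ⟨k, hk1, hk2⟩ := atom_exists' (‖G s x‖ₑ / N s) (1-1/q) (ENNReal.div_ne_zero.2 ⟨hGx, hNt s⟩)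
      (ENNReal.div_ne_top enorm_ne_top hN0) hq2
    have r1 : ENNReal.ofReal a ≤ ‖G s x‖ₑ / N s := by
      rw [ENNReal.le_div_iff_mul_le (Or.inl hN0) (Or.inl (hNt s)), mul_comm]; exact g1
    have r2 : ‖G s x‖ₑ / N s ≤ ENNReal.ofReal (max a b) := by
      refine le_trans ?_ (ENNReal.ofReal_le_ofReal (le_max_right a b))
      rw [ENNReal.div_le_iff hN0 (hNt s), mul_comm]; exact g2
    refine ⟨k, Finset.mem_Icc.2 ⟨?_, ?_⟩, ?_, ?_⟩
    · by_contra hlt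
      push Not at hlt
      have hle : (k:ℝ) ≤ kb - 1 := by have : k ≤ kb - 1 := by omega
                                      exact_mod_cast this
      have : tw (-((kb - 1) * (1-1/q))) ≤ tw (-(k * (1-1/q))) := tw_mono (by nlinarith)
      exact absurd ((hb2.trans_le this).trans_le (hk1.trans r2)) (lt_irrefl _)
    · by_contra hlt
      push Not at hlt
      have hle : (ka:ℝ) ≤ k - 1 := by have : ka ≤ k - 1 := by omega
                                      exact_mod_cast this
      have : tw (-((k - 1) * (1-1/q))) ≤ tw (-(ka * (1-1/q))) := tw_mono (by nlinarith)
      exact absurd (hk2.trans_le (this.trans (ha1.trans r1))) (lt_irrefl _)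
    · show κ k * N s ≤ ‖G s x‖ₑ
      rwa [ENNReal.le_div_iff_mul_le (Or.inl hN0) (Or.inl (hNt s))] at hk1
    · show ‖G s x‖ₑ < κ (k-1) * N s
      have := (ENNReal.div_lt_iff (Or.inl hN0) (Or.inl (hNt s))).1 hk2
      simpa [hκ] using this
  obtain ⟨K, hK⟩ := hex
  set Gk : ℤ → ℝ → EuclideanSpace ℝ (Fin d) → ℂ := fun k s x => (A k).indicator (Function.uncurry G) (s, x) with hGk
  have hCs : ∀ k, Cs R B (Gk k) := fun k => hG.indicator (A k) (hAm k) hB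
  have hsum : ∀ s x, ∑ k ∈ K, Gk k s x = G s x := by
    intro s x
    by_cases h0 : G s x = 0
    · rw [h0]; apply Finset.sum_eq_zero; intro k _
      simp only [hGk, Set.indicator, Function.uncurry, h0, ite_self]
    · obtain ⟨k, hk, hk2⟩ := hK s x h0
      rw [Finset.sum_eq_single k]
      · simp only [hGk, Set.indicator_of_mem hk2, Function.uncurry]
      · intro l _ hlk
        simp only [hGk]
        apply Set.indicator_of_notMem
        intro hl
        rcases lt_or_gt_of_ne hlk with h | h
        · exact hdisj _ _ _ h hl hk2
        · exact hdisj _ _ _ h hk2 hl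
      · intro h; exact absurd hk h
  set e : ℤ → ℝ → ℝ≥0∞ := fun k s => tw (-k) * ∫⁻ x, (A k).indicator 1 (s, x) with he
  have hem : ∀ k, Measurable (e k) := fun k => by
    refine Measurable.const_mul ?_ _
    exact Measurable.lintegral_prod_right' (f := (A k).indicator 1) (measurable_one.indicator (hAm k))
  have hind : ∀ k s, Measurable fun x => (A k).indicator (1 : ℝ × EuclideanSpace ℝ (Fin d) → ℝ≥0∞) (s, x) := fun k s =>
    (measurable_one.indicator (hAm k)).comp measurable_prodMk_left
  have hesum : ∀ s, ∑ k ∈ K, e k s ≤ 1 := by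
    intro s
    have hpt : ∀ x, N s ^ (1/(1-1/q)) * ∑ k ∈ K, tw (-k) * (A k).indicator (1 : ℝ × EuclideanSpace ℝ (Fin d) → ℝ≥0∞) (s, x) ≤
        ‖G s x‖ₑ ^ (1/(1-1/q)) := by
      intro x
      by_cases hex : ∃ k ∈ K, (s, x) ∈ A k
      · obtain ⟨k, hk, hk2⟩ := hex
        rw [Finset.sum_eq_single k]
        · rw [Set.indicator_of_mem hk2, Pi.one_apply, mul_one]
          have h1 : tw (-k) = κ k ^ (1/(1-1/q)) := by
            rw [hκ]; simp only []; rw [tw_rpow]; congr 1; rw [neg_mul, mul_assoc, mul_one_div_cancel hq2.ne', mul_one]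
          rw [h1, ← ENNReal.mul_rpow_of_nonneg _ _ (by positivity), mul_comm]
          exact ENNReal.rpow_le_rpow hk2.1 (by positivity)
        · intro l _ hlk
          rw [Set.indicator_of_notMem, mul_zero]
          intro hl
          rcases lt_or_gt_of_ne hlk with h | h
          · exact hdisj _ _ _ h hl hk2
          · exact hdisj _ _ _ h hk2 hl
        · intro h; exact absurd hk h
      · push Not at hex
        rw [Finset.sum_eq_zero]
        · simp
        · intro k hk
          rw [Set.indicator_of_notMem (hex k hk), mul_zero]
    have e0 : ∑ k ∈ K, e k s = ∫⁻ x, ∑ k ∈ K, tw (-k) * (A k).indicator (1 : ℝ × EuclideanSpace ℝ (Fin d) → ℝ≥0∞) (s, x) := by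
      rw [lintegral_finsetSum' _ (fun k _ => ((hind k s).const_mul _).aemeasurable)]
      refine Finset.sum_congr rfl fun k _ => ?_
      rw [lintegral_const_mul _ (hind k s)]
    by_cases hN0 : N s = 0
    · rw [e0]
      have : ∀ x, ∑ k ∈ K, tw (-k) * (A k).indicator (1 : ℝ × EuclideanSpace ℝ (Fin d) → ℝ≥0∞) (s, x) = 0 := by
        intro x
        apply Finset.sum_eq_zero; intro k _
        rw [Set.indicator_of_notMem, mul_zero]
        intro h
        have := h.2
        simp [hN0] at this
      simp [this]
    · have hNq0 : N s ^ (1/(1-1/q)) ≠ 0 := by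
        rw [Ne, ENNReal.rpow_eq_zero_iff]; push Not
        exact ⟨fun h => absurd h hN0, fun h => absurd h (hNt s)⟩
      have hNqt : N s ^ (1/(1-1/q)) ≠ ∞ := ENNReal.rpow_ne_top_of_nonneg (by positivity) (hNt s)
      have h1 := (lintegral_mono hpt).trans (hGN s)
      rw [lintegral_const_mul' _ _ hNqt, ← e0] at h1
      rw [← ENNReal.mul_le_mul_iff_right hNq0 hNqt, mul_one]
      exact h1
  have he1 : ∀ k ∈ K, ∀ s, e k s ≤ 1 := fun k hk s => (Finset.single_le_sum (f := fun k => e k s) (fun _ _ => zero_le) hk).trans (hesum s)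
  have hvol : ∀ k s, ∫⁻ x, (A k).indicator (1 : ℝ × EuclideanSpace ℝ (Fin d) → ℝ≥0∞) (s, x) = tw k * e k s := by
    intro k s
    rw [he]; simp only []
    rw [← mul_assoc, ← tw_add]; simp [tw_zero]
  have hGkle : ∀ k s x, ‖Gk k s x‖ₑ ≤ (κ (k-1) * N s) * (A k).indicator (1 : ℝ × EuclideanSpace ℝ (Fin d) → ℝ≥0∞) (s, x) := by
    intro k s x
    by_cases hx : (s, x) ∈ A k
    · simpa [hGk, Set.indicator_of_mem hx, Function.uncurry] using hx.2.le
    · simp [hGk, Set.indicator_of_notMem hx]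
  have hL1 : ∀ k s, ∫⁻ x, ‖Gk k s x‖ₑ ≤ tw (1-1/q) * (tw (k/q) * (N s * e k s)) := by
    intro k s
    refine (lintegral_mono (hGkle k s)).trans ?_
    rw [lintegral_const_mul _ (hind k s), hvol]
    have : tw (1-1/q) * tw (k/q) = κ (k-1) * tw k := by
      rw [hκ]; simp only []; rw [← tw_add, ← tw_add]; congr 1; push_cast; ring
    rw [← mul_assoc (tw (1-1/q)), this]
    apply le_of_eq; ring
  have hL2' : ∀ k s, ∫⁻ x, ‖Gk k s x‖ₑ ^ 2 ≤ tw (2*(1-1/q)) * (tw (-(2*k*(1/2-1/q))) * (N s * e k s ^ (1/2:ℝ))^2) := by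
    intro k s
    have : ∀ x, ‖Gk k s x‖ₑ ^ 2 ≤ (κ (k-1) * N s)^2 * (A k).indicator (1 : ℝ × EuclideanSpace ℝ (Fin d) → ℝ≥0∞) (s, x) := by
      intro x
      by_cases hx : (s, x) ∈ A k
      · have := hGkle k s x
        simp only [Set.indicator_of_mem hx, Pi.one_apply, mul_one] at this ⊢; gcongr
      · simp [hGk, Set.indicator_of_notMem hx]
    refine (lintegral_mono this).trans ?_
    rw [lintegral_const_mul _ (hind k s), hvol]
    have h2 : tw (2*(1-1/q)) * tw (-(2*k*(1/2-1/q))) = κ (k-1) ^ 2 * tw k := by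
      rw [hκ]; simp only []; rw [pow_two, ← tw_add, ← tw_add, ← tw_add]; congr 1; push_cast; ring
    have h3 : (e k s ^ (1/2:ℝ))^2 = e k s := by
      rw [← ENNReal.rpow_natCast, ← ENNReal.rpow_mul]; norm_num
    rw [← mul_assoc (tw (2*(1-1/q))), h2, mul_pow, mul_pow, h3]
    apply le_of_eq; ring
  have hhalf : ∀ k ∈ K, ∀ s, e k s ≤ e k s ^ (1/2:ℝ) := by
    intro k hk s
    conv_lhs => rw [← ENNReal.rpow_one (e k s)]
    exact ENNReal.rpow_le_rpow_of_exponent_ge (he1 k hk s) (by norm_num)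
  have hcE : ∀ k s ξ, ‖(c:ℂ) * al (Gk k) s ξ‖ₑ = ENNReal.ofReal c * ‖al (Gk k) s ξ‖ₑ := by
    intro k s ξ
    rw [enorm_mul, ← ofReal_norm (c:ℂ), Complex.norm_real, Real.norm_of_nonneg hc.le]
  have main := habs R _ (((mK_cont (d := d)).measurable.mul_const _).const_mul c) (by
      simp only [mul_pow]; exact (mK2_int.mul_const _).const_mul _) K (fun k s ξ => (c:ℂ) * al (Gk k) s ξ) (fun k => (hCs k).dom.smul c hc.le)
    N hN e hem hesum hN1 ?_ ?_
  · have e2 : ∀ ξ, ‖∫ s, ∑ k ∈ K, (c:ℂ) * al (Gk k) s ξ‖ₑ ^ 2 = ENNReal.ofReal c ^ 2 * ‖∫ s, al G s ξ‖ₑ ^ 2 := by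
      intro ξ
      have : ∀ s, ∑ k ∈ K, (c:ℂ) * al (Gk k) s ξ = (c:ℂ) * al G s ξ := by
        intro s
        rw [← Finset.mul_sum]; congr 1
        unfold al
        rw [← Finset.mul_sum]; congr 1
        have : G s = fun x => ∑ k ∈ K, Gk k s x := by funext x; rw [hsum]
        rw [this, Real.fourier_eq]
        simp_rw [Real.fourier_eq]
        rw [← integral_finsetSum]
        · simp_rw [Finset.smul_sum]
        · intro k _
          exact (Real.fourierIntegral_convergent_iff ξ).2 ((hCs k).int s)
      simp_rw [this]
      rw [integral_const_mul, enorm_mul, mul_pow, ← ofReal_norm (c:ℂ), Complex.norm_real, Real.norm_of_nonneg hc.le]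
    simp_rw [e2] at main
    rw [lintegral_const_mul' _ _ (by finiteness)] at main
    rw [mul_comm, ← div_eq_mul_inv]
    rw [ENNReal.le_div_iff_mul_le (Or.inl (by simpa using hc)) (Or.inl (by finiteness)), mul_comm]
    exact main
  · intro k hk l hl s t hst
    have e3 : ip volume (fun ξ => (c:ℂ) * al (Gk k) s ξ) (fun ξ => (c:ℂ) * al (Gk l) t ξ) =
       ((c^2:ℝ):ℂ) * ip volume (al (Gk k) s) (al (Gk l) t) := by
      unfold ip
      rw [← integral_const_mul]
      apply integral_congr_ae; filter_upwards with ξ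
      rw [map_mul, Complex.conj_ofReal]; push_cast; ring
    rw [e3, enorm_mul, ← ofReal_norm (((c^2:ℝ)):ℂ), Complex.norm_real, Real.norm_of_nonneg (sq_nonneg c), ENNReal.ofReal_pow hc.le]
    have h4 := al_ip (hCs k) (hCs l) s t _ (hker s t hst)
    set Z := ENNReal.ofReal |t - s| ^ (-(2 / p / (1 - 2 / q)))
    have htw : tw (1-1/q) * tw (1-1/q) = tw (2 * (1-1/q)) := by rw [← tw_add]; congr 1; ring
    have htw2 : tw (k/q) * tw (l/q) = tw ((k+l)/q) := by rw [← tw_add]; congr 1; ring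
    calc ENNReal.ofReal c ^ 2 * ‖ip volume (al (Gk k) s) (al (Gk l) t)‖ₑ
        ≤ ENNReal.ofReal c ^ 2 * (ENNReal.ofReal C2 * Z * ((tw (1-1/q) * (tw (k/q) * (N s * e k s ^ (1/2:ℝ)))) *
            (tw (1-1/q) * (tw (l/q) * (N t * e l t ^ (1/2:ℝ)))))) := by
          refine mul_le_mul_right (h4.trans (mul_le_mul_right (mul_le_mul' ?_ ?_) _)) _
          · refine (hL1 k s).trans ?_
            exact mul_le_mul_right (mul_le_mul_right (mul_le_mul_right (hhalf k hk s) _) _) _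
          · refine (hL1 l t).trans ?_
            exact mul_le_mul_right (mul_le_mul_right (mul_le_mul_right (hhalf l hl t) _) _) _
      _ = (ENNReal.ofReal c ^ 2 * (tw (2 * (1-1/q)) * ENNReal.ofReal C2)) * (Z * tw ((k+l)/q) * (N s * N t * (e k s ^ (1/2:ℝ) * e l t ^ (1/2:ℝ)))) := by
          rw [← htw, ← htw2]; ring
      _ ≤ 1 * _ := by
          refine mul_le_mul_left (le_trans ?_ hcL) _
          exact mul_le_mul_right (mul_le_mul_right le_add_self _) _
      _ = _ := one_mul _
  · intro k hk s
    simp_rw [hcE, mul_pow]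
    rw [lintegral_const_mul' _ _ (by finiteness)]
    calc ENNReal.ofReal c ^ 2 * ∫⁻ ξ, ‖al (Gk k) s ξ‖ₑ ^ 2
       ≤ ENNReal.ofReal c ^ 2 * (C1 * (tw (2*(1-1/q)) * (tw (-(2*k*(1/2-1/q))) * (N s * e k s ^ (1/2:ℝ))^2))) :=
        mul_le_mul_right ((hL2 R B _ (hCs k) s).trans (mul_le_mul_right (hL2' k s) _)) _
      _ = (ENNReal.ofReal c ^ 2 * (tw (2*(1-1/q)) * C1)) * (tw (-(2*k*(1/2-1/q))) * (N s * e k s ^ (1/2:ℝ))^2) := by ring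
      _ ≤ 1 * _ := by
          refine mul_le_mul_left (le_trans ?_ hcL) _
          exact mul_le_mul_right (mul_le_mul_right le_self_add _) _
      _ = _ := by rw [one_mul, mul_pow]
end Strich

set_option linter.unusedVariables false
set_option linter.unusedSectionVars false
namespace Strich

variable {d : ℕ}

noncomputable def Wf (ψ : EuclideanSpace ℝ (Fin d) → ℂ) (t : ℝ) : EuclideanSpace ℝ (Fin d) → ℂ :=
  Ef (fun ξ => phase t ξ * ((mK d ξ : ℂ) * ψ ξ))

lemma mKpsi_int (ψ : EuclideanSpace ℝ (Fin d) → ℂ) (hψ : Measurable ψ) (h2 : ∫⁻ ξ, ‖ψ ξ‖ₑ ^ 2 ≠ ∞) :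
    Integrable (fun ξ => (mK d ξ : ℂ) * ψ ξ) := by
  have m1 : MemLp (fun ξ => (mK d ξ : ℂ)) 2 := by
    rw [memLp_two_iff_integrable_sq_norm]
    · refine mK2_int.congr (Filter.Eventually.of_forall fun ξ => ?_)
      simp only [Complex.norm_real, Real.norm_eq_abs, sq_abs]
    · exact (Complex.continuous_ofReal.comp mK_cont).aestronglyMeasurable
  have m2 : MemLp ψ 2 := by
    refine ⟨hψ.aestronglyMeasurable, ?_⟩
    rw [eLpNorm_lt_top_iff_lintegral_rpow_enorm_lt_top (by norm_num) (by norm_num)]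
    simpa using h2.lt_top
  exact m1.integrable_mul m2

lemma W_meas (ψ : EuclideanSpace ℝ (Fin d) → ℂ) (hψ : Measurable ψ) : Measurable (Function.uncurry (Wf ψ)) := by
  unfold Wf Ef
  refine (StronglyMeasurable.integral_prod_right' (f := fun w : (ℝ × EuclideanSpace ℝ (Fin d)) × EuclideanSpace ℝ (Fin d) =>
    cexp (2 * π * I * ((⟪w.1.2, w.2⟫ : ℝ) : ℂ)) * (phase w.1.1 w.2 * ((mK d w.2 : ℂ) * ψ w.2))) ?_).measurable
  refine Measurable.stronglyMeasurable (Measurable.mul ?_ (Measurable.mul ?_ (Measurable.mul ?_ ?_)))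
  · exact Continuous.measurable (by fun_prop)
  · exact (phase_cont.comp (by fun_prop : Continuous fun w : (ℝ × EuclideanSpace ℝ (Fin d)) × EuclideanSpace ℝ (Fin d) => (w.1.1, w.2))).measurable
  · have := mK_cont (d := d)
    exact Continuous.measurable (by fun_prop)
  · exact hψ.comp measurable_snd

lemma W_le (ψ : EuclideanSpace ℝ (Fin d) → ℂ) (t x) : ‖Wf ψ t x‖ₑ ≤ ∫⁻ ξ, ‖(mK d ξ : ℂ) * ψ ξ‖ₑ := by
  refine (Ef_le _ x).trans (le_of_eq ?_)
  refine lintegral_congr fun ξ => ?_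
  rw [enorm_mul, ← ofReal_norm (phase _ _), norm_phase]; simp

lemma Cs.int_prod {R B : ℝ} {G : ℝ → EuclideanSpace ℝ (Fin d) → ℂ} (h : Cs R B G) :
    Integrable (Function.uncurry G) (volume.prod volume) := by
  have h1 : Integrable ((Set.Icc (-R) R).indicator (fun _ => (1:ℝ))) :=
    (integrableOn_const (by simp)).integrable_indicator measurableSet_Icc
  refine (h1.mul_prod (ball_int (d := d) R B)).mono' h.meas.aestronglyMeasurable (Filter.Eventually.of_forall fun z => ?_)
  by_cases hs : z.1 ∈ Set.Icc (-R) R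
  · rw [Set.indicator_of_mem hs, one_mul]; exact h.le' _ _
  · simp [Set.indicator_of_notMem hs, Function.uncurry, h.supt _ z.2 hs]

lemma pairing {R B : ℝ} {G : ℝ → EuclideanSpace ℝ (Fin d) → ℂ} (h : Cs R B G)
    (ψ : EuclideanSpace ℝ (Fin d) → ℂ) (hψ : Measurable ψ) (h2 : ∫⁻ ξ, ‖ψ ξ‖ₑ ^ 2 ≠ ∞) :
    ‖∫ z, Wf ψ z.1 z.2 * (starRingEnd ℂ) (G z.1 z.2) ∂(volume.prod volume)‖ₑ ≤
      (∫⁻ ξ, ‖ψ ξ‖ₑ ^ 2) ^ (1/2:ℝ) * (∫⁻ ξ, ‖∫ s, al G s ξ‖ₑ ^ 2) ^ (1/2:ℝ) := by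
  set kk : ℝ × EuclideanSpace ℝ (Fin d) → EuclideanSpace ℝ (Fin d) → ℂ := fun z ξ =>
    (cexp (2 * π * I * ((⟪z.2, ξ⟫ : ℝ) : ℂ)) * (phase z.1 ξ * ((mK d ξ : ℂ) * ψ ξ))) * (starRingEnd ℂ) (G z.1 z.2) with hkk
  have e1 : ∀ z : ℝ × EuclideanSpace ℝ (Fin d), Wf ψ z.1 z.2 * (starRingEnd ℂ) (G z.1 z.2) = ∫ ξ, kk z ξ := by
    intro z
    rw [hkk]; simp only []; rw [integral_mul_const]; rfl
  simp_rw [e1]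
  have hInt : Integrable (Function.uncurry kk) ((volume.prod volume).prod volume) := by
    have := (h.int_prod.norm).mul_prod (mKpsi_int ψ hψ h2).norm
    refine this.mono' ?_ (Filter.Eventually.of_forall fun w => ?_)
    · refine Measurable.aestronglyMeasurable ?_
      refine Measurable.mul (Measurable.mul ?_ (Measurable.mul ?_ (Measurable.mul ?_ ?_))) ?_
      · exact Continuous.measurable (by fun_prop)
      · exact (phase_cont.comp (by fun_prop : Continuous fun w : (ℝ × EuclideanSpace ℝ (Fin d)) × EuclideanSpace ℝ (Fin d) => (w.1.1, w.2))).measurable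
      · have := mK_cont (d := d)
        exact Continuous.measurable (by fun_prop)
      · exact hψ.comp measurable_snd
      · exact Complex.continuous_conj.measurable.comp (h.meas.comp measurable_fst)
    · apply le_of_eq
      simp only [Function.uncurry, hkk, norm_mul, RCLike.norm_conj, norm_phase, norm_e2]
      ring
  rw [integral_integral_swap hInt]
  have e2 : ∀ ξ, ∫ z, kk z ξ ∂(volume.prod volume) = ψ ξ * (starRingEnd ℂ) (∫ s, al G s ξ) := by
    intro ξ
    have hcz : Integrable (fun z : ℝ × EuclideanSpace ℝ (Fin d) => cexp (((-2 * π * ⟪z.2, ξ⟫ : ℝ) : ℂ) * I) * phase (-z.1) ξ * G z.1 z.2) (volume.prod volume) := by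
      refine h.int_prod.norm.mono' (Measurable.aestronglyMeasurable (Measurable.mul (Measurable.mul ?_ ?_) h.meas)) (Filter.Eventually.of_forall fun z => ?_)
      · exact Continuous.measurable (by fun_prop)
      · exact (phase_cont.comp (by fun_prop : Continuous fun w : ℝ × EuclideanSpace ℝ (Fin d) => (-w.1, ξ))).measurable
      · rw [norm_mul, norm_mul, norm_phase, Complex.norm_exp_ofReal_mul_I]; simp [Function.uncurry]
    have a1 : ∫ s, al G s ξ = (mK d ξ : ℂ) * ∫ z, cexp (((-2 * π * ⟪z.2, ξ⟫ : ℝ) : ℂ) * I) * phase (-z.1) ξ * G z.1 z.2 ∂(volume.prod volume) := by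
      rw [integral_prod _ hcz, ← integral_const_mul]
      apply integral_congr_ae; filter_upwards with s
      unfold al
      rw [Real.fourier_eq', mul_assoc, ← integral_const_mul]
      congr 1
      apply integral_congr_ae; filter_upwards with x
      simp only [smul_eq_mul]; ring
    rw [a1, map_mul, ← integral_conj, ← mul_assoc, ← integral_const_mul]
    apply integral_congr_ae; filter_upwards with z
    rw [hkk]
    simp only [map_mul, phase_conj, neg_neg, Complex.conj_ofReal]
    rw [← Complex.exp_conj, map_mul, Complex.conj_I, Complex.conj_ofReal]
    rw [show ((-2 * π * ⟪z.2, ξ⟫ : ℝ) : ℂ) * -I = 2 * π * I * ((⟪z.2, ξ⟫ : ℝ) : ℂ) by push_cast; ring]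
    ring
  simp_rw [e2]
  exact ip_cs hψ (h.dom.meas_int)

end Strich

set_option linter.unusedVariables false
set_option linter.unusedSectionVars false
namespace Strich

variable {d : ℕ}

lemma rpow_between (a b x : ℝ≥0∞) (r : ℝ) (h1 : a ≤ x) (h2 : x ≤ b) : x ^ r ≤ a ^ r + b ^ r := by
  rcases le_total 0 r with h | h
  · exact (ENNReal.rpow_le_rpow h2 h).trans le_add_self
  · refine le_trans ?_ le_self_add
    rw [← neg_neg r, ENNReal.rpow_neg, ENNReal.rpow_neg a]
    exact ENNReal.inv_le_inv.2 (ENNReal.rpow_le_rpow h1 (by linarith))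

lemma rpow_nt {x : ℝ≥0∞} (r : ℝ) (h0 : x ≠ 0) (h1 : x ≠ ∞) : x ^ r ≠ ∞ := by
  rw [Ne, ENNReal.rpow_eq_top_iff]; push Not
  exact ⟨fun h => absurd h h0, fun h => absurd h h1⟩

lemma rpow_nz {x : ℝ≥0∞} (r : ℝ) (h0 : x ≠ 0) (h1 : x ≠ ∞) : x ^ r ≠ 0 := by
  rw [Ne, ENNReal.rpow_eq_zero_iff]; push Not
  exact ⟨fun h => absurd h h0, fun h => absurd h h1⟩

lemma dual_step (hd : 1 ≤ d) (p q : ℝ) (hp : 2 ≤ p) (hq : 2 < q) (hpq : (2/p)/(1-2/q) ≤ (d:ℝ)/2) :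
    ∃ C : ℝ≥0∞, C ≠ ∞ ∧ ∀ (ψ : EuclideanSpace ℝ (Fin d) → ℂ) (hψ : Measurable ψ) (h2 : ∫⁻ ξ, ‖ψ ξ‖ₑ ^ 2 ≠ ∞)
      (R ε : ℝ) (hε : 0 < ε) (S : Set (ℝ × EuclideanSpace ℝ (Fin d))) (hS : MeasurableSet S)
      (m : ℝ → ℝ≥0∞) (hm : ∀ t, m t = ∫⁻ x, S.indicator (fun z => ‖Wf ψ z.1 z.2‖ₑ ^ q) (t, x))
      (hSp : ∀ z ∈ S, z.1 ∈ Set.Icc (-R) R ∧ z.2 ∈ Metric.closedBall (0 : EuclideanSpace ℝ (Fin d)) R ∧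
        ENNReal.ofReal ε ≤ ‖Wf ψ z.1 z.2‖ₑ ∧ ENNReal.ofReal ε ≤ m z.1),
      (∫⁻ t, m t ^ (p/q)) ^ (1/p) ≤ C * (∫⁻ ξ, ‖ψ ξ‖ₑ ^ 2) ^ (1/2:ℝ) := by
  obtain ⟨C, hC, hdual⟩ := dual_bound hd p q hp hq hpq
  refine ⟨C ^ (1/2:ℝ), ENNReal.rpow_ne_top_of_nonneg (by norm_num) hC, ?_⟩
  intro ψ hψ h2 R ε hε S hS m hm hSp
  have hq0 : 0 < q := by linarith
  have hp0 : 0 < p := by linarith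
  have hp1 : 0 < 1 - 1/p := by
    rw [sub_pos, div_lt_one hp0]; linarith
  have hq1 : 0 < 1 - 1/q := by
    rw [sub_pos, div_lt_one hq0]; linarith
  set V := Wf ψ with hV
  have hVm : Measurable fun z : ℝ × EuclideanSpace ℝ (Fin d) => V z.1 z.2 := W_meas ψ hψ
  set B : ℝ≥0∞ := ∫⁻ ξ, ‖(mK d ξ : ℂ) * ψ ξ‖ₑ with hB
  have hBt : B ≠ ∞ := (mKpsi_int ψ hψ h2).2.ne
  have hVB : ∀ t x, ‖V t x‖ₑ ≤ B := W_le ψ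
  have hfm : Measurable (S.indicator (fun z => ‖V z.1 z.2‖ₑ ^ q)) := (hVm.enorm.pow_const q).indicator hS
  have hfs : ∀ t, Measurable fun x => S.indicator (fun z => ‖V z.1 z.2‖ₑ ^ q) (t, x) := fun t => hfm.comp measurable_prodMk_left
  have hmm : Measurable m := by
    have : m = fun t => ∫⁻ x, S.indicator (fun z => ‖V z.1 z.2‖ₑ ^ q) (t, x) := funext hm
    rw [this]; exact Measurable.lintegral_prod_right' hfm
  set M : ℝ≥0∞ := B ^ q * volume (Metric.closedBall (0 : EuclideanSpace ℝ (Fin d)) R) + 1 with hM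
  have hMt : M ≠ ∞ := by
    refine ENNReal.add_ne_top.2 ⟨ENNReal.mul_ne_top (ENNReal.rpow_ne_top_of_nonneg hq0.le hBt) measure_closedBall_lt_top.ne, by simp⟩
  have hM0 : M ≠ 0 := by rw [hM]; simp
  have hmM : ∀ t, m t ≤ M := by
    intro t
    rw [hm]
    refine le_trans (lintegral_mono (g := (Metric.closedBall (0 : EuclideanSpace ℝ (Fin d)) R).indicator (fun _ => B^q)) fun x => ?_) ?_
    · by_cases hx : (t, x) ∈ S
      · rw [Set.indicator_of_mem hx, Set.indicator_of_mem (hSp _ hx).2.1]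
        exact ENNReal.rpow_le_rpow (hVB t x) hq0.le
      · rw [Set.indicator_of_notMem hx]; exact zero_le
    · rw [lintegral_indicator_const Metric.isClosed_closedBall.measurableSet]; exact le_self_add
  have hm0 : ∀ t, t ∉ Set.Icc (-R) R → m t = 0 := by
    intro t ht
    rw [hm]
    have : ∀ x, S.indicator (fun z => ‖V z.1 z.2‖ₑ ^ q) (t, x) = 0 := fun x =>
      Set.indicator_of_notMem (fun h => ht (hSp _ h).1) _
    simp [this]
  set Q := ∫⁻ t, m t ^ (p/q) with hQ
  have hQt : Q ≠ ∞ := by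
    refine ne_top_of_le_ne_top ?_ (lintegral_mono (g := (Set.Icc (-R) R).indicator (fun _ => M^(p/q))) fun t => ?_)
    · rw [lintegral_indicator_const measurableSet_Icc]
      exact ENNReal.mul_ne_top (ENNReal.rpow_ne_top_of_nonneg (by positivity) hMt) (by simp)
    · by_cases ht : t ∈ Set.Icc (-R) R
      · rw [Set.indicator_of_mem ht]; exact ENNReal.rpow_le_rpow (hmM t) (by positivity)
      · rw [hm0 t ht, ENNReal.zero_rpow_of_pos (by positivity)]; exact zero_le
  by_cases hQ0 : Q = 0
  · rw [hQ0, ENNReal.zero_rpow_of_pos (by positivity)]; exact zero_le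
  set Qi : ℝ≥0∞ := Q ^ (-(1-1/p)) with hQi
  have hQit : Qi ≠ ∞ := rpow_nt _ hQ0 hQt
  have hQi0 : Qi ≠ 0 := rpow_nz _ hQ0 hQt
  set w : ℝ → ℝ≥0∞ := fun t => m t ^ ((p-q)/q) * Qi with hw
  have hmt : ∀ t, m t ≠ ∞ := fun t => ne_top_of_le_ne_top hMt (hmM t)
  have hwt : ∀ t, m t ≠ 0 → w t ≠ ∞ := fun t ht => ENNReal.mul_ne_top (rpow_nt _ ht (hmt t)) hQit
  have hwm : Measurable w := (hmm.pow_const _).mul_const _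
  have hSm : ∀ z ∈ S, m z.1 ≠ 0 := by
    intro z hz h0
    have := (hSp z hz).2.2.2
    rw [h0] at this
    simp at this; linarith
  set N : ℝ → ℝ≥0∞ := fun t => m t ^ ((p-1)/q) * Qi with hNdef
  have hNw : ∀ t, m t ≠ 0 → N t = m t ^ ((q-1)/q) * w t := by
    intro t ht
    rw [hNdef, hw]; simp only []
    rw [← mul_assoc, ← ENNReal.rpow_add _ _ ht (hmt t)]
    congr 2; ring
  set G : ℝ → EuclideanSpace ℝ (Fin d) → ℂ := fun t x => S.indicator (fun z => ((‖V z.1 z.2‖ ^ (q-2) * (w z.1).toReal : ℝ) : ℂ) * V z.1 z.2) (t, x) with hG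
  have hε0 : ENNReal.ofReal ε ≠ 0 := by simpa using hε
  have hVn0 : ∀ z ∈ S, ‖V z.1 z.2‖ₑ ≠ 0 := by
    intro z hz h0
    have := (hSp z hz).2.2.1
    rw [h0] at this
    exact hε0 (le_antisymm this zero_le)
  have hr : ∀ (z : ℂ) (r : ℝ), ‖z‖ₑ ≠ 0 → ENNReal.ofReal (‖z‖ ^ r) = ‖z‖ₑ ^ r := by
    intro z r hz
    rw [← ofReal_norm, ENNReal.ofReal_rpow_of_pos]
    exact norm_pos_iff.2 (by simpa using hz)
  have hGe : ∀ t x, (t, x) ∈ S → ‖G t x‖ₑ = ‖V t x‖ₑ ^ (q-1) * w t := by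
    intro t x hz
    rw [hG]; simp only []
    rw [Set.indicator_of_mem hz]; simp only []
    rw [enorm_mul, ← ofReal_norm (Complex.ofReal _), Complex.norm_real, Real.norm_of_nonneg (by positivity),
      ENNReal.ofReal_mul (by positivity), hr _ _ (hVn0 _ hz), ENNReal.ofReal_toReal (hwt t (hSm _ hz)), mul_right_comm]
    congr 1
    conv_lhs => rw [← ENNReal.rpow_one ‖V t x‖ₑ, ← ENNReal.rpow_mul, one_mul, ← ENNReal.rpow_add _ _ (hVn0 _ hz) enorm_ne_top]
    congr 1; ring
  have hG0 : ∀ t x, (t, x) ∉ S → G t x = 0 := by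
    intro t x hz
    rw [hG]; simp only []
    exact Set.indicator_of_notMem hz _
  have hGm : Measurable (Function.uncurry G) := by
    have : Function.uncurry G = S.indicator (fun z => ((‖V z.1 z.2‖ ^ (q-2) * (w z.1).toReal : ℝ) : ℂ) * V z.1 z.2) := by
      funext z; rfl
    rw [this]
    refine Measurable.indicator (Measurable.mul ?_ hVm) hS
    refine Complex.measurable_ofReal.comp ?_
    exact (hVm.norm.pow_const _).mul ((hwm.comp measurable_fst).ennreal_toReal)
  set B' : ℝ≥0∞ := B ^ (q-1) * ((ENNReal.ofReal ε ^ ((p-q)/q) + M ^ ((p-q)/q)) * Qi) with hB'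
  have hB't : B' ≠ ∞ := by
    refine ENNReal.mul_ne_top (ENNReal.rpow_ne_top_of_nonneg (by linarith) hBt) (ENNReal.mul_ne_top (ENNReal.add_ne_top.2 ⟨?_, ?_⟩) hQit)
    · exact rpow_nt _ hε0 ENNReal.ofReal_ne_top
    · exact rpow_nt _ hM0 hMt
  have hCs : Cs R B'.toReal G := by
    refine ⟨hGm, ?_, ?_, ?_⟩
    · intro t x
      have : ‖G t x‖ₑ ≤ B' := by
        by_cases hz : (t, x) ∈ S
        · rw [hGe t x hz]
          refine mul_le_mul' (ENNReal.rpow_le_rpow (hVB t x) (by linarith)) (mul_le_mul_left ?_ _)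
          exact rpow_between _ _ _ _ (hSp _ hz).2.2.2 (hmM t)
        · rw [hG0 t x hz]; simp
      have := ENNReal.toReal_mono hB't this
      rwa [toReal_enorm] at this
    · intro t x ht
      exact hG0 t x fun h => ht (hSp _ h).1
    · intro t x ht
      exact hG0 t x fun h => ht (hSp _ h).2.1
  have hNt : ∀ t, N t ≠ ∞ := fun t => ENNReal.mul_ne_top (ENNReal.rpow_ne_top_of_nonneg (div_nonneg (by linarith) hq0.le) (hmt t)) hQit
  have hGn : ∀ t x, G t x ≠ 0 → (t, x) ∈ S := fun t x h => by
    by_contra h'; exact h (hG0 t x h')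
  set a : ℝ≥0∞ := ENNReal.ofReal ε ^ (q-1) / M ^ ((q-1)/q) with ha
  have hM1t : M ^ ((q-1)/q) ≠ ∞ := rpow_nt _ hM0 hMt
  have hM10 : M ^ ((q-1)/q) ≠ 0 := rpow_nz _ hM0 hMt
  have hε1t : ENNReal.ofReal ε ^ ((q-1)/q) ≠ ∞ := rpow_nt _ hε0 ENNReal.ofReal_ne_top
  have hε10 : ENNReal.ofReal ε ^ ((q-1)/q) ≠ 0 := rpow_nz _ hε0 ENNReal.ofReal_ne_top
  have hat : a ≠ ∞ := ENNReal.div_ne_top (rpow_nt _ hε0 ENNReal.ofReal_ne_top) hM10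
  have ha0 : a ≠ 0 := ENNReal.div_ne_zero.2 ⟨rpow_nz _ hε0 ENNReal.ofReal_ne_top, hM1t⟩
  set b : ℝ≥0∞ := B ^ (q-1) / ENNReal.ofReal ε ^ ((q-1)/q) with hb
  have hbt : b ≠ ∞ := ENNReal.div_ne_top (ENNReal.rpow_ne_top_of_nonneg (by linarith) hBt) hε10
  have hqq : 0 ≤ (q-1)/q := div_nonneg (by linarith) hq0.le
  have main := hdual R B'.toReal a.toReal b.toReal ENNReal.toReal_nonneg (ENNReal.toReal_pos ha0 hat) G hCs N
    ((hmm.pow_const _).mul_const _) hNt ?_ ?_ ?_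
  · have hpair := pairing hCs ψ hψ h2
    have hVG : ∀ z : ℝ × EuclideanSpace ℝ (Fin d), V z.1 z.2 * (starRingEnd ℂ) (G z.1 z.2) = ((‖V z.1 z.2‖ * ‖G z.1 z.2‖ : ℝ) : ℂ) := by
      intro z
      by_cases hz : z ∈ S
      · rw [hG]; simp only []
        rw [Set.indicator_of_mem (show (z.1, z.2) ∈ S from hz)]; simp only []
        rw [map_mul, Complex.conj_ofReal, norm_mul, Complex.norm_real, Real.norm_of_nonneg (by positivity), mul_left_comm, Complex.mul_conj,
          Complex.normSq_eq_norm_sq]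
        push_cast; ring
      · rw [hG0 _ _ (show (z.1, z.2) ∉ S from hz)]; simp
    rw [← hV] at hpair
    simp_rw [hVG] at hpair
    have hInt : Integrable (fun z : ℝ × EuclideanSpace ℝ (Fin d) => ‖V z.1 z.2‖ * ‖G z.1 z.2‖) (volume.prod volume) := by
      refine (hCs.int_prod.norm.const_mul B.toReal).mono' (hVm.norm.mul hGm.norm).aestronglyMeasurable (Filter.Eventually.of_forall fun z => ?_)
      rw [Real.norm_of_nonneg (by positivity)]
      refine mul_le_mul_of_nonneg_right ?_ (norm_nonneg _)
      have := ENNReal.toReal_mono hBt (hVB z.1 z.2)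
      rwa [toReal_enorm] at this
    rw [integral_complex_ofReal, ← ofReal_norm (Complex.ofReal _), Complex.norm_real, Real.norm_of_nonneg (integral_nonneg fun z => by positivity),
      ofReal_integral_eq_lintegral_ofReal hInt (Filter.Eventually.of_forall fun z => by positivity)] at hpair
    have e1 : ∫⁻ z, ENNReal.ofReal (‖V z.1 z.2‖ * ‖G z.1 z.2‖) ∂(volume.prod volume) = Q ^ (1/p) := by
      have e2 : ∀ z : ℝ × EuclideanSpace ℝ (Fin d), ENNReal.ofReal (‖V z.1 z.2‖ * ‖G z.1 z.2‖) = w z.1 * S.indicator (fun z => ‖V z.1 z.2‖ₑ ^ q) z := by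
        intro z
        rw [ENNReal.ofReal_mul (norm_nonneg _), ofReal_norm, ofReal_norm]
        by_cases hz : z ∈ S
        · rw [Set.indicator_of_mem hz, hGe _ _ (show (z.1, z.2) ∈ S from hz), ← mul_assoc, mul_comm (w z.1)]
          congr 1
          conv_lhs => rw [← ENNReal.rpow_one ‖V z.1 z.2‖ₑ, ← ENNReal.rpow_mul, one_mul, ← ENNReal.rpow_add _ _ (hVn0 _ hz) enorm_ne_top]
          congr 1; ring
        · rw [Set.indicator_of_notMem hz, hG0 _ _ (show (z.1, z.2) ∉ S from hz)]; simp
      simp_rw [e2]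
      rw [lintegral_prod (fun z => w z.1 * S.indicator (fun z => ‖V z.1 z.2‖ₑ ^ q) z) ((hwm.comp measurable_fst).mul hfm).aemeasurable]
      have e3 : ∀ t, ∫⁻ x, w t * S.indicator (fun z => ‖V z.1 z.2‖ₑ ^ q) (t, x) = m t ^ (p/q) * Qi := by
        intro t
        rw [lintegral_const_mul _ (hfs t), ← hm]
        by_cases h0 : m t = 0
        · rw [h0, mul_zero, ENNReal.zero_rpow_of_pos (by positivity), zero_mul]
        · rw [hw]; simp only []
          rw [mul_right_comm]; congr 1
          conv_lhs => rw [← ENNReal.rpow_one (m t), ← ENNReal.rpow_mul, one_mul, ← ENNReal.rpow_add _ _ h0 (hmt t)]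
          congr 1; field_simp; ring
      simp only [Function.comp]
      simp_rw [e3]
      rw [lintegral_mul_const' _ _ hQit, ← hQ, hQi]
      conv_lhs => rw [← ENNReal.rpow_one Q, ← ENNReal.rpow_mul, one_mul, ← ENNReal.rpow_add _ _ hQ0 hQt]
      congr 1; ring
    rw [e1] at hpair
    refine hpair.trans ?_
    rw [mul_comm]
    exact mul_le_mul_left (ENNReal.rpow_le_rpow main (by norm_num)) _
  · intro t x hx
    have hz := hGn t x hx
    rw [ENNReal.ofReal_toReal hat, ENNReal.ofReal_toReal hbt, hGe t x hz, hNw t (hSm _ hz)]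
    constructor
    · rw [mul_right_comm]
      refine mul_le_mul_left ?_ _
      calc m t ^ ((q-1)/q) * a ≤ M ^ ((q-1)/q) * a := mul_le_mul_left (ENNReal.rpow_le_rpow (hmM t) hqq) _
        _ = ENNReal.ofReal ε ^ (q-1) := by rw [ha]; exact ENNReal.mul_div_cancel hM10 hM1t
        _ ≤ _ := ENNReal.rpow_le_rpow (hSp _ hz).2.2.1 (by linarith)
    · rw [mul_right_comm]
      refine mul_le_mul_left ?_ _
      calc ‖V t x‖ₑ ^ (q-1) ≤ B ^ (q-1) := ENNReal.rpow_le_rpow (hVB t x) (by linarith)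
        _ = ENNReal.ofReal ε ^ ((q-1)/q) * b := by rw [hb]; exact (ENNReal.mul_div_cancel hε10 hε1t).symm
        _ ≤ _ := mul_le_mul_left (ENNReal.rpow_le_rpow (hSp _ hz).2.2.2 hqq) _
  · have : ∀ t, N t ^ (1/(1-1/p)) = m t ^ (p/q) * Q⁻¹ := by
      intro t
      rw [hNdef]; simp only []
      rw [ENNReal.mul_rpow_of_nonneg _ _ (by positivity), ← ENNReal.rpow_mul, hQi, ← ENNReal.rpow_mul]
      congr 1
      · congr 1
        have : p - 1 ≠ 0 := by linarith
        field_simp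
      · rw [← ENNReal.rpow_neg_one]; congr 1
        rw [neg_mul, mul_one_div_cancel hp1.ne']
    simp_rw [this]
    rw [lintegral_mul_const' _ _ (ENNReal.inv_ne_top.2 hQ0), ← hQ, ENNReal.mul_inv_cancel hQ0 hQt]
  · intro t
    by_cases h0 : m t = 0
    · have : ∀ x, G t x = 0 := fun x => hG0 t x fun h => hSm _ h h0
      simp only [this, enorm_zero]
      rw [ENNReal.zero_rpow_of_pos (by positivity)]; simp
    · have : ∀ x, ‖G t x‖ₑ ^ (1/(1-1/q)) = S.indicator (fun z => ‖V z.1 z.2‖ₑ ^ q) (t, x) * w t ^ (1/(1-1/q)) := by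
        intro x
        by_cases hz : (t, x) ∈ S
        · rw [Set.indicator_of_mem hz, hGe t x hz, ENNReal.mul_rpow_of_nonneg _ _ (by positivity), ← ENNReal.rpow_mul]
          congr 2
          have : q - 1 ≠ 0 := by linarith
          field_simp
        · rw [Set.indicator_of_notMem hz, hG0 t x hz, enorm_zero, ENNReal.zero_rpow_of_pos (by positivity), zero_mul]
      simp_rw [this]
      rw [lintegral_mul_const _ (hfs t), ← hm, hNw t h0, ENNReal.mul_rpow_of_nonneg (m t ^ ((q-1)/q)) (w t) (by positivity), ← ENNReal.rpow_mul (m t)]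
      have e9 : (q-1)/q*(1/(1-1/q)) = 1 := by
        have : q - 1 ≠ 0 := by linarith
        field_simp
      rw [e9, ENNReal.rpow_one]

end Strich

set_option linter.unusedVariables false
set_option linter.unusedSectionVars false
namespace Strich
open Filter Topology

variable {d : ℕ}

lemma fatou_le {X : Type*} [MeasurableSpace X] {μ : Measure X} (f : ℕ → X → ℝ≥0∞) (g : X → ℝ≥0∞) (C : ℝ≥0∞)
    (hf : ∀ n, AEMeasurable (f n) μ) (h : ∀ᵐ t ∂μ, Tendsto (fun n => f n t) atTop (𝓝 (g t))) (hb : ∀ n, ∫⁻ t, f n t ∂μ ≤ C) :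
    ∫⁻ t, g t ∂μ ≤ C := by
  have h1 : ∫⁻ t, g t ∂μ = ∫⁻ t, liminf (fun n => f n t) atTop ∂μ := by
    apply lintegral_congr_ae; filter_upwards [h] with t ht; rw [ht.liminf_eq]
  rw [h1]
  refine (lintegral_liminf_le' hf).trans ?_
  refine (liminf_le_liminf (v := fun _ => C) (Eventually.of_forall hb)).trans ?_
  simp

lemma unit_strich (hd : 1 ≤ d) (p q : ℝ) (hp : 2 ≤ p) (hq : 2 < q) (hpq : (2/p)/(1-2/q) ≤ (d:ℝ)/2) :
    ∃ C : ℝ≥0∞, C ≠ ∞ ∧ ∀ (ψ : EuclideanSpace ℝ (Fin d) → ℂ) (hψ : Measurable ψ) (h2 : ∫⁻ ξ, ‖ψ ξ‖ₑ ^ 2 ≠ ∞),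
      (∫⁻ t, (∫⁻ x, ‖Wf ψ t x‖ₑ ^ q) ^ (p/q)) ^ (1/p) ≤ C * (∫⁻ ξ, ‖ψ ξ‖ₑ ^ 2) ^ (1/2:ℝ) := by
  obtain ⟨C, hC, hst⟩ := dual_step hd p q hp hq hpq
  refine ⟨C, hC, fun ψ hψ h2 => ?_⟩
  have hq0 : 0 < q := by linarith
  have hp0 : 0 < p := by linarith
  have hVm : Measurable fun z : ℝ × EuclideanSpace ℝ (Fin d) => Wf ψ z.1 z.2 := W_meas ψ hψ
  set ε : ℕ → ℝ := fun n => 1 / ((n:ℝ) + 1) with hε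
  have hεp : ∀ n, 0 < ε n := fun n => by rw [hε]; positivity
  have hεa : ∀ i j, i ≤ j → ε j ≤ ε i := by
    intro i j hij; rw [hε]; simp only []; gcongr
  have hε0 : Tendsto (fun n => ENNReal.ofReal (ε n)) atTop (𝓝 0) := by
    have := ENNReal.tendsto_ofReal (tendsto_one_div_add_atTop_nhds_zero_nat (𝕜 := ℝ))
    rw [ENNReal.ofReal_zero] at this; exact this
  set S : ℕ → Set (ℝ × EuclideanSpace ℝ (Fin d)) := fun n =>
    {z | (z.1 ∈ Set.Icc (-((n:ℝ)+1)) ((n:ℝ)+1) ∧ z.2 ∈ Metric.closedBall (0 : EuclideanSpace ℝ (Fin d)) ((n:ℝ)+1)) ∧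
      ENNReal.ofReal (ε n) ≤ ‖Wf ψ z.1 z.2‖ₑ} with hS
  have hSm : ∀ n, MeasurableSet (S n) := by
    intro n
    refine MeasurableSet.inter (MeasurableSet.inter ?_ ?_) ?_
    · exact measurable_fst measurableSet_Icc
    · exact measurable_snd Metric.isClosed_closedBall.measurableSet
    · exact measurableSet_le measurable_const hVm.enorm
  have hfm : ∀ (T : Set (ℝ × EuclideanSpace ℝ (Fin d))), MeasurableSet T → Measurable (T.indicator (fun z => ‖Wf ψ z.1 z.2‖ₑ ^ q)) := fun T hT =>
    (hVm.enorm.pow_const q).indicator hT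
  set m0 : ℕ → ℝ → ℝ≥0∞ := fun n t => ∫⁻ x, (S n).indicator (fun z => ‖Wf ψ z.1 z.2‖ₑ ^ q) (t, x) with hm0
  have hm0m : ∀ n, Measurable (m0 n) := fun n => Measurable.lintegral_prod_right' (hfm _ (hSm n))
  set S' : ℕ → Set (ℝ × EuclideanSpace ℝ (Fin d)) := fun n => S n ∩ {z | ENNReal.ofReal (ε n) ≤ m0 n z.1} with hS'
  have hS'm : ∀ n, MeasurableSet (S' n) := fun n =>
    (hSm n).inter (measurableSet_le measurable_const ((hm0m n).comp measurable_fst))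
  set m : ℕ → ℝ → ℝ≥0∞ := fun n t => ∫⁻ x, (S' n).indicator (fun z => ‖Wf ψ z.1 z.2‖ₑ ^ q) (t, x) with hm
  have hmm0 : ∀ n t, ENNReal.ofReal (ε n) ≤ m0 n t → m n t = m0 n t := by
    intro n t h
    refine lintegral_congr fun x => ?_
    by_cases hx : (t, x) ∈ S n
    · rw [Set.indicator_of_mem hx, Set.indicator_of_mem (show (t, x) ∈ S' n from ⟨hx, h⟩)]
    · rw [Set.indicator_of_notMem hx, Set.indicator_of_notMem (fun h => hx h.1)]
  have hmm : ∀ n, Measurable (m n) := fun n => Measurable.lintegral_prod_right' (hfm _ (hS'm n))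
  have hbd : ∀ n, ∫⁻ t, m n t ^ (p/q) ≤ (C * (∫⁻ ξ, ‖ψ ξ‖ₑ ^ 2) ^ (1/2:ℝ)) ^ p := by
    intro n
    have := hst ψ hψ h2 ((n:ℝ)+1) (ε n) (hεp n) (S' n) (hS'm n) (m n) (fun t => rfl) (by
      intro z hz
      refine ⟨hz.1.1.1, hz.1.1.2, hz.1.2, ?_⟩
      rw [hmm0 n z.1 hz.2]; exact hz.2)
    have h3 := ENNReal.rpow_le_rpow this hp0.le
    rwa [← ENNReal.rpow_mul, one_div_mul_cancel hp0.ne', ENNReal.rpow_one] at h3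
  have hlim0 : ∀ t, Tendsto (fun n => m0 n t) atTop (𝓝 (∫⁻ x, ‖Wf ψ t x‖ₑ ^ q)) := by
    intro t
    refine lintegral_tendsto_of_tendsto_of_monotone (fun n => ((hfm _ (hSm n)).comp measurable_prodMk_left).aemeasurable) ?_ ?_
    · refine Eventually.of_forall fun x i j hij => ?_
      refine Set.indicator_le_indicator_of_subset ?_ (fun _ => zero_le) _
      intro z hz
      have hij' : (i:ℝ) ≤ j := by exact_mod_cast hij
      refine ⟨⟨⟨by linarith [hz.1.1.1], by linarith [hz.1.1.2]⟩, ?_⟩, (ENNReal.ofReal_le_ofReal (hεa i j hij)).trans hz.2⟩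
      exact Metric.closedBall_subset_closedBall (by linarith) hz.1.2
    · refine Eventually.of_forall fun x => ?_
      by_cases h0 : ‖Wf ψ t x‖ₑ = 0
      · have : ∀ n, (S n).indicator (fun z => ‖Wf ψ z.1 z.2‖ₑ ^ q) (t, x) = ‖Wf ψ t x‖ₑ ^ q := by
          intro n
          by_cases hx : (t, x) ∈ S n
          · rw [Set.indicator_of_mem hx]
          · rw [Set.indicator_of_notMem hx, h0, ENNReal.zero_rpow_of_pos hq0]
        simp only [this]; exact tendsto_const_nhds
      · refine tendsto_const_nhds.congr' ?_
        have hpos : 0 < ‖Wf ψ t x‖ₑ := pos_iff_ne_zero.2 h0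
        filter_upwards [hε0.eventually (gt_mem_nhds hpos), (tendsto_natCast_atTop_atTop (R := ℝ)).eventually_ge_atTop (max |t| ‖x‖)] with n h1 h2
        rw [Set.indicator_of_mem]
        have h3 := (le_max_left _ _).trans h2
        have h4 := (le_max_right _ _).trans h2
        refine ⟨⟨⟨by linarith [neg_abs_le t], by linarith [le_abs_self t]⟩, ?_⟩, h1.le⟩
        simp only [Metric.mem_closedBall, dist_zero_right]; linarith
  have hlim : ∀ t, Tendsto (fun n => m n t) atTop (𝓝 (∫⁻ x, ‖Wf ψ t x‖ₑ ^ q)) := by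
    intro t
    by_cases h0 : ∫⁻ x, ‖Wf ψ t x‖ₑ ^ q = 0
    · have : ∀ n, m n t = 0 := by
        intro n
        rw [← nonpos_iff_eq_zero, ← h0]
        refine lintegral_mono fun x => ?_
        exact Set.indicator_le_self (S' n) (fun z => ‖Wf ψ z.1 z.2‖ₑ ^ q) (t, x)
      simp only [this, h0]; exact tendsto_const_nhds
    · refine (hlim0 t).congr' ?_
      obtain ⟨c, hc0, hc⟩ := exists_between (pos_iff_ne_zero.2 h0)
      filter_upwards [hε0.eventually (gt_mem_nhds hc0), (hlim0 t).eventually (lt_mem_nhds hc)] with n h1 h2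
      rw [hmm0 n t (h1.le.trans h2.le)]
  have := fatou_le (fun n t => m n t ^ (p/q)) (fun t => (∫⁻ x, ‖Wf ψ t x‖ₑ ^ q) ^ (p/q)) _
    (fun n => ((hmm n).pow_const _).aemeasurable)
    (Eventually.of_forall fun t => (ENNReal.continuous_rpow_const.tendsto _).comp (hlim t)) hbd
  have h3 := ENNReal.rpow_le_rpow this (by positivity : 0 ≤ 1/p)
  rwa [← ENNReal.rpow_mul _ p, mul_one_div_cancel hp0.ne', ENNReal.rpow_one] at h3

end Strich

set_option linter.unusedVariables false
set_option linter.unusedSectionVars false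
namespace Strich
open Filter Topology

variable {d : ℕ}

lemma lint_scale (f : EuclideanSpace ℝ (Fin d) → ℝ≥0∞) (hf : Measurable f) (l : ℝ) (hl : 0 < l) :
    ∫⁻ x, f (l • x) = ENNReal.ofReal (l ^ (-(d:ℝ))) * ∫⁻ x, f x := by
  have h := Measure.map_addHaar_smul (volume : Measure (EuclideanSpace ℝ (Fin d))) hl.ne'
  rw [← lintegral_map (μ := volume) (g := fun x => l • x) hf (measurable_const_smul l), h, lintegral_smul_measure]
  rw [finrank_euclideanSpace_fin, abs_of_nonneg (by positivity), Real.rpow_neg hl.le, Real.rpow_natCast]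
  rfl

lemma lint_scale1 (f : ℝ → ℝ≥0∞) (hf : Measurable f) (l : ℝ) (hl : 0 < l) :
    ∫⁻ x, f (l * x) = ENNReal.ofReal (l⁻¹) * ∫⁻ x, f x := by
  have h := Measure.map_addHaar_smul (volume : Measure ℝ) hl.ne'
  have e : ∫⁻ x, f (l * x) = ∫⁻ x, f ((fun x => l • x) x) := rfl
  rw [e, ← lintegral_map (μ := volume) (g := fun x => l • x) hf (measurable_const_smul l), h, lintegral_smul_measure]
  rw [Module.finrank_self, abs_of_nonneg (by positivity), pow_one]
  rfl

lemma Ef_scale (φ ψ : EuclideanSpace ℝ (Fin d) → ℂ) (l : ℝ) (hl : 0 < l)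
    (h : ∀ η, φ (l • η) = (mK d η : ℂ) * ψ η) (t : ℝ) (x) :
    Ef (fun ξ => phase t ξ * φ ξ) x = ((l ^ d : ℝ) : ℂ) * Wf ψ (l ^ 4 * t) (l • x) := by
  unfold Wf Ef
  have h1 := Measure.integral_comp_smul (volume : Measure (EuclideanSpace ℝ (Fin d)))
    (fun ξ => cexp (2 * π * I * ((⟪x, ξ⟫ : ℝ) : ℂ)) * (phase t ξ * φ ξ)) l
  have h2 : ∀ η : EuclideanSpace ℝ (Fin d), cexp (2 * π * I * ((⟪l • x, η⟫ : ℝ) : ℂ)) * (phase (l ^ 4 * t) η * ((mK d η : ℂ) * ψ η))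
      = cexp (2 * π * I * ((⟪x, l • η⟫ : ℝ) : ℂ)) * (phase t (l • η) * φ (l • η)) := by
    intro η
    rw [h, real_inner_smul_left, real_inner_smul_right]
    congr 2
    unfold phase
    rw [norm_smul, Real.norm_of_nonneg hl.le]
    congr 3; ring
  simp_rw [h2]
  rw [h1, finrank_euclideanSpace_fin, abs_of_nonneg (by positivity), Complex.real_smul, ← mul_assoc, ← Complex.ofReal_mul,
    mul_inv_cancel₀ (by positivity)]
  simp

set_option maxHeartbeats 800000 in
lemma annulus_strich (hd : 1 ≤ d) (p q : ℝ) (hp : 2 ≤ p) (hq : 2 < q) (hpq : (2/p)/(1-2/q) ≤ (d:ℝ)/2) :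
    ∃ C : ℝ≥0∞, C ≠ ∞ ∧ ∀ l : ℝ, 0 < l → ∀ (φ : EuclideanSpace ℝ (Fin d) → ℂ) (hφ : Measurable φ)
      (hs : ∀ ξ, φ ξ ≠ 0 → l ≤ ‖ξ‖ ∧ ‖ξ‖ ≤ 2 * l) (h2 : ∫⁻ ξ, ‖φ ξ‖ₑ ^ 2 ≠ ∞),
      (∫⁻ t, (∫⁻ x, ‖Ef (fun ξ => phase t ξ * φ ξ) x‖ₑ ^ q) ^ (p/q)) ^ (1/p) ≤
        C * ENNReal.ofReal (l ^ ((d:ℝ)/2 - d/q - 4/p)) * (∫⁻ ξ, ‖φ ξ‖ₑ ^ 2) ^ (1/2:ℝ) := by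
  obtain ⟨C, hC, hst⟩ := unit_strich hd p q hp hq hpq
  have hq0 : 0 < q := by linarith
  have hp0 : 0 < p := by linarith
  refine ⟨C * ENNReal.ofReal (Real.exp 4), ENNReal.mul_ne_top hC ENNReal.ofReal_ne_top, fun l hl φ hφ hs h2 => ?_⟩
  set ψ : EuclideanSpace ℝ (Fin d) → ℂ := fun η => φ (l • η) / (mK d η : ℂ) with hψd
  have hψ : Measurable ψ := by
    refine (hφ.comp (measurable_const_smul l)).div ?_
    have := mK_cont (d := d)
    exact Continuous.measurable (by fun_prop)
  have hk : ∀ η : EuclideanSpace ℝ (Fin d), φ (l • η) ≠ 0 → Real.exp (-4) ≤ mK d η := by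
    intro η hη
    obtain ⟨a, b⟩ := hs _ hη
    rw [norm_smul, Real.norm_of_nonneg hl.le] at a b
    have a' : 1 ≤ ‖η‖ := by
      by_contra h; push Not at h; nlinarith
    have b' : ‖η‖ ≤ 2 := by
      by_contra h; push Not at h; nlinarith
    unfold mK
    have e1 : Real.exp (-4) ≤ Real.exp (-‖η‖^2) := Real.exp_le_exp.2 (by nlinarith)
    have e2 : 1 ≤ ‖η‖ ^ (2 * (d+1)) := one_le_pow₀ a'
    nlinarith [Real.exp_pos (-‖η‖^2)]
  have hid : ∀ η, φ (l • η) = (mK d η : ℂ) * ψ η := by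
    intro η
    by_cases h0 : φ (l • η) = 0
    · simp [hψd, h0]
    · have := hk η h0
      have hp : (0:ℝ) < mK d η := (Real.exp_pos _).trans_le this
      have : (mK d η : ℂ) ≠ 0 := by exact_mod_cast hp.ne'
      simp only [hψd]; field_simp
  have hψle : ∀ η, ‖ψ η‖ₑ ≤ ENNReal.ofReal (Real.exp 4) * ‖φ (l • η)‖ₑ := by
    intro η
    by_cases h0 : φ (l • η) = 0
    · simp [hψd, h0]
    · have := hk η h0
      have hp : (0:ℝ) < mK d η := (Real.exp_pos _).trans_le this
      rw [← ofReal_norm, ← ofReal_norm, ← ENNReal.ofReal_mul (by positivity)]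
      apply ENNReal.ofReal_le_ofReal
      simp only [hψd, norm_div, Complex.norm_real, Real.norm_of_nonneg hp.le]
      rw [div_le_iff₀ hp]
      have : 1 ≤ Real.exp 4 * mK d η := by
        calc (1:ℝ) = Real.exp 4 * Real.exp (-4) := by rw [← Real.exp_add]; simp
          _ ≤ _ := by gcongr
      nlinarith [norm_nonneg (φ (l • η))]
  have hψ2 : ∫⁻ ξ, ‖ψ ξ‖ₑ ^ 2 ≤ ENNReal.ofReal (Real.exp 4) ^ 2 * (ENNReal.ofReal (l ^ (-(d:ℝ))) * ∫⁻ ξ, ‖φ ξ‖ₑ ^ 2) := by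
    rw [← lint_scale (fun ξ => ‖φ ξ‖ₑ^2) (by fun_prop) l hl, ← lintegral_const_mul _ (by fun_prop)]
    refine lintegral_mono fun η => ?_
    rw [← mul_pow]
    exact pow_le_pow_left' (hψle η) 2
  have hψf : ∫⁻ ξ, ‖ψ ξ‖ₑ ^ 2 ≠ ∞ := by
    refine ne_top_of_le_ne_top ?_ hψ2
    exact ENNReal.mul_ne_top (ENNReal.pow_ne_top ENNReal.ofReal_ne_top) (ENNReal.mul_ne_top ENNReal.ofReal_ne_top h2)
  have key := hst ψ hψ hψf
  have hWm : Measurable fun z : ℝ × EuclideanSpace ℝ (Fin d) => ‖Wf ψ z.1 z.2‖ₑ ^ q := (W_meas ψ hψ).enorm.pow_const q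
  have hWs : ∀ s, Measurable fun x => ‖Wf ψ s x‖ₑ ^ q := by
    intro s
    have h0 : Measurable (Wf ψ s) := (W_meas ψ hψ).of_uncurry_left
    exact h0.enorm.pow_const q
  have hin : ∀ t, ∫⁻ x, ‖Ef (fun ξ => phase t ξ * φ ξ) x‖ₑ ^ q =
      ENNReal.ofReal (l ^ (d * q - d)) * ∫⁻ x, ‖Wf ψ (l ^ 4 * t) x‖ₑ ^ q := by
    intro t
    have e1 : ∀ x, ‖Ef (fun ξ => phase t ξ * φ ξ) x‖ₑ ^ q = ENNReal.ofReal (l ^ (d * q)) * ‖Wf ψ (l^4*t) (l • x)‖ₑ ^ q := by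
      intro x
      rw [Ef_scale φ ψ l hl hid, enorm_mul, ENNReal.mul_rpow_of_nonneg _ _ hq0.le]
      congr 1
      rw [← ofReal_norm, Complex.norm_real, Real.norm_of_nonneg (by positivity), ENNReal.ofReal_rpow_of_nonneg (by positivity) hq0.le,
        ← Real.rpow_natCast, ← Real.rpow_mul hl.le]
    simp_rw [e1]
    rw [lintegral_const_mul (f := fun x => ‖Wf ψ (l^4*t) (l • x)‖ₑ ^ q) _ ((hWs (l^4*t)).comp (measurable_const_smul l)),
      lint_scale (fun x => ‖Wf ψ (l ^ 4 * t) x‖ₑ ^ q) (hWs (l^4*t)) l hl, ← mul_assoc,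
      ← ENNReal.ofReal_mul (by positivity), ← Real.rpow_add hl, ← sub_eq_add_neg]
  have hout : (∫⁻ t, (∫⁻ x, ‖Ef (fun ξ => phase t ξ * φ ξ) x‖ₑ ^ q) ^ (p/q)) =
      ENNReal.ofReal (l ^ ((d * q - d) * (p/q) - 4)) * ∫⁻ t, (∫⁻ x, ‖Wf ψ t x‖ₑ ^ q) ^ (p/q) := by
    have hpq0 : 0 ≤ p / q := by positivity
    have hm : Measurable fun t => (∫⁻ x, ‖Wf ψ t x‖ₑ ^ q) ^ (p/q) := (Measurable.lintegral_prod_right' hWm).pow_const _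
    simp_rw [hin, ENNReal.mul_rpow_of_nonneg _ _ hpq0]
    rw [lintegral_const_mul (f := fun t => (∫⁻ x, ‖Wf ψ (l ^ 4 * t) x‖ₑ ^ q) ^ (p / q)) _ (hm.comp (measurable_const_mul (l^4))),
      lint_scale1 (fun t => (∫⁻ x, ‖Wf ψ t x‖ₑ ^ q) ^ (p/q)) hm (l^4) (by positivity), ← mul_assoc]
    congr 1
    rw [ENNReal.ofReal_rpow_of_nonneg (by positivity) hpq0, ← ENNReal.ofReal_mul (by positivity), ← Real.rpow_mul hl.le,
      Real.rpow_sub hl, div_eq_mul_inv]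
    have h4 : l ^ (4:ℝ) = l ^ 4 := by exact_mod_cast Real.rpow_natCast l 4
    rw [h4, ← div_eq_mul_inv (l ^ _) (l^4)]
  rw [hout, ENNReal.mul_rpow_of_nonneg _ _ (by positivity : 0 ≤ 1/p)]
  have hψ3 : (∫⁻ ξ, ‖ψ ξ‖ₑ ^ 2)^(1/2:ℝ) ≤ ENNReal.ofReal (Real.exp 4) * (ENNReal.ofReal (l ^ (-(d:ℝ)/2)) * (∫⁻ ξ, ‖φ ξ‖ₑ ^ 2)^(1/2:ℝ)) := by
    refine (ENNReal.rpow_le_rpow hψ2 (by norm_num)).trans (le_of_eq ?_)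
    rw [ENNReal.mul_rpow_of_nonneg _ _ (by norm_num), ENNReal.mul_rpow_of_nonneg _ _ (by norm_num), ← ENNReal.rpow_natCast, ← ENNReal.rpow_mul,
      ENNReal.ofReal_rpow_of_nonneg (p := 1/2) (by positivity : 0 ≤ l ^ (-(d:ℝ))) (by norm_num), ← Real.rpow_mul hl.le]
    norm_num
    congr 3; ring_nf
  refine (mul_le_mul_right (key.trans (mul_le_mul_right hψ3 C)) _).trans (le_of_eq ?_)
  rw [ENNReal.ofReal_rpow_of_nonneg (by positivity) (by positivity), ← Real.rpow_mul hl.le]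
  have : l ^ ((d:ℝ)/2 - d/q - 4/p) = l ^ (((d * q - d) * (p/q) - 4) * (1/p)) * l ^ (-(d:ℝ)/2) := by
    rw [← Real.rpow_add hl]
    congr 1
    field_simp
    ring
  rw [this, ENNReal.ofReal_mul (by positivity)]
  ring

lemma supp_int (φ : EuclideanSpace ℝ (Fin d) → ℂ) (hφ : Measurable φ) (R : ℝ)
    (hs : ∀ ξ, φ ξ ≠ 0 → ‖ξ‖ ≤ R) (h2 : ∫⁻ ξ, ‖φ ξ‖ₑ ^ 2 ≠ ∞) :
    MemLp φ 2 ∧ Integrable φ ∧ ∫⁻ ξ, ‖φ ξ‖ₑ ≤ volume (Metric.closedBall (0 : EuclideanSpace ℝ (Fin d)) R) ^ (1/2:ℝ) * (∫⁻ ξ, ‖φ ξ‖ₑ ^ 2) ^ (1/2:ℝ) := by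
  have m2 : MemLp φ 2 := by
    refine ⟨hφ.aestronglyMeasurable, ?_⟩
    rw [eLpNorm_lt_top_iff_lintegral_rpow_enorm_lt_top (by norm_num) (by norm_num)]
    simpa using h2.lt_top
  have hb : ∫⁻ ξ, ‖φ ξ‖ₑ ≤ volume (Metric.closedBall (0 : EuclideanSpace ℝ (Fin d)) R) ^ (1/2:ℝ) * (∫⁻ ξ, ‖φ ξ‖ₑ ^ 2) ^ (1/2:ℝ) := by
    have h := ENNReal.lintegral_mul_le_Lp_mul_Lq (μ := (volume : Measure (EuclideanSpace ℝ (Fin d)))) (p := 2) (q := 2) (Real.HolderConjugate.two_two)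
      (f := (Metric.closedBall (0 : EuclideanSpace ℝ (Fin d)) R).indicator (1 : EuclideanSpace ℝ (Fin d) → ℝ≥0∞)) (g := fun ξ => ‖φ ξ‖ₑ)
      ((measurable_one.indicator Metric.isClosed_closedBall.measurableSet).aemeasurable) hφ.enorm.aemeasurable
    have e1 : ∀ ξ, ‖φ ξ‖ₑ = ((Metric.closedBall (0 : EuclideanSpace ℝ (Fin d)) R).indicator (1 : EuclideanSpace ℝ (Fin d) → ℝ≥0∞) * fun ξ => ‖φ ξ‖ₑ) ξ := by
      intro ξ
      by_cases h0 : φ ξ = 0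
      · simp [h0]
      · have : ξ ∈ Metric.closedBall (0 : EuclideanSpace ℝ (Fin d)) R := by simpa using hs ξ h0
        simp [Pi.mul_apply, Set.indicator_of_mem this]
    rw [lintegral_congr e1]
    refine h.trans (le_of_eq ?_)
    congr 2
    · rw [← lintegral_indicator_one Metric.isClosed_closedBall.measurableSet]
      refine lintegral_congr fun ξ => ?_
      by_cases h0 : ξ ∈ Metric.closedBall (0 : EuclideanSpace ℝ (Fin d)) R
      · rw [Set.indicator_of_mem h0]; simp
      · rw [Set.indicator_of_notMem h0]; simp
    · refine lintegral_congr fun ξ => ?_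
      exact ENNReal.rpow_two _
  refine ⟨m2, ⟨hφ.aestronglyMeasurable, ?_⟩, hb⟩
  refine lt_of_le_of_lt hb ?_
  have : volume (Metric.closedBall (0 : EuclideanSpace ℝ (Fin d)) R) ≠ ∞ := (measure_closedBall_lt_top).ne
  exact ENNReal.mul_lt_top (ENNReal.rpow_lt_top_of_nonneg (by norm_num) this) (ENNReal.rpow_lt_top_of_nonneg (by norm_num) h2)

lemma bernstein (d : ℕ) (q : ℝ) (hq : 2 ≤ q) :
    ∃ C : ℝ≥0∞, C ≠ ∞ ∧ ∀ R : ℝ, 0 < R → ∀ (φ : EuclideanSpace ℝ (Fin d) → ℂ) (hφ : Measurable φ)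
      (hs : ∀ ξ, φ ξ ≠ 0 → ‖ξ‖ ≤ R) (h2 : ∫⁻ ξ, ‖φ ξ‖ₑ ^ 2 ≠ ∞),
      (∫⁻ x, ‖Ef φ x‖ₑ ^ q) ^ (1/q) ≤
        C * ENNReal.ofReal (R ^ ((d:ℝ)/2 - d/q)) * (∫⁻ ξ, ‖φ ξ‖ₑ ^ 2) ^ (1/2:ℝ) := by
  have hq0 : 0 < q := by linarith
  set v := volume (Metric.closedBall (0 : EuclideanSpace ℝ (Fin d)) 1) with hv
  have hvt : v ≠ ∞ := measure_closedBall_lt_top.ne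
  have hr : 0 ≤ (q-2)/(2*q) := div_nonneg (by linarith) (by linarith)
  refine ⟨v ^ ((q-2)/(2*q)), ENNReal.rpow_ne_top_of_nonneg hr hvt, fun R hR φ hφ hs h2 => ?_⟩
  obtain ⟨m2, hi, hb⟩ := supp_int φ hφ R hs h2
  have hvol : volume (Metric.closedBall (0 : EuclideanSpace ℝ (Fin d)) R) = ENNReal.ofReal (R ^ d) * v := by
    rw [Measure.addHaar_closedBall' _ _ hR.le, finrank_euclideanSpace_fin, hv]
  set L := ∫⁻ ξ, ‖φ ξ‖ₑ ^ 2 with hL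
  set B := volume (Metric.closedBall (0 : EuclideanSpace ℝ (Fin d)) R) with hB
  have h1 : ∫⁻ x, ‖Ef φ x‖ₑ ^ q ≤ (B ^ (1/2:ℝ) * L ^ (1/2:ℝ)) ^ (q-2) * L := by
    rw [hL, ← Ef_plancherel φ hi m2]
    rw [← lintegral_const_mul _ (by have := (Ef_cont φ hi).measurable; fun_prop)]
    refine lintegral_mono fun x => ?_
    have : ‖Ef φ x‖ₑ ^ q = ‖Ef φ x‖ₑ ^ (q-2) * ‖Ef φ x‖ₑ ^ 2 := by
      rw [← ENNReal.rpow_two, ← ENNReal.rpow_add_of_nonneg _ _ (by linarith) (by norm_num)]; congr 1; ring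
    rw [this]
    rw [Ef_plancherel φ hi m2]
    exact mul_le_mul_left (ENNReal.rpow_le_rpow ((Ef_le φ x).trans hb) (by linarith)) _
  refine (ENNReal.rpow_le_rpow h1 (by positivity)).trans (le_of_eq ?_)
  rw [hvol]
  have hr2 : 0 ≤ (q-2) * (1/q) := mul_nonneg (by linarith) (by positivity)
  rw [ENNReal.mul_rpow_of_nonneg _ _ (by positivity : 0 ≤ 1/q), ← ENNReal.rpow_mul, ENNReal.mul_rpow_of_nonneg _ _ hr2,
    ← ENNReal.rpow_mul, ← ENNReal.rpow_mul, ENNReal.mul_rpow_of_nonneg _ _ (by positivity), mul_assoc, ← ENNReal.rpow_add_of_nonneg _ _ (by positivity) (by positivity),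
    ENNReal.ofReal_rpow_of_nonneg (by positivity) (by positivity), ← Real.rpow_natCast, ← Real.rpow_mul hR.le, mul_comm (v ^ _)]
  congr 1
  · congr 1
    · congr 2; field_simp
    · congr 1; field_simp
  · congr 1; field_simp; ring

end Strich

set_option linter.unusedVariables false
set_option linter.unusedSectionVars false
namespace Strich
open Filter Topology

variable {d : ℕ}

noncomputable def Nq (q : ℝ) (z : ℂ) : ℂ := ((‖z‖ ^ (q - 2) : ℝ) : ℂ) * z

lemma rpow_diff (x y s : ℝ) (hx : 0 ≤ x) (hxy : x ≤ y) (hs : 1 ≤ s) :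
    y ^ s - x ^ s ≤ s * y ^ (s - 1) * (y - x) := by
  rcases eq_or_lt_of_le (hx.trans hxy) with h0 | h0
  · have : x = 0 := le_antisymm (by rw [h0]; exact hxy) hx
    subst this; rw [← h0]; simp
  · have h1 := one_add_mul_self_le_rpow_one_add (s := x / y - 1) (by have := div_nonneg hx h0.le; linarith) hs
    rw [add_sub_cancel, Real.div_rpow hx h0.le] at h1
    have h2 : y ^ s = y ^ (s-1) * y := by rw [← Real.rpow_add_one h0.ne']; congr 1; ring
    have h3 : 0 < y ^ s := Real.rpow_pos_of_pos h0 _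
    rw [le_div_iff₀ h3] at h1
    have h4 : (1 + s * (x / y - 1)) * y ^ s = y ^ s + s * y ^ (s-1) * (x - y) := by
      rw [h2]; field_simp
    linarith

lemma Nq_lip (q : ℝ) (hq : 2 < q) (a b : ℂ) : ‖Nq q a - Nq q b‖ ≤ q * (max ‖a‖ ‖b‖) ^ (q - 2) * ‖a - b‖ := by
  set m := max ‖a‖ ‖b‖ with hm
  have ham : ‖a‖ ≤ m := le_max_left _ _
  have hbm : ‖b‖ ≤ m := le_max_right _ _
  have hr : 0 ≤ q - 2 := by linarith
  have e : Nq q a - Nq q b = ((‖a‖ ^ (q-2) : ℝ) : ℂ) * (a - b) + ((‖a‖ ^ (q-2) - ‖b‖ ^ (q-2) : ℝ) : ℂ) * b := by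
    unfold Nq; push_cast; ring
  have h1 : ‖((‖a‖ ^ (q-2) : ℝ) : ℂ) * (a - b)‖ ≤ m ^ (q-2) * ‖a - b‖ := by
    rw [norm_mul, Complex.norm_real, Real.norm_of_nonneg (by positivity)]; gcongr
  have gen : ∀ x y : ℝ, 0 ≤ x → x ≤ y → y ≤ m → y ^ (q-2) * y - x ^ (q-2) * x ≤ (q-1) * m ^ (q-2) * (y - x) := by
    intro x y hx hxy hy
    have h := rpow_diff x y (q-1) hx hxy (by linarith)
    have e1 : ∀ z : ℝ, 0 ≤ z → z ^ (q-1) = z ^ (q-2) * z := by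
      intro z hz
      nth_rewrite 3 [← Real.rpow_one z]
      rw [← Real.rpow_add_of_nonneg hz hr (by norm_num)]; congr 1; ring
    rw [e1 x hx, e1 y (hx.trans hxy)] at h
    refine h.trans ?_
    have : y ^ (q - 1 - 1) ≤ m ^ (q-2) := by
      rw [show q - 1 - 1 = q - 2 by ring]; exact Real.rpow_le_rpow (hx.trans hxy) hy hr
    have hn : 0 ≤ y - x := by linarith
    have hn' : 0 ≤ q - 1 := by linarith
    gcongr
  have h2 : ‖((‖a‖ ^ (q-2) - ‖b‖ ^ (q-2) : ℝ) : ℂ) * b‖ ≤ (q-1) * m ^ (q-2) * ‖a - b‖ := by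
    rw [norm_mul, Complex.norm_real, Real.norm_eq_abs]
    have hc : 0 ≤ (q-1) * m ^ (q-2) := mul_nonneg (by linarith) (Real.rpow_nonneg ((norm_nonneg a).trans ham) _)
    have hab : |‖a‖ - ‖b‖| ≤ ‖a - b‖ := abs_norm_sub_norm_le a b
    rcases le_total ‖a‖ ‖b‖ with h | h
    · have h3 := gen _ _ (norm_nonneg a) h hbm
      have h4 : ‖a‖ ^ (q-2) ≤ ‖b‖ ^ (q-2) := Real.rpow_le_rpow (norm_nonneg a) h hr
      rw [abs_of_nonpos (by linarith)]
      rw [abs_of_nonpos (by linarith)] at hab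
      have h5 : ‖a‖ ^ (q-2) * ‖a‖ ≤ ‖a‖ ^ (q-2) * ‖b‖ := by gcongr
      have := mul_le_mul_of_nonneg_left hab hc
      nlinarith
    · have h3 := gen _ _ (norm_nonneg b) h ham
      have h4 : ‖b‖ ^ (q-2) ≤ ‖a‖ ^ (q-2) := Real.rpow_le_rpow (norm_nonneg b) h hr
      rw [abs_of_nonneg (by linarith)]
      rw [abs_of_nonneg (by linarith)] at hab
      have h5 : ‖a‖ ^ (q-2) * ‖b‖ ≤ ‖a‖ ^ (q-2) * ‖a‖ := by gcongr
      have := mul_le_mul_of_nonneg_left hab hc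
      nlinarith
  rw [e]
  refine (norm_add_le _ _).trans ?_
  calc _ ≤ m ^ (q-2) * ‖a - b‖ + (q-1) * m ^ (q-2) * ‖a - b‖ := add_le_add h1 h2
    _ = _ := by ring

lemma norm_Nq (q : ℝ) (hq : 2 < q) (z : ℂ) : ‖Nq q z‖ = ‖z‖ ^ (q - 1) := by
  unfold Nq
  rw [norm_mul, Complex.norm_real, Real.norm_of_nonneg (by positivity)]
  nth_rewrite 2 [← Real.rpow_one ‖z‖]
  rw [← Real.rpow_add_of_nonneg (norm_nonneg z) (by linarith) (by norm_num)]; congr 1; ring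

lemma Nq_diff (q : ℝ) (hq : 2 < q) : Differentiable ℝ (Nq q) := by
  intro z
  by_cases hz : z = 0
  · subst hz
    refine HasFDerivAt.differentiableAt (f' := (0 : ℂ →L[ℝ] ℂ)) ?_
    rw [hasFDerivAt_iff_isLittleO_nhds_zero, Asymptotics.isLittleO_iff]
    intro c hc
    have h0 : Tendsto (fun z : ℂ => q * ‖z‖ ^ (q-2)) (𝓝 0) (𝓝 0) := by
      have : Continuous (fun z : ℂ => q * ‖z‖ ^ (q-2)) :=
        continuous_const.mul (continuous_norm.rpow_const (fun _ => Or.inr (by linarith)))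
      have h := this.tendsto 0
      rwa [norm_zero, Real.zero_rpow (by linarith), mul_zero] at h
    filter_upwards [h0.eventually (eventually_le_nhds hc)] with z hz
    have h1 := Nq_lip q hq (0 + z) 0
    simp only [zero_add, norm_zero, sub_zero, ContinuousLinearMap.zero_apply] at h1 ⊢
    rw [max_eq_left (norm_nonneg z)] at h1
    exact h1.trans (by gcongr)
  · unfold Nq
    have h1 : DifferentiableAt ℝ (fun z : ℂ => ‖z‖ ^ (q-2)) z := by
      refine DifferentiableAt.rpow_const ?_ (Or.inl (by simpa using hz))
      exact differentiableAt_id.norm ℝ hz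
    have h2 : DifferentiableAt ℝ (fun z : ℂ => ((‖z‖ ^ (q-2) : ℝ) : ℂ)) z :=
      Complex.ofRealCLM.differentiableAt.comp z h1
    exact h2.mul differentiableAt_id

lemma Nq_deriv (q : ℝ) (hq : 2 < q) (c : ℝ → ℂ) (c' : ℂ) (t : ℝ) (hc : HasDerivAt c c' t) :
    ‖deriv (fun s => Nq q (c s)) t‖ ≤ q * ‖c t‖ ^ (q-2) * ‖c'‖ := by
  have hD : DifferentiableAt ℝ (fun s => Nq q (c s)) t := (Nq_diff q hq (c t)).comp t hc.differentiableAt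
  have h1 := hasDerivAt_iff_tendsto_slope.1 hD.hasDerivAt
  have h2 := hasDerivAt_iff_tendsto_slope.1 hc
  have h3 : Tendsto (fun s => q * (max ‖c s‖ ‖c t‖) ^ (q-2) * ‖slope c t s‖) (𝓝[≠] t) (𝓝 (q * (max ‖c t‖ ‖c t‖) ^ (q-2) * ‖c'‖)) := by
    refine Tendsto.mul (Tendsto.mul tendsto_const_nhds ?_) h2.norm
    refine Tendsto.rpow_const ?_ (Or.inr (by linarith))
    refine Tendsto.max ?_ tendsto_const_nhds
    exact (hc.continuousAt.tendsto.norm).mono_left nhdsWithin_le_nhds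
  rw [max_self] at h3
  refine le_of_tendsto_of_tendsto h1.norm h3 (Eventually.of_forall fun s => ?_)
  simp only [slope, vsub_eq_sub, norm_smul]
  have := Nq_lip q hq (c s) (c t)
  calc _ ≤ ‖(s - t)⁻¹‖ * (q * (max ‖c s‖ ‖c t‖) ^ (q-2) * ‖c s - c t‖) := by gcongr
    _ = _ := by ring

lemma taylor_q (q : ℝ) (hq : 2 < q) (z w : ℂ) :
    ‖z + w‖ ^ q ≤ ‖z‖ ^ q + q * ((starRingEnd ℂ) (Nq q z) * w).re + q ^ 2 * ((‖z‖ + ‖w‖) ^ (q-2) * ‖w‖ ^ 2) := by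
  have hd : ∀ θ : ℝ, HasDerivAt (fun θ : ℝ => ‖z + (θ:ℂ) * w‖ ^ q) (q * ((starRingEnd ℂ) (Nq q (z + (θ:ℂ) * w)) * w).re) θ := by
    intro θ
    have h1 := hasFDerivAt_norm_rpow (z + (θ:ℂ) * w) (p := q) (by linarith)
    have h2 : HasDerivAt (fun θ : ℝ => z + (θ:ℂ) * w) w θ := by
      have := ((Complex.ofRealCLM.hasDerivAt (x := θ)).mul_const w).const_add z
      simpa using this
    refine (h1.comp_hasDerivAt θ h2).congr_deriv ?_
    simp only [Nq, map_mul, Complex.conj_ofReal, ContinuousLinearMap.smul_apply, innerSL_apply_apply, smul_eq_mul]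
    rw [mul_assoc ((‖z + (θ:ℂ) * w‖ ^ (q-2) : ℝ) : ℂ), Complex.re_ofReal_mul, Complex.inner]
    ring
  obtain ⟨θ, hθ, he⟩ := exists_hasDerivAt_eq_slope (fun θ : ℝ => ‖z + (θ:ℂ) * w‖ ^ q) _ (zero_lt_one)
    (fun θ _ => (hd θ).continuousAt.continuousWithinAt) (fun θ _ => hd θ)
  simp only [Complex.ofReal_one, one_mul, Complex.ofReal_zero, zero_mul, add_zero, sub_zero, div_one] at he
  have hl := Nq_lip q hq (z + (θ:ℂ) * w) z
  have hw : ‖(θ:ℂ) * w‖ ≤ ‖w‖ := by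
    rw [norm_mul, Complex.norm_real, Real.norm_of_nonneg hθ.1.le]
    nlinarith [norm_nonneg w, hθ.2]
  have hm : max ‖z + (θ:ℂ) * w‖ ‖z‖ ≤ ‖z‖ + ‖w‖ := by
    refine max_le ((norm_add_le _ _).trans (by linarith)) (by linarith [norm_nonneg w])
  have h3 : ‖Nq q (z + (θ:ℂ) * w) - Nq q z‖ ≤ q * (‖z‖ + ‖w‖) ^ (q-2) * ‖w‖ := by
    refine hl.trans ?_
    rw [add_sub_cancel_left]
    have : (max ‖z + (θ:ℂ) * w‖ ‖z‖) ^ (q-2) ≤ (‖z‖ + ‖w‖) ^ (q-2) := Real.rpow_le_rpow (le_max_of_le_right (norm_nonneg _)) hm (by linarith)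
    gcongr
  have h4 : ((starRingEnd ℂ) (Nq q (z + (θ:ℂ) * w)) * w).re ≤ ((starRingEnd ℂ) (Nq q z) * w).re + q * (‖z‖ + ‖w‖) ^ (q-2) * ‖w‖ * ‖w‖ := by
    have : ((starRingEnd ℂ) (Nq q (z + (θ:ℂ) * w)) * w).re - ((starRingEnd ℂ) (Nq q z) * w).re = ((starRingEnd ℂ) (Nq q (z + (θ:ℂ) * w) - Nq q z) * w).re := by
      rw [map_sub, sub_mul, Complex.sub_re]
    have h5 := (Complex.re_le_norm ((starRingEnd ℂ) (Nq q (z + (θ:ℂ) * w) - Nq q z) * w))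
    rw [norm_mul, Complex.norm_conj] at h5
    have h6 := mul_le_mul_of_nonneg_right h3 (norm_nonneg w)
    linarith
  have h7 := mul_le_mul_of_nonneg_left h4 (by linarith : 0 ≤ q)
  rw [he] at h7
  nlinarith

end Strich

set_option linter.unusedVariables false
set_option linter.unusedSectionVars false
namespace Strich
open Filter Topology

variable {d : ℕ}

lemma holder3 {X : Type*} [MeasurableSpace X] {μ : Measure X} (q : ℝ) (hq : 2 < q) (a b c : X → ℝ≥0∞)
    (ha : Measurable a) (hb : Measurable b) (hc : Measurable c) :
    ∫⁻ x, a x ^ (q-2) * b x * c x ∂μ ≤ ((∫⁻ x, a x ^ q ∂μ) ^ (1/q)) ^ (q-2) * (∫⁻ x, b x ^ q ∂μ) ^ (1/q) * (∫⁻ x, c x ^ q ∂μ) ^ (1/q) := by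
  have hq0 : 0 < q := by linarith
  have h := ENNReal.lintegral_prod_norm_pow_le (μ := μ) (Finset.univ : Finset (Fin 3)) (f := ![fun x => a x ^ q, fun x => b x ^ q, fun x => c x ^ q])
    (p := ![(q-2)/q, 1/q, 1/q]) (by
      intro i _; fin_cases i
      · exact (ha.pow_const q).aemeasurable
      · exact (hb.pow_const q).aemeasurable
      · exact (hc.pow_const q).aemeasurable) (by simp [Fin.sum_univ_three]; field_simp; ring) (by
      intro i _; fin_cases i
      · simp; exact div_nonneg (by linarith) hq0.le
      · simp; positivity
      · simp; positivity)
  simp only [Fin.prod_univ_three, Matrix.cons_val_zero, Matrix.cons_val_one, Matrix.cons_val, ← ENNReal.rpow_mul] at h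
  have e1 : q * ((q-2)/q) = q - 2 := by field_simp
  have e2 : q * (1/q) = 1 := by field_simp
  have e3 : 1/q * (q-2) = (q-2)/q := by field_simp
  rw [← ENNReal.rpow_mul, e3]
  simpa only [e1, e2, ENNReal.rpow_one] using h

lemma int_tri (q : ℝ) (hq : 2 < q) (a b c : EuclideanSpace ℝ (Fin d) → ℝ≥0∞) (g : EuclideanSpace ℝ (Fin d) → ℂ)
    (ha : Measurable a) (hb : Measurable b) (hc : Measurable c)
    (hA : ∫⁻ x, a x ^ q ≠ ∞) (hB : ∫⁻ x, b x ^ q ≠ ∞) (hC : ∫⁻ x, c x ^ q ≠ ∞) (hg : AEStronglyMeasurable g) (K : ℝ≥0∞) (hK : K ≠ ∞)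
    (hle : ∀ x, ‖g x‖ₑ ≤ K * (a x ^ (q-2) * b x * c x)) : Integrable g := by
  have hq0 : 0 < q := by linarith
  refine ⟨hg, ?_⟩
  refine lt_of_le_of_lt (lintegral_mono hle) ?_
  rw [lintegral_const_mul _ (by fun_prop)]
  refine ENNReal.mul_lt_top hK.lt_top (lt_of_le_of_lt (holder3 q hq a b c ha hb hc) ?_)
  have t : ∀ y : ℝ≥0∞, y ≠ ∞ → y ^ (1/q) < ∞ := fun y hy => ENNReal.rpow_lt_top_of_nonneg (by positivity) hy
  exact ENNReal.mul_lt_top (ENNReal.mul_lt_top (ENNReal.rpow_lt_top_of_nonneg (by linarith) (t _ hA).ne) (t _ hB)) (t _ hC)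

lemma real_enorm (g : ℂ) (r : ℝ) (hr : 0 ≤ r) : ENNReal.ofReal (‖g‖ ^ r) = ‖g‖ₑ ^ r := by
  rw [← ENNReal.ofReal_rpow_of_nonneg (norm_nonneg _) hr, ofReal_norm]

set_option maxHeartbeats 800000 in
lemma lp_step (q : ℝ) (hq : 2 < q) (S f : EuclideanSpace ℝ (Fin d) → ℂ) (dS h dh : Fin d → EuclideanSpace ℝ (Fin d) → ℂ)
    (Sc : Continuous S) (fc : Continuous f) (dSc : ∀ i, Continuous (dS i)) (hc : ∀ i, Continuous (h i)) (dhc : ∀ i, Continuous (dh i))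
    (hdS : ∀ i x, HasLineDerivAt ℝ S (dS i x) x (EuclideanSpace.single i 1))
    (hdh : ∀ i x, HasLineDerivAt ℝ (h i) (dh i x) x (EuclideanSpace.single i 1))
    (hf : ∀ x, f x = ∑ i, dh i x)
    (nS : ∫⁻ x, ‖S x‖ₑ ^ q ≠ ∞) (nf : ∫⁻ x, ‖f x‖ₑ ^ q ≠ ∞) (ndS : ∀ i, ∫⁻ x, ‖dS i x‖ₑ ^ q ≠ ∞)
    (nh : ∀ i, ∫⁻ x, ‖h i x‖ₑ ^ q ≠ ∞) (ndh : ∀ i, ∫⁻ x, ‖dh i x‖ₑ ^ q ≠ ∞) :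
    ∫⁻ x, ‖S x + f x‖ₑ ^ q ≤ (∫⁻ x, ‖S x‖ₑ ^ q) + ENNReal.ofReal (q^2) *
      ((∫⁻ x, (‖S x‖ₑ + ‖f x‖ₑ) ^ (q-2) * ‖f x‖ₑ * ‖f x‖ₑ) + ∑ i, ∫⁻ x, ‖S x‖ₑ ^ (q-2) * ‖dS i x‖ₑ * ‖h i x‖ₑ) := by
  have hq0 : 0 < q := by linarith
  have hq2 : 0 ≤ q - 2 := by linarith
  have nSf : ∫⁻ x, (‖S x‖ₑ + ‖f x‖ₑ) ^ q ≠ ∞ := by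
    have := ENNReal.lintegral_rpow_add_lt_top_of_lintegral_rpow_lt_top (μ := (volume : Measure (EuclideanSpace ℝ (Fin d)))) (p := q) (f := fun x => ‖S x‖ₑ) (g := fun x => ‖f x‖ₑ)
      Sc.measurable.enorm.aemeasurable nS.lt_top nf.lt_top (by linarith)
    exact this.ne
  have mS : Measurable fun x => ‖S x‖ₑ := Sc.measurable.enorm
  have mf : Measurable fun x => ‖f x‖ₑ := fc.measurable.enorm
  have Nc : Continuous (Nq q) := (Nq_diff q hq).continuous
  have nN : ∀ z : ℂ, ‖Nq q z‖ₑ = ‖z‖ₑ ^ (q-2) * ‖z‖ₑ := by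
    intro z
    unfold Nq
    rw [enorm_mul]; congr 1
    rw [← ofReal_norm, Complex.norm_real, Real.norm_of_nonneg (by positivity), real_enorm z _ hq2]
  -- product integrability
  have iN : ∀ g : EuclideanSpace ℝ (Fin d) → ℂ, Continuous g → ∫⁻ x, ‖g x‖ₑ ^ q ≠ ∞ → Integrable (fun x => (starRingEnd ℂ) (Nq q (S x)) * g x) := by
    intro g gc ng
    refine int_tri q hq (fun x => ‖S x‖ₑ) (fun x => ‖S x‖ₑ) (fun x => ‖g x‖ₑ) _ mS mS gc.measurable.enorm nS nS ng ?_ 1 (by simp) ?_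
    · exact ((Complex.continuous_conj.comp (Nc.comp Sc)).mul gc).aestronglyMeasurable
    · intro x
      rw [enorm_mul, one_mul]
      refine mul_le_mul_left (le_of_eq ?_) _
      rw [← nN, ← ofReal_norm, ← ofReal_norm, Complex.norm_conj]
  set L : Fin d → EuclideanSpace ℝ (Fin d) → ℂ := fun i x => lineDeriv ℝ (fun y => Nq q (S y)) x (EuclideanSpace.single i 1) with hL
  have Lm : ∀ i, Measurable (L i) := fun i => measurable_lineDeriv (Nc.comp Sc)
  have Lle : ∀ i x, ‖L i x‖ ≤ q * ‖S x‖ ^ (q-2) * ‖dS i x‖ := by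
    intro i x
    have := Nq_deriv q hq (fun t : ℝ => S (x + t • EuclideanSpace.single i 1)) (dS i x) 0 (hdS i x)
    simpa [hL, lineDeriv] using this
  have hG : ∀ i x, HasLineDerivAt ℝ (fun y => (starRingEnd ℂ) (Nq q (S y))) ((starRingEnd ℂ) (L i x)) x (EuclideanSpace.single i 1) := by
    intro i x
    have h1 : DifferentiableAt ℝ (fun t : ℝ => Nq q (S (x + t • EuclideanSpace.single i 1))) 0 :=
      (Nq_diff q hq _).comp (0:ℝ) (hdS i x).differentiableAt
    exact (Complex.conjCLE.toContinuousLinearMap.hasFDerivAt).comp_hasDerivAt (0:ℝ) h1.hasDerivAt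
  have Jint : ∀ i, Integrable fun x => ‖S x‖ ^ (q-2) * ‖dS i x‖ * ‖h i x‖ := by
    intro i
    have := int_tri q hq (fun x => ‖S x‖ₑ) (fun x => ‖dS i x‖ₑ) (fun x => ‖h i x‖ₑ) (fun x => ((‖S x‖ ^ (q-2) * ‖dS i x‖ * ‖h i x‖ : ℝ) : ℂ)) mS
      (dSc i).measurable.enorm (hc i).measurable.enorm nS (ndS i) (nh i) ?_ 1 (by simp) ?_
    · have h2 := this.re
      simpa using h2
    · refine Continuous.aestronglyMeasurable ?_
      refine Complex.continuous_ofReal.comp ?_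
      exact (((Sc.norm.rpow_const (fun _ => Or.inr hq2)).mul (dSc i).norm).mul (hc i).norm)
    · intro x
      rw [one_mul, ← ofReal_norm, Complex.norm_real, Real.norm_of_nonneg (by positivity), ENNReal.ofReal_mul (by positivity),
        ENNReal.ofReal_mul (by positivity), real_enorm _ _ hq2, ofReal_norm, ofReal_norm]
  have iL : ∀ i, Integrable (fun x => (starRingEnd ℂ) (L i x) * h i x) := by
    intro i
    refine ((Jint i).const_mul q).mono' ?_ (Eventually.of_forall fun x => ?_)
    · exact ((Complex.continuous_conj.measurable.comp (Lm i)).mul (hc i).measurable).aestronglyMeasurable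
    · rw [norm_mul, Complex.norm_conj]
      calc _ ≤ (q * ‖S x‖ ^ (q-2) * ‖dS i x‖) * ‖h i x‖ := by gcongr; exact Lle i x
        _ = _ := by ring
  have ibp : ∀ i, ∫ x, (starRingEnd ℂ) (Nq q (S x)) * dh i x = - ∫ x, (starRingEnd ℂ) (L i x) * h i x := by
    intro i
    have := integral_bilinear_hasLineDerivAt_right_eq_neg_left_of_integrable (μ := (volume : Measure (EuclideanSpace ℝ (Fin d))))
      (f := fun x => (starRingEnd ℂ) (Nq q (S x))) (f' := fun x => (starRingEnd ℂ) (L i x)) (g := h i) (g' := dh i)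
      (v := EuclideanSpace.single i 1) (B := ContinuousLinearMap.mul ℝ ℂ) (iL i) (iN _ (dhc i) (ndh i)) (iN _ (hc i) (nh i))
      (fun x _ => hG i x) (fun x _ => hdh i x)
    exact this
  set J : Fin d → ℝ := fun i => ∫ x, ‖S x‖ ^ (q-2) * ‖dS i x‖ * ‖h i x‖ with hJ
  have hre : ∫ x, ((starRingEnd ℂ) (Nq q (S x)) * f x).re ≤ q * ∑ i, J i := by
    have e1 : ∫ x, ((starRingEnd ℂ) (Nq q (S x)) * f x).re = (∫ x, (starRingEnd ℂ) (Nq q (S x)) * f x).re :=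
      integral_re (iN f fc nf)
    have e2 : ∫ x, (starRingEnd ℂ) (Nq q (S x)) * f x = ∑ i, - ∫ x, (starRingEnd ℂ) (L i x) * h i x := by
      simp_rw [hf, Finset.mul_sum]
      rw [integral_finsetSum _ (fun i _ => iN _ (dhc i) (ndh i))]
      exact Finset.sum_congr rfl fun i _ => ibp i
    rw [e1, e2]
    refine (Complex.re_le_norm _).trans ((norm_sum_le _ _).trans ?_)
    rw [Finset.mul_sum]
    refine Finset.sum_le_sum fun i _ => ?_
    rw [norm_neg, hJ, ← integral_const_mul]
    refine (norm_integral_le_integral_norm _).trans ?_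
    refine integral_mono (iL i).norm ((Jint i).const_mul q) fun x => ?_
    simp only [norm_mul, Complex.norm_conj]
    calc _ ≤ (q * ‖S x‖ ^ (q-2) * ‖dS i x‖) * ‖h i x‖ := by gcongr; exact Lle i x
        _ = _ := by ring
  have Qint : Integrable fun x => (‖S x‖ + ‖f x‖) ^ (q-2) * ‖f x‖ ^ 2 := by
    have := int_tri q hq (fun x => ‖S x‖ₑ + ‖f x‖ₑ) (fun x => ‖f x‖ₑ) (fun x => ‖f x‖ₑ) (fun x => (((‖S x‖ + ‖f x‖) ^ (q-2) * ‖f x‖ ^ 2 : ℝ) : ℂ)) (mS.add mf)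
      mf mf nSf nf nf ?_ 1 (by simp) ?_
    · have h2 := this.re
      exact h2
    · refine Continuous.aestronglyMeasurable ?_
      refine Complex.continuous_ofReal.comp ?_
      exact (((Sc.norm.add fc.norm).rpow_const (fun _ => Or.inr hq2)).mul (fc.norm.pow 2))
    · intro x
      rw [one_mul, ← ofReal_norm, Complex.norm_real, Real.norm_of_nonneg (by positivity), ENNReal.ofReal_mul (by positivity),
        ← ENNReal.ofReal_rpow_of_nonneg (by positivity) hq2, ENNReal.ofReal_add (by positivity) (by positivity), pow_two, ENNReal.ofReal_mul (by positivity), ofReal_norm, ofReal_norm, mul_assoc]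
  have hpw : ∀ g : EuclideanSpace ℝ (Fin d) → ℂ, Continuous g → ∫⁻ x, ‖g x‖ₑ ^ q ≠ ∞ → Integrable (fun x => ‖g x‖ ^ q) := by
    intro g gc ng
    refine ⟨(gc.norm.rpow_const (fun _ => Or.inr hq0.le)).aestronglyMeasurable, ?_⟩
    rw [hasFiniteIntegral_iff_ofReal (Eventually.of_forall fun x => by positivity)]
    simp_rw [real_enorm _ _ hq0.le]
    exact ng.lt_top
  have hpe : ∀ g : EuclideanSpace ℝ (Fin d) → ℂ, Continuous g → ∫⁻ x, ‖g x‖ₑ ^ q ≠ ∞ → ∫⁻ x, ‖g x‖ₑ ^ q = ENNReal.ofReal (∫ x, ‖g x‖ ^ q) := by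
    intro g gc ng
    rw [ofReal_integral_eq_lintegral_ofReal (hpw g gc ng) (Eventually.of_forall fun x => by positivity)]
    simp_rw [real_enorm _ _ hq0.le]
  have nT : ∫⁻ x, ‖S x + f x‖ₑ ^ q ≠ ∞ := by
    refine ne_top_of_le_ne_top nSf (lintegral_mono fun x => ?_)
    exact ENNReal.rpow_le_rpow (enorm_add_le _ _) hq0.le
  rw [hpe (fun x => S x + f x) (Sc.add fc) nT, hpe S Sc nS]
  have eQ : ∫⁻ x, (‖S x‖ₑ + ‖f x‖ₑ) ^ (q-2) * ‖f x‖ₑ * ‖f x‖ₑ = ENNReal.ofReal (∫ x, (‖S x‖ + ‖f x‖) ^ (q-2) * ‖f x‖ ^ 2) := by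
    rw [ofReal_integral_eq_lintegral_ofReal Qint (Eventually.of_forall fun x => by positivity)]
    refine lintegral_congr fun x => ?_
    rw [ENNReal.ofReal_mul (by positivity),
        ← ENNReal.ofReal_rpow_of_nonneg (by positivity) hq2, ENNReal.ofReal_add (by positivity) (by positivity), pow_two, ENNReal.ofReal_mul (by positivity), ofReal_norm, ofReal_norm, mul_assoc]
  have eJ : ∀ i, ∫⁻ x, ‖S x‖ₑ ^ (q-2) * ‖dS i x‖ₑ * ‖h i x‖ₑ = ENNReal.ofReal (J i) := by
    intro i
    rw [hJ, ofReal_integral_eq_lintegral_ofReal (Jint i) (Eventually.of_forall fun x => by positivity)]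
    refine lintegral_congr fun x => ?_
    rw [ENNReal.ofReal_mul (by positivity),
        ENNReal.ofReal_mul (by positivity), real_enorm _ _ hq2, ofReal_norm, ofReal_norm]
  simp_rw [eQ, eJ]
  have J0 : ∀ i, 0 ≤ J i := fun i => integral_nonneg fun x => by positivity
  have Q0 : 0 ≤ ∫ x, (‖S x‖ + ‖f x‖) ^ (q-2) * ‖f x‖ ^ 2 := integral_nonneg fun x => by positivity
  rw [← ENNReal.ofReal_sum_of_nonneg (fun i _ => J0 i), ← ENNReal.ofReal_add Q0 (Finset.sum_nonneg fun i _ => J0 i),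
    ← ENNReal.ofReal_mul (by positivity), ← ENNReal.ofReal_add (integral_nonneg fun x => by positivity) (mul_nonneg (by positivity) (add_nonneg Q0 (Finset.sum_nonneg fun i _ => J0 i)))]
  apply ENNReal.ofReal_le_ofReal
  have iR : Integrable fun x => ((starRingEnd ℂ) (Nq q (S x)) * f x).re := (iN f fc nf).re
  have main : ∫ x, ‖S x + f x‖ ^ q ≤ ∫ x, (‖S x‖ ^ q + q * ((starRingEnd ℂ) (Nq q (S x)) * f x).re + q ^ 2 * ((‖S x‖ + ‖f x‖) ^ (q-2) * ‖f x‖ ^ 2)) := by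
    refine integral_mono (hpw _ (Sc.add fc) nT) (((hpw S Sc nS).add (iR.const_mul q)).add (Qint.const_mul _)) fun x => ?_
    exact taylor_q q hq (S x) (f x)
  rw [integral_add ((hpw S Sc nS).fun_add (iR.const_mul q)) (Qint.const_mul _), integral_add (hpw S Sc nS) (iR.const_mul q), integral_const_mul, integral_const_mul] at main
  have := mul_le_mul_of_nonneg_left hre hq0.le
  nlinarith

end Strich

set_option linter.unusedVariables false
set_option linter.unusedSectionVars false
namespace Strich
open Filter Topology

variable {d : ℕ}

lemma lp_scalar (q : ℝ) (hq : 2 < q) (K : ℝ) (hK : 0 ≤ K) (s b a T : ℕ → ℝ) (N : ℕ)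
    (s0 : ∀ n, 0 ≤ s n) (b0 : ∀ n, 0 ≤ b n) (hT0 : T 0 = a 0 / 2) (hT : ∀ n, T (n+1) = (T n + a (n+1)) / 2)
    (h0 : s 0 ≤ a 0) (hba : ∀ n, b n ≤ a n) (hbs : ∀ n, b (n+1) ≤ s n + s (n+1))
    (hst : ∀ n, s (n+1) ^ q ≤ s n ^ q + K * ((s n + b (n+1)) ^ (q-2) * b (n+1) ^ 2 + s n ^ (q-2) * (T n * a (n+1)))) :
    s N ^ 2 ≤ (1 + 2 * K * 3 ^ (q-2)) * ∑ k ∈ Finset.range (N+1), a k ^ 2 := by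
  have hr : 0 ≤ q - 2 := by linarith
  have a0 : ∀ n, 0 ≤ a n := fun n => (b0 n).trans (hba n)
  have T0 : ∀ n, 0 ≤ T n := by
    intro n
    induction n with
    | zero => rw [hT0]; linarith [a0 0]
    | succ n ih => rw [hT]; linarith [a0 (n+1)]
  obtain ⟨m, hm, hmax⟩ := Finset.exists_max_image (Finset.range (N+1)) s ⟨0, by simp⟩
  set M := s m with hM
  have hM0 : 0 ≤ M := s0 m
  have hmN : m ≤ N := by simpa [Nat.lt_succ_iff] using hm
  have hle : ∀ k, k ≤ N → s k ≤ M := fun k hk => hmax k (by simpa [Nat.lt_succ_iff] using hk)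
  set c : ℝ := (3:ℝ) ^ (q-2) with hc
  have hc1 : 1 ≤ c := Real.one_le_rpow (by norm_num) hr
  have hMr : 0 ≤ M ^ (q-2) := Real.rpow_nonneg hM0 _
  have step : ∀ n, n + 1 ≤ N → s (n+1) ^ q ≤ s n ^ q + K * c * M ^ (q-2) * (a (n+1) ^ 2 + T n * a (n+1)) := by
    intro n hn
    refine (hst n).trans ?_
    have e1 : (s n + b (n+1)) ^ (q-2) ≤ c * M ^ (q-2) := by
      rw [hc, ← Real.mul_rpow (by norm_num) hM0]
      refine Real.rpow_le_rpow (add_nonneg (s0 n) (b0 _)) ?_ hr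
      linarith [hbs n, hle n (by omega), hle (n+1) hn]
    have e2 : s n ^ (q-2) ≤ c * M ^ (q-2) := by
      have : s n ^ (q-2) ≤ M ^ (q-2) := Real.rpow_le_rpow (s0 n) (hle n (by omega)) hr
      nlinarith
    have e3 : b (n+1) ^ 2 ≤ a (n+1) ^ 2 := pow_le_pow_left₀ (b0 _) (hba _) 2
    have e4 : 0 ≤ T n * a (n+1) := mul_nonneg (T0 n) (a0 _)
    have : K * ((s n + b (n+1)) ^ (q-2) * b (n+1) ^ 2 + s n ^ (q-2) * (T n * a (n+1))) ≤ K * ((c * M ^ (q-2)) * a (n+1) ^ 2 + (c * M ^ (q-2)) * (T n * a (n+1))) := by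
      gcongr
    linarith
  have tele : ∀ n, n ≤ N → s n ^ q ≤ s 0 ^ q + K * c * M ^ (q-2) * ∑ k ∈ Finset.range n, (a (k+1) ^ 2 + T k * a (k+1)) := by
    intro n hn
    induction n with
    | zero => simp
    | succ n ih =>
      rw [Finset.sum_range_succ, mul_add]
      linarith [ih (by omega), step n hn]
  have hTs : ∀ n, ∑ k ∈ Finset.range (n+1), T k ^ 2 + T n ^ 2 ≤ ∑ k ∈ Finset.range (n+1), a k ^ 2 := by
    intro n
    induction n with
    | zero => simp [hT0]; nlinarith [sq_nonneg (a 0)]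
    | succ n ih =>
      rw [Finset.sum_range_succ, Finset.sum_range_succ _ (n+1), hT]
      nlinarith [sq_nonneg (T n - a (n+1))]
  set A := ∑ k ∈ Finset.range (N+1), a k ^ 2 with hA
  have hsum : ∑ k ∈ Finset.range m, (a (k+1) ^ 2 + T k * a (k+1)) ≤ 2 * A := by
    have h1 : ∑ k ∈ Finset.range m, (a (k+1) ^ 2 + T k * a (k+1)) ≤ ∑ k ∈ Finset.range m, (3/2 * a (k+1) ^ 2 + 1/2 * T k ^ 2) := by
      refine Finset.sum_le_sum fun k _ => ?_
      nlinarith [sq_nonneg (T k - a (k+1))]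
    have h2 : ∑ k ∈ Finset.range m, a (k+1) ^ 2 ≤ A := by
      rw [hA, Finset.sum_range_succ']
      have : ∑ k ∈ Finset.range m, a (k+1) ^ 2 ≤ ∑ k ∈ Finset.range N, a (k+1) ^ 2 :=
        Finset.sum_le_sum_of_subset_of_nonneg (Finset.range_mono hmN) (fun _ _ _ => sq_nonneg _)
      nlinarith [sq_nonneg (a 0)]
    have h3 : ∑ k ∈ Finset.range m, T k ^ 2 ≤ A := by
      have : ∑ k ∈ Finset.range m, T k ^ 2 ≤ ∑ k ∈ Finset.range (N+1), T k ^ 2 :=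
        Finset.sum_le_sum_of_subset_of_nonneg (Finset.range_mono (by omega)) (fun _ _ _ => sq_nonneg _)
      nlinarith [hTs N, sq_nonneg (T N)]
    refine h1.trans ?_
    rw [Finset.sum_add_distrib, ← Finset.mul_sum, ← Finset.mul_sum]
    linarith
  have hAa : a 0 ^ 2 ≤ A := by
    rw [hA, Finset.sum_range_succ']
    have : 0 ≤ ∑ k ∈ Finset.range N, a (k+1) ^ 2 := Finset.sum_nonneg fun _ _ => sq_nonneg _
    linarith
  have e : ∀ x : ℝ, 0 ≤ x → x ^ q = x ^ (q-2) * x ^ 2 := by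
    intro x hx
    rw [← Real.rpow_two, ← Real.rpow_add_of_nonneg hx hr (by norm_num)]; congr 1; ring
  have h00 : s 0 ^ q ≤ M ^ (q-2) * A := by
    rw [e _ (s0 0)]
    refine mul_le_mul (Real.rpow_le_rpow (s0 0) (hle 0 (by omega)) hr) ?_ (sq_nonneg _) hMr
    exact (pow_le_pow_left₀ (s0 0) h0 2).trans hAa
  have fin : M ^ (q-2) * M ^ 2 ≤ M ^ (q-2) * ((1 + 2 * K * c) * A) := by
    rw [← e M hM0]
    have h1 := tele m hmN
    have h2 := mul_le_mul_of_nonneg_left hsum (by positivity : 0 ≤ K * c * M ^ (q-2))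
    rw [← hM] at h1
    nlinarith
  have hA0 : 0 ≤ A := Finset.sum_nonneg fun _ _ => sq_nonneg _
  have hN : s N ^ 2 ≤ M ^ 2 := pow_le_pow_left₀ (s0 N) (hle N le_rfl) 2
  refine hN.trans ?_
  rcases eq_or_lt_of_le hM0 with h | h
  · rw [← h]; simp; positivity
  · exact le_of_mul_le_mul_left fin (Real.rpow_pos_of_pos h _)

lemma Ef_lineDeriv (φ : EuclideanSpace ℝ (Fin d) → ℂ) (hφ : Integrable φ) (R : ℝ)
    (hs : ∀ ξ, φ ξ ≠ 0 → ‖ξ‖ ≤ R) (i : Fin d) (x : EuclideanSpace ℝ (Fin d)) :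
    HasLineDerivAt ℝ (Ef φ) (Ef (fun ξ => (2 * π * I * ((ξ i : ℝ) : ℂ)) * φ ξ) x) x (EuclideanSpace.single i 1) := by
  have hin : ∀ (s : ℝ) (ξ : EuclideanSpace ℝ (Fin d)), ⟪x + s • EuclideanSpace.single i (1:ℝ), ξ⟫ = ⟪x, ξ⟫ + s * ξ i := by
    intro s ξ
    rw [inner_add_left, real_inner_smul_left, EuclideanSpace.inner_single_left]; simp
  have hR : ∀ ξ, ‖φ ξ‖ * |ξ i| ≤ R * ‖φ ξ‖ := by
    intro ξ
    by_cases h : φ ξ = 0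
    · simp [h]
    · have h1 := hs ξ h
      have h2 : ‖ξ i‖ ≤ ‖ξ‖ := PiLp.norm_apply_le ξ i
      rw [Real.norm_eq_abs] at h2
      nlinarith [norm_nonneg (φ ξ)]
  have key := hasDerivAt_integral_of_dominated_loc_of_deriv_le (μ := (volume : Measure (EuclideanSpace ℝ (Fin d)))) (𝕜 := ℝ)
    (F := fun (s : ℝ) (ξ : EuclideanSpace ℝ (Fin d)) => cexp (2 * π * I * ((⟪x, ξ⟫ + s * ξ i : ℝ) : ℂ)) * φ ξ)
    (F' := fun (s : ℝ) (ξ : EuclideanSpace ℝ (Fin d)) => cexp (2 * π * I * ((⟪x, ξ⟫ + s * ξ i : ℝ) : ℂ)) * ((2 * π * I * ((ξ i : ℝ) : ℂ)) * φ ξ))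
    (x₀ := 0) (s := Set.univ) (bound := fun ξ => 2 * π * (R * ‖φ ξ‖)) univ_mem ?_ ?_ ?_ ?_ ?_ ?_
  · have h2 := key.2
    unfold HasLineDerivAt Ef
    simp only [zero_mul, add_zero] at h2
    refine h2.congr_of_eventuallyEq (Eventually.of_forall fun s => ?_)
    simp only [hin]
  · refine Eventually.of_forall fun s => ?_
    refine AEStronglyMeasurable.mul (Continuous.aestronglyMeasurable ?_) hφ.1
    fun_prop
  · refine hφ.norm.mono' ?_ (Eventually.of_forall fun ξ => ?_)
    · refine AEStronglyMeasurable.mul (Continuous.aestronglyMeasurable ?_) hφ.1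
      fun_prop
    · rw [norm_mul, norm_e2, one_mul]
  · refine AEStronglyMeasurable.mul (Continuous.aestronglyMeasurable ?_) (AEStronglyMeasurable.mul (Continuous.aestronglyMeasurable ?_) hφ.1)
    · fun_prop
    · fun_prop
  · refine Eventually.of_forall fun ξ s _ => ?_
    rw [norm_mul, norm_e2, one_mul, norm_mul]
    simp only [norm_mul, Complex.norm_real, Complex.norm_I, Complex.norm_ofNat, mul_one, Real.norm_eq_abs, abs_of_pos Real.pi_pos]
    have := hR ξ
    have := mul_le_mul_of_nonneg_left this (by positivity : 0 ≤ 2 * π)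
    linarith
  · exact (hφ.norm.const_mul R).const_mul _
  · refine Eventually.of_forall fun ξ s _ => ?_
    have h1 : HasDerivAt (fun s : ℝ => 2 * π * I * ((⟪x, ξ⟫ + s * ξ i : ℝ) : ℂ)) (2 * π * I * ((ξ i : ℝ):ℂ)) s := by
      have h0 : HasDerivAt (fun s : ℝ => ⟪x, ξ⟫ + s * ξ i) (ξ i) s := by
        simpa using ((hasDerivAt_id s).mul_const (ξ i)).const_add ⟪x, ξ⟫
      exact (h0.ofReal_comp).const_mul _
    refine (h1.cexp.mul_const (φ ξ)).congr_deriv ?_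
    ring

end Strich

set_option linter.unusedVariables false
set_option linter.unusedSectionVars false
namespace Strich
open Filter Topology

variable {d : ℕ}

noncomputable def nq (q : ℝ) (f : EuclideanSpace ℝ (Fin d) → ℂ) : ℝ≥0∞ := (∫⁻ x, ‖f x‖ₑ ^ q) ^ (1/q)

lemma nq_pow (q : ℝ) (hq : 0 < q) (f : EuclideanSpace ℝ (Fin d) → ℂ) : ∫⁻ x, ‖f x‖ₑ ^ q = nq q f ^ q := by
  unfold nq; rw [← ENNReal.rpow_mul, one_div, inv_mul_cancel₀ hq.ne', ENNReal.rpow_one]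

lemma nq_fin (q : ℝ) (hq : 0 < q) (f : EuclideanSpace ℝ (Fin d) → ℂ) (h : nq q f ≠ ∞) : ∫⁻ x, ‖f x‖ₑ ^ q ≠ ∞ := by
  rw [nq_pow q hq]; exact ENNReal.rpow_ne_top_of_nonneg hq.le h

lemma nq_add' (q : ℝ) (hq : 1 ≤ q) (f g : EuclideanSpace ℝ (Fin d) → ℂ) (hf : Continuous f) (hg : Continuous g) :
    (∫⁻ x, (‖f x‖ₑ + ‖g x‖ₑ) ^ q) ^ (1/q) ≤ nq q f + nq q g :=
  ENNReal.lintegral_Lp_add_le hf.measurable.enorm.aemeasurable hg.measurable.enorm.aemeasurable hq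

lemma nq_add (q : ℝ) (hq : 1 ≤ q) (f g : EuclideanSpace ℝ (Fin d) → ℂ) (hf : Continuous f) (hg : Continuous g) :
    nq q (fun x => f x + g x) ≤ nq q f + nq q g := by
  refine le_trans ?_ (nq_add' q hq f g hf hg)
  unfold nq
  refine ENNReal.rpow_le_rpow (lintegral_mono fun x => ?_) (by positivity)
  exact ENNReal.rpow_le_rpow (enorm_add_le _ _) (by linarith)

lemma nq_mul (q : ℝ) (hq : 0 < q) (c : ℂ) (f : EuclideanSpace ℝ (Fin d) → ℂ) (hf : Continuous f) :
    nq q (fun x => c * f x) = ‖c‖ₑ * nq q f := by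
  unfold nq
  simp_rw [enorm_mul, ENNReal.mul_rpow_of_nonneg _ _ hq.le]
  rw [lintegral_const_mul _ (by have := hf.measurable; fun_prop), ENNReal.mul_rpow_of_nonneg _ _ (by positivity), ← ENNReal.rpow_mul,
    mul_one_div_cancel hq.ne', ENNReal.rpow_one]

noncomputable def Tq (a : ℕ → ℝ) : ℕ → ℝ
  | 0 => a 0 / 2
  | n+1 => (Tq a n + a (n+1)) / 2

lemma Tq_nonneg (a : ℕ → ℝ) (ha : ∀ n, 0 ≤ a n) (n) : 0 ≤ Tq a n := by
  induction n with
  | zero => simp only [Tq]; linarith [ha 0]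
  | succ n ih => simp only [Tq]; linarith [ha (n+1)]

set_option maxHeartbeats 800000 in
lemma lp_abs (q : ℝ) (hq : 2 < q) (f : ℕ → EuclideanSpace ℝ (Fin d) → ℂ) (df h dh : ℕ → Fin d → EuclideanSpace ℝ (Fin d) → ℂ)
    (fc : ∀ n, Continuous (f n)) (dfc : ∀ n i, Continuous (df n i)) (hc : ∀ n i, Continuous (h n i)) (dhc : ∀ n i, Continuous (dh n i))
    (hdf : ∀ n i x, HasLineDerivAt ℝ (f n) (df n i x) x (EuclideanSpace.single i 1))
    (hdh : ∀ n i x, HasLineDerivAt ℝ (h n i) (dh n i x) x (EuclideanSpace.single i 1))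
    (hf : ∀ n x, f (n+1) x = ∑ i, dh (n+1) i x)
    (a : ℕ → ℝ) (ha : ∀ n, 0 ≤ a n) (nf : ∀ n, nq q (f n) ≤ ENNReal.ofReal (a n))
    (ndf : ∀ n i, nq q (df n i) ≤ ENNReal.ofReal (2 ^ n * a n)) (nh : ∀ n i, nq q (h n i) ≤ ENNReal.ofReal ((2 ^ n)⁻¹ * a n))
    (ndh : ∀ n i, nq q (dh n i) ≠ ∞) (N : ℕ) :
    nq q (fun x => ∑ k ∈ Finset.range (N+1), f k x) ^ 2 ≤
      ENNReal.ofReal ((1 + 2 * (q^2 * (1 + d)) * 3 ^ (q-2)) * ∑ k ∈ Finset.range (N+1), a k ^ 2) := by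
  have hq0 : 0 < q := by linarith
  have hq1 : 1 ≤ q := by linarith
  have hq2 : 0 ≤ q - 2 := by linarith
  have hot : ∀ {y : ℝ≥0∞} {r : ℝ}, y ≤ ENNReal.ofReal r → y ≠ ∞ := fun h => ne_top_of_le_ne_top ENNReal.ofReal_ne_top h
  set S : ℕ → EuclideanSpace ℝ (Fin d) → ℂ := fun n x => ∑ k ∈ Finset.range (n+1), f k x with hS
  set dS : ℕ → Fin d → EuclideanSpace ℝ (Fin d) → ℂ := fun n i x => ∑ k ∈ Finset.range (n+1), df k i x with hdS
  have Sc : ∀ n, Continuous (S n) := fun n => continuous_finset_sum _ fun k _ => fc k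
  have dSc : ∀ n i, Continuous (dS n i) := fun n i => continuous_finset_sum _ fun k _ => dfc k i
  have Sd : ∀ n i x, HasLineDerivAt ℝ (S n) (dS n i x) x (EuclideanSpace.single i 1) := by
    intro n i x
    exact HasDerivAt.fun_sum fun k _ => hdf k i x
  have Ss : ∀ n, S (n+1) = fun x => S n x + f (n+1) x := by
    intro n; funext x; simp only [hS]; rw [Finset.sum_range_succ]
  have dSs : ∀ n i, dS (n+1) i = fun x => dS n i x + df (n+1) i x := by
    intro n i; funext x; simp only [hdS]; rw [Finset.sum_range_succ]
  have S0 : S 0 = f 0 := by funext x; simp [hS]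
  have dS0 : ∀ i, dS 0 i = df 0 i := by intro i; funext x; simp [hdS]
  have ndS : ∀ n i, nq q (dS n i) ≤ ENNReal.ofReal (2 ^ (n+1) * Tq a n) := by
    intro n i
    induction n with
    | zero =>
      rw [dS0]; refine (ndf 0 i).trans (le_of_eq ?_); simp only [Tq]; congr 1; ring
    | succ n ih =>
      rw [dSs]
      refine (nq_add q hq1 _ _ (dSc n i) (dfc _ i)).trans ((add_le_add ih (ndf _ i)).trans ?_)
      rw [← ENNReal.ofReal_add (by have := Tq_nonneg a ha n; positivity) (by have := ha (n+1); positivity)]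
      refine le_of_eq ?_
      congr 1; simp only [Tq]; ring
  have nSf : ∀ n, nq q (S n) ≠ ∞ := by
    intro n
    induction n with
    | zero => rw [S0]; exact hot (nf 0)
    | succ n ih =>
      rw [Ss]
      exact ne_top_of_le_ne_top (ENNReal.add_ne_top.2 ⟨ih, hot (nf (n+1))⟩) (nq_add q hq1 _ _ (Sc n) (fc _))
  have eS : ∀ n, nq q (S n) = ENNReal.ofReal (nq q (S n)).toReal := fun n => (ENNReal.ofReal_toReal (nSf n)).symm
  have ef : ∀ n, nq q (f n) = ENNReal.ofReal (nq q (f n)).toReal := fun n => (ENNReal.ofReal_toReal (hot (nf n))).symm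
  have key := lp_scalar q hq (q^2 * (1+d)) (by positivity) (fun n => (nq q (S n)).toReal) (fun n => (nq q (f n)).toReal) a (Tq a) N
    (fun n => ENNReal.toReal_nonneg) (fun n => ENNReal.toReal_nonneg) rfl (fun n => rfl) ?_ ?_ ?_ ?_
  · rw [eS N, ← ENNReal.ofReal_pow ENNReal.toReal_nonneg]
    exact ENNReal.ofReal_le_ofReal key
  · simp only [S0]; exact ENNReal.toReal_le_of_le_ofReal (ha 0) (nf 0)
  · intro n; exact ENNReal.toReal_le_of_le_ofReal (ha n) (nf n)
  · intro n
    rw [← ENNReal.toReal_add (nSf n) (nSf (n+1))]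
    refine ENNReal.toReal_mono (ENNReal.add_ne_top.2 ⟨nSf n, nSf (n+1)⟩) ?_
    have e1 : f (n+1) = fun x => S (n+1) x + (-1) * S n x := by funext x; rw [Ss]; ring
    have e2 := nq_add q hq1 (S (n+1)) (fun x => (-1) * S n x) (Sc _) (continuous_const.mul (Sc n))
    rw [← e1, nq_mul q hq0 _ _ (Sc n)] at e2
    simpa [add_comm] using e2
  · intro n
    have st := lp_step q hq (S n) (f (n+1)) (dS n) (h (n+1)) (dh (n+1)) (Sc n) (fc _) (dSc n) (hc _) (dhc _) (Sd n) (hdh _) (hf n)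
      (nq_fin q hq0 _ (nSf n)) (nq_fin q hq0 _ (hot (nf _))) (fun i => nq_fin q hq0 _ (hot (ndS n i))) (fun i => nq_fin q hq0 _ (hot (nh _ i)))
      (fun i => nq_fin q hq0 _ (ndh _ i))
    have es : ∫⁻ x, ‖S n x + f (n+1) x‖ₑ ^ q = nq q (S (n+1)) ^ q := by rw [← nq_pow q hq0, Ss]
    rw [es, nq_pow q hq0] at st
    set s := (nq q (S n)).toReal with hs
    set b := (nq q (f (n+1))).toReal with hb
    have s0 : 0 ≤ s := ENNReal.toReal_nonneg
    have b0 : 0 ≤ b := ENNReal.toReal_nonneg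
    have Tn := Tq_nonneg a ha n
    have an := ha (n+1)
    have h1 : ∫⁻ x, (‖S n x‖ₑ + ‖f (n+1) x‖ₑ) ^ (q-2) * ‖f (n+1) x‖ₑ * ‖f (n+1) x‖ₑ ≤ ENNReal.ofReal ((s + b) ^ (q-2) * b ^ 2) := by
      refine (holder3 q hq (fun x => ‖S n x‖ₑ + ‖f (n+1) x‖ₑ) (fun x => ‖f (n+1) x‖ₑ) (fun x => ‖f (n+1) x‖ₑ)
        ((Sc n).measurable.enorm.add (fc _).measurable.enorm) (fc _).measurable.enorm (fc _).measurable.enorm).trans ?_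
      rw [ENNReal.ofReal_mul (by positivity), ← ENNReal.ofReal_rpow_of_nonneg (by positivity) hq2, ENNReal.ofReal_add s0 b0, pow_two,
        ENNReal.ofReal_mul b0, hs, hb, ← eS, ← ef, ← mul_assoc]
      refine mul_le_mul_left (mul_le_mul_left (ENNReal.rpow_le_rpow ?_ hq2) _) _
      exact nq_add' q hq1 _ _ (Sc n) (fc _)
    have h2 : ∀ i, ∫⁻ x, ‖S n x‖ₑ ^ (q-2) * ‖dS n i x‖ₑ * ‖h (n+1) i x‖ₑ ≤ ENNReal.ofReal (s ^ (q-2) * (Tq a n * a (n+1))) := by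
      intro i
      refine (holder3 q hq (fun x => ‖S n x‖ₑ) (fun x => ‖dS n i x‖ₑ) (fun x => ‖h (n+1) i x‖ₑ)
        (Sc n).measurable.enorm (dSc n i).measurable.enorm (hc _ i).measurable.enorm).trans ?_
      have e3 : s ^ (q-2) * (Tq a n * a (n+1)) = s ^ (q-2) * ((2 ^ (n+1) * Tq a n) * ((2 ^ (n+1))⁻¹ * a (n+1))) := by
        field_simp
      rw [e3, ENNReal.ofReal_mul (by positivity), ← ENNReal.ofReal_rpow_of_nonneg (by positivity) hq2,
        ENNReal.ofReal_mul (by positivity), hs, ← eS, ← mul_assoc]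
      exact mul_le_mul' (mul_le_mul_right (ndS n i) _) (nh _ i)
    have h3 : ∑ i, ∫⁻ x, ‖S n x‖ₑ ^ (q-2) * ‖dS n i x‖ₑ * ‖h (n+1) i x‖ₑ ≤ ENNReal.ofReal (d * (s ^ (q-2) * (Tq a n * a (n+1)))) := by
      refine (Finset.sum_le_sum fun i _ => h2 i).trans (le_of_eq ?_)
      rw [Finset.sum_const, Finset.card_univ, Fintype.card_fin, nsmul_eq_mul, ENNReal.ofReal_mul (p := (d:ℝ)) (by positivity), ENNReal.ofReal_natCast]
    have st2 := st.trans (add_le_add_right (mul_le_mul_right (add_le_add h1 h3) _) _)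
    rw [eS n, eS (n+1), ← hs, ENNReal.ofReal_rpow_of_nonneg ENNReal.toReal_nonneg hq0.le, ENNReal.ofReal_rpow_of_nonneg s0 hq0.le,
      ← ENNReal.ofReal_add (by positivity) (by positivity), ← ENNReal.ofReal_mul (by positivity), ← ENNReal.ofReal_add (by positivity) (by positivity),
      ENNReal.ofReal_le_ofReal_iff (by positivity)] at st2
    refine st2.trans ?_
    have p1 : 0 ≤ (s + b) ^ (q-2) * b ^ 2 := by positivity
    have p2 : 0 ≤ s ^ (q-2) * (Tq a n * a (n+1)) := by positivity
    have p3 : (0:ℝ) ≤ d := by positivity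
    have p4 : (s + b) ^ (q-2) * b ^ 2 + d * (s ^ (q-2) * (Tq a n * a (n+1))) ≤ (1 + d) * ((s + b) ^ (q-2) * b ^ 2 + s ^ (q-2) * (Tq a n * a (n+1))) := by
      nlinarith [mul_nonneg p3 p1]
    have := mul_le_mul_of_nonneg_left p4 (by positivity : 0 ≤ q^2)
    linarith

end Strich

set_option linter.unusedVariables false
set_option linter.unusedSectionVars false
namespace Strich
open Filter Topology

variable {d : ℕ}

/-- dyadic shells -/
def An (d n : ℕ) : Set (EuclideanSpace ℝ (Fin d)) := {ξ | (n = 0 ∨ (2:ℝ)^n ≤ 2*‖ξ‖) ∧ ‖ξ‖ < 2^n}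

/-- multipliers used for the square function estimate -/
noncomputable def mu (n : ℕ) : Option (Fin d × Bool) → EuclideanSpace ℝ (Fin d) → ℂ
  | none, _ => 1
  | some (i, false), ξ => (((2:ℝ)^n)⁻¹ : ℝ) * (2*π*I*((ξ i:ℝ):ℂ))
  | some (i, true), ξ => if n = 0 then 0 else (((2:ℝ)^n : ℝ):ℂ) * ((ξ i : ℝ) : ℂ) / (2*π*I*((‖ξ‖^2:ℝ):ℂ))

noncomputable def pc (n : ℕ) (j : Option (Fin d × Bool)) (φ : EuclideanSpace ℝ (Fin d) → ℂ) (ξ : EuclideanSpace ℝ (Fin d)) : ℂ :=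
  (An d n).indicator (fun ξ => mu n j ξ * φ ξ) ξ

lemma An_meas (n : ℕ) : MeasurableSet (An d n) := by
  unfold An
  by_cases h : n = 0
  · simp only [h, true_or, true_and]
    exact measurableSet_lt (by fun_prop) (by fun_prop)
  · simp only [h, false_or]
    have h1 : MeasurableSet {ξ : EuclideanSpace ℝ (Fin d) | (2:ℝ)^n ≤ 2*‖ξ‖} := measurableSet_le (by fun_prop) (by fun_prop)
    have h2 : MeasurableSet {ξ : EuclideanSpace ℝ (Fin d) | ‖ξ‖ < (2:ℝ)^n} := measurableSet_lt (by fun_prop) (by fun_prop)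
    exact h1.inter h2

lemma mu_meas (n : ℕ) (j : Option (Fin d × Bool)) : Measurable (mu n j) := by
  match j with
  | none => exact measurable_const
  | some (i, false) => 
    change Measurable fun ξ : EuclideanSpace ℝ (Fin d) => ((((2:ℝ)^n)⁻¹ : ℝ):ℂ) * (2*π*I*((ξ i:ℝ):ℂ))
    exact Continuous.measurable (by fun_prop)
  | some (i, true) =>
    change Measurable fun ξ : EuclideanSpace ℝ (Fin d) => if n = 0 then (0:ℂ) else (((2:ℝ)^n : ℝ):ℂ) * ((ξ i : ℝ) : ℂ) / (2*π*I*((‖ξ‖^2:ℝ):ℂ))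
    by_cases h : n = 0
    · simp only [h, if_true]; exact measurable_const
    · simp only [h, if_false]
      exact Measurable.div (Continuous.measurable (by fun_prop)) (Continuous.measurable (by fun_prop))

lemma An_pos {n : ℕ} (hn : n ≠ 0) {ξ : EuclideanSpace ℝ (Fin d)} (h : ξ ∈ An d n) : (2:ℝ)^n ≤ 2*‖ξ‖ ∧ 0 < ‖ξ‖ := by
  have h1 : (2:ℝ)^n ≤ 2*‖ξ‖ := h.1.resolve_left hn
  have : (0:ℝ) < 2^n := by positivity
  exact ⟨h1, by linarith⟩

lemma mu_bound (n : ℕ) (j : Option (Fin d × Bool)) (ξ : EuclideanSpace ℝ (Fin d)) (h : ξ ∈ An d n) : ‖mu n j ξ‖ ≤ 7 := by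
  have hp := Real.pi_gt_three
  have hp2 := Real.pi_lt_d2
  match j with
  | none => change ‖(1:ℂ)‖ ≤ 7; norm_num
  | some (i, false) => 
    change ‖((((2:ℝ)^n)⁻¹ : ℝ):ℂ) * (2*π*I*((ξ i:ℝ):ℂ))‖ ≤ 7
    have h1 : |ξ i| ≤ 2^n := (PiLp.norm_apply_le ξ i).trans h.2.le
    rw [norm_mul, norm_mul, norm_mul, norm_mul, Complex.norm_real, Complex.norm_real, Complex.norm_real, Complex.norm_I, Real.norm_eq_abs, Real.norm_eq_abs,
      Real.norm_eq_abs, abs_of_pos (by positivity : (0:ℝ) < (2^n)⁻¹), abs_of_pos Real.pi_pos]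
    have : ((2:ℝ)^n)⁻¹ * |ξ i| ≤ 1 := by
      rw [inv_mul_le_iff₀ (by positivity)]; simpa using h1
    norm_num
    nlinarith [abs_nonneg (ξ i)]
  | some (i, true) =>
    change ‖if n = 0 then (0:ℂ) else (((2:ℝ)^n : ℝ):ℂ) * ((ξ i : ℝ) : ℂ) / (2*π*I*((‖ξ‖^2:ℝ):ℂ))‖ ≤ 7
    by_cases hn : n = 0
    · simp [hn]
    · simp only [hn, if_false]
      obtain ⟨h1, h0⟩ := An_pos hn h
      have h3 : |ξ i| ≤ ‖ξ‖ := PiLp.norm_apply_le ξ i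
      rw [norm_div, norm_mul, norm_mul, norm_mul, norm_mul, Complex.norm_real, Complex.norm_real, Complex.norm_real, Complex.norm_real, Complex.norm_I, Real.norm_eq_abs, Real.norm_eq_abs,
        Real.norm_eq_abs, Real.norm_eq_abs, abs_of_pos (by positivity : (0:ℝ) < (2^n)), abs_of_pos Real.pi_pos, abs_of_pos (by positivity : (0:ℝ) < ‖ξ‖^2)]
      rw [div_le_iff₀ (by norm_num; positivity)]
      norm_num
      have : (2:ℝ)^n * |ξ i| ≤ 2*‖ξ‖ * ‖ξ‖ := mul_le_mul h1 h3 (abs_nonneg _) (by positivity)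
      nlinarith [sq_nonneg ‖ξ‖]

lemma pc_meas (n : ℕ) (j : Option (Fin d × Bool)) (φ : EuclideanSpace ℝ (Fin d) → ℂ) (hφ : Measurable φ) : Measurable (pc n j φ) :=
  ((mu_meas n j).mul hφ).indicator (An_meas n)

lemma pc_supp (n : ℕ) (j : Option (Fin d × Bool)) (φ : EuclideanSpace ℝ (Fin d) → ℂ) (ξ) (h : pc n j φ ξ ≠ 0) : ξ ∈ An d n :=
  Set.mem_of_indicator_ne_zero h

lemma pc_phase (n : ℕ) (j : Option (Fin d × Bool)) (φ m : EuclideanSpace ℝ (Fin d) → ℂ) :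
    pc n j (fun ξ => m ξ * φ ξ) = fun ξ => m ξ * pc n j φ ξ := by
  funext ξ
  unfold pc
  by_cases h : ξ ∈ An d n
  · simp only [Set.indicator_of_mem h]; ring
  · simp only [Set.indicator_of_notMem h]; ring

lemma pc_enorm (n : ℕ) (j : Option (Fin d × Bool)) (φ : EuclideanSpace ℝ (Fin d) → ℂ) (ξ) :
    ‖pc n j φ ξ‖ₑ ≤ 7 * ‖(An d n).indicator φ ξ‖ₑ := by
  unfold pc
  by_cases h : ξ ∈ An d n
  · simp only [Set.indicator_of_mem h]
    rw [enorm_mul]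
    refine mul_le_mul_left ?_ _
    rw [← ofReal_norm]
    refine (ENNReal.ofReal_le_ofReal (mu_bound n j ξ h)).trans ?_
    norm_num
  · simp [Set.indicator_of_notMem h]

lemma pc_L2 (n : ℕ) (j : Option (Fin d × Bool)) (φ : EuclideanSpace ℝ (Fin d) → ℂ) (hφ : Measurable φ) :
    ∫⁻ ξ, ‖pc n j φ ξ‖ₑ ^ 2 ≤ 49 * ∫⁻ ξ, ‖(An d n).indicator φ ξ‖ₑ ^ 2 := by
  rw [← lintegral_const_mul _ ((hφ.indicator (An_meas n)).enorm.pow_const 2)]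
  refine lintegral_mono fun ξ => ?_
  refine (pow_le_pow_left' (pc_enorm n j φ ξ) 2).trans (le_of_eq ?_)
  rw [mul_pow]; norm_num

set_option maxHeartbeats 800000 in
lemma lp_thm (q : ℝ) (hq : 2 < q) : ∃ C : ℝ≥0∞, C ≠ ∞ ∧ ∀ φ : EuclideanSpace ℝ (Fin d) → ℂ, Measurable φ →
    (∀ n, ∫⁻ ξ, ‖(An d n).indicator φ ξ‖ₑ ^ 2 ≠ ∞) → ∀ N : ℕ,
    nq q (fun x => ∑ k ∈ Finset.range (N+1), Ef (pc k none φ) x) ^ 2 ≤ C * ∑ k ∈ Finset.range (N+1), ∑ j, nq q (Ef (pc k j φ)) ^ 2 := by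
  have hq0 : 0 < q := by linarith
  refine ⟨ENNReal.ofReal (1 + 2 * (q^2 * (1 + d)) * 3 ^ (q-2)), ENNReal.ofReal_ne_top, ?_⟩
  intro φ hφ h2 N
  obtain ⟨B, hB, hb⟩ := bernstein d q hq.le
  have s2 : ∀ n j, ∫⁻ ξ, ‖pc n j φ ξ‖ₑ ^ 2 ≠ ∞ := fun n j =>
    ne_top_of_le_ne_top (ENNReal.mul_ne_top (by norm_num) (h2 n)) (pc_L2 n j φ hφ)
  have sR : ∀ n j ξ, pc n j φ ξ ≠ 0 → ‖ξ‖ ≤ 2^n := fun n j ξ h => (pc_supp n j φ ξ h).2.le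
  have pm := fun n j => pc_meas n j φ hφ
  have fin0 : ∀ (ψ : EuclideanSpace ℝ (Fin d) → ℂ) (R : ℝ), 0 < R → Measurable ψ → (∀ ξ, ψ ξ ≠ 0 → ‖ξ‖ ≤ R) → (∫⁻ ξ, ‖ψ ξ‖ₑ ^ 2 ≠ ∞) → nq q (Ef ψ) ≠ ∞ := by
    intro ψ R hR hm hs h
    refine ne_top_of_le_ne_top ?_ (hb R hR ψ hm hs h)
    exact ENNReal.mul_ne_top (ENNReal.mul_ne_top hB ENNReal.ofReal_ne_top) (ENNReal.rpow_ne_top_of_nonneg (by norm_num) h)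
  have nfin : ∀ n j, nq q (Ef (pc n j φ)) ≠ ∞ := fun n j => fin0 _ (2^n) (by positivity) (pm n j) (sR n j) (s2 n j)
  have pint : ∀ n j, Integrable (pc n j φ) := fun n j => (supp_int _ (pm n j) (2^n) (sR n j) (s2 n j)).2.1
  have Ec : ∀ n j, Continuous (Ef (pc n j φ)) := fun n j => Ef_cont _ (pint n j)
  -- derivative symbol functions
  have d2 : ∀ n j i, ∫⁻ ξ, ‖(2*π*I*((ξ i:ℝ):ℂ)) * pc n j φ ξ‖ₑ ^ 2 ≠ ∞ := by
    intro n j i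
    refine ne_top_of_le_ne_top (b := ENNReal.ofReal (7*2^n) ^ 2 * ∫⁻ ξ, ‖pc n j φ ξ‖ₑ ^ 2) (ENNReal.mul_ne_top (by finiteness) (s2 n j)) ?_
    rw [← lintegral_const_mul _ ((pm n j).enorm.pow_const 2)]
    refine lintegral_mono fun ξ => ?_
    simp only [enorm_mul _ (pc n j φ ξ), mul_pow]
    by_cases h : pc n j φ ξ = 0
    · simp [h]
    · refine mul_le_mul_left (pow_le_pow_left' ?_ 2) _
      rw [← ofReal_norm]
      refine ENNReal.ofReal_le_ofReal ?_
      have h1 : |ξ i| ≤ 2^n := (PiLp.norm_apply_le ξ i).trans (sR n j ξ h)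
      rw [norm_mul, norm_mul, norm_mul, Complex.norm_real, Complex.norm_real, Complex.norm_I, Real.norm_eq_abs, Real.norm_eq_abs, abs_of_pos Real.pi_pos]
      norm_num
      have hp2 := Real.pi_lt_d2
      nlinarith [abs_nonneg (ξ i), Real.pi_pos]
  have dm : ∀ n j i, Measurable fun ξ : EuclideanSpace ℝ (Fin d) => (2*π*I*((ξ i:ℝ):ℂ)) * pc n j φ ξ := by
    intro n j i
    exact (Continuous.measurable (by fun_prop)).mul (pm n j)
  have ds : ∀ n j i (ξ : EuclideanSpace ℝ (Fin d)), (2*π*I*((ξ i:ℝ):ℂ)) * pc n j φ ξ ≠ 0 → ‖ξ‖ ≤ 2^n := fun n j i ξ h => sR n j ξ (right_ne_zero_of_mul h)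
  have dint : ∀ n j i, Integrable fun ξ : EuclideanSpace ℝ (Fin d) => (2*π*I*((ξ i:ℝ):ℂ)) * pc n j φ ξ := fun n j i =>
    (supp_int _ (dm n j i) (2^n) (ds n j i) (d2 n j i)).2.1
  have dc : ∀ n j i, Continuous (Ef fun ξ : EuclideanSpace ℝ (Fin d) => (2*π*I*((ξ i:ℝ):ℂ)) * pc n j φ ξ) := fun n j i => Ef_cont _ (dint n j i)
  have dfin : ∀ n j i, nq q (Ef fun ξ : EuclideanSpace ℝ (Fin d) => (2*π*I*((ξ i:ℝ):ℂ)) * pc n j φ ξ) ≠ ∞ := fun n j i =>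
    fin0 _ (2^n) (by positivity) (dm n j i) (ds n j i) (d2 n j i)
  have Emul : ∀ (c : ℂ) (ψ : EuclideanSpace ℝ (Fin d) → ℂ) x, Ef (fun ξ => c * ψ ξ) x = c * Ef ψ x := by
    intro c ψ x
    unfold Ef
    rw [← integral_const_mul]; congr 1; funext ξ; ring
  set a : ℕ → ℝ := fun n => Real.sqrt (∑ j, (nq q (Ef (pc n j φ))).toReal ^ 2) with ha
  have ale : ∀ n j, nq q (Ef (pc n j φ)) ≤ ENNReal.ofReal (a n) := by
    intro n j
    rw [← ENNReal.ofReal_toReal (nfin n j)]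
    refine ENNReal.ofReal_le_ofReal (Real.le_sqrt_of_sq_le ?_)
    exact Finset.single_le_sum (f := fun j => (nq q (Ef (pc n j φ))).toReal ^ 2) (fun j _ => by positivity) (Finset.mem_univ j)
  have asq : ∀ n, a n ^ 2 = ∑ j, (nq q (Ef (pc n j φ))).toReal ^ 2 := fun n => Real.sq_sqrt (Finset.sum_nonneg fun j _ => by positivity)
  have scal : ∀ (r : ℝ), 0 ≤ r → ‖(r:ℂ)‖ₑ = ENNReal.ofReal r := by
    intro r hr
    rw [← ofReal_norm, Complex.norm_real, Real.norm_of_nonneg hr]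
  have main := lp_abs q hq (fun n => Ef (pc n none φ)) (fun n i => Ef fun ξ => (2*π*I*((ξ i:ℝ):ℂ)) * pc n none φ ξ)
    (fun n i x => ((((2:ℝ)^n)⁻¹:ℝ):ℂ) * Ef (pc n (some (i,true)) φ) x)
    (fun n i x => ((((2:ℝ)^n)⁻¹:ℝ):ℂ) * Ef (fun ξ => (2*π*I*((ξ i:ℝ):ℂ)) * pc n (some (i,true)) φ ξ) x)
    (fun n => Ec n none) (fun n i => dc n none i) (fun n i => continuous_const.mul (Ec n _)) (fun n i => continuous_const.mul (dc n _ i))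
    (fun n i x => Ef_lineDeriv _ (pint n none) _ (sR n none) i x)
    (fun n i x => HasDerivAt.const_mul _ (Ef_lineDeriv _ (pint n _) _ (sR n _) i x))
    ?_ a (fun n => Real.sqrt_nonneg _) (fun n => ale n none) ?_ ?_ ?_ N
  · refine main.trans (le_of_eq ?_)
    rw [ENNReal.ofReal_mul (by positivity), ENNReal.ofReal_sum_of_nonneg (fun k _ => by positivity)]
    congr 1
    refine Finset.sum_congr rfl fun k _ => ?_
    rw [asq, ENNReal.ofReal_sum_of_nonneg (fun k _ => by positivity)]
    refine Finset.sum_congr rfl fun j _ => ?_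
    rw [ENNReal.ofReal_pow ENNReal.toReal_nonneg, ENNReal.ofReal_toReal (nfin k j)]
  · intro n x
    rw [← Finset.mul_sum]
    unfold Ef
    rw [← integral_finsetSum]
    · rw [← integral_const_mul]
      congr 1
      funext ξ
      rw [← Finset.mul_sum, mul_left_comm]
      congr 1
      unfold pc
      by_cases h : ξ ∈ An d (n+1)
      · simp only [Set.indicator_of_mem h]
        obtain ⟨h1, h0⟩ := An_pos (Nat.succ_ne_zero n) h
        have e : ∀ i, (2*π*I*((ξ i:ℝ):ℂ)) * (mu (n+1) (some (i,true)) ξ * φ ξ) = (((2:ℝ)^(n+1):ℝ):ℂ) * (((ξ i^2:ℝ):ℂ) * (((‖ξ‖^2:ℝ):ℂ)⁻¹ * φ ξ)) := by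
          intro i
          have : mu (n+1) (some (i,true)) ξ = (((2:ℝ)^(n+1) : ℝ):ℂ) * ((ξ i : ℝ) : ℂ) / (2*π*I*((‖ξ‖^2:ℝ):ℂ)) := rfl
          rw [this]
          have h5 : ((‖ξ‖:ℝ):ℂ) ≠ 0 := by exact_mod_cast h0.ne'
          have h6 : (π:ℂ) ≠ 0 := by exact_mod_cast Real.pi_ne_zero
          push_cast
          field_simp
        simp_rw [e]
        rw [← Finset.mul_sum, ← Finset.sum_mul, ← Complex.ofReal_sum]
        have e2 : ∑ i, ξ i ^ 2 = ‖ξ‖^2 := by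
          rw [EuclideanSpace.norm_sq_eq]; simp
        rw [e2]
        change 1 * φ ξ = _
        have h5 : ((‖ξ‖^2:ℝ):ℂ) ≠ 0 := by exact_mod_cast (by positivity)
        rw [mul_inv_cancel_left₀ h5, ← mul_assoc, ← Complex.ofReal_mul, inv_mul_cancel₀ (by positivity)]
        simp
      · simp [Set.indicator_of_notMem h]
    · intro i _
      refine (dint (n+1) (some (i,true)) i).norm.mono' ?_ ?_
      · exact (Continuous.measurable (by fun_prop)).aestronglyMeasurable.mul (dint (n+1) (some (i,true)) i).aestronglyMeasurable
      · refine Filter.Eventually.of_forall fun ξ => ?_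
        rw [norm_mul, norm_e2, one_mul]
  · intro n i
    have e : (Ef fun ξ => (2*π*I*((ξ i:ℝ):ℂ)) * pc n none φ ξ) = fun x => (((2:ℝ)^n:ℝ):ℂ) * Ef (pc n (some (i,false)) φ) x := by
      funext x
      rw [← Emul]
      congr 1
      funext ξ
      unfold pc
      by_cases h : ξ ∈ An d n
      · simp only [Set.indicator_of_mem h]
        change _ * (1 * φ ξ) = _ * ((((((2:ℝ)^n)⁻¹ : ℝ):ℂ) * (2*π*I*((ξ i:ℝ):ℂ))) * φ ξ)
        push_cast
        field_simp
      · simp [Set.indicator_of_notMem h]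
    rw [e, nq_mul q hq0 _ _ (Ec n _), scal _ (by positivity), ENNReal.ofReal_mul (by positivity)]
    exact mul_le_mul_right (ale n _) _
  · intro n i
    rw [nq_mul q hq0 _ _ (Ec n _), scal _ (by positivity), ENNReal.ofReal_mul (by positivity)]
    exact mul_le_mul_right (ale n _) _
  · intro n i
    rw [nq_mul q hq0 _ _ (dc n _ i), scal _ (by positivity)]
    exact ENNReal.mul_ne_top ENNReal.ofReal_ne_top (dfin n _ i)

end Strich

set_option linter.unusedVariables false
set_option linter.unusedSectionVars false
namespace Strich
open Filter Topology

variable {d : ℕ}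

lemma minkowski_sum {A ι : Type*} [MeasurableSpace A] [Countable ι] (μ : Measure A) [SigmaFinite μ]
    (b : ι → A → ℝ≥0∞) (hb : ∀ i, Measurable (b i)) (q : ℝ) (hq : 1 ≤ q) :
    (∫⁻ a, (∑' i, b i a) ^ q ∂μ) ^ (1/q) ≤ ∑' i, (∫⁻ a, b i a ^ q ∂μ) ^ (1/q) := by
  letI : MeasurableSpace ι := ⊤
  haveI : DiscreteMeasurableSpace ι := ⟨fun _ => trivial⟩
  have h := minkowski μ (Measure.count : Measure ι) (fun a i => b i a)
    (measurable_from_prod_countable_left fun i => hb i) q hq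
  simpa only [lintegral_count] using h

lemma Ef_phase_meas (ψ : EuclideanSpace ℝ (Fin d) → ℂ) (hψ : Measurable ψ) :
    Measurable (Function.uncurry fun t : ℝ => Ef fun ξ => phase t ξ * ψ ξ) := by
  unfold Ef
  refine (StronglyMeasurable.integral_prod_right' (f := fun w : (ℝ × EuclideanSpace ℝ (Fin d)) × EuclideanSpace ℝ (Fin d) =>
    cexp (2 * π * I * ((⟪w.1.2, w.2⟫ : ℝ) : ℂ)) * (phase w.1.1 w.2 * ψ w.2)) ?_).measurable
  refine Measurable.stronglyMeasurable (Measurable.mul ?_ (Measurable.mul ?_ ?_))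
  · exact Continuous.measurable (by fun_prop)
  · exact (phase_cont.comp (by fun_prop : Continuous fun w : (ℝ × EuclideanSpace ℝ (Fin d)) × EuclideanSpace ℝ (Fin d) => (w.1.1, w.2))).measurable
  · exact hψ.comp measurable_snd

lemma nq_phase_meas (q : ℝ) (ψ : EuclideanSpace ℝ (Fin d) → ℂ) (hψ : Measurable ψ) :
    Measurable fun t : ℝ => nq q (Ef fun ξ => phase t ξ * ψ ξ) := by
  unfold nq
  exact (Measurable.lintegral_prod_right' ((Ef_phase_meas ψ hψ).enorm.pow_const q)).pow_const _

lemma An_sum {M : Type*} [AddCommMonoid M] (g : EuclideanSpace ℝ (Fin d) → M) (ξ) (N : ℕ) :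
    ∑ k ∈ Finset.range (N+1), (An d k).indicator g ξ = {ξ : EuclideanSpace ℝ (Fin d) | ‖ξ‖ < 2^N}.indicator g ξ := by
  classical
  induction N with
  | zero =>
    rw [zero_add, Finset.sum_range_one]
    congr 1
    ext η
    simp [An]
  | succ N ih =>
    rw [Finset.sum_range_succ, ih]
    have e : (2:ℝ)^(N+1) = 2 * 2^N := by ring
    have hp : (0:ℝ) < 2^N := by positivity
    simp only [Set.indicator_apply, An, Set.mem_setOf_eq, e]
    by_cases h1 : ‖ξ‖ < 2^N
    · have h2 : ¬ (2 * 2^N ≤ 2 * ‖ξ‖) := by linarith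
      have h3 : ‖ξ‖ < 2 * 2^N := by linarith
      simp [h1, h2, h3]
    · have h2 : (2 * 2^N ≤ 2 * ‖ξ‖) := by linarith
      simp [h1, h2]

lemma lp_full (q : ℝ) (hq : 2 < q) : ∃ C : ℝ≥0∞, C ≠ ∞ ∧ ∀ φ : EuclideanSpace ℝ (Fin d) → ℂ, Measurable φ → Integrable φ →
    (∀ n, ∫⁻ ξ, ‖(An d n).indicator φ ξ‖ₑ ^ 2 ≠ ∞) →
    nq q (Ef φ) ≤ (C * ∑' k, ∑ j, nq q (Ef (pc k j φ)) ^ 2) ^ (1/2:ℝ) := by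
  obtain ⟨C, hC, h⟩ := lp_thm (d := d) q hq
  have hq0 : 0 < q := by linarith
  refine ⟨C, hC, ?_⟩
  intro φ hφ hi h2
  set X := C * ∑' k, ∑ j, nq q (Ef (pc k j φ)) ^ 2 with hX
  have pn : ∀ k, pc k none φ = (An d k).indicator φ := by
    intro k; funext ξ; unfold pc
    congr 1
    funext η
    change 1 * φ η = φ η
    rw [one_mul]
  have pint : ∀ k, Integrable (pc k none φ) := fun k => by rw [pn]; exact hi.indicator (An_meas k)
  have hb : ∀ N, ∫⁻ x, ‖∑ k ∈ Finset.range (N+1), Ef (pc k none φ) x‖ₑ ^ q ≤ X ^ (q/2) := by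
    intro N
    rw [nq_pow q hq0 (fun x => ∑ k ∈ Finset.range (N+1), Ef (pc k none φ) x)]
    have h1 := (h φ hφ h2 N).trans (mul_le_mul_right (ENNReal.sum_le_tsum (f := fun k => ∑ j, nq q (Ef (pc k j φ)) ^ 2) (Finset.range (N+1))) C)
    have h3 := ENNReal.rpow_le_rpow h1 (by positivity : 0 ≤ q/2)
    rw [← ENNReal.rpow_natCast, ← ENNReal.rpow_mul] at h3
    have e : ((2:ℕ):ℝ) * (q/2) = q := by push_cast; ring
    rwa [e] at h3
  have key := fatou_le (fun N x => ‖∑ k ∈ Finset.range (N+1), Ef (pc k none φ) x‖ₑ ^ q) (fun x => ‖Ef φ x‖ₑ ^ q) _ ?_ ?_ hb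
  · unfold nq
    have h3 := ENNReal.rpow_le_rpow key (by positivity : 0 ≤ 1/q)
    rw [← ENNReal.rpow_mul] at h3
    have e : q/2 * (1/q) = 1/2 := by field_simp
    rwa [e] at h3
  · intro N
    exact ((continuous_finsetSum _ fun k _ => Ef_cont _ (pint k)).measurable.enorm.pow_const q).aemeasurable
  · refine Eventually.of_forall fun x => ?_
    refine (ENNReal.continuous_rpow_const.tendsto _).comp ?_
    refine (continuous_enorm.tendsto _).comp ?_
    have es : ∀ N, ∑ k ∈ Finset.range (N+1), Ef (pc k none φ) x = ∫ ξ, cexp (2*π*I*((⟪x,ξ⟫:ℝ):ℂ)) * {ξ : EuclideanSpace ℝ (Fin d) | ‖ξ‖ < 2^N}.indicator φ ξ := by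
      intro N
      unfold Ef
      rw [← integral_finsetSum]
      · congr 1; funext ξ
        rw [← Finset.mul_sum, ← An_sum]
        simp_rw [pn]
      · intro k _
        refine (pint k).norm.mono' ((Continuous.measurable (by fun_prop)).aestronglyMeasurable.mul (pint k).aestronglyMeasurable) ?_
        refine Eventually.of_forall fun ξ => ?_
        rw [norm_mul, norm_e2, one_mul]
    simp_rw [es]
    unfold Ef
    refine tendsto_integral_of_dominated_convergence (fun ξ => ‖φ ξ‖) ?_ hi.norm ?_ ?_
    · intro N
      refine (Continuous.measurable (by fun_prop)).aestronglyMeasurable.mul (hφ.indicator ?_).aestronglyMeasurable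
      exact measurableSet_lt (by fun_prop) (by fun_prop)
    · intro N
      refine Eventually.of_forall fun ξ => ?_
      rw [norm_mul, norm_e2, one_mul]
      exact norm_indicator_le_norm_self _ _
    · refine Eventually.of_forall fun ξ => ?_
      refine tendsto_const_nhds.congr' ?_
      have := (tendsto_pow_atTop_atTop_of_one_lt (by norm_num : (1:ℝ) < 2)).eventually_gt_atTop ‖ξ‖
      filter_upwards [this] with N hN
      rw [Set.indicator_of_mem]
      exact hN

lemma shell_wt (σ : ℝ) (n : ℕ) (ξ : EuclideanSpace ℝ (Fin d)) (h : ξ ∈ An d n) :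
    ((2:ℝ)^n) ^ (2*σ) ≤ 4 ^ |σ| * (1+‖ξ‖^2) ^ σ := by
  have e : ((2:ℝ)^n) ^ (2*σ) = ((4:ℝ)^n)^σ := by
    rw [Real.rpow_mul (by positivity)]
    congr 1
    rw [Real.rpow_two, ← pow_mul, mul_comm n 2, pow_mul]; norm_num
  have e4 : (4:ℝ)^n = 2^n * 2^n := by rw [← mul_pow]; norm_num
  have hp : (1:ℝ) ≤ 2^n := one_le_pow₀ (by norm_num)
  have hn := norm_nonneg ξ
  have h1 : (4:ℝ)^n ≤ 4 * (1+‖ξ‖^2) := by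
    by_cases h0 : n = 0
    · subst h0; nlinarith
    · have := (An_pos h0 h).1
      nlinarith
  have h2 : 1+‖ξ‖^2 ≤ 4 * 4^n := by
    have := h.2
    nlinarith
  rw [e]
  rcases le_total 0 σ with hs | hs
  · rw [abs_of_nonneg hs, ← Real.mul_rpow (by norm_num) (by positivity)]
    exact Real.rpow_le_rpow (by positivity) h1 hs
  · rw [abs_of_nonpos hs, Real.rpow_neg (by norm_num), ← Real.inv_rpow (by norm_num), ← Real.mul_rpow (by norm_num) (by positivity)]
    refine Real.rpow_le_rpow_of_nonpos (by positivity) ?_ hs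
    linarith

lemma shell_sum (σ : ℝ) (φ : EuclideanSpace ℝ (Fin d) → ℂ) (hφ : Measurable φ) :
    ∑' k : ℕ, ENNReal.ofReal (((2:ℝ)^k)^σ) ^ 2 * ∫⁻ ξ, ‖(An d k).indicator φ ξ‖ₑ ^ 2 ≤
      ENNReal.ofReal (4 ^ |σ|) * ∫⁻ ξ, ENNReal.ofReal ((1+‖ξ‖^2)^σ) * ‖φ ξ‖ₑ ^ 2 := by
  have hm : Measurable fun ξ : EuclideanSpace ℝ (Fin d) => ENNReal.ofReal ((1+‖ξ‖^2)^σ) * ‖φ ξ‖ₑ ^ 2 :=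
    (Measurable.ennreal_ofReal (by fun_prop)).mul (hφ.enorm.pow_const 2)
  refine ENNReal.tsum_le_of_sum_range_le fun N => ?_
  have h1 : ∀ k : ℕ, ENNReal.ofReal (((2:ℝ)^k)^σ) ^ 2 * ∫⁻ ξ, ‖(An d k).indicator φ ξ‖ₑ ^ 2 ≤
      ENNReal.ofReal (4 ^ |σ|) * ∫⁻ ξ, (An d k).indicator (fun ξ => ENNReal.ofReal ((1+‖ξ‖^2)^σ) * ‖φ ξ‖ₑ ^ 2) ξ := by
    intro k
    rw [← lintegral_const_mul _ ((hφ.indicator (An_meas k)).enorm.pow_const 2), ← lintegral_const_mul _ (hm.indicator (An_meas k))]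
    refine lintegral_mono fun ξ => ?_
    by_cases h : ξ ∈ An d k
    · simp only [Set.indicator_of_mem h]
      rw [← mul_assoc, ← ENNReal.ofReal_pow (by positivity), ← ENNReal.ofReal_mul (by positivity)]
      refine mul_le_mul_left (ENNReal.ofReal_le_ofReal ?_) _
      have := shell_wt σ k ξ h
      rwa [mul_comm 2 σ, Real.rpow_mul (by positivity), Real.rpow_two] at this
    · simp [Set.indicator_of_notMem h]
  refine (Finset.sum_le_sum fun k _ => h1 k).trans ?_
  rw [← Finset.mul_sum, ← lintegral_finsetSum _ (fun k _ => hm.indicator (An_meas k))]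
  refine mul_le_mul_right (lintegral_mono fun ξ => ?_) _
  refine (Finset.sum_le_sum_of_subset (Finset.range_mono (Nat.le_succ N))).trans ?_
  rw [An_sum]
  exact Set.indicator_le_self _ _ _

end Strich

set_option linter.unusedVariables false
set_option linter.unusedSectionVars false
namespace Strich
open Filter Topology

variable {d : ℕ}

lemma enorm_phase (t : ℝ) (ξ : EuclideanSpace ℝ (Fin d)) : ‖phase t ξ‖ₑ = 1 := by
  rw [← ofReal_norm, norm_phase]; simp

lemma phase_meas (t : ℝ) : Measurable (phase (d := d) t) :=
  (phase_cont.comp (by fun_prop : Continuous fun ξ : EuclideanSpace ℝ (Fin d) => (t, ξ))).measurable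

lemma pc_L2' (n : ℕ) (j : Option (Fin d × Bool)) (φ : EuclideanSpace ℝ (Fin d) → ℂ) (hφ : Measurable φ) :
    (∫⁻ ξ, ‖pc n j φ ξ‖ₑ ^ 2) ^ (1/2:ℝ) ≤ 7 * (∫⁻ ξ, ‖(An d n).indicator φ ξ‖ₑ ^ 2) ^ (1/2:ℝ) := by
  refine (ENNReal.rpow_le_rpow (pc_L2 n j φ hφ) (by norm_num)).trans (le_of_eq ?_)
  rw [ENNReal.mul_rpow_of_nonneg _ _ (by norm_num)]
  congr 1
  rw [show (49:ℝ≥0∞) = 7^(2:ℝ) by norm_num, ← ENNReal.rpow_mul]; norm_num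

lemma shell_inf (q : ℝ) (hq : 2 < q) : ∃ C : ℝ≥0∞, C ≠ ∞ ∧ ∀ φ : EuclideanSpace ℝ (Fin d) → ℂ, Measurable φ →
    (∀ n, ∫⁻ ξ, ‖(An d n).indicator φ ξ‖ₑ ^ 2 ≠ ∞) → ∀ k j t,
    nq q (Ef fun ξ => phase t ξ * pc k j φ ξ) ≤ C * ENNReal.ofReal (((2:ℝ)^k) ^ ((d:ℝ)/2 - d/q)) * (∫⁻ ξ, ‖(An d k).indicator φ ξ‖ₑ ^ 2) ^ (1/2:ℝ) := by
  obtain ⟨B, hB, hb⟩ := bernstein d q hq.le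
  refine ⟨B * 7, ENNReal.mul_ne_top hB (by norm_num), ?_⟩
  intro φ hφ h2 k j t
  have e : ∫⁻ ξ, ‖phase t ξ * pc k j φ ξ‖ₑ ^ 2 = ∫⁻ ξ, ‖pc k j φ ξ‖ₑ ^ 2 := by
    refine lintegral_congr fun ξ => ?_
    rw [enorm_mul, enorm_phase, one_mul]
  have s2 : ∫⁻ ξ, ‖pc k j φ ξ‖ₑ ^ 2 ≠ ∞ := ne_top_of_le_ne_top (ENNReal.mul_ne_top (by norm_num) (h2 k)) (pc_L2 k j φ hφ)
  have := hb (2^k) (by positivity) (fun ξ => phase t ξ * pc k j φ ξ) ((phase_meas t).mul (pc_meas k j φ hφ))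
    (fun ξ h => (pc_supp k j φ ξ (right_ne_zero_of_mul h)).2.le) (by rw [e]; exact s2)
  rw [e] at this
  refine (this.trans (mul_le_mul_right (pc_L2' k j φ hφ) _)).trans (le_of_eq ?_)
  ring

lemma shell_p (hd : 1 ≤ d) (T : ℝ) (hT : 0 < T) (p q : ℝ) (hp : 2 ≤ p) (hq : 2 < q) (hpq : (2/p)/(1-2/q) ≤ (d:ℝ)/2) :
    ∃ C : ℝ≥0∞, C ≠ ∞ ∧ ∀ φ : EuclideanSpace ℝ (Fin d) → ℂ, Measurable φ →
    (∀ n, ∫⁻ ξ, ‖(An d n).indicator φ ξ‖ₑ ^ 2 ≠ ∞) → ∀ k j,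
    (∫⁻ t in Set.Icc 0 T, nq q (Ef fun ξ => phase t ξ * pc k j φ ξ) ^ p) ^ (1/p) ≤
      C * ENNReal.ofReal (((2:ℝ)^k) ^ ((d:ℝ)/2 - d/q - 4/p)) * (∫⁻ ξ, ‖(An d k).indicator φ ξ‖ₑ ^ 2) ^ (1/2:ℝ) := by
  obtain ⟨B, hB, hb⟩ := shell_inf (d := d) q hq
  obtain ⟨C, hC, hc⟩ := annulus_strich hd p q hp hq hpq
  have hp0 : 0 < p := by linarith
  set γ := (d:ℝ)/2 - d/q - 4/p with hγ
  set K1 := B * ENNReal.ofReal T ^ (1/p) with hK1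
  set K2 := C * ENNReal.ofReal ((2⁻¹:ℝ)^γ) * 7 with hK2
  have hK1t : K1 ≠ ∞ := ENNReal.mul_ne_top hB (ENNReal.rpow_ne_top_of_nonneg (by positivity) ENNReal.ofReal_ne_top)
  have hK2t : K2 ≠ ∞ := ENNReal.mul_ne_top (ENNReal.mul_ne_top hC ENNReal.ofReal_ne_top) (by norm_num)
  refine ⟨K1 + K2, ENNReal.add_ne_top.2 ⟨hK1t, hK2t⟩, ?_⟩
  intro φ hφ h2 k j
  by_cases hk : k = 0
  · subst hk
    set w := (∫⁻ ξ, ‖(An d 0).indicator φ ξ‖ₑ ^ 2) ^ (1/2:ℝ) with hw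
    have h1 : ∀ t, nq q (Ef fun ξ => phase t ξ * pc 0 j φ ξ) ≤ B * w := by
      intro t
      refine (hb φ hφ h2 0 j t).trans (le_of_eq ?_)
      simp [hw]
    calc (∫⁻ t in Set.Icc 0 T, nq q (Ef fun ξ => phase t ξ * pc 0 j φ ξ) ^ p) ^ (1/p)
        ≤ (∫⁻ t in Set.Icc 0 T, (B * w) ^ p) ^ (1/p) :=
          ENNReal.rpow_le_rpow (lintegral_mono fun t => ENNReal.rpow_le_rpow (h1 t) hp0.le) (by positivity)
      _ = K1 * w := by
          rw [lintegral_const, Measure.restrict_apply_univ, Real.volume_Icc, sub_zero, ENNReal.mul_rpow_of_nonneg _ _ (by positivity),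
            ← ENNReal.rpow_mul, mul_one_div_cancel hp0.ne', ENNReal.rpow_one, hK1]; ring
      _ ≤ (K1 + K2) * ENNReal.ofReal (((2:ℝ)^0) ^ γ) * w := by
          simp only [pow_zero, Real.one_rpow, ENNReal.ofReal_one, mul_one]
          exact mul_le_mul_left le_self_add _
  · have s2 : ∫⁻ ξ, ‖pc k j φ ξ‖ₑ ^ 2 ≠ ∞ := ne_top_of_le_ne_top (ENNReal.mul_ne_top (by norm_num) (h2 k)) (pc_L2 k j φ hφ)
    have h1 := hc (2⁻¹ * 2^k) (by positivity) (pc k j φ) (pc_meas k j φ hφ) (fun ξ h => by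
      have hA := pc_supp k j φ ξ h
      have := (An_pos hk hA).1
      have := hA.2
      constructor <;> linarith) s2
    have h3 : (∫⁻ t in Set.Icc 0 T, nq q (Ef fun ξ => phase t ξ * pc k j φ ξ) ^ p) ^ (1/p) ≤
      (∫⁻ t, (∫⁻ x, ‖Ef (fun ξ => phase t ξ * pc k j φ ξ) x‖ₑ ^ q) ^ (p/q)) ^ (1/p) := by
      refine ENNReal.rpow_le_rpow ((setLIntegral_le_lintegral _ _).trans (le_of_eq ?_)) (by positivity)
      refine lintegral_congr fun t => ?_
      unfold nq
      rw [← ENNReal.rpow_mul]; congr 1; ring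
    refine h3.trans (h1.trans ((mul_le_mul_right (pc_L2' k j φ hφ) _).trans ?_))
    rw [Real.mul_rpow (by positivity) (by positivity), ENNReal.ofReal_mul (by positivity)]
    calc _ = K2 * ENNReal.ofReal (((2:ℝ)^k) ^ γ) * (∫⁻ ξ, ‖(An d k).indicator φ ξ‖ₑ ^ 2) ^ (1/2:ℝ) := by rw [hK2]; ring
      _ ≤ _ := mul_le_mul_left (mul_le_mul_left le_add_self _) _

lemma shell_fin (σ : ℝ) (φ : EuclideanSpace ℝ (Fin d) → ℂ) (hφ : Measurable φ)
    (hW : ∫⁻ ξ, ENNReal.ofReal ((1+‖ξ‖^2)^σ) * ‖φ ξ‖ₑ ^ 2 ≠ ∞) (n : ℕ) : ∫⁻ ξ, ‖(An d n).indicator φ ξ‖ₑ ^ 2 ≠ ∞ := by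
  have h := (ENNReal.le_tsum (f := fun k : ℕ => ENNReal.ofReal (((2:ℝ)^k)^σ) ^ 2 * ∫⁻ ξ, ‖(An d k).indicator φ ξ‖ₑ ^ 2) n).trans (shell_sum σ φ hφ)
  have h2 := ne_top_of_le_ne_top (ENNReal.mul_ne_top ENNReal.ofReal_ne_top hW) h
  intro h3
  rw [h3] at h2
  refine h2 (ENNReal.mul_top ?_)
  have : (0:ℝ) < ((2:ℝ)^n)^σ := by positivity
  simp [ENNReal.ofReal_eq_zero, this]

lemma sum_bound (σ : ℝ) (φ : EuclideanSpace ℝ (Fin d) → ℂ) (hφ : Measurable φ) (C : ℝ≥0∞) (b : ℕ → Option (Fin d × Bool) → ℝ≥0∞)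
    (hb : ∀ k j, b k j ≤ C * ENNReal.ofReal (((2:ℝ)^k)^σ) * (∫⁻ ξ, ‖(An d k).indicator φ ξ‖ₑ ^ 2) ^ (1/2:ℝ)) :
    ∑' k, ∑ j, b k j ^ 2 ≤ (Fintype.card (Option (Fin d × Bool)) * C^2 * ENNReal.ofReal (4 ^ |σ|)) * ∫⁻ ξ, ENNReal.ofReal ((1+‖ξ‖^2)^σ) * ‖φ ξ‖ₑ ^ 2 := by
  have h1 : ∀ k, ∑ j, b k j ^ 2 ≤ (Fintype.card (Option (Fin d × Bool)) * C^2) * (ENNReal.ofReal (((2:ℝ)^k)^σ) ^ 2 * ∫⁻ ξ, ‖(An d k).indicator φ ξ‖ₑ ^ 2) := by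
    intro k
    refine (Finset.sum_le_sum fun j _ => pow_le_pow_left' (hb k j) 2).trans (le_of_eq ?_)
    rw [Finset.sum_const, Finset.card_univ, nsmul_eq_mul, mul_pow, mul_pow, ← ENNReal.rpow_natCast ((∫⁻ ξ, ‖(An d k).indicator φ ξ‖ₑ ^ 2) ^ (1/2:ℝ)), ← ENNReal.rpow_mul]
    norm_num
    ring
  refine (ENNReal.tsum_le_tsum h1).trans ?_
  rw [ENNReal.tsum_mul_left, mul_assoc _ (ENNReal.ofReal (4 ^ |σ|))]
  exact mul_le_mul_right (shell_sum σ φ hφ) _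

lemma phase_int (t : ℝ) (φ : EuclideanSpace ℝ (Fin d) → ℂ) (hφ : Measurable φ) (hi : Integrable φ) : Integrable fun ξ => phase t ξ * φ ξ := by
  refine hi.norm.mono' ((phase_meas t).mul hφ).aestronglyMeasurable (Eventually.of_forall fun ξ => ?_)
  rw [norm_mul, norm_phase, one_mul]

lemma phase_shell (t : ℝ) (n : ℕ) (φ : EuclideanSpace ℝ (Fin d) → ℂ) :
    ∫⁻ ξ, ‖(An d n).indicator (fun ξ => phase t ξ * φ ξ) ξ‖ₑ ^ 2 = ∫⁻ ξ, ‖(An d n).indicator φ ξ‖ₑ ^ 2 := by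
  refine lintegral_congr fun ξ => ?_
  by_cases h : ξ ∈ An d n
  · simp only [Set.indicator_of_mem h, enorm_mul, enorm_phase, one_mul]
  · simp only [Set.indicator_of_notMem h]

lemma hom_inf (q : ℝ) (hq : 2 < q) : ∃ C : ℝ≥0∞, C ≠ ∞ ∧ ∀ φ : EuclideanSpace ℝ (Fin d) → ℂ, Measurable φ → Integrable φ →
    (∫⁻ ξ, ENNReal.ofReal ((1+‖ξ‖^2)^((d:ℝ)/2 - d/q)) * ‖φ ξ‖ₑ ^ 2 ≠ ∞) → ∀ t,
    nq q (Ef fun ξ => phase t ξ * φ ξ) ≤ C * (∫⁻ ξ, ENNReal.ofReal ((1+‖ξ‖^2)^((d:ℝ)/2 - d/q)) * ‖φ ξ‖ₑ ^ 2) ^ (1/2:ℝ) := by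
  obtain ⟨C, hC, hc⟩ := lp_full (d := d) q hq
  obtain ⟨B, hB, hb⟩ := shell_inf (d := d) q hq
  set K := C * (Fintype.card (Option (Fin d × Bool)) * B^2 * ENNReal.ofReal (4 ^ |(d:ℝ)/2 - d/q|)) with hK
  refine ⟨K ^ (1/2:ℝ), ENNReal.rpow_ne_top_of_nonneg (by norm_num) ?_, ?_⟩
  · exact ENNReal.mul_ne_top hC (ENNReal.mul_ne_top (ENNReal.mul_ne_top (ENNReal.natCast_ne_top _) (ENNReal.pow_ne_top hB)) ENNReal.ofReal_ne_top)
  intro φ hφ hi hW t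
  have hsf := shell_fin _ φ hφ hW
  refine (hc (fun ξ => phase t ξ * φ ξ) ((phase_meas t).mul hφ) (phase_int t φ hφ hi) (fun n => by rw [phase_shell]; exact hsf n)).trans ?_
  rw [← ENNReal.mul_rpow_of_nonneg _ _ (by norm_num), hK]
  refine ENNReal.rpow_le_rpow ?_ (by norm_num)
  rw [mul_assoc]
  refine mul_le_mul_right ?_ C
  simp_rw [pc_phase]
  exact sum_bound _ φ hφ B (fun k j => nq q (Ef fun ξ => phase t ξ * pc k j φ ξ)) fun k j => hb φ hφ hsf k j t

lemma hom_p (hd : 1 ≤ d) (T : ℝ) (hT : 0 < T) (p q : ℝ) (hp : 2 ≤ p) (hq : 2 < q) (hpq : (2/p)/(1-2/q) ≤ (d:ℝ)/2) :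
    ∃ C : ℝ≥0∞, C ≠ ∞ ∧ ∀ φ : EuclideanSpace ℝ (Fin d) → ℂ, Measurable φ → Integrable φ →
    (∫⁻ ξ, ENNReal.ofReal ((1+‖ξ‖^2)^((d:ℝ)/2 - d/q - 4/p)) * ‖φ ξ‖ₑ ^ 2 ≠ ∞) →
    (∫⁻ t in Set.Icc 0 T, nq q (Ef fun ξ => phase t ξ * φ ξ) ^ p) ^ (1/p) ≤
      C * (∫⁻ ξ, ENNReal.ofReal ((1+‖ξ‖^2)^((d:ℝ)/2 - d/q - 4/p)) * ‖φ ξ‖ₑ ^ 2) ^ (1/2:ℝ) := by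
  obtain ⟨C, hC, hc⟩ := lp_full (d := d) q hq
  obtain ⟨B, hB, hb⟩ := shell_p hd T hT p q hp hq hpq
  have hp0 : 0 < p := by linarith
  set γ := (d:ℝ)/2 - d/q - 4/p with hγ
  set K := C * (Fintype.card (Option (Fin d × Bool)) * B^2 * ENNReal.ofReal (4 ^ |γ|)) with hK
  refine ⟨K ^ (1/2:ℝ), ENNReal.rpow_ne_top_of_nonneg (by norm_num) ?_, ?_⟩
  · exact ENNReal.mul_ne_top hC (ENNReal.mul_ne_top (ENNReal.mul_ne_top (ENNReal.natCast_ne_top _) (ENNReal.pow_ne_top hB)) ENNReal.ofReal_ne_top)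
  intro φ hφ hi hW
  have hsf := shell_fin _ φ hφ hW
  set b : ℕ × Option (Fin d × Bool) → ℝ → ℝ≥0∞ := fun i t => nq q (Ef fun ξ => phase t ξ * pc i.1 i.2 φ ξ) with hbd
  have bm : ∀ i, Measurable (b i) := fun i => nq_phase_meas q _ (pc_meas _ _ φ hφ)
  have h1 : ∀ t, nq q (Ef fun ξ => phase t ξ * φ ξ) ≤ (C * ∑' i, b i t ^ 2) ^ (1/2:ℝ) := by
    intro t
    refine (hc (fun ξ => phase t ξ * φ ξ) ((phase_meas t).mul hφ) (phase_int t φ hφ hi) (fun n => by rw [phase_shell]; exact hsf n)).trans (le_of_eq ?_)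
    rw [ENNReal.tsum_prod']
    simp_rw [pc_phase, tsum_fintype, hbd]
  have h2 := minkowski_sum (volume.restrict (Set.Icc 0 T)) (fun i t => b i t ^ 2) (fun i => (bm i).pow_const 2) (p/2) (by linarith)
  calc (∫⁻ t in Set.Icc 0 T, nq q (Ef fun ξ => phase t ξ * φ ξ) ^ p) ^ (1/p)
      ≤ (∫⁻ t in Set.Icc 0 T, C ^ (p/2) * (∑' i, b i t ^ 2) ^ (p/2)) ^ (1/p) := by
        refine ENNReal.rpow_le_rpow (lintegral_mono fun t => ?_) (by positivity)
        refine (ENNReal.rpow_le_rpow (h1 t) hp0.le).trans (le_of_eq ?_)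
        rw [← ENNReal.rpow_mul, ← ENNReal.mul_rpow_of_nonneg _ _ (by positivity)]
        congr 1; ring
    _ = (C * (∫⁻ t in Set.Icc 0 T, (∑' i, b i t ^ 2) ^ (p/2)) ^ (1/(p/2))) ^ (1/2:ℝ) := by
        have hm : Measurable fun t => (∑' i, b i t ^ 2) ^ (p/2) := (Measurable.tsum fun i => (bm i).pow_const 2).pow_const _
        rw [lintegral_const_mul _ hm,
          ENNReal.mul_rpow_of_nonneg _ _ (by positivity), ENNReal.mul_rpow_of_nonneg _ _ (by positivity), ← ENNReal.rpow_mul, ← ENNReal.rpow_mul]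
        congr 2 <;> field_simp
    _ ≤ (C * ((Fintype.card (Option (Fin d × Bool)) * B^2 * ENNReal.ofReal (4 ^ |γ|)) * ∫⁻ ξ, ENNReal.ofReal ((1+‖ξ‖^2)^γ) * ‖φ ξ‖ₑ ^ 2)) ^ (1/2:ℝ) := by
        refine ENNReal.rpow_le_rpow (mul_le_mul_right (h2.trans ?_) C) (by norm_num)
        have h3 := sum_bound γ φ hφ B (fun k j => (∫⁻ t in Set.Icc 0 T, b (k,j) t ^ p) ^ (1/p)) (fun k j => hb φ hφ hsf k j)
        refine le_trans (le_of_eq ?_) h3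
        rw [ENNReal.tsum_prod']
        simp_rw [tsum_fintype]
        refine tsum_congr fun k => Finset.sum_congr rfl fun j _ => ?_
        rw [← ENNReal.rpow_natCast (_ ^ (1/p)), ← ENNReal.rpow_mul]
        have e1 : ∀ t, (b (k,j) t ^ 2) ^ (p/2) = b (k,j) t ^ p := by
          intro t
          rw [← ENNReal.rpow_natCast, ← ENNReal.rpow_mul]; congr 1; push_cast; ring
        simp_rw [e1]
        congr 1; push_cast; field_simp
    _ = _ := by rw [← mul_assoc, ← hK, ENNReal.mul_rpow_of_nonneg _ _ (by norm_num)]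

end Strich

set_option linter.unusedVariables false
set_option linter.unusedSectionVars false
namespace Strich
open Filter Topology

variable {d : ℕ}

lemma nq_eLp (q : ℝ≥0∞) (h2 : 2 ≤ q) (hq : q ≠ ∞) (f : EuclideanSpace ℝ (Fin d) → ℂ) : eLpNorm f q volume = nq q.toReal f := by
  rw [eLpNorm_eq_lintegral_rpow_enorm_toReal (by rintro rfl; simp at h2) hq]; rfl

/-- `L^p` in time, with a true supremum when the exponent is infinite -/
noncomputable def tLp (p : ℝ≥0∞) (I : Set ℝ) (g : ℝ → ℝ≥0∞) : ℝ≥0∞ :=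
  if p = ∞ then ⨆ t, g t else (∫⁻ t in I, g t ^ p.toReal) ^ (1 / p.toReal)

theorem hom (hd : 1 ≤ d) (T : ℝ) (hT : 0 < T) (p q : ℝ≥0∞) (hpq : Admissible d p q) (hq : q ≠ ∞) :
    ∃ C : ℝ≥0∞, C ≠ ∞ ∧ ∀ φ : EuclideanSpace ℝ (Fin d) → ℂ, Measurable φ → Integrable φ →
    tLp p (Set.Icc 0 T) (fun t => eLpNorm (Ef fun ξ => phase t ξ * φ ξ) q volume) ≤
      C * (∫⁻ ξ, ENNReal.ofReal ((1+‖ξ‖^2)^(gammaExp d p q)) * ‖φ ξ‖ₑ ^ 2) ^ (1/2:ℝ) := by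
  obtain ⟨hp2, hq2, -, hadm⟩ := hpq
  have hd0 : (0:ℝ) < d := by exact_mod_cast hd
  have hq2' : 2 ≤ q.toReal := by
    have := ENNReal.toReal_mono hq hq2; simpa using this
  -- it suffices to treat finite right-hand sides
  suffices H : ∃ C : ℝ≥0∞, C ≠ ∞ ∧ ∀ φ : EuclideanSpace ℝ (Fin d) → ℂ, Measurable φ → Integrable φ →
      (∫⁻ ξ, ENNReal.ofReal ((1+‖ξ‖^2)^(gammaExp d p q)) * ‖φ ξ‖ₑ ^ 2 ≠ ∞) →
    tLp p (Set.Icc 0 T) (fun t => eLpNorm (Ef fun ξ => phase t ξ * φ ξ) q volume) ≤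
      C * (∫⁻ ξ, ENNReal.ofReal ((1+‖ξ‖^2)^(gammaExp d p q)) * ‖φ ξ‖ₑ ^ 2) ^ (1/2:ℝ) by
    obtain ⟨C, hC, h⟩ := H
    refine ⟨C + 1, by simp [hC], fun φ hφ hi => ?_⟩
    by_cases hW : ∫⁻ ξ, ENNReal.ofReal ((1+‖ξ‖^2)^(gammaExp d p q)) * ‖φ ξ‖ₑ ^ 2 = ∞
    · rw [hW, ENNReal.top_rpow_of_pos (by norm_num), ENNReal.mul_top (by simp)]
      exact le_top
    · exact (h φ hφ hi hW).trans (mul_le_mul_left le_self_add _)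
  simp_rw [nq_eLp q hq2 hq]
  by_cases hp : p = ∞
  · subst hp
    have hg : gammaExp d ∞ q = (d:ℝ)/2 - d/q.toReal := by simp [gammaExp]
    rw [hg]
    rcases eq_or_lt_of_le hq2' with h2 | h2
    · refine ⟨1, by simp, ?_⟩
      intro φ hφ hi hW
      rw [← h2] at hW ⊢
      unfold tLp
      rw [if_pos rfl]
      refine iSup_le fun t => ?_
      have e0 : (d:ℝ)/2 - d/2 = 0 := by ring
      simp only [e0, Real.rpow_zero, ENNReal.ofReal_one, one_mul] at hW ⊢
      have e : ∫⁻ ξ, ‖phase t ξ * φ ξ‖ₑ ^ 2 = ∫⁻ ξ, ‖φ ξ‖ₑ ^ 2 := by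
        refine lintegral_congr fun ξ => ?_
        rw [enorm_mul, enorm_phase, one_mul]
      have m2 : MemLp (fun ξ => phase t ξ * φ ξ) 2 := by
        refine ⟨((phase_meas t).mul hφ).aestronglyMeasurable, ?_⟩
        rw [eLpNorm_lt_top_iff_lintegral_rpow_enorm_lt_top (by norm_num) (by norm_num)]
        have : ∫⁻ ξ, ‖phase t ξ * φ ξ‖ₑ ^ 2 < ∞ := by rw [e]; exact hW.lt_top
        simpa using this
      have := Ef_plancherel _ (phase_int t φ hφ hi) m2
      rw [e] at this
      unfold nq
      simp only [ENNReal.rpow_two]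
      rw [this]
    · obtain ⟨C, hC, h⟩ := hom_inf (d := d) q.toReal h2
      refine ⟨C, hC, ?_⟩
      intro φ hφ hi hW
      unfold tLp
      rw [if_pos rfl]
      exact iSup_le fun t => h φ hφ hi hW t
  · have hp2' : 2 ≤ p.toReal := by
      have := ENNReal.toReal_mono hp hp2; simpa using this
    have hr : 2 / p.toReal + d / q.toReal ≤ (d:ℝ)/2 := by
      have h1 := ENNReal.toReal_mono (ENNReal.div_ne_top (ENNReal.natCast_ne_top _) (by norm_num)) hadm
      rw [ENNReal.toReal_add (ENNReal.div_ne_top (by norm_num) (by rintro rfl; simp at hp2))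
        (ENNReal.div_ne_top (ENNReal.natCast_ne_top _) (by rintro rfl; simp at hq2))] at h1
      simpa [ENNReal.toReal_div] using h1
    have hpp : 0 < 2 / p.toReal := by positivity
    have hlt : 2 < q.toReal := by
      rcases eq_or_lt_of_le hq2' with h2 | h2
      · rw [← h2] at hr; linarith
      · exact h2
    have hc : (2/p.toReal)/(1-2/q.toReal) ≤ (d:ℝ)/2 := by
      have : 0 < 1 - 2/q.toReal := by
        rw [sub_pos, div_lt_one (by linarith)]; exact hlt
      rw [div_le_iff₀ this]
      have e : (d:ℝ)/2 * (1 - 2/q.toReal) = d/2 - d/q.toReal := by ring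
      rw [e]; linarith
    obtain ⟨C, hC, h⟩ := hom_p hd T hT p.toReal q.toReal hp2' hlt hc
    refine ⟨C, hC, ?_⟩
    intro φ hφ hi hW
    unfold tLp
    rw [if_neg hp]
    exact h φ hφ hi hW

end Strich

set_option linter.unusedVariables false
set_option linter.unusedSectionVars false
namespace Strich
open Filter Topology

variable {d : ℕ}

lemma slice_deriv (F : 𝓢(ℝ × EuclideanSpace ℝ (Fin d), ℂ)) (s : ℝ) (n : ℕ) (y : EuclideanSpace ℝ (Fin d)) :
    ‖iteratedFDeriv ℝ n (fun y => F (s, y)) y‖ ≤ ‖iteratedFDeriv ℝ n F (s, y)‖ := by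
  set g := ContinuousLinearMap.inr ℝ ℝ (EuclideanSpace ℝ (Fin d)) with hg
  have e : (fun y => F (s, y)) = (fun z => F (((s:ℝ), (0 : EuclideanSpace ℝ (Fin d))) + z)) ∘ g := by
    funext y
    simp [hg]
  have hF : ContDiff ℝ n (fun z => F (((s:ℝ), (0 : EuclideanSpace ℝ (Fin d))) + z)) :=
    (F.smooth n).comp (contDiff_const.add contDiff_id)
  rw [e, ContinuousLinearMap.iteratedFDeriv_comp_right g hF y le_rfl, iteratedFDeriv_comp_add_left]
  refine (ContinuousMultilinearMap.norm_compContinuousLinearMap_le _ _).trans ?_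
  have hgn : ‖g‖ ≤ 1 := by
    refine ContinuousLinearMap.opNorm_le_bound _ (by norm_num) fun x => ?_
    simp [hg]
  have e2 : ((s:ℝ), (0 : EuclideanSpace ℝ (Fin d))) + g y = (s, y) := by simp [hg]
  rw [e2]
  refine mul_le_of_le_one_right (norm_nonneg _) ?_
  exact Finset.prod_le_one (fun _ _ => norm_nonneg _) fun _ _ => hgn

lemma slice_decay (F : 𝓢(ℝ × EuclideanSpace ℝ (Fin d), ℂ)) (s : ℝ) (k n : ℕ) (y : EuclideanSpace ℝ (Fin d)) :
    ‖y‖ ^ k * ‖iteratedFDeriv ℝ n (fun y => F (s, y)) y‖ ≤ SchwartzMap.seminorm ℝ k n F := by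
  refine le_trans ?_ (SchwartzMap.le_seminorm ℝ k n F (s, y))
  refine mul_le_mul (pow_le_pow_left₀ (norm_nonneg _) ?_ k) (slice_deriv F s n y) (norm_nonneg _) (by positivity)
  rw [Prod.norm_def]; exact le_max_right _ _

noncomputable def slice (F : 𝓢(ℝ × EuclideanSpace ℝ (Fin d), ℂ)) (s : ℝ) : 𝓢(EuclideanSpace ℝ (Fin d), ℂ) where
  toFun := fun y => F (s, y)
  smooth' := (F.smooth ⊤).comp (contDiff_const.prodMk contDiff_id)
  decay' := fun k n => ⟨SchwartzMap.seminorm ℝ k n F, fun y => slice_decay F s k n y⟩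

lemma slice_coe (F : 𝓢(ℝ × EuclideanSpace ℝ (Fin d), ℂ)) (s : ℝ) : ⇑(slice F s) = fun y => F (s, y) := rfl

lemma slice_semi (F : 𝓢(ℝ × EuclideanSpace ℝ (Fin d), ℂ)) (s : ℝ) (k n : ℕ) :
    SchwartzMap.seminorm ℝ k n (slice F s) ≤ SchwartzMap.seminorm ℝ k n F :=
  SchwartzMap.seminorm_le_bound ℝ k n _ (apply_nonneg _ _) fun y => slice_decay F s k n y

lemma four_decay (N : ℕ) : ∃ (t : Finset (ℕ × ℕ)) (C : ℝ), 0 ≤ C ∧ ∀ (f : 𝓢(EuclideanSpace ℝ (Fin d), ℂ)) (a : ℝ), 0 ≤ a →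
    (∀ i ∈ t, SchwartzMap.seminorm ℝ i.1 i.2 f ≤ a) → ∀ ξ, (1 + ‖ξ‖)^N * ‖𝓕 (f : EuclideanSpace ℝ (Fin d) → ℂ) ξ‖ ≤ C * a := by
  set P : Seminorm ℝ 𝓢(EuclideanSpace ℝ (Fin d), ℂ) :=
    (((Finset.Iic (N, 0)).sup (schwartzSeminormFamily ℝ (EuclideanSpace ℝ (Fin d)) ℂ)).comp
      ((FourierTransform.fourierCLM ℝ 𝓢(EuclideanSpace ℝ (Fin d), ℂ)) : 𝓢(EuclideanSpace ℝ (Fin d), ℂ) →ₗ[ℝ] 𝓢(EuclideanSpace ℝ (Fin d), ℂ))) with hP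
  have hPc : Continuous P := by
    have h0 : Continuous (fun x => (((Finset.Iic (N, 0)).sup (schwartzSeminormFamily ℝ (EuclideanSpace ℝ (Fin d)) ℂ) : Seminorm ℝ 𝓢(EuclideanSpace ℝ (Fin d), ℂ))) x) :=
      Finset.sup_induction (p := fun s : Seminorm ℝ 𝓢(EuclideanSpace ℝ (Fin d), ℂ) => Continuous (fun x => s x)) continuous_const
        (fun p hp q hq => Continuous.sup hp hq)
        (fun i _ => (schwartz_withSeminorms ℝ (EuclideanSpace ℝ (Fin d)) ℂ).continuous_seminorm i)
    exact h0.comp (FourierTransform.fourierCLM ℝ 𝓢(EuclideanSpace ℝ (Fin d), ℂ)).continuous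
  obtain ⟨t, C, hC, h⟩ := Seminorm.bound_of_continuous (schwartz_withSeminorms ℝ (EuclideanSpace ℝ (Fin d)) ℂ) P hPc
  refine ⟨t, 2^N * C, by positivity, ?_⟩
  intro f a ha hf ξ
  have h1 := SchwartzMap.one_add_le_sup_seminorm_apply (𝕜 := ℝ) (m := (N,0)) (k := N) (n := 0) le_rfl le_rfl (𝓕 f) ξ
  rw [norm_iteratedFDeriv_zero] at h1
  have h2 : P f ≤ C * t.sup (schwartzSeminormFamily ℝ (EuclideanSpace ℝ (Fin d)) ℂ) f := h f
  have h3 : t.sup (schwartzSeminormFamily ℝ (EuclideanSpace ℝ (Fin d)) ℂ) f ≤ a := Seminorm.finset_sup_apply_le ha fun i hi => hf i hi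
  have h4 : (1 + ‖ξ‖)^N * ‖𝓕 (f : EuclideanSpace ℝ (Fin d) → ℂ) ξ‖ ≤ 2^N * P f := h1
  refine h4.trans ?_
  rw [mul_assoc]
  exact mul_le_mul_of_nonneg_left (h2.trans (mul_le_mul_of_nonneg_left h3 C.2)) (by positivity)

lemma four_dom (σ : ℝ) (f : ℝ → 𝓢(EuclideanSpace ℝ (Fin d), ℂ)) (b : ℕ → ℕ → ℝ) (hb : ∀ s k n, SchwartzMap.seminorm ℝ k n (f s) ≤ b k n) :
    ∃ D : EuclideanSpace ℝ (Fin d) → ℝ, Integrable D ∧ ∀ s ξ, (1+‖ξ‖^2)^(σ/2) * ‖𝓕 (f s : EuclideanSpace ℝ (Fin d) → ℂ) ξ‖ ≤ D ξ := by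
  obtain ⟨N, hN⟩ := exists_nat_ge (|σ| + (d+1))
  obtain ⟨t, C, hC, h⟩ := four_decay (d := d) N
  have b0 : ∀ k n, 0 ≤ b k n := fun k n => (apply_nonneg _ _).trans (hb 0 k n)
  set a := ∑ i ∈ t, b i.1 i.2 with ha
  have a0 : 0 ≤ a := Finset.sum_nonneg fun i _ => b0 _ _
  refine ⟨fun ξ => C * a * (1 + ‖ξ‖) ^ (-((d:ℝ)+1)), (integrable_one_add_norm (by simp)).const_mul _, ?_⟩
  intro s ξ
  have h1 := h (f s) a a0 (fun i hi => (hb s _ _).trans (Finset.single_le_sum (f := fun i : ℕ × ℕ => b i.1 i.2) (fun i _ => b0 _ _) hi)) ξ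
  have hx : 1 ≤ 1 + ‖ξ‖ := by linarith [norm_nonneg ξ]
  have hx0 : 0 < 1 + ‖ξ‖ := by linarith
  have h2 : (1+‖ξ‖^2)^(σ/2) ≤ (1+‖ξ‖)^|σ| := by
    calc (1+‖ξ‖^2)^(σ/2) ≤ (1+‖ξ‖^2)^(|σ|/2) := Real.rpow_le_rpow_of_exponent_le (by nlinarith [norm_nonneg ξ]) (by linarith [le_abs_self σ])
      _ ≤ ((1+‖ξ‖)^2)^(|σ|/2) := Real.rpow_le_rpow (by positivity) (by nlinarith [norm_nonneg ξ]) (by positivity)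
      _ = _ := by rw [← Real.rpow_natCast, ← Real.rpow_mul hx0.le]; congr 1; push_cast; ring
  have h3 : (1+‖ξ‖)^|σ| ≤ (1+‖ξ‖)^N * (1+‖ξ‖)^(-((d:ℝ)+1)) := by
    rw [← Real.rpow_natCast, ← Real.rpow_add hx0]
    exact Real.rpow_le_rpow_of_exponent_le hx (by linarith)
  calc (1+‖ξ‖^2)^(σ/2) * ‖𝓕 (f s : EuclideanSpace ℝ (Fin d) → ℂ) ξ‖ ≤ ((1+‖ξ‖)^N * (1+‖ξ‖)^(-((d:ℝ)+1))) * ‖𝓕 (f s : EuclideanSpace ℝ (Fin d) → ℂ) ξ‖ :=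
        mul_le_mul_of_nonneg_right (h2.trans h3) (norm_nonneg _)
    _ = ((1+‖ξ‖)^N * ‖𝓕 (f s : EuclideanSpace ℝ (Fin d) → ℂ) ξ‖) * (1+‖ξ‖)^(-((d:ℝ)+1)) := by ring
    _ ≤ _ := mul_le_mul_of_nonneg_right h1 (by positivity)

lemma slice_four_meas (F : 𝓢(ℝ × EuclideanSpace ℝ (Fin d), ℂ)) : Measurable (Function.uncurry fun s => 𝓕 (fun y => F (s, y))) := by
  have : (Function.uncurry fun s => 𝓕 (fun y => F (s, y))) = fun z : ℝ × EuclideanSpace ℝ (Fin d) =>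
      ∫ x, cexp (((-2 * π * ⟪x, z.2⟫ : ℝ) : ℂ) * I) * F (z.1, x) := by
    funext z
    rw [Function.uncurry, Real.fourier_eq']
    simp only [smul_eq_mul]
  rw [this]
  refine (StronglyMeasurable.integral_prod_right' (f := fun w : (ℝ × EuclideanSpace ℝ (Fin d)) × EuclideanSpace ℝ (Fin d) =>
    cexp (((-2 * π * ⟪w.2, w.1.2⟫ : ℝ) : ℂ) * I) * F (w.1.1, w.2)) ?_).measurable
  refine Continuous.stronglyMeasurable (Continuous.mul (by fun_prop) ?_)
  exact F.continuous.comp (by fun_prop)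

end Strich

set_option linter.unusedVariables false
set_option linter.unusedSectionVars false
namespace Strich
open Filter Topology

variable {d : ℕ}

lemma Ef_add' (f g : EuclideanSpace ℝ (Fin d) → ℂ) (hf : Integrable f) (hg : Integrable g) (x : EuclideanSpace ℝ (Fin d)) :
    Ef (fun ξ => f ξ + g ξ) x = Ef f x + Ef g x := by
  unfold Ef
  rw [← integral_add]
  · simp_rw [mul_add]
  · refine hf.norm.mono' (AEStronglyMeasurable.mul (Continuous.aestronglyMeasurable (by fun_prop)) hf.1) (Eventually.of_forall fun ξ => ?_)
    rw [norm_mul, norm_e2, one_mul]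
  · refine hg.norm.mono' (AEStronglyMeasurable.mul (Continuous.aestronglyMeasurable (by fun_prop)) hg.1) (Eventually.of_forall fun ξ => ?_)
    rw [norm_mul, norm_e2, one_mul]

lemma dom_prod_int (H : ℝ → EuclideanSpace ℝ (Fin d) → ℂ) (hm : Measurable (Function.uncurry H)) (D : EuclideanSpace ℝ (Fin d) → ℝ)
    (hD : Integrable D) (hb : ∀ s ξ, ‖H s ξ‖ ≤ D ξ) (t : ℝ) :
    Integrable (Function.uncurry H) ((volume.restrict (Set.Ioc 0 t)).prod volume) := by
  have h1 : Integrable (fun z : ℝ × EuclideanSpace ℝ (Fin d) => (1:ℝ) * D z.2) ((volume.restrict (Set.Ioc 0 t)).prod volume) :=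
    Integrable.mul_prod (f := fun _ : ℝ => (1:ℝ)) (integrable_const _) hD
  refine h1.mono' hm.aestronglyMeasurable (Eventually.of_forall fun z => ?_)
  rw [one_mul]; exact hb z.1 z.2

lemma Ef_swap (H : ℝ → EuclideanSpace ℝ (Fin d) → ℂ) (hm : Measurable (Function.uncurry H)) (D : EuclideanSpace ℝ (Fin d) → ℝ)
    (hD : Integrable D) (hb : ∀ s ξ, ‖H s ξ‖ ≤ D ξ) (t : ℝ) (ht : 0 ≤ t) (x : EuclideanSpace ℝ (Fin d)) :
    Ef (fun ξ => ∫ s in (0:ℝ)..t, H s ξ) x = ∫ s in (0:ℝ)..t, Ef (H s) x := by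
  have hi := dom_prod_int (fun s ξ => cexp (2 * π * I * ((⟪x, ξ⟫ : ℝ) : ℂ)) * H s ξ)
    (Measurable.mul (f := fun z : ℝ × EuclideanSpace ℝ (Fin d) => cexp (2 * π * I * ((⟪x, z.2⟫ : ℝ) : ℂ))) (Continuous.measurable (by fun_prop)) hm) D hD
    (fun s ξ => by rw [norm_mul, norm_e2, one_mul]; exact hb s ξ) t
  unfold Ef
  rw [intervalIntegral.integral_of_le ht, integral_integral_swap hi]
  refine integral_congr_ae (Eventually.of_forall fun ξ => ?_)
  simp only
  rw [intervalIntegral.integral_of_le ht, integral_const_mul]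

lemma int_dom (H : ℝ → EuclideanSpace ℝ (Fin d) → ℂ) (hm : Measurable (Function.uncurry H)) (D : EuclideanSpace ℝ (Fin d) → ℝ)
    (hD : Integrable D) (hb : ∀ s ξ, ‖H s ξ‖ ≤ D ξ) (t : ℝ) (ht : 0 ≤ t) :
    Integrable (fun ξ => ∫ s in (0:ℝ)..t, H s ξ) := by
  simp_rw [intervalIntegral.integral_of_le ht]
  exact (dom_prod_int H hm D hD hb t).integral_prod_right

lemma Ef_param_meas (H : ℝ → EuclideanSpace ℝ (Fin d) → ℂ) (hm : Measurable (Function.uncurry H)) :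
    Measurable (Function.uncurry fun s => Ef (H s)) := by
  unfold Ef
  refine (StronglyMeasurable.integral_prod_right' (f := fun w : (ℝ × EuclideanSpace ℝ (Fin d)) × EuclideanSpace ℝ (Fin d) =>
    cexp (2 * π * I * ((⟪w.1.2, w.2⟫ : ℝ) : ℂ)) * H w.1.1 w.2) ?_).measurable
  refine (Measurable.mul (Continuous.measurable (by fun_prop)) ?_).stronglyMeasurable
  exact hm.comp (f := fun w : (ℝ × EuclideanSpace ℝ (Fin d)) × EuclideanSpace ℝ (Fin d) => (w.1.1, w.2)) (by fun_prop)

lemma nq_int (H : ℝ → EuclideanSpace ℝ (Fin d) → ℂ) (hm : Measurable (Function.uncurry H)) (q : ℝ) (hq : 1 ≤ q)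
    (t T : ℝ) (ht : t ∈ Set.Icc 0 T) :
    nq q (fun x => ∫ s in (0:ℝ)..t, Ef (H s) x) ≤ ∫⁻ s in Set.Icc 0 T, nq q (Ef (H s)) := by
  have h1 : nq q (fun x => ∫ s in (0:ℝ)..t, Ef (H s) x) ≤ (∫⁻ x, (∫⁻ s in Set.Icc 0 T, ‖Ef (H s) x‖ₑ) ^ q) ^ (1/q) := by
    unfold nq
    refine ENNReal.rpow_le_rpow (lintegral_mono fun x => ?_) (by positivity)
    refine ENNReal.rpow_le_rpow ?_ (by positivity)
    simp only
    rw [intervalIntegral.integral_of_le ht.1]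
    refine (enorm_integral_le_lintegral_enorm _).trans ?_
    exact lintegral_mono_set fun s hs => ⟨hs.1.le, hs.2.trans ht.2⟩
  refine h1.trans ?_
  exact minkowski volume (volume.restrict (Set.Icc 0 T)) (fun x s => ‖Ef (H s) x‖ₑ)
    ((Ef_param_meas H hm).comp measurable_swap).enorm q hq

/-- the weighted `L²` norm of the Fourier data -/
noncomputable def Wn (g : ℝ) (φ : EuclideanSpace ℝ (Fin d) → ℂ) : ℝ≥0∞ :=
  (∫⁻ ξ, ENNReal.ofReal ((1+‖ξ‖^2)^g) * ‖φ ξ‖ₑ ^ 2) ^ (1/2:ℝ)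

theorem inhom (hd : 1 ≤ d) (T : ℝ) (hT : 0 < T) (p q : ℝ≥0∞) (hpq : Admissible d p q) (hq : q ≠ ∞) :
    ∃ C : ℝ≥0∞, C ≠ ∞ ∧ ∀ φ0 : EuclideanSpace ℝ (Fin d) → ℂ, Measurable φ0 → Integrable φ0 →
    ∀ φ : ℝ → EuclideanSpace ℝ (Fin d) → ℂ, Measurable (Function.uncurry φ) → (∀ s, Integrable (φ s)) →
    tLp p (Set.Icc 0 T) (fun t => nq q.toReal (Ef fun ξ => phase t ξ * φ0 ξ) +
        ∫⁻ s in Set.Icc 0 T, nq q.toReal (Ef fun ξ => phase t ξ * φ s ξ)) ≤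
      C * (Wn (gammaExp d p q) φ0 + ∫⁻ s in Set.Icc 0 T, Wn (gammaExp d p q) (φ s)) := by
  obtain ⟨C, hC, h⟩ := hom hd T hT p q hpq hq
  simp_rw [nq_eLp q hpq.2.1 hq] at h
  refine ⟨C, hC, ?_⟩
  intro φ0 hm0 hi0 φ hm hi
  have hms : ∀ s, Measurable (φ s) := fun s => hm.of_uncurry_left
  have key : tLp p (Set.Icc 0 T) (fun t => nq q.toReal (Ef fun ξ => phase t ξ * φ0 ξ) +
        ∫⁻ s in Set.Icc 0 T, nq q.toReal (Ef fun ξ => phase t ξ * φ s ξ)) ≤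
      tLp p (Set.Icc 0 T) (fun t => nq q.toReal (Ef fun ξ => phase t ξ * φ0 ξ)) +
      ∫⁻ s in Set.Icc 0 T, tLp p (Set.Icc 0 T) (fun t => nq q.toReal (Ef fun ξ => phase t ξ * φ s ξ)) := by
    unfold tLp
    by_cases hp : p = ∞
    · simp only [if_pos hp]
      refine iSup_le fun t => add_le_add (le_iSup (fun t => nq q.toReal (Ef fun ξ => phase t ξ * φ0 ξ)) t) ?_
      exact lintegral_mono fun s => le_iSup (fun t => nq q.toReal (Ef fun ξ => phase t ξ * φ s ξ)) t
    · simp only [if_neg hp]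
      have hp1 : 1 ≤ p.toReal := by
        have := ENNReal.toReal_mono hp hpq.1
        have h2 : (2:ℝ) ≤ p.toReal := by simpa using this
        linarith
      have hB : Measurable (Function.uncurry fun (t s : ℝ) => nq q.toReal (Ef fun ξ => phase t ξ * φ s ξ)) := by
        have h1 : Measurable (fun w : (ℝ × ℝ) × EuclideanSpace ℝ (Fin d) => Ef (fun ξ => phase w.1.1 ξ * φ w.1.2 ξ) w.2) := by
          unfold Ef
          refine (StronglyMeasurable.integral_prod_right' (f := fun w : ((ℝ × ℝ) × EuclideanSpace ℝ (Fin d)) × EuclideanSpace ℝ (Fin d) =>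
            cexp (2 * π * I * ((⟪w.1.2, w.2⟫ : ℝ) : ℂ)) * (phase w.1.1.1 w.2 * φ w.1.1.2 w.2)) ?_).measurable
          refine (Measurable.mul (Continuous.measurable (by fun_prop)) (Measurable.mul ?_ ?_)).stronglyMeasurable
          · exact phase_cont.measurable.comp (g := Function.uncurry phase) (f := fun w : ((ℝ × ℝ) × EuclideanSpace ℝ (Fin d)) × EuclideanSpace ℝ (Fin d) => (w.1.1.1, w.2)) (by fun_prop)
          · exact hm.comp (f := fun w : ((ℝ × ℝ) × EuclideanSpace ℝ (Fin d)) × EuclideanSpace ℝ (Fin d) => (w.1.1.2, w.2)) (by fun_prop)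
        unfold nq
        exact (Measurable.lintegral_prod_right' (h1.enorm.pow_const q.toReal)).pow_const _
      refine (ENNReal.lintegral_Lp_add_le (nq_phase_meas _ φ0 hm0).aemeasurable
        (Measurable.lintegral_prod_right' hB).aemeasurable hp1).trans ?_
      refine add_le_add le_rfl ?_
      exact minkowski (volume.restrict (Set.Icc 0 T)) (volume.restrict (Set.Icc 0 T)) _ hB p.toReal hp1
  refine key.trans ?_
  rw [mul_add]
  refine add_le_add (h φ0 hm0 hi0) ?_
  rw [← lintegral_const_mul' _ _ hC]
  exact lintegral_mono fun s => h (φ s) (hms s) (hi s)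

lemma bessel_Ef (σ : ℝ) (q : ℝ≥0∞) (Ψ : EuclideanSpace ℝ (Fin d) → ℂ) (hc : Continuous Ψ) (hi : Integrable Ψ) :
    sobNormQ σ q (Ef Ψ) ≤ eLpNorm (Ef fun ξ => (((1 + ‖ξ‖ ^ 2) ^ (σ / 2) : ℝ) : ℂ) * Ψ ξ) q volume := by
  unfold sobNormQ
  by_cases hu : Integrable (Ef Ψ)
  · have e : 𝓕 (Ef Ψ) = Ψ := by
      have h1 : Ef Ψ = 𝓕⁻ Ψ := funext fun x => Ef_eq_inv Ψ x
      have h2 : Integrable (𝓕 Ψ) := by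
        have : 𝓕 Ψ = fun x => Ef Ψ (-x) := by funext x; rw [Ef_eq_neg, neg_neg]
        rw [this]; exact hu.comp_neg
      rw [h1]
      exact hc.fourier_fourierInv_eq hi h2
    refine le_of_eq ?_
    congr 1
    funext x
    unfold besselPot
    rw [e]
    unfold Ef
    simp_rw [mul_assoc]
  · have e : ∀ ξ, 𝓕 (Ef Ψ) ξ = 0 := by
      intro ξ
      rw [Real.fourier_eq]
      refine integral_undef ?_
      rwa [Real.fourierIntegral_convergent_iff]
    have : besselPot σ (Ef Ψ) = 0 := by
      funext x
      unfold besselPot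
      simp [e]
    rw [this]
    simp

end Strich

set_option linter.unusedVariables false
set_option linter.unusedSectionVars false
namespace Strich
open Filter Topology

variable {d : ℕ}

lemma prop4_Ef (t : ℝ) (f : EuclideanSpace ℝ (Fin d) → ℂ) (x : EuclideanSpace ℝ (Fin d)) :
    prop4 t f x = Ef (fun ξ => phase t ξ * 𝓕 f ξ) x := by
  unfold prop4 Ef phase
  refine integral_congr_ae (Eventually.of_forall fun ξ => ?_)
  simp only
  rw [mul_assoc]
  congr 3
  push_cast
  ring

/-- the Bessel weight -/
noncomputable def jap (σ : ℝ) (ξ : EuclideanSpace ℝ (Fin d)) : ℝ := (1 + ‖ξ‖ ^ 2) ^ (σ / 2)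

lemma jap_nonneg (σ : ℝ) (ξ : EuclideanSpace ℝ (Fin d)) : 0 ≤ jap σ ξ := by unfold jap; positivity

lemma jap_cont (σ : ℝ) : Continuous (jap (d := d) σ) := by
  unfold jap
  exact Continuous.rpow_const (by fun_prop) fun x => Or.inl (by positivity)

lemma Wn_sob (γ g : ℝ) (f φ : EuclideanSpace ℝ (Fin d) → ℂ) (h : ∀ ξ, ‖φ ξ‖ = jap (γ - g) ξ * ‖𝓕 f ξ‖) :
    Wn g φ = sobNorm γ f := by
  unfold Wn sobNorm
  congr 1
  refine lintegral_congr fun ξ => ?_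
  have e : ‖φ ξ‖ₑ = ENNReal.ofReal (jap (γ - g) ξ) * ‖𝓕 f ξ‖ₑ := by
    rw [← ofReal_norm, h, ENNReal.ofReal_mul (jap_nonneg _ _), ofReal_norm]
  have e2 : (‖𝓕 f ξ‖₊ : ℝ≥0∞) ^ (2:ℝ) = ‖𝓕 f ξ‖ₑ ^ 2 := by
    rw [← ENNReal.rpow_natCast]; norm_num [enorm]
  rw [e2, e, mul_pow, ← mul_assoc, ← ENNReal.ofReal_pow (jap_nonneg _ _), ← ENNReal.ofReal_mul (by positivity)]
  congr 2
  unfold jap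
  rw [← Real.rpow_natCast (_ ^ ((γ - g) / 2)) 2, ← Real.rpow_mul (by positivity), ← Real.rpow_add (by positivity)]
  congr 1
  push_cast
  ring

/-- pointwise in time bound of the Duhamel solution -/
lemma sol_bound (σ : ℝ) (q : ℝ≥0∞) (h2 : 2 ≤ q) (hq : q ≠ ∞) (T : ℝ) (u₀ : 𝓢(EuclideanSpace ℝ (Fin d), ℂ))
    (F : 𝓢(ℝ × EuclideanSpace ℝ (Fin d), ℂ)) :
    Integrable (fun ξ => ((jap σ ξ : ℝ) : ℂ) * 𝓕 (u₀ : EuclideanSpace ℝ (Fin d) → ℂ) ξ) ∧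
    (∀ s, Integrable (fun ξ => ((jap σ ξ : ℝ) : ℂ) * (phase (-s) ξ * 𝓕 (fun y => F (s, y)) ξ))) ∧
    ∀ t ∈ Set.Icc 0 T, sobNormQ σ q (fun x => prop4 t u₀ x + ∫ s in (0:ℝ)..t, prop4 (t - s) (fun y => F (s, y)) x) ≤
      nq q.toReal (Ef fun ξ => phase t ξ * (((jap σ ξ : ℝ) : ℂ) * 𝓕 (u₀ : EuclideanSpace ℝ (Fin d) → ℂ) ξ)) +
      ∫⁻ s in Set.Icc 0 T, nq q.toReal (Ef fun ξ => phase t ξ * (((jap σ ξ : ℝ) : ℂ) * (phase (-s) ξ * 𝓕 (fun y => F (s, y)) ξ))) := by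
  have hq1 : 1 ≤ q.toReal := by
    have := ENNReal.toReal_mono hq h2
    have h2 : (2:ℝ) ≤ q.toReal := by simpa using this
    linarith
  -- data for `u₀`
  have cu : Continuous (𝓕 (u₀ : EuclideanSpace ℝ (Fin d) → ℂ)) := (𝓕 u₀).continuous
  have iu : Integrable (𝓕 (u₀ : EuclideanSpace ℝ (Fin d) → ℂ)) := (𝓕 u₀).integrable
  obtain ⟨D0, hD0, hb0⟩ := four_dom (d := d) σ (fun _ => u₀) (fun k n => SchwartzMap.seminorm ℝ k n u₀) (fun _ _ _ => le_rfl)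
  have iju : Integrable (fun ξ => ((jap σ ξ : ℝ) : ℂ) * 𝓕 (u₀ : EuclideanSpace ℝ (Fin d) → ℂ) ξ) := by
    refine hD0.mono' (((Complex.continuous_ofReal.comp (jap_cont σ)).mul cu).aestronglyMeasurable) (Eventually.of_forall fun ξ => ?_)
    rw [norm_mul, Complex.norm_real, Real.norm_of_nonneg (jap_nonneg _ _)]
    exact hb0 0 ξ
  -- data for `F`
  have cG : ∀ s, Continuous (𝓕 (fun y => F (s, y))) := fun s => (𝓕 (slice F s)).continuous
  have mG := slice_four_meas F
  obtain ⟨D1, hD1, hb1⟩ := four_dom (d := d) 0 (slice F) (fun k n => SchwartzMap.seminorm ℝ k n F) (slice_semi F)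
  obtain ⟨D2, hD2, hb2⟩ := four_dom (d := d) σ (slice F) (fun k n => SchwartzMap.seminorm ℝ k n F) (slice_semi F)
  have hb1' : ∀ s ξ, ‖𝓕 (fun y => F (s, y)) ξ‖ ≤ D1 ξ := by
    intro s ξ
    have := hb1 s ξ
    rw [zero_div, Real.rpow_zero, one_mul] at this
    exact this
  have hbB : ∃ B : ℝ, ∀ s ξ, ‖𝓕 (fun y => F (s, y)) ξ‖ ≤ B := by
    obtain ⟨t, C, hC, h⟩ := four_decay (d := d) 0
    refine ⟨C * ∑ i ∈ t, SchwartzMap.seminorm ℝ i.1 i.2 F, fun s ξ => ?_⟩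
    have := h (slice F s) (∑ i ∈ t, SchwartzMap.seminorm ℝ i.1 i.2 F) (Finset.sum_nonneg fun i _ => apply_nonneg _ _)
      (fun i hi => (slice_semi F s _ _).trans (Finset.single_le_sum (f := fun i : ℕ × ℕ => SchwartzMap.seminorm ℝ i.1 i.2 F) (fun i _ => apply_nonneg _ _) hi)) ξ
    rw [pow_zero, one_mul] at this
    exact this
  obtain ⟨B, hB⟩ := hbB
  have pc : ∀ t : ℝ, Continuous (phase (d := d) t) := fun t => phase_cont.comp (g := Function.uncurry phase) (f := fun ξ => (t, ξ)) (by fun_prop)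
  have mph : Measurable (Function.uncurry fun (s : ℝ) (ξ : EuclideanSpace ℝ (Fin d)) => phase (-s) ξ) :=
    (phase_cont.comp (g := Function.uncurry phase) (f := fun z : ℝ × EuclideanSpace ℝ (Fin d) => (-z.1, z.2)) (by fun_prop)).measurable
  have ijF : ∀ s, Integrable (fun ξ => ((jap σ ξ : ℝ) : ℂ) * (phase (-s) ξ * 𝓕 (fun y => F (s, y)) ξ)) := by
    intro s
    refine hD2.mono' (((Complex.continuous_ofReal.comp (jap_cont σ)).mul ((pc _).mul (cG s))).aestronglyMeasurable) (Eventually.of_forall fun ξ => ?_)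
    rw [norm_mul, Complex.norm_real, Real.norm_of_nonneg (jap_nonneg _ _), norm_mul, norm_phase, one_mul]
    exact hb2 s ξ
  refine ⟨iju, ijF, ?_⟩
  intro t ht
  -- the Fourier side of the solution
  set H : ℝ → EuclideanSpace ℝ (Fin d) → ℂ := fun s ξ => phase t ξ * (phase (-s) ξ * 𝓕 (fun y => F (s, y)) ξ) with hH
  set K : ℝ → EuclideanSpace ℝ (Fin d) → ℂ := fun s ξ => phase t ξ * (((jap σ ξ : ℝ) : ℂ) * (phase (-s) ξ * 𝓕 (fun y => F (s, y)) ξ)) with hK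
  have mpt : Measurable (fun z : ℝ × EuclideanSpace ℝ (Fin d) => phase t z.2) := (phase_meas t).comp measurable_snd
  have mj : Measurable (fun z : ℝ × EuclideanSpace ℝ (Fin d) => ((jap σ z.2 : ℝ) : ℂ)) :=
    (Complex.continuous_ofReal.comp (jap_cont σ)).measurable.comp measurable_snd
  have mH : Measurable (Function.uncurry H) := mpt.mul (mph.mul mG)
  have mK : Measurable (Function.uncurry K) := mpt.mul (mj.mul (mph.mul mG))
  have nH : ∀ s ξ, ‖H s ξ‖ = ‖𝓕 (fun y => F (s, y)) ξ‖ := by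
    intro s ξ
    simp only [hH]
    rw [norm_mul, norm_phase, norm_mul, norm_phase, one_mul, one_mul]
  have bH : ∀ s ξ, ‖H s ξ‖ ≤ D1 ξ := fun s ξ => (nH s ξ).trans_le (hb1' s ξ)
  have bK : ∀ s ξ, ‖K s ξ‖ ≤ D2 ξ := by
    intro s ξ
    simp only [hK]
    rw [norm_mul, norm_phase, one_mul, norm_mul, Complex.norm_real, Real.norm_of_nonneg (jap_nonneg _ _), norm_mul, norm_phase, one_mul]
    exact hb2 s ξ
  set Ψ : EuclideanSpace ℝ (Fin d) → ℂ := fun ξ => phase t ξ * 𝓕 (u₀ : EuclideanSpace ℝ (Fin d) → ℂ) ξ + ∫ s in (0:ℝ)..t, H s ξ with hΨ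
  have iI := int_dom H mH D1 hD1 bH t ht.1
  have iPu := phase_int t _ cu.measurable iu
  have iΨ : Integrable Ψ := Integrable.fun_add iPu iI
  have cΨ : Continuous Ψ := by
    refine ((pc t).mul cu).add ?_
    refine intervalIntegral.continuous_of_dominated_interval (F := fun ξ s => H s ξ) (bound := fun _ => B) (fun ξ => ?_) (fun ξ => ?_) intervalIntegrable_const ?_
    · exact (mH.comp (measurable_id.prodMk measurable_const)).aestronglyMeasurable
    · exact Eventually.of_forall fun s _ => (nH s ξ).trans_le (hB s ξ)
    · exact Eventually.of_forall fun s _ => (pc t).mul ((pc (-s)).mul (cG s))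
  have eu : (fun x => prop4 t u₀ x + ∫ s in (0:ℝ)..t, prop4 (t - s) (fun y => F (s, y)) x) = Ef Ψ := by
    funext x
    rw [hΨ, Ef_add' _ _ iPu iI, Ef_swap H mH D1 hD1 bH t ht.1, prop4_Ef]
    congr 1
    refine intervalIntegral.integral_congr fun s _ => ?_
    simp only [hH]
    rw [prop4_Ef]
    congr 1
    funext ξ
    rw [sub_eq_add_neg, phase_add, mul_assoc]
  rw [eu]
  refine (bessel_Ef σ q Ψ cΨ iΨ).trans ?_
  have iK := int_dom K mK D2 hD2 bK t ht.1
  have iPj := phase_int t (fun ξ => ((jap σ ξ : ℝ) : ℂ) * 𝓕 (u₀ : EuclideanSpace ℝ (Fin d) → ℂ) ξ) ((Complex.continuous_ofReal.comp (jap_cont σ)).mul cu).measurable iju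
  have e2 : (Ef fun ξ => (((1 + ‖ξ‖ ^ 2) ^ (σ / 2) : ℝ) : ℂ) * Ψ ξ) = fun x =>
      Ef (fun ξ => phase t ξ * (((jap σ ξ : ℝ) : ℂ) * 𝓕 (u₀ : EuclideanSpace ℝ (Fin d) → ℂ) ξ)) x + ∫ s in (0:ℝ)..t, Ef (K s) x := by
    funext x
    rw [← Ef_swap K mK D2 hD2 bK t ht.1, ← Ef_add' _ _ iPj iK]
    congr 1
    funext ξ
    change ((jap σ ξ : ℝ) : ℂ) * Ψ ξ = _
    rw [hΨ]
    simp only [hK]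
    rw [mul_add, ← intervalIntegral.integral_const_mul]
    congr 1
    · ring
    · refine intervalIntegral.integral_congr fun s _ => ?_
      simp only [hH]
      ring
  rw [nq_eLp q h2 hq, e2]
  have cK : Continuous fun x => ∫ s in (0:ℝ)..t, Ef (K s) x := by
    have : (fun x => ∫ s in (0:ℝ)..t, Ef (K s) x) = Ef (fun ξ => ∫ s in (0:ℝ)..t, K s ξ) := by
      funext x; rw [Ef_swap K mK D2 hD2 bK t ht.1]
    rw [this]; exact Ef_cont _ iK
  refine (nq_add q.toReal hq1 _ _ (Ef_cont _ iPj) cK).trans ?_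
  exact add_le_add le_rfl (nq_int K mK q.toReal hq1 t T ht)

lemma time_le (p : ℝ≥0∞) (T : ℝ) (g h : ℝ → ℝ≥0∞) (hgh : ∀ t ∈ Set.Icc 0 T, g t ≤ h t) :
    timeLp p (Set.Icc 0 T) g ≤ tLp p (Set.Icc 0 T) h := by
  unfold timeLp tLp
  split_ifs with hp
  · refine essSup_le_of_ae_le _ ?_
    exact ae_restrict_of_forall_mem measurableSet_Icc fun t ht => (hgh t ht).trans (le_iSup h t)
  · refine ENNReal.rpow_le_rpow ?_ (by positivity)
    exact setLIntegral_mono' measurableSet_Icc fun t ht => ENNReal.rpow_le_rpow (hgh t ht) (by positivity)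

theorem final (hd : 1 ≤ d) (γ : ℝ) (T : ℝ) (hT : 0 < T) (p q : ℝ≥0∞) (hpq : Admissible d p q) (hq : q ≠ ∞) :
    ∃ C > (0:ℝ), ∀ (u₀ : 𝓢(EuclideanSpace ℝ (Fin d), ℂ)) (F : 𝓢(ℝ × EuclideanSpace ℝ (Fin d), ℂ)),
      timeLp p (Set.Icc 0 T) (fun t => sobNormQ (γ - gammaExp d p q) q
        (fun x => prop4 t u₀ x + ∫ s in (0:ℝ)..t, prop4 (t - s) (fun y => F (s, y)) x)) ≤
      ENNReal.ofReal C * (sobNorm γ u₀ + ∫⁻ t in Set.Icc 0 T, sobNorm γ (fun y => F (t, y))) := by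
  obtain ⟨C, hC, h⟩ := inhom hd T hT p q hpq hq
  refine ⟨C.toReal + 1, by positivity, fun u₀ F => ?_⟩
  obtain ⟨i0, iF, hs⟩ := sol_bound (γ - gammaExp d p q) q hpq.2.1 hq T u₀ F
  refine (time_le p T _ _ hs).trans ?_
  refine (h _ (((Complex.continuous_ofReal.comp (jap_cont _)).mul (𝓕 u₀).continuous).measurable) i0
    (fun s ξ => ((jap (γ - gammaExp d p q) ξ : ℝ) : ℂ) * (phase (-s) ξ * 𝓕 (fun y => F (s, y)) ξ)) ?_ iF).trans ?_
  · have mph : Measurable (Function.uncurry fun (s : ℝ) (ξ : EuclideanSpace ℝ (Fin d)) => phase (-s) ξ) :=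
      (phase_cont.comp (g := Function.uncurry phase) (f := fun z : ℝ × EuclideanSpace ℝ (Fin d) => (-z.1, z.2)) (by fun_prop)).measurable
    have mj : Measurable (fun z : ℝ × EuclideanSpace ℝ (Fin d) => ((jap (γ - gammaExp d p q) z.2 : ℝ) : ℂ)) :=
      (Complex.continuous_ofReal.comp (jap_cont _)).measurable.comp measurable_snd
    exact mj.mul (mph.mul (slice_four_meas F))
  · refine mul_le_mul' ?_ (le_of_eq ?_)
    · rw [← ENNReal.ofReal_toReal hC]
      exact ENNReal.ofReal_le_ofReal (by simp)
    · congr 1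
      · refine Wn_sob γ _ _ _ fun ξ => ?_
        rw [Pi.mul_apply, Function.comp, norm_mul, Complex.norm_real, Real.norm_of_nonneg (jap_nonneg _ _)]
      · refine lintegral_congr fun s => Wn_sob γ _ _ _ fun ξ => ?_
        rw [norm_mul, Complex.norm_real, Real.norm_of_nonneg (jap_nonneg _ _), norm_mul, norm_phase, one_mul]

end Strich

/-- local Strichartz estimate in generalized Sobolev spaces. -/
theorem stmt6 (d : ℕ) (hd : 1 ≤ d) (γ : ℝ) (hγ : 0 ≤ γ) (T : ℝ) (hT : 0 < T)
    (p q : ℝ≥0∞) (hpq : Admissible d p q) (hq : q ≠ ∞) :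
    ∃ C > (0 : ℝ), ∀ (u₀ : 𝓢(EuclideanSpace ℝ (Fin d), ℂ))
      (F : 𝓢(ℝ × EuclideanSpace ℝ (Fin d), ℂ)),
      timeLp p (Set.Icc 0 T)
          (fun t => sobNormQ (γ - gammaExp d p q) q
            (fun x => prop4 t ⇑u₀ x + ∫ s in (0 : ℝ)..t, prop4 (t - s) (fun y => F (s, y)) x)) ≤
        ENNReal.ofReal C *
          (sobNorm γ ⇑u₀ + ∫⁻ t in Set.Icc 0 T, sobNorm γ (fun y => F (t, y))) :=
  Strich.final hd γ T hT p q hpq hq
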